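/- For (I₀,J₀) ∈ ℚ × ℚ, let h(I₀,J₀) denote the number of SL₃(ℤ)-equivalence classes of strongly irreducible integral ternary cubic forms f with I(f) = I₀ and J(f) = J₀. Then the average of h over eligible pairs equals 3ζ(2)ζ(3) for each sign of the discriminant: lim_{X→∞} [Σ_{(I₀,J₀): Δ(I₀,J₀)>0, H(I₀,J₀)<X} h(I₀,J₀)] / [#{eligible (I₀,J₀) : Δ(I₀,J₀)>0, H(I₀,J₀)<X}] = 3·ζ(2)·ζ(3), and likewise with Δ(I₀,J₀) < 0 in both numerator and denominator. -/

import Mathlib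

open MvPolynomial

/-- The action of a 3×3 matrix on ternary forms: `(γ·f)(x,y,z) = f((x,y,z)·γ)`. -/
noncomputable def actGL {R : Type*} [CommRing R] (γ : Matrix (Fin 3) (Fin 3) R)
    (f : MvPolynomial (Fin 3) R) : MvPolynomial (Fin 3) R :=
  bind₁ (fun j => ∑ i : Fin 3, C (γ i j) * X i) f

/-- The Hessian of a ternary form: the determinant of the matrix of second partials. -/
noncomputable def hess {R : Type*} [CommRing R] (f : MvPolynomial (Fin 3) R) :
    MvPolynomial (Fin 3) R :=
  Matrix.det (Matrix.of fun i j => pderiv i (pderiv j f))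

/-- The exponent vectors of the ten monomials of a ternary cubic form. -/
def expo : Fin 10 → Fin 3 → ℕ :=
  ![![3,0,0], ![0,3,0], ![0,0,3], ![2,1,0], ![2,0,1],
    ![1,2,0], ![0,2,1], ![1,0,2], ![0,1,2], ![1,1,1]]

/-- The ternary cubic form with coefficient vector `c : Fin 10 → R`. -/
noncomputable def cubic {R : Type*} [CommRing R] (c : Fin 10 → R) : MvPolynomial (Fin 3) R :=
  ∑ k : Fin 10, C (c k) * ∏ i : Fin 3, X i ^ expo k i

/-- The coefficient vector of the Weierstrass cubic `x³ + A·x·z² + B·z³ − y²·z`. -/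
noncomputable def wcoeffs {R : Type*} [CommRing R] (A B : R) : Fin 10 → R :=
  ![1, 0, B, 0, 0, 0, -1, A, 0, 0]

/-- The generic ternary cubic form, whose coefficients are the 10 indeterminates. -/
noncomputable def genCubic (R : Type*) [CommRing R] :
    MvPolynomial (Fin 3) (MvPolynomial (Fin 10) R) :=
  cubic (fun k => X k)

/-- `P` and `Q` are the invariants `I` and `J`: they are homogeneous of degrees 4 and 6
in the ten coefficients, they satisfy the identity
`H(H(f)) = 12288·I(f)²·f + 512·J(f)·H(f)` (stated for the generic ternary cubic form,
hence for every ternary cubic form over every commutative `R`-algebra), and they are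
normalized so that `x³ + A·x·z² + B·z³ − y²·z` has `I = −3A` and `J = −27B`. -/
def IsInvariantPair (R : Type*) [CommRing R] (P Q : MvPolynomial (Fin 10) R) : Prop :=
  P.IsHomogeneous 4 ∧ Q.IsHomogeneous 6 ∧
  hess (hess (genCubic R)) =
    12288 * C P ^ 2 * genCubic R + 512 * C Q * hess (genCubic R) ∧
  ∀ A B : R, aeval (wcoeffs A B) P = -3 * A ∧ aeval (wcoeffs A B) Q = -27 * B

/-- The invariant `I` of the integral ternary cubic form with coefficients `c`,
where `P` is the degree-4 invariant polynomial. -/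
noncomputable def Iinv (P : MvPolynomial (Fin 10) ℚ) (c : Fin 10 → ℤ) : ℚ :=
  aeval (fun k => (c k : ℚ)) P

/-- The invariant `J` of the integral ternary cubic form with coefficients `c`,
where `Q` is the degree-6 invariant polynomial. -/
noncomputable def Jinv (Q : MvPolynomial (Fin 10) ℚ) (c : Fin 10 → ℤ) : ℚ :=
  aeval (fun k => (c k : ℚ)) Q

/-- The discriminant `Δ = (4I³ − J²)/27` of the integral ternary cubic form `c`. -/
noncomputable def Δinv (P Q : MvPolynomial (Fin 10) ℚ) (c : Fin 10 → ℤ) : ℚ :=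
  (4 * Iinv P c ^ 3 - Jinv Q c ^ 2) / 27

/-- The height `H = max(|I|³, J²/4)` of the integral ternary cubic form `c`. -/
noncomputable def Hinv (P Q : MvPolynomial (Fin 10) ℚ) (c : Fin 10 → ℤ) : ℚ :=
  max (|Iinv P c| ^ 3) (Jinv Q c ^ 2 / 4)

/-- An integral ternary cubic form is strongly irreducible if `f` and its Hessian have no
common nontrivial rational zero. -/
def StronglyIrred (c : Fin 10 → ℤ) : Prop :=
  ¬ ∃ v : Fin 3 → ℚ, v ≠ 0 ∧ eval v (cubic fun k => (c k : ℚ)) = 0 ∧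
      eval v (hess (cubic fun k => (c k : ℚ))) = 0

/-- The `SL₃(ℤ)`-orbit (equivalence class) of the integral ternary cubic form `c`. -/
noncomputable def orbitZ (c : Fin 10 → ℤ) : Set (Fin 10 → ℤ) :=
  {c' | ∃ γ : Matrix.SpecialLinearGroup (Fin 3) ℤ,
    actGL (γ : Matrix (Fin 3) (Fin 3) ℤ) (cubic c) = cubic c'}

/-- `ζ(2)`. -/
noncomputable def zeta2 : ℝ := ∑' n : ℕ, (1 : ℝ) / (n + 1) ^ 2

/-- `ζ(3)`. -/
noncomputable def zeta3 : ℝ := ∑' n : ℕ, (1 : ℝ) / (n + 1) ^ 3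

/-- The number of `SL₃(ℤ)`-equivalence classes of strongly irreducible integral ternary
cubic forms with invariants `I = I₀` and `J = J₀`. -/
noncomputable def hclass (P Q : MvPolynomial (Fin 10) ℚ) (I₀ J₀ : ℚ) : ℕ :=
  Set.ncard {T : Set (Fin 10 → ℤ) | ∃ c : Fin 10 → ℤ, StronglyIrred c ∧
    Iinv P c = I₀ ∧ Jinv Q c = J₀ ∧ T = orbitZ c}

/-- `(I₀, J₀)` occurs as the pair of invariants of some integral ternary cubic form. -/
def Eligible (P Q : MvPolynomial (Fin 10) ℚ) (I₀ J₀ : ℚ) : Prop :=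
  ∃ c : Fin 10 → ℤ, Iinv P c = I₀ ∧ Jinv Q c = J₀

/-- The discriminant `Δ(I₀,J₀) = (4I₀³ − J₀²)/27` of a pair. -/
noncomputable def Δpair (p : ℚ × ℚ) : ℚ := (4 * p.1 ^ 3 - p.2 ^ 2) / 27

/-- The height `H(I₀,J₀) = max(|I₀|³, J₀²/4)` of a pair. -/
noncomputable def Hpair (p : ℚ × ℚ) : ℚ := max (|p.1| ^ 3) (p.2 ^ 2 / 4)

open MvPolynomial

namespace TC

section basic
variable {R : Type*} [CommRing R]

/-- value of the cubic form with coefficient vector `c` -/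
def ev (c : Fin 10 → R) (v : Fin 3 → R) : R :=
  c 0 * v 0 ^ 3 + c 1 * v 1 ^ 3 + c 2 * v 2 ^ 3 + c 3 * v 0 ^ 2 * v 1 + c 4 * v 0 ^ 2 * v 2
    + c 5 * v 0 * v 1 ^ 2 + c 6 * v 1 ^ 2 * v 2 + c 7 * v 0 * v 2 ^ 2 + c 8 * v 1 * v 2 ^ 2
    + c 9 * v 0 * v 1 * v 2

/-- first partial derivatives -/
def gr (c : Fin 10 → R) (v : Fin 3 → R) : Fin 3 → R :=
  ![3 * c 0 * v 0 ^ 2 + 2 * c 3 * v 0 * v 1 + 2 * c 4 * v 0 * v 2 + c 5 * v 1 ^ 2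
      + c 7 * v 2 ^ 2 + c 9 * v 1 * v 2,
    3 * c 1 * v 1 ^ 2 + c 3 * v 0 ^ 2 + 2 * c 5 * v 0 * v 1 + 2 * c 6 * v 1 * v 2
      + c 8 * v 2 ^ 2 + c 9 * v 0 * v 2,
    3 * c 2 * v 2 ^ 2 + c 4 * v 0 ^ 2 + c 6 * v 1 ^ 2 + 2 * c 7 * v 0 * v 2
      + 2 * c 8 * v 1 * v 2 + c 9 * v 0 * v 1]

/-- matrix of second partial derivatives -/
def hm (c : Fin 10 → R) (v : Fin 3 → R) : Matrix (Fin 3) (Fin 3) R :=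
  !![6 * c 0 * v 0 + 2 * c 3 * v 1 + 2 * c 4 * v 2, 2 * c 3 * v 0 + 2 * c 5 * v 1 + c 9 * v 2,
      2 * c 4 * v 0 + c 9 * v 1 + 2 * c 7 * v 2;
     2 * c 3 * v 0 + 2 * c 5 * v 1 + c 9 * v 2, 6 * c 1 * v 1 + 2 * c 5 * v 0 + 2 * c 6 * v 2,
      c 9 * v 0 + 2 * c 6 * v 1 + 2 * c 8 * v 2;
     2 * c 4 * v 0 + c 9 * v 1 + 2 * c 7 * v 2, c 9 * v 0 + 2 * c 6 * v 1 + 2 * c 8 * v 2,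
      6 * c 2 * v 2 + 2 * c 7 * v 0 + 2 * c 8 * v 1]

/-- value of the Hessian -/
def he (c : Fin 10 → R) (v : Fin 3 → R) : R := (hm c v).det

/-- directional derivative -/
def dv (c : Fin 10 → R) (v w : Fin 3 → R) : R :=
  gr c v 0 * w 0 + gr c v 1 * w 1 + gr c v 2 * w 2

/-- the polarised trilinear form -/
def tri (c : Fin 10 → R) (u v w : Fin 3 → R) : R :=
  u 0 * (hm c w 0 0 * v 0 + hm c w 0 1 * v 1 + hm c w 0 2 * v 2)
  + u 1 * (hm c w 1 0 * v 0 + hm c w 1 1 * v 1 + hm c w 1 2 * v 2)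
  + u 2 * (hm c w 2 0 * v 0 + hm c w 2 1 * v 1 + hm c w 2 2 * v 2)

/-- action of matrices on coefficient vectors -/
def act (γ : Matrix (Fin 3) (Fin 3) R) (c : Fin 10 → R) : Fin 10 → R :=
  ![ev c (γ 0), ev c (γ 1), ev c (γ 2), dv c (γ 0) (γ 1), dv c (γ 0) (γ 2), dv c (γ 1) (γ 0),
    dv c (γ 1) (γ 2), dv c (γ 2) (γ 0), dv c (γ 2) (γ 1), tri c (γ 0) (γ 1) (γ 2)]

theorem ev_act (γ : Matrix (Fin 3) (Fin 3) R) (c : Fin 10 → R) (v : Fin 3 → R) :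
    ev (act γ c) v = ev c (Matrix.vecMul v γ) := by
  have h : ∀ j, Matrix.vecMul v γ j = v 0 * γ 0 j + v 1 * γ 1 j + v 2 * γ 2 j := by
    intro j; simp [Matrix.vecMul, dotProduct, Fin.sum_univ_three]
  have e : ev c (Matrix.vecMul v γ) = ev c (fun j => v 0 * γ 0 j + v 1 * γ 1 j + v 2 * γ 2 j) := by
    congr 1; funext j; exact h j
  rw [e]
  simp only [ev, act, dv, tri, gr, hm, Matrix.cons_val, Matrix.of_apply]
  ring

/-- the Hessian matrix is covariant -/
theorem hm_act (γ : Matrix (Fin 3) (Fin 3) R) (c : Fin 10 → R) (v : Fin 3 → R) :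
    hm (act γ c) v = γ * hm c (Matrix.vecMul v γ) * γ.transpose := by
  have e : Matrix.vecMul v γ = (fun j => v 0 * γ 0 j + v 1 * γ 1 j + v 2 * γ 2 j) := by
    funext j; simp [Matrix.vecMul, dotProduct, Fin.sum_univ_three]
  rw [e]
  ext i j
  simp only [Matrix.mul_apply, Fin.sum_univ_three, Matrix.transpose_apply]
  fin_cases i <;> fin_cases j <;>
    simp [hm, act, ev, dv, tri, gr] <;> ring

theorem he_act (γ : Matrix (Fin 3) (Fin 3) R) (c : Fin 10 → R) (v : Fin 3 → R) :
    he (act γ c) v = γ.det ^ 2 * he c (Matrix.vecMul v γ) := by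
  simp only [he, hm_act, Matrix.det_mul, Matrix.det_transpose]; ring

/-- the coefficients of the Hessian form -/
def heC (c : Fin 10 → R) : Fin 10 → R :=
  let A := fun k : Fin 3 => hm c (Pi.single k 1)
  let D := fun (k l m : Fin 3) => Matrix.det !![A k 0 0, A k 0 1, A k 0 2; A l 1 0, A l 1 1, A l 1 2;
    A m 2 0, A m 2 1, A m 2 2]
  ![D 0 0 0, D 1 1 1, D 2 2 2, D 0 0 1 + D 0 1 0 + D 1 0 0, D 0 0 2 + D 0 2 0 + D 2 0 0,
    D 0 1 1 + D 1 0 1 + D 1 1 0, D 1 1 2 + D 1 2 1 + D 2 1 1, D 0 2 2 + D 2 0 2 + D 2 2 0,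
    D 1 2 2 + D 2 1 2 + D 2 2 1,
    D 0 1 2 + D 0 2 1 + D 1 0 2 + D 1 2 0 + D 2 0 1 + D 2 1 0]

theorem ev_heC (c : Fin 10 → R) (v : Fin 3 → R) : ev (heC c) v = he c v := by
  simp [ev, heC, he, hm, Matrix.det_fin_three]
  ring

end basic

section inj
variable {R : Type*} [CommRing R]

theorem ev_inj [IsDomain R] (h2 : (2 : R) ≠ 0) (c d : Fin 10 → R) (h : ∀ v, ev c v = ev d v) :
    c = d := by
  have a0 := h ![1,0,0]
  have a1 := h ![0,1,0]
  have a2 := h ![0,0,1]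
  have a3 := h ![1,1,0]
  have a4 := h ![1,-1,0]
  have a5 := h ![1,0,1]
  have a6 := h ![1,0,-1]
  have a7 := h ![0,1,1]
  have a8 := h ![0,1,-1]
  have a9 := h ![1,1,1]
  simp [ev] at a0 a1 a2 a3 a4 a5 a6 a7 a8 a9
  have c3 : c 3 = d 3 := by
    apply mul_left_cancel₀ h2; linear_combination a3 - a4 - 2 * a1
  have c5 : c 5 = d 5 := by
    apply mul_left_cancel₀ h2; linear_combination a3 + a4 - 2 * a0
  have c4 : c 4 = d 4 := by
    apply mul_left_cancel₀ h2; linear_combination a5 - a6 - 2 * a2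
  have c7 : c 7 = d 7 := by
    apply mul_left_cancel₀ h2; linear_combination a5 + a6 - 2 * a0
  have c6 : c 6 = d 6 := by
    apply mul_left_cancel₀ h2; linear_combination a7 - a8 - 2 * a2
  have c8 : c 8 = d 8 := by
    apply mul_left_cancel₀ h2; linear_combination a7 + a8 - 2 * a1
  have c9 : c 9 = d 9 := by
    linear_combination a9 - a0 - a1 - a2 - c3 - c4 - c5 - c6 - c7 - c8
  funext i
  fin_cases i <;> assumption

theorem act_mul [IsDomain R] (h2 : (2 : R) ≠ 0) (γ δ : Matrix (Fin 3) (Fin 3) R) (c : Fin 10 → R) :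
    act (γ * δ) c = act γ (act δ c) := by
  apply ev_inj h2; intro v
  simp only [ev_act, Matrix.vecMul_vecMul]

theorem act_one [IsDomain R] (h2 : (2 : R) ≠ 0) (c : Fin 10 → R) : act 1 c = c := by
  apply ev_inj h2; intro v; simp [ev_act]

theorem act_add (γ : Matrix (Fin 3) (Fin 3) R) (c d : Fin 10 → R) :
    act γ (c + d) = act γ c + act γ d := by
  funext i; fin_cases i <;> simp [act, ev, dv, tri, gr, hm] <;> ring

theorem act_smul (γ : Matrix (Fin 3) (Fin 3) R) (a : R) (c : Fin 10 → R) :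
    act γ (a • c) = a • act γ c := by
  funext i; fin_cases i <;> simp [act, ev, dv, tri, gr, hm] <;> ring

theorem act_smul_mat (γ : Matrix (Fin 3) (Fin 3) R) (a : R) (c : Fin 10 → R) :
    act (a • γ) c = a ^ 3 • act γ c := by
  funext i; fin_cases i <;> simp [act, ev, dv, tri, gr, hm] <;> ring

theorem heC_act [IsDomain R] (h2 : (2 : R) ≠ 0) (γ : Matrix (Fin 3) (Fin 3) R) (c : Fin 10 → R) :
    heC (act γ c) = γ.det ^ 2 • act γ (heC c) := by
  apply ev_inj h2; intro v
  rw [ev_heC, he_act, ← act_smul, ev_act]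
  have : ∀ (a : R) (d : Fin 10 → R) w, ev (a • d) w = a * ev d w := by
    intro a d w; simp [ev]; ring
  rw [this, ev_heC]

theorem ev_smul (a : R) (d : Fin 10 → R) (w : Fin 3 → R) : ev (a • d) w = a * ev d w := by
  simp [ev]; ring

theorem ev_smul_vec (a : R) (d : Fin 10 → R) (w : Fin 3 → R) : ev d (a • w) = a ^ 3 * ev d w := by
  simp [ev]; ring

theorem he_smul_vec (a : R) (d : Fin 10 → R) (w : Fin 3 → R) : he d (a • w) = a ^ 3 * he d w := by
  rw [← ev_heC, ev_smul_vec, ev_heC]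

theorem heC_smul [IsDomain R] (h2 : (2 : R) ≠ 0) (a : R) (c : Fin 10 → R) :
    heC (a • c) = a ^ 3 • heC c := by
  apply ev_inj h2; intro v
  rw [ev_heC, ev_smul, ev_heC]
  have : hm (a • c) v = a • hm c v := by
    ext i j; fin_cases i <;> fin_cases j <;> simp [hm] <;> ring
  simp [he, this]

variable {S : Type*} [CommRing S]

theorem map_ev (φ : R →+* S) (c : Fin 10 → R) (v : Fin 3 → R) :
    φ (ev c v) = ev (fun k => φ (c k)) (fun i => φ (v i)) := by
  simp [ev]

theorem map_he (φ : R →+* S) (c : Fin 10 → R) (v : Fin 3 → R) :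
    φ (he c v) = he (fun k => φ (c k)) (fun i => φ (v i)) := by
  simp [he, hm, Matrix.det_fin_three, map_ofNat]

theorem map_act (φ : R →+* S) (γ : Matrix (Fin 3) (Fin 3) R) (c : Fin 10 → R) :
    (fun k => φ (act γ c k)) = act (γ.map φ) (fun k => φ (c k)) := by
  funext k
  fin_cases k <;> simp [act, ev, dv, tri, gr, hm, map_ofNat]

end inj

section bridge
variable {R : Type*} [CommRing R]

theorem eval_cubic (c : Fin 10 → R) (v : Fin 3 → R) : eval v (cubic c) = ev c v := by
  simp [cubic, ev, Fin.sum_univ_succ, Fin.prod_univ_three, expo]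
  ring

theorem pderiv_cubic (c : Fin 10 → R) (v : Fin 3 → R) (i j : Fin 3) :
    eval v (pderiv i (pderiv j (cubic c))) = hm c v i j := by
  have h2 : ∀ i : Fin 3, pderiv i (2 : MvPolynomial (Fin 3) R) = 0 := fun i => by
    rw [← map_ofNat C 2]; exact pderiv_C
  have h3 : ∀ i : Fin 3, pderiv i (3 : MvPolynomial (Fin 3) R) = 0 := fun i => by
    rw [← map_ofNat C 3]; exact pderiv_C
  fin_cases i <;> fin_cases j <;>
    simp [cubic, hm, Fin.sum_univ_succ, Fin.prod_univ_three, expo, pderiv_X, Pi.single_apply, h2, h3] <;> ring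

theorem eval_hess (c : Fin 10 → R) (v : Fin 3 → R) : eval v (hess (cubic c)) = he c v := by
  rw [hess, he, RingHom.map_det]
  congr 1; ext i j; simp [pderiv_cubic]

theorem actGL_cubic [IsDomain R] [Infinite R] (γ : Matrix (Fin 3) (Fin 3) R) (c : Fin 10 → R) :
    actGL γ (cubic c) = cubic (act γ c) := by
  apply MvPolynomial.funext; intro v
  rw [eval_cubic, ev_act, ← eval_cubic, actGL, ← coe_aeval_eq_eval, ← coe_aeval_eq_eval]
  simp only [RingHom.coe_coe, aeval_bind₁]
  congr 2
  funext j
  simp [Matrix.vecMul, dotProduct, mul_comm]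

theorem cubic_inj [IsDomain R] [Infinite R] (h2 : (2 : R) ≠ 0) {c d : Fin 10 → R}
    (h : cubic c = cubic d) : c = d := by
  apply ev_inj h2; intro v; rw [← eval_cubic, h, eval_cubic]

theorem hess_cubic [IsDomain R] [Infinite R] (c : Fin 10 → R) : hess (cubic c) = cubic (heC c) := by
  apply MvPolynomial.funext; intro v
  rw [eval_hess, eval_cubic, ev_heC]

theorem mem_orbitZ (c c' : Fin 10 → ℤ) : c' ∈ orbitZ c ↔
    ∃ γ : Matrix.SpecialLinearGroup (Fin 3) ℤ, act (γ : Matrix (Fin 3) (Fin 3) ℤ) c = c' := by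
  simp only [orbitZ, Set.mem_setOf_eq, actGL_cubic]
  exact exists_congr fun γ => ⟨fun h => cubic_inj two_ne_zero h, fun h => by rw [h]⟩

theorem stronglyIrred_iff (c : Fin 10 → ℤ) : StronglyIrred c ↔
    ¬ ∃ v : Fin 3 → ℚ, v ≠ 0 ∧ ev (fun k => (c k : ℚ)) v = 0 ∧ he (fun k => (c k : ℚ)) v = 0 := by
  simp only [StronglyIrred, eval_cubic, eval_hess]

end bridge

end TC

open MvPolynomial

namespace TC
open Filter Topology MeasureTheory

/-- componentwise floor of `x / ε` -/
noncomputable def flr {n : ℕ} (ε : Fin n → ℝ) (x : Fin n → ℝ) : Fin n → ℤ := fun i => ⌊x i / ε i⌋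

theorem flr_meas {n : ℕ} (ε : Fin n → ℝ) : Measurable (flr ε) := by
  apply measurable_pi_lambda; intro i
  exact Int.measurable_floor.comp ((measurable_pi_apply i).div_const _)

theorem flr_preimage {n : ℕ} (ε : Fin n → ℝ) (hε : ∀ i, 0 < ε i) (k : Fin n → ℤ) :
    flr ε ⁻¹' {k} = Set.pi Set.univ (fun i => Set.Ico (ε i * k i) (ε i * (k i + 1))) := by
  ext x
  simp only [Set.mem_preimage, Set.mem_singleton_iff, Set.mem_pi, Set.mem_univ, true_imp_iff,
    Set.mem_Ico, flr, funext_iff, Int.floor_eq_iff]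
  refine forall_congr' fun i => ?_
  rw [le_div_iff₀ (hε i), div_lt_iff₀ (hε i), mul_comm (ε i), mul_comm (ε i)]

theorem flr_close {n : ℕ} (ε : Fin n → ℝ) (hε : ∀ i, 0 < ε i) (x : Fin n → ℝ) :
    ‖x - fun i => ε i * (flr ε x i : ℝ)‖ ≤ ‖ε‖ := by
  rw [pi_norm_le_iff_of_nonneg (norm_nonneg _)]
  intro i
  refine le_trans ?_ (norm_le_pi_norm ε i)
  have h1 := Int.floor_le (x i / ε i)
  have h2 := Int.lt_floor_add_one (x i / ε i)
  rw [le_div_iff₀ (hε i)] at h1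
  rw [div_lt_iff₀ (hε i)] at h2
  simp only [flr, Pi.sub_apply, Real.norm_eq_abs, abs_of_pos (hε i)]
  rw [abs_le]; constructor <;> nlinarith [hε i]

theorem riemann {n : ℕ} (F : (Fin n → ℝ) → ℝ) (B r : ℝ) (hB : ∀ x, |F x| ≤ B)
    (hr : ∀ x, r < ‖x‖ → F x = 0) (hc : ∀ᵐ x, ContinuousAt F x)
    {α : Type*} {l : Filter α} [l.IsCountablyGenerated] (ε : α → Fin n → ℝ)
    (hε : ∀ᶠ a in l, ∀ i, 0 < ε a i) (hε0 : Tendsto ε l (𝓝 0))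
    (p : α → (Fin n → ℤ) → (Fin n → ℝ)) (δ : α → ℝ) (hδ : Tendsto δ l (𝓝 0))
    (hp : ∀ᶠ a in l, ∀ k, ‖p a k - fun i => ε a i * (k i : ℝ)‖ ≤
      δ a * (1 + ‖fun i => ε a i * (k i : ℝ)‖)) :
    Tendsto (fun a => (∏ i, ε a i) * ∑' k, F (p a k)) l (𝓝 (∫ x, F x)) := by
  have hB0 : 0 ≤ B := le_trans (abs_nonneg _) (hB 0)
  have hεn : Tendsto (fun a => ‖ε a‖) l (𝓝 0) := by simpa using hε0.norm
  -- closeness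
  have close : ∀ᶠ a in l, ∀ x, ‖x - p a (flr (ε a) x)‖ ≤ ‖ε a‖ + |δ a| * (1 + ‖x‖ + ‖ε a‖) := by
    filter_upwards [hε, hp] with a h1 h2 x
    have h3 := flr_close (ε a) h1 x
    have h4 := h2 (flr (ε a) x)
    have h5 : ‖fun i => ε a i * (flr (ε a) x i : ℝ)‖ ≤ ‖x‖ + ‖ε a‖ := by
      have := norm_sub_norm_le (fun i => ε a i * (flr (ε a) x i : ℝ)) x
      rw [norm_sub_rev] at this; linarith
    have h6 : ‖x - p a (flr (ε a) x)‖ ≤ ‖x - fun i => ε a i * (flr (ε a) x i : ℝ)‖ +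
        ‖p a (flr (ε a) x) - fun i => ε a i * (flr (ε a) x i : ℝ)‖ := by
      rw [norm_sub_rev (p a _)]; exact norm_sub_le_norm_sub_add_norm_sub _ _ _
    have h7 : δ a * (1 + ‖fun i => ε a i * (flr (ε a) x i : ℝ)‖) ≤
        |δ a| * (1 + ‖x‖ + ‖ε a‖) := by
      apply mul_le_mul (le_abs_self _) (by linarith) (by positivity) (abs_nonneg _)
    linarith
  set G : α → (Fin n → ℝ) → ℝ := fun a x => F (p a (flr (ε a) x)) with hG
  have Gmeas : ∀ a, Measurable (G a) := fun a =>
    (measurable_of_countable (fun k => F (p a k))).comp (flr_meas (ε a))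
  have small : ∀ᶠ a in l, ‖ε a‖ ≤ 1 ∧ |δ a| ≤ 1/2 := by
    have h1 := hεn.eventually (Iio_mem_nhds (show (0:ℝ) < 1 by norm_num))
    have h2 := (hδ.abs).eventually (Iio_mem_nhds (show |(0:ℝ)| < 1/2 by norm_num))
    filter_upwards [h1, h2] with a h h' using ⟨le_of_lt h, le_of_lt h'⟩
  set D : (Fin n → ℝ) → ℝ := (Metric.closedBall (0 : Fin n → ℝ) (2 * (|r| + 2))).indicator
    (fun _ => B) with hD
  have bound : ∀ᶠ a in l, ∀ x, ‖G a x‖ ≤ D x := by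
    filter_upwards [close, small] with a h1 h2 x
    by_cases hx : x ∈ Metric.closedBall (0 : Fin n → ℝ) (2 * (|r| + 2))
    · rw [hD, Set.indicator_of_mem hx]; exact hB _
    · rw [hD, Set.indicator_of_notMem hx]
      simp only [Metric.mem_closedBall, dist_zero_right, not_le] at hx
      have h3 := h1 x
      have h4 := norm_sub_norm_le x (p a (flr (ε a) x))
      have h5 : |δ a| * (1 + ‖x‖ + ‖ε a‖) ≤ 1/2 * (1 + ‖x‖ + 1) := by
        apply mul_le_mul h2.2 (by linarith) (by positivity) (by norm_num)
      have : r < ‖p a (flr (ε a) x)‖ := by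
        have := le_abs_self r
        linarith
      simp [hG, hr _ this]
  have Dint : Integrable D := by
    rw [hD, integrable_indicator_iff Metric.isClosed_closedBall.measurableSet]
    exact integrableOn_const (by exact measure_closedBall_lt_top.ne)
  have key : Tendsto (fun a => ∫ x, G a x) l (𝓝 (∫ x, F x)) := by
    apply tendsto_integral_filter_of_dominated_convergence D
    · exact Eventually.of_forall fun a => (Gmeas a).aestronglyMeasurable
    · filter_upwards [bound] with a h using Eventually.of_forall h
    · exact Dint
    · filter_upwards [hc] with x hx
      have : Tendsto (fun a => p a (flr (ε a) x)) l (𝓝 x) := by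
        rw [tendsto_iff_norm_sub_tendsto_zero]
        have hz : Tendsto (fun a => ‖ε a‖ + |δ a| * (1 + ‖x‖ + ‖ε a‖)) l (𝓝 0) := by
          have := hεn.add (hδ.abs.mul (hεn.const_add (1 + ‖x‖)))
          simpa using this
        refine squeeze_zero' (Eventually.of_forall fun a => norm_nonneg _) ?_ hz
        filter_upwards [close] with a h
        rw [norm_sub_rev]; exact h x
      exact hx.tendsto.comp this
  refine key.congr' ?_
  filter_upwards [hε, bound] with a h1 h2
  have Gint : Integrable (G a) := Dint.mono' (Gmeas a).aestronglyMeasurable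
    (Eventually.of_forall h2)
  have e1 : ∫ x, G a x = ∫ k, F (p a k) ∂(Measure.map (flr (ε a)) volume) := by
    rw [integral_map (flr_meas _).aemeasurable
      (measurable_of_countable _).aestronglyMeasurable]
  rw [e1, integral_countable', ← tsum_mul_left]
  · congr 1; funext k
    rw [Measure.real, Measure.map_apply (flr_meas _) (measurableSet_singleton k),
      flr_preimage _ h1, Real.volume_pi_Ico]
    rw [ENNReal.toReal_prod, smul_eq_mul]
    congr 1
    apply Finset.prod_congr rfl
    intro i _
    rw [ENNReal.toReal_ofReal] <;> nlinarith [h1 i]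
  · rw [integrable_map_measure (measurable_of_countable _).aestronglyMeasurable
      (flr_meas _).aemeasurable]
    exact Gint

end TC

open MvPolynomial

namespace TC
open Filter Topology MeasureTheory

/-- sum of the squares of naturals less than `x` -/
noncomputable def sqs (x : ℝ) : ℝ := ∑ c ∈ Finset.range ⌈x⌉₊, (c : ℝ) ^ 2

theorem sqs_closed (n : ℕ) : ∑ c ∈ Finset.range n, (c : ℝ) ^ 2 = n * (n - 1) * (2 * n - 1) / 6 := by
  induction n with
  | zero => simp
  | succ n ih => rw [Finset.sum_range_succ, ih]; push_cast; ring

theorem sqs_nonneg (x : ℝ) : 0 ≤ sqs x := Finset.sum_nonneg fun _ _ => by positivity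

theorem sqs_bounds (x : ℝ) (hx : 1 ≤ x) :
    x * (x - 1) * (2 * x - 1) / 6 ≤ sqs x ∧ sqs x ≤ x * (x + 1) * (2 * x + 1) / 6 := by
  rw [sqs, sqs_closed]
  have h1 := Nat.le_ceil x
  have h2 := Nat.ceil_lt_add_one (show 0 ≤ x by linarith)
  set n : ℝ := (⌈x⌉₊ : ℝ)
  constructor
  · have : x * (x - 1) * (2 * x - 1) ≤ n * (n - 1) * (2 * n - 1) := by
      gcongr <;> nlinarith
    linarith
  · have : n * (n - 1) * (2 * n - 1) ≤ (x + 1) * x * (2 * x + 1) := by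
      gcongr <;> nlinarith
    nlinarith

theorem sqs_le (x : ℝ) (hx : 0 < x) : sqs x ≤ x ^ 3 := by
  by_cases h : 1 ≤ x
  · refine (sqs_bounds x h).2.trans ?_
    nlinarith [mul_nonneg (sub_nonneg.2 h) (sub_nonneg.2 h), mul_nonneg hx.le (mul_nonneg hx.le (sub_nonneg.2 h)), mul_nonneg hx.le (sub_nonneg.2 h)]
  · have : ⌈x⌉₊ = 1 := by
      rw [Nat.ceil_eq_iff] <;> norm_num; constructor <;> linarith
    rw [sqs, this]; simp; positivity

theorem sqs_tendsto : Tendsto (fun x : ℝ => sqs x / x ^ 3) atTop (𝓝 (1/3)) := by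
  have hi : Tendsto (fun x : ℝ => x⁻¹) atTop (𝓝 0) := tendsto_inv_atTop_zero
  have h1 : Tendsto (fun x : ℝ => (1 - x⁻¹) * (2 - x⁻¹) / 6) atTop (𝓝 (1/3)) := by
    have := ((hi.const_sub 1).mul (hi.const_sub 2)).div_const 6
    convert this using 2; norm_num
  have h2 : Tendsto (fun x : ℝ => (1 + x⁻¹) * (2 + x⁻¹) / 6) atTop (𝓝 (1/3)) := by
    have := ((hi.const_add 1).mul (hi.const_add 2)).div_const 6
    convert this using 2; norm_num
  apply tendsto_of_tendsto_of_tendsto_of_le_of_le' h1 h2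
  · filter_upwards [eventually_ge_atTop 1] with x hx
    rw [le_div_iff₀ (by positivity)]
    refine le_trans (le_of_eq ?_) (sqs_bounds x hx).1
    field_simp
  · filter_upwards [eventually_ge_atTop 1] with x hx
    rw [div_le_iff₀ (by positivity)]
    refine (sqs_bounds x hx).2.trans (le_of_eq ?_)
    field_simp

/-- the number of upper triangular matrices in Hermite normal form of determinant `< T` -/
noncomputable def hnfCount (T : ℝ) : ℝ :=
  ∑' ab : ℕ × ℕ, ((ab.2 : ℝ) + 1) * sqs (T / ((ab.1 + 1) * (ab.2 + 1)))

theorem hnfCount_tendsto :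
    Tendsto (fun T : ℝ => hnfCount T / T ^ 3) atTop (𝓝 (zeta2 * zeta3 / 3)) := by
  have s2 : Summable (fun n : ℕ => (1 : ℝ) / (n + 1) ^ 2) := by
    have := (summable_nat_add_iff 1).2 (Real.summable_one_div_nat_pow.2 (show 1 < 2 by norm_num))
    simpa using this
  have s3 : Summable (fun n : ℕ => (1 : ℝ) / (n + 1) ^ 3) := by
    have := (summable_nat_add_iff 1).2 (Real.summable_one_div_nat_pow.2 (show 1 < 3 by norm_num))
    simpa using this
  have sp : Summable (fun ab : ℕ × ℕ => (1 : ℝ) / (ab.1 + 1) ^ 3 * (1 / (ab.2 + 1) ^ 2)) :=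
    s3.mul_of_nonneg s2 (fun _ => by positivity) (fun _ => by positivity)
  have e : zeta2 * zeta3 / 3 = ∑' ab : ℕ × ℕ, ((1 : ℝ) / (ab.1 + 1) ^ 3 * (1 / (ab.2 + 1) ^ 2)) * (1/3) := by
    rw [tsum_mul_right, ← s3.tsum_mul_tsum s2 sp, zeta2, zeta3]; ring
  rw [e]
  have e2 : (fun T : ℝ => hnfCount T / T ^ 3) = fun T => ∑' ab : ℕ × ℕ,
      (((ab.2 : ℝ) + 1) * sqs (T / ((ab.1 + 1) * (ab.2 + 1)))) / T ^ 3 := by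
    funext T; rw [tsum_div_const]; rfl
  rw [e2]
  apply tendsto_tsum_of_dominated_convergence sp
  · rintro ⟨a, b⟩
    simp only
    have hd : (0:ℝ) < (a + 1) * (b + 1) := by positivity
    have h := (sqs_tendsto.comp (tendsto_id.atTop_div_const hd)).const_mul
      ((1 : ℝ) / (a + 1) ^ 3 * (1 / (b + 1) ^ 2))
    refine h.congr' ?_
    filter_upwards [eventually_gt_atTop 0] with T hT
    simp only [Function.comp, id]
    field_simp
  · filter_upwards [eventually_gt_atTop 0] with T hT
    rintro ⟨a, b⟩
    simp only
    have hd : (0:ℝ) < (a + 1) * (b + 1) := by positivity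
    rw [Real.norm_of_nonneg (by have := sqs_nonneg (T / ((a + 1) * (b + 1))); positivity)]
    rw [div_le_iff₀ (by positivity)]
    have := sqs_le (T / ((a + 1) * (b + 1))) (by positivity)
    calc ((b:ℝ) + 1) * sqs (T / ((a + 1) * (b + 1))) ≤ (b + 1) * (T / ((a + 1) * (b + 1))) ^ 3 := by gcongr
      _ = _ := by field_simp

end TC

open MvPolynomial

namespace TC
open Filter Topology MeasureTheory

abbrev M3 (R : Type*) := Matrix (Fin 3) (Fin 3) R
abbrev Γ3 := Matrix.SpecialLinearGroup (Fin 3) ℤ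

/-- an integer matrix as a real matrix -/
def rM (A : M3 ℤ) : M3 ℝ := A.map (Int.castRingHom ℝ)

theorem rM_apply (A : M3 ℤ) (i j : Fin 3) : rM A i j = (A i j : ℝ) := rfl

theorem rM_mul (A B : M3 ℤ) : rM (A * B) = rM A * rM B := by
  rw [rM, Matrix.map_mul]; rfl

theorem rM_one : rM 1 = 1 := by simp [rM]

theorem rM_det (A : M3 ℤ) : (rM A).det = (A.det : ℝ) := by
  rw [rM, ← RingHom.mapMatrix_apply, ← RingHom.map_det]; rfl

theorem rM_det_SL (γ : Γ3) : (rM (γ : M3 ℤ)).det = 1 := by rw [rM_det, γ.2]; simp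

theorem rM_inj {A B : M3 ℤ} (h : rM A = rM B) : A = B := by
  ext i j
  have := congrFun (congrFun h i) j
  simpa [rM_apply] using this

/-- inner product of rows -/
def gg (B : M3 ℝ) (i j : Fin 3) : ℝ := B i 0 * B j 0 + B i 1 * B j 1 + B i 2 * B j 2

def dd (B : M3 ℝ) : ℝ := gg B 0 0 * gg B 1 1 - gg B 0 1 ^ 2

theorem vecMul_bound (M : M3 ℝ) (hM : M.det ≠ 0) :
    ∃ K : ℝ, 0 < K ∧ ∀ v : Fin 3 → ℝ, ‖v‖ ≤ K * ‖Matrix.vecMul v M‖ := by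
  have hu : IsUnit M.det := isUnit_iff_ne_zero.2 hM
  let L := LinearMap.toContinuousLinearMap (Matrix.vecMulLinear M⁻¹)
  refine ⟨‖L‖ + 1, by positivity, fun v => ?_⟩
  have h : v = L (Matrix.vecMul v M) := by
    simp [L, Matrix.vecMulLinear, Matrix.vecMul_vecMul, Matrix.mul_nonsing_inv _ hu]
  calc ‖v‖ = ‖L (Matrix.vecMul v M)‖ := by rw [← h]
    _ ≤ ‖L‖ * ‖Matrix.vecMul v M‖ := L.le_opNorm _
    _ ≤ _ := by gcongr; linarith

/-- square length -/
def nsq (v : Fin 3 → ℝ) : ℝ := v 0 ^ 2 + v 1 ^ 2 + v 2 ^ 2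

theorem norm_sq_le_nsq (v : Fin 3 → ℝ) : ‖v‖ ^ 2 ≤ nsq v := by
  have h0 : 0 ≤ nsq v := by unfold nsq; positivity
  have : ‖v‖ ≤ Real.sqrt (nsq v) := by
    rw [pi_norm_le_iff_of_nonneg (Real.sqrt_nonneg _)]
    intro i
    apply Real.le_sqrt_of_sq_le
    rw [Real.norm_eq_abs, sq_abs]
    fin_cases i <;> simp [nsq] <;> nlinarith [sq_nonneg (v 0), sq_nonneg (v 1), sq_nonneg (v 2)]
  calc ‖v‖ ^ 2 ≤ Real.sqrt (nsq v) ^ 2 := by gcongr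
    _ = _ := Real.sq_sqrt h0

theorem int_vec_norm (v : Fin 3 → ℤ) (hv : v ≠ 0) : (1:ℝ) ≤ ‖fun i => (v i : ℝ)‖ := by
  obtain ⟨i, hi⟩ := Function.ne_iff.1 hv
  refine le_trans ?_ (norm_le_pi_norm _ i)
  rw [Real.norm_eq_abs]
  exact_mod_cast Int.one_le_abs hi

theorem int_vec_finite (K : ℝ) : {v : Fin 3 → ℤ | ‖fun i => (v i : ℝ)‖ ≤ K}.Finite := by
  have : {v : Fin 3 → ℤ | ‖fun i => (v i : ℝ)‖ ≤ K} ⊆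
      Set.pi Set.univ (fun _ => Set.Icc (-⌈K⌉) ⌈K⌉) := by
    intro v hv i _
    have h1 := (norm_le_pi_norm (fun i => (v i : ℝ)) i).trans hv
    rw [Real.norm_eq_abs] at h1
    have h2 : ((|v i| : ℤ) : ℝ) ≤ (⌈K⌉ : ℝ) := by
      rw [Int.cast_abs]; exact h1.trans (Int.le_ceil K)
    exact abs_le.1 (by exact_mod_cast h2)
  exact (Set.Finite.pi' fun _ => Set.finite_Icc _ _).subset (by simpa [Set.pi] using this)

/-- cross product of the first two rows -/
def crs {R : Type*} [CommRing R] (A : M3 R) : Fin 3 → R :=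
  ![A 0 1 * A 1 2 - A 0 2 * A 1 1, A 0 2 * A 1 0 - A 0 0 * A 1 2, A 0 0 * A 1 1 - A 0 1 * A 1 0]

theorem dd_eq (B : M3 ℝ) : dd B = nsq (crs B) := by
  simp [dd, gg, nsq, crs]; ring

theorem crs_mul (A M : M3 ℝ) : crs (A * M) = Matrix.vecMul (crs A) M.adjugate.transpose := by
  have : ∀ i j, (A * M) i j = A i 0 * M 0 j + A i 1 * M 1 j + A i 2 * M 2 j := by
    intro i j; simp [Matrix.mul_apply, Fin.sum_univ_three]
  funext j
  simp only [crs, this, Matrix.vecMul, dotProduct, Fin.sum_univ_three, Matrix.transpose_apply,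
    Matrix.adjugate_fin_three]
  fin_cases j <;> simp <;> ring

theorem crs_det {R : Type*} [CommRing R] (A : M3 R) :
    A.det = crs A 0 * A 2 0 + crs A 1 * A 2 1 + crs A 2 * A 2 2 := by
  simp [Matrix.det_fin_three, crs]; ring

theorem gg_zero (B : M3 ℝ) : gg B 0 0 = nsq (B 0) := by simp [gg, nsq]; ring

theorem mul_row (A M : M3 ℝ) (i : Fin 3) : (A * M) i = Matrix.vecMul (A i) M := by
  funext j; simp [Matrix.mul_apply, Matrix.vecMul, dotProduct]

theorem pot_min (M : M3 ℝ) (hM : M.det ≠ 0) : ∃ γ : Γ3, ∀ γ' : Γ3,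
    gg (rM γ * M) 0 0 * dd (rM γ * M) ≤ gg (rM γ' * M) 0 0 * dd (rM γ' * M) := by
  obtain ⟨K1, hK1, h1⟩ := vecMul_bound M hM
  obtain ⟨K2, hK2, h2⟩ := vecMul_bound M.adjugate.transpose (by
    rw [Matrix.det_transpose, Matrix.det_adjugate]; exact pow_ne_zero _ hM)
  let D : Γ3 → ℝ := fun γ => gg (rM γ * M) 0 0 * dd (rM γ * M)
  let e : Γ3 → (Fin 3 → ℤ) × (Fin 3 → ℤ) := fun γ => ((γ : M3 ℤ) 0, crs (γ : M3 ℤ))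
  let q : (Fin 3 → ℤ) × (Fin 3 → ℤ) → ℝ := fun x =>
    nsq (Matrix.vecMul (fun i => (x.1 i : ℝ)) M) *
      nsq (Matrix.vecMul (fun i => (x.2 i : ℝ)) M.adjugate.transpose)
  have hcr : ∀ γ : Γ3, crs (rM (γ : M3 ℤ)) = fun i => ((crs (γ : M3 ℤ) i : ℤ) : ℝ) := by
    intro γ; funext i; fin_cases i <;> simp [crs, rM_apply]
  have hq : ∀ γ, D γ = q (e γ) := by
    intro γ
    simp only [D, q, e, gg_zero, dd_eq, crs_mul, mul_row, hcr]
    rfl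
  have hv : ∀ γ : Γ3, (γ : M3 ℤ) 0 ≠ 0 := by
    intro γ h
    have := γ.2
    rw [Matrix.det_fin_three] at this
    simp [show ∀ j, (γ : M3 ℤ) 0 j = 0 from fun j => congrFun h j] at this
  have hw : ∀ γ : Γ3, crs (γ : M3 ℤ) ≠ 0 := by
    intro γ h
    have := γ.2
    rw [crs_det, h] at this
    simp at this
  have hf : {x | x ∈ Set.range e ∧ q x ≤ D 1}.Finite := by
    have lb : ∀ (N : M3 ℝ) (K : ℝ), 0 < K → (∀ v : Fin 3 → ℝ, ‖v‖ ≤ K * ‖Matrix.vecMul v N‖) →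
      ∀ v : Fin 3 → ℝ, ‖v‖ ^ 2 ≤ K ^ 2 * nsq (Matrix.vecMul v N) := by
      intro N K hK h v
      calc ‖v‖ ^ 2 ≤ (K * ‖Matrix.vecMul v N‖) ^ 2 := by gcongr; exact h v
        _ = K ^ 2 * ‖Matrix.vecMul v N‖ ^ 2 := by ring
        _ ≤ _ := by gcongr; exact norm_sq_le_nsq _
    set K : ℝ := K1 ^ 2 * K2 ^ 2 * D 1 with hK
    refine ((int_vec_finite K).prod (int_vec_finite K)).subset ?_
    rintro x ⟨⟨γ, rfl⟩, hx⟩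
    have a1 := lb M K1 hK1 h1 (fun i => ((e γ).1 i : ℝ))
    have a2 := lb _ K2 hK2 h2 (fun i => ((e γ).2 i : ℝ))
    have b1 := int_vec_norm _ (hv γ)
    have b2 := int_vec_norm _ (hw γ)
    change (1:ℝ) ≤ ‖fun i => ((e γ).1 i : ℝ)‖ at b1
    change (1:ℝ) ≤ ‖fun i => ((e γ).2 i : ℝ)‖ at b2
    have a3 : ‖fun i => ((e γ).1 i : ℝ)‖ ^ 2 * ‖fun i => ((e γ).2 i : ℝ)‖ ^ 2 ≤ K := by
      calc _ ≤ (K1 ^ 2 * nsq (Matrix.vecMul (fun i => ((e γ).1 i : ℝ)) M)) *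
            (K2 ^ 2 * nsq (Matrix.vecMul (fun i => ((e γ).2 i : ℝ)) M.adjugate.transpose)) := by
              exact mul_le_mul a1 a2 (by positivity) (le_trans (by positivity) a1)
        _ = K1 ^ 2 * K2 ^ 2 * q (e γ) := by simp only [q]; ring
        _ ≤ _ := by rw [hK]; gcongr
    constructor
    · change ‖fun i => ((e γ).1 i : ℝ)‖ ≤ K
      nlinarith [mul_le_mul b1 b1 zero_le_one (by linarith), mul_le_mul b2 b2 zero_le_one (by linarith)]
    · change ‖fun i => ((e γ).2 i : ℝ)‖ ≤ K
      nlinarith [mul_le_mul b1 b1 zero_le_one (by linarith), mul_le_mul b2 b2 zero_le_one (by linarith)]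
  obtain ⟨x, ⟨⟨γ, rfl⟩, hx⟩, hmin⟩ := hf.exists_minimalFor q _ ⟨e 1, ⟨1, rfl⟩, (hq 1).symm.le⟩
  refine ⟨γ, fun γ' => ?_⟩
  change D γ ≤ D γ'
  by_contra hlt
  push Not at hlt
  have hm : e γ' ∈ {x | x ∈ Set.range e ∧ q x ≤ D 1} := by
    refine ⟨⟨γ', rfl⟩, ?_⟩
    rw [← hq]; rw [← hq] at hx; linarith
  have := hmin hm (by rw [← hq, ← hq]; exact hlt.le)
  rw [← hq, ← hq] at this
  linarith

def slmk (A : M3 ℤ) (h : A.det = 1) : Γ3 := ⟨A, h⟩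

theorem round_bound (x d : ℝ) (hd : 0 < d) : ∃ n : ℤ, |x + n * d| ≤ d / 2 := by
  refine ⟨-round (x / d), ?_⟩
  have h := abs_sub_round (x / d)
  have e : x + ((-round (x / d) : ℤ) : ℝ) * d = (x / d - round (x / d)) * d := by
    push_cast; field_simp; ring
  rw [e, abs_mul, abs_of_pos hd]; nlinarith

theorem red_ineq (d1 d2 g1 g2 h1 h2 e d : ℝ) (p1 : 0 < d1) (p2 : 0 < d2) (hd : 0 < d)
    (ha : |h1| ≤ d1 / 2) (hb : |h2| ≤ d1 / 2) (hc : |e| ≤ d2 / 2) (m1 : d1 ≤ g1)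
    (m2 : d2 ≤ d1 * g2 - h2 ^ 2) (syl : d1 * d ^ 2 = d2 * (d1 * g2 - h2 ^ 2) - e ^ 2)
    (hdd : d2 = d1 * g1 - h1 ^ 2) :
    d1 ≤ 4 / 3 * (d2 / d1) ∧ 4 / 3 * (d2 / d1) ≤ 16 / 9 * (d ^ 2 / d2) ∧
    g1 ≤ 4 / 3 * (d2 / d1) ∧ g2 ≤ 16 / 9 * (d ^ 2 / d2) := by
  have sq1 : h1 ^ 2 ≤ (d1 / 2) ^ 2 := sq_le_sq' (by linarith [(abs_le.1 ha).1]) (abs_le.1 ha).2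
  have sq2 : h2 ^ 2 ≤ (d1 / 2) ^ 2 := sq_le_sq' (by linarith [(abs_le.1 hb).1]) (abs_le.1 hb).2
  have sq3 : e ^ 2 ≤ (d2 / 2) ^ 2 := sq_le_sq' (by linarith [(abs_le.1 hc).1]) (abs_le.1 hc).2
  have k0 : d1 * d1 ≤ d1 * g1 := mul_le_mul_of_nonneg_left m1 p1.le
  have k1 : 3 / 4 * d1 ^ 2 ≤ d2 := by nlinarith
  generalize hf2 : d1 * g2 - h2 ^ 2 = f2 at *
  have k20 : d2 * d2 ≤ d2 * f2 := mul_le_mul_of_nonneg_left m2 p2.le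
  have k2 : 3 / 4 * (d2 * f2) ≤ d1 * d ^ 2 := by nlinarith
  have k3 : 3 / 4 * d2 ^ 2 ≤ d1 * d ^ 2 := by nlinarith
  have l1 : d1 ≤ 4 / 3 * (d2 / d1) := by
    rw [← mul_div_assoc, le_div_iff₀ p1]; linarith
  have l2 : 4 / 3 * (d2 / d1) ≤ 16 / 9 * (d ^ 2 / d2) := by
    rw [← mul_div_assoc, ← mul_div_assoc, div_le_div_iff₀ p1 p2]; linarith
  refine ⟨l1, l2, ?_, ?_⟩
  · rw [← mul_div_assoc, le_div_iff₀ p1]; linarith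
  · have l3 : f2 / d1 ≤ 4 / 3 * (d ^ 2 / d2) := by
      rw [← mul_div_assoc, div_le_div_iff₀ p1 p2]; linarith
    have l4 : g2 = f2 / d1 + h2 ^ 2 / d1 := by rw [← hf2]; field_simp; ring
    have l5 : h2 ^ 2 / d1 ≤ d1 / 4 := by rw [div_le_iff₀ p1]; linarith
    linarith

theorem reduction (M : M3 ℝ) (hM : 0 < M.det) : ∃ γ : Γ3, ∃ ρ : Fin 3 → ℝ,
    0 < ρ 0 ∧ ρ 0 ≤ ρ 1 ∧ ρ 1 ≤ ρ 2 ∧ (∀ i, gg (rM γ * M) i i ≤ ρ i ^ 2) ∧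
    ρ 0 * ρ 1 * ρ 2 ≤ 2 * M.det := by
  obtain ⟨γ, hγ⟩ := pot_min M hM.ne'
  set B := rM (γ : M3 ℤ) * M with hB
  have hBd : B.det = M.det := by rw [hB, Matrix.det_mul, rM_det_SL, one_mul]
  have dpos : ∀ C : M3 ℝ, C.det ≠ 0 → 0 < gg C 0 0 ∧ 0 < dd C := by
    intro C hC
    constructor
    · by_contra h
      have h0 : C 0 0 = 0 ∧ C 0 1 = 0 ∧ C 0 2 = 0 := by
        simp only [gg] at h
        refine ⟨?_, ?_, ?_⟩ <;> nlinarith [sq_nonneg (C 0 0), sq_nonneg (C 0 1), sq_nonneg (C 0 2)]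
      apply hC; rw [Matrix.det_fin_three]; simp [h0.1, h0.2.1, h0.2.2]
    · by_contra h
      rw [dd_eq] at h
      have h0 : crs C 0 = 0 ∧ crs C 1 = 0 ∧ crs C 2 = 0 := by
        simp only [nsq] at h
        refine ⟨?_, ?_, ?_⟩ <;> nlinarith [sq_nonneg (crs C 0), sq_nonneg (crs C 1), sq_nonneg (crs C 2)]
      apply hC; rw [crs_det]; simp [h0.1, h0.2.1, h0.2.2]
  -- size reduction
  obtain ⟨p1, p2⟩ := dpos B (by rw [hBd]; exact hM.ne')
  obtain ⟨a, ha⟩ := round_bound (gg B 0 1) (gg B 0 0) p1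
  obtain ⟨c, hc⟩ := round_bound (gg B 0 0 * gg B 1 2 - gg B 0 1 * gg B 0 2) (dd B) p2
  obtain ⟨b, hb⟩ := round_bound (gg B 0 2 + c * gg B 0 1) (gg B 0 0) p1
  let U : Γ3 := slmk !![1,0,0; a,1,0; b,c,1] (by simp [Matrix.det_fin_three])
  let S1 : Γ3 := slmk !![0,1,0; -1,0,0; 0,0,1] (by simp [Matrix.det_fin_three])
  let S2 : Γ3 := slmk !![1,0,0; 0,0,1; 0,-1,0] (by simp [Matrix.det_fin_three])
  set E := rM ((U * γ : Γ3) : M3 ℤ) * M with hE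
  have hEB : E = rM (U : M3 ℤ) * B := by
    rw [hE, hB, Matrix.SpecialLinearGroup.coe_mul, rM_mul, Matrix.mul_assoc]
  have hEd : E.det = M.det := by rw [hE, Matrix.det_mul, rM_det_SL, one_mul]
  have E0 : ∀ j, E 0 j = B 0 j := by
    intro j; rw [hEB]; simp [Matrix.mul_apply, Fin.sum_univ_three, rM_apply, U, slmk]
  have E1 : ∀ j, E 1 j = a * B 0 j + B 1 j := by
    intro j; rw [hEB]; simp [Matrix.mul_apply, Fin.sum_univ_three, rM_apply, U, slmk]
  have E2 : ∀ j, E 2 j = b * B 0 j + c * B 1 j + B 2 j := by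
    intro j; rw [hEB]; simp [Matrix.mul_apply, Fin.sum_univ_three, rM_apply, U, slmk]
  have g00 : gg E 0 0 = gg B 0 0 := by simp only [gg, E0]
  have g01 : gg E 0 1 = gg B 0 1 + a * gg B 0 0 := by simp only [gg, E0, E1]; ring
  have g02 : gg E 0 2 = gg B 0 2 + c * gg B 0 1 + b * gg B 0 0 := by simp only [gg, E0, E2]; ring
  have gdd : dd E = dd B := by simp only [dd, gg, E0, E1]; ring
  have ge : gg E 0 0 * gg E 1 2 - gg E 0 1 * gg E 0 2 =
      gg B 0 0 * gg B 1 2 - gg B 0 1 * gg B 0 2 + c * dd B := by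
    simp only [dd, gg, E0, E1, E2]; ring
  rw [← g01, ← g00] at ha
  rw [← g02, ← g00] at hb
  rw [← ge, ← gdd] at hc
  rw [← g00] at p1
  rw [← gdd] at p2
  have min1 := hγ (S1 * (U * γ))
  have min2 := hγ (S2 * (U * γ))
  rw [Matrix.SpecialLinearGroup.coe_mul, rM_mul, Matrix.mul_assoc, ← hE, ← gdd, ← g00]
    at min1 min2
  have F1 : ∀ i j, (rM (S1 : M3 ℤ) * E) i j = ![E 1 j, - E 0 j, E 2 j] i := by
    intro i j; fin_cases i <;> simp [Matrix.mul_apply, Fin.sum_univ_three, rM_apply, S1, slmk]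
  have F2 : ∀ i j, (rM (S2 : M3 ℤ) * E) i j = ![E 0 j, E 2 j, - E 1 j] i := by
    intro i j; fin_cases i <;> simp [Matrix.mul_apply, Fin.sum_univ_three, rM_apply, S2, slmk]
  have m1 : gg E 0 0 ≤ gg E 1 1 := by
    have e1 : gg (rM (S1 : M3 ℤ) * E) 0 0 = gg E 1 1 := by simp [gg, F1]
    have e2 : dd (rM (S1 : M3 ℤ) * E) = dd E := by simp [dd, gg, F1]; ring
    rw [e1, e2] at min1
    exact le_of_mul_le_mul_right min1 p2
  have m2 : dd E ≤ gg E 0 0 * gg E 2 2 - gg E 0 2 ^ 2 := by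
    have e1 : gg (rM (S2 : M3 ℤ) * E) 0 0 = gg E 0 0 := by simp [gg, F2]
    have e2 : dd (rM (S2 : M3 ℤ) * E) = gg E 0 0 * gg E 2 2 - gg E 0 2 ^ 2 := by
      simp [dd, gg, F2]
    rw [e1, e2] at min2
    exact le_of_mul_le_mul_left min2 p1
  have syl : gg E 0 0 * M.det ^ 2 = dd E * (gg E 0 0 * gg E 2 2 - gg E 0 2 ^ 2) -
      (gg E 0 0 * gg E 1 2 - gg E 0 1 * gg E 0 2) ^ 2 := by
    rw [← hEd, Matrix.det_fin_three]; simp only [dd, gg]; ring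
  have hdd : dd E = gg E 0 0 * gg E 1 1 - gg E 0 1 ^ 2 := rfl
  obtain ⟨l1, l2, l3, l4⟩ := red_ineq _ _ _ _ _ _ _ _ p1 p2 hM ha hb hc m1 m2 syl hdd
  refine ⟨U * γ, ![Real.sqrt (gg E 0 0), Real.sqrt (4 / 3 * (dd E / gg E 0 0)),
    Real.sqrt (16 / 9 * (M.det ^ 2 / dd E))], ?_, Real.sqrt_le_sqrt l1, Real.sqrt_le_sqrt l2, ?_, ?_⟩
  · simpa using p1
  · intro i
    rw [← hE]
    fin_cases i
    · exact (Real.sq_sqrt p1.le).ge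
    · exact l3.trans (Real.sq_sqrt (by positivity)).ge
    · exact l4.trans (Real.sq_sqrt (by positivity)).ge
  · clear_value E
    simp only [Matrix.cons_val]
    rw [← Real.sqrt_mul p1.le, ← Real.sqrt_mul (by positivity)]
    apply Real.sqrt_le_iff.2 ⟨by positivity, ?_⟩
    have : gg E 0 0 * (4 / 3 * (dd E / gg E 0 0)) * (16 / 9 * (M.det ^ 2 / dd E))
        = 64 / 27 * M.det ^ 2 := by
      field_simp; ring
    rw [this]; nlinarith [sq_nonneg M.det]

end TC

open MvPolynomial

namespace TC
open Filter Topology MeasureTheory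

theorem exp_lift_const (g : ℝ → ℂ) (hg : Continuous g) (w : ℂ) (h : ∀ t, Complex.exp (g t) = w)
    (s t : ℝ) : g s = g t := by
  have hw : w ≠ 0 := by rw [← h 0]; exact Complex.exp_ne_zero _
  obtain ⟨F, -, hu⟩ := Complex.isCoveringMapOn_exp.existsUnique_continuousMap_lifts
    (A := ℝ) (ContinuousMap.const ℝ w) (a₀ := s) (e₀ := g s) (h s) (fun _ => hw)
  have h1 := hu ⟨g, hg⟩ ⟨rfl, by funext t; exact h t⟩
  have h2 := hu (ContinuousMap.const ℝ (g s)) ⟨rfl, by funext t; exact h s⟩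
  have := congrArg (fun k : C(ℝ, ℂ) => k t) (h1.trans h2.symm)
  exact this.symm

/-- Borsuk–Ulam for two odd functions on the sphere -/
theorem borsuk (f g : (Fin 3 → ℝ) → ℝ) (hf : Continuous f) (hg : Continuous g)
    (of : ∀ v, f (-v) = - f v) (og : ∀ v, g (-v) = - g v) :
    ∃ v : Fin 3 → ℝ, v ≠ 0 ∧ f v = 0 ∧ g v = 0 := by
  by_contra hcon
  push Not at hcon
  let v : ℝ × ℝ → Fin 3 → ℝ := fun p => ![Real.sin p.1 * Real.cos p.2, Real.sin p.1 * Real.sin p.2, Real.cos p.1]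
  have hv : Continuous v := by
    refine continuous_pi fun i => ?_
    fin_cases i <;> simp [v] <;> fun_prop
  have hv0 : ∀ p, v p ≠ 0 := by
    intro p h
    have h0 := congrFun h 0
    have h1 := congrFun h 1
    have h2 := congrFun h 2
    simp [v] at h0 h1 h2
    have a := Real.sin_sq_add_cos_sq p.1
    have b := Real.sin_sq_add_cos_sq p.2
    rw [h2] at a
    rcases h0 with h0 | h0
    · rw [h0] at a; norm_num at a
    · rcases h1 with h1 | h1
      · rw [h1] at a; norm_num at a
      · rw [h0, h1] at b; norm_num at b
  let F : C(ℝ × ℝ, ℂ) := ⟨fun p => (f (v p) : ℂ) + (g (v p) : ℂ) * Complex.I, by fun_prop⟩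
  have hF : ∀ p, F p ∈ ({0}ᶜ : Set ℂ) := by
    intro p h
    have h' : (f (v p) : ℂ) + (g (v p) : ℂ) * Complex.I = 0 := h
    have r := congrArg Complex.re h'
    have i := congrArg Complex.im h'
    simp at r i
    exact hcon _ (hv0 p) r i
  obtain ⟨L, ⟨-, hL⟩, -⟩ := Complex.isCoveringMapOn_exp.existsUnique_continuousMap_lifts
    F (a₀ := (0, 0)) (e₀ := Complex.log (F (0, 0))) (Complex.exp_log (hF (0, 0))) hF
  have hL' : ∀ p, Complex.exp (L p) = F p := fun p => congrFun hL p
  have c1 : ∀ θ, L (Real.pi / 2, θ + Real.pi) - L (Real.pi / 2, θ) =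
      L (Real.pi / 2, 0 + Real.pi) - L (Real.pi / 2, 0) := by
    intro θ
    refine exp_lift_const (fun θ => L (Real.pi / 2, θ + Real.pi) - L (Real.pi / 2, θ))
      (by fun_prop) (-1) ?_ θ 0
    intro t
    rw [Complex.exp_sub, hL', hL', div_eq_iff (hF _)]
    have : v (Real.pi / 2, t + Real.pi) = - v (Real.pi / 2, t) := by
      funext i; fin_cases i <;> simp [v, Real.cos_add_pi, Real.sin_add_pi]
    simp only [F, ContinuousMap.coe_mk, this, of, og]
    push_cast; ring
  have c2 : ∀ s, L (s, 0 + Real.pi + Real.pi) - L (s, 0) = L (0, 0 + Real.pi + Real.pi) - L (0, 0) := by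
    intro s
    refine exp_lift_const (fun s => L (s, 0 + Real.pi + Real.pi) - L (s, 0)) (by fun_prop) 1 ?_ s 0
    intro t
    rw [Complex.exp_sub, hL', hL', div_eq_iff (hF _)]
    have : v (t, 0 + Real.pi + Real.pi) = v (t, 0) := by
      funext i; fin_cases i <;> simp [v]
    simp only [F, ContinuousMap.coe_mk, this, one_mul]
  have c3 : L (0, 0 + Real.pi + Real.pi) = L (0, 0) := by
    refine exp_lift_const (fun θ => L (0, θ)) (by fun_prop) (F (0, 0)) ?_ _ _
    intro t
    rw [hL']
    have : v (0, t) = v (0, 0) := by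
      funext i; fin_cases i <;> simp [v]
    simp [F, this]
  have c4 := c1 (0 + Real.pi)
  have c5 := c2 (Real.pi / 2)
  rw [c3, sub_self] at c5
  have c6 : L (Real.pi / 2, 0 + Real.pi) = L (Real.pi / 2, 0) := by
    linear_combination (1/2 : ℂ) * c5 - (1/2 : ℂ) * c4
  have e : Complex.exp (L (Real.pi / 2, 0 + Real.pi)) = Complex.exp (L (Real.pi / 2, 0)) := by rw [c6]
  rw [hL', hL'] at e
  have hvv : v (Real.pi / 2, 0 + Real.pi) = - v (Real.pi / 2, 0) := by
    funext i; fin_cases i <;> simp [v]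
  have e2 : F (Real.pi / 2, 0 + Real.pi) = - F (Real.pi / 2, 0) := by
    simp only [F, ContinuousMap.coe_mk, hvv, of, og]; push_cast; ring
  rw [e2] at e
  exact hF (Real.pi / 2, 0) (by simpa using (self_eq_neg.1 e.symm))

theorem exists_flex (c : Fin 10 → ℝ) : ∃ v : Fin 3 → ℝ, v ≠ 0 ∧ ev c v = 0 ∧ he c v = 0 := by
  apply borsuk
  · unfold ev; fun_prop
  · have : he c = ev (heC c) := by funext v; rw [ev_heC]
    rw [this]; unfold ev; fun_prop
  · intro v; have := ev_smul_vec (-1) c v; simp at this; linarith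
  · intro v; have := he_smul_vec (-1) c v; simp at this; linarith

end TC

open MvPolynomial

namespace TC
open Filter Topology MeasureTheory

section invs
variable {R : Type*} [CommRing R]

/-- Coefficients of the Jacobian of a ternary cubic (Artin, Rodriguez-Villegas, Tate). -/
def wa1 (c : Fin 10 → R) : R := c 9

def wa2 (c : Fin 10 → R) : R :=
  - c 3 * c 8 - c 4 * c 6 - c 5 * c 7

def wa3 (c : Fin 10 → R) : R :=
  9 * c 0 * c 1 * c 2 - c 0 * c 6 * c 8 - c 1 * c 4 * c 7 - c 2 * c 3 * c 5 - c 3 * c 6 * c 7 -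
    c 4 * c 5 * c 8

def wa4 (c : Fin 10 → R) : R :=
  - 3 * c 0 * c 1 * c 7 * c 8 - 3 * c 0 * c 2 * c 5 * c 6 + c 0 * c 5 * c 8 ^ 2 + c 0 * c 6 ^ 2
    * c 7 - 3 * c 1 * c 2 * c 3 * c 4 + c 1 * c 3 * c 7 ^ 2 + c 1 * c 4 ^ 2 * c 8 + c 2 * c 3 ^
    2 * c 6 + c 2 * c 4 * c 5 ^ 2 + c 3 * c 4 * c 6 * c 8 + c 3 * c 5 * c 7 * c 8 + c 4 * c 5 *
    c 6 * c 7

def wa6 (c : Fin 10 → R) : R :=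
  - 27 * c 0 ^ 2 * c 1 ^ 2 * c 2 ^ 2 + 9 * c 0 ^ 2 * c 1 * c 2 * c 6 * c 8 - c 0 ^ 2 * c 1 * c 8
    ^ 3 - c 0 ^ 2 * c 2 * c 6 ^ 3 + 9 * c 0 * c 1 ^ 2 * c 2 * c 4 * c 7 - c 0 * c 1 ^ 2 * c 7 ^
    3 + 9 * c 0 * c 1 * c 2 ^ 2 * c 3 * c 5 + 3 * c 0 * c 1 * c 2 * c 3 * c 6 * c 7 - 3 * c 0 *
    c 1 * c 2 * c 3 * c 8 * c 9 + 3 * c 0 * c 1 * c 2 * c 4 * c 5 * c 8 - 3 * c 0 * c 1 * c 2 *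
    c 4 * c 6 * c 9 - 3 * c 0 * c 1 * c 2 * c 5 * c 7 * c 9 + c 0 * c 1 * c 2 * c 9 ^ 3 + 2 * c
    0 * c 1 * c 3 * c 7 * c 8 ^ 2 - c 0 * c 1 * c 4 * c 6 * c 7 * c 8 + c 0 * c 1 * c 4 * c 8 ^
    2 * c 9 + 2 * c 0 * c 1 * c 5 * c 7 ^ 2 * c 8 + c 0 * c 1 * c 6 * c 7 ^ 2 * c 9 - c 0 * c 1
    * c 7 * c 8 * c 9 ^ 2 - c 0 * c 2 ^ 2 * c 5 ^ 3 - c 0 * c 2 * c 3 * c 5 * c 6 * c 8 + c 0 *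
    c 2 * c 3 * c 6 ^ 2 * c 9 + 2 * c 0 * c 2 * c 4 * c 5 * c 6 ^ 2 + 2 * c 0 * c 2 * c 5 ^ 2 *
    c 6 * c 7 + c 0 * c 2 * c 5 ^ 2 * c 8 * c 9 - c 0 * c 2 * c 5 * c 6 * c 9 ^ 2 - c 0 * c 3 *
    c 6 ^ 2 * c 7 * c 8 - c 0 * c 4 * c 5 * c 6 * c 8 ^ 2 - c 0 * c 5 ^ 2 * c 7 * c 8 ^ 2 - c 0
    * c 5 * c 6 ^ 2 * c 7 ^ 2 + c 0 * c 5 * c 6 * c 7 * c 8 * c 9 - c 1 ^ 2 * c 2 * c 4 ^ 3 - c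
    1 * c 2 ^ 2 * c 3 ^ 3 + 2 * c 1 * c 2 * c 3 ^ 2 * c 4 * c 8 + c 1 * c 2 * c 3 ^ 2 * c 7 * c
    9 + 2 * c 1 * c 2 * c 3 * c 4 ^ 2 * c 6 - c 1 * c 2 * c 3 * c 4 * c 5 * c 7 - c 1 * c 2 * c
    3 * c 4 * c 9 ^ 2 + c 1 * c 2 * c 4 ^ 2 * c 5 * c 9 - c 1 * c 3 ^ 2 * c 7 ^ 2 * c 8 - c 1 *
    c 3 * c 4 ^ 2 * c 8 ^ 2 - c 1 * c 3 * c 4 * c 6 * c 7 ^ 2 + c 1 * c 3 * c 4 * c 7 * c 8 * c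
    9 - c 1 * c 4 ^ 2 * c 5 * c 7 * c 8 - c 2 * c 3 ^ 2 * c 4 * c 6 ^ 2 - c 2 * c 3 ^ 2 * c 5 *
    c 6 * c 7 - c 2 * c 3 * c 4 * c 5 ^ 2 * c 8 + c 2 * c 3 * c 4 * c 5 * c 6 * c 9 - c 2 * c 4
    ^ 2 * c 5 ^ 2 * c 6 - c 3 * c 4 * c 5 * c 6 * c 7 * c 8

def wb2 (c : Fin 10 → R) : R := wa1 c ^ 2 + 4 * wa2 c

def wb4 (c : Fin 10 → R) : R := 2 * wa4 c + wa1 c * wa3 c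

def wb6 (c : Fin 10 → R) : R := wa3 c ^ 2 + 4 * wa6 c

/-- `16 I` -/
def wc4 (c : Fin 10 → R) : R := wb2 c ^ 2 - 24 * wb4 c

/-- `32 J` -/
def wc6 (c : Fin 10 → R) : R := - wb2 c ^ 3 + 36 * wb2 c * wb4 c - 216 * wb6 c

/-- the matrix `M` transforms the invariants in the expected way -/
def Cov (M : Matrix (Fin 3) (Fin 3) R) : Prop :=
  ∀ c : Fin 10 → R, wc4 (act M c) = M.det ^ 4 * wc4 c ∧ wc6 (act M c) = M.det ^ 6 * wc6 c

theorem Cov.mul [IsDomain R] (h2 : (2 : R) ≠ 0) {M N : Matrix (Fin 3) (Fin 3) R} (hM : Cov M)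
    (hN : Cov N) : Cov (M * N) := by
  intro c
  rw [act_mul h2, (hM _).1, (hM _).2, (hN _).1, (hN _).2, Matrix.det_mul]
  constructor <;> ring

set_option maxHeartbeats 4000000 in
theorem cov_t (t : R) : Cov !![1, t, 0; 0, 1, 0; 0, 0, 1] := by
  intro c
  rw [Matrix.det_fin_three]
  constructor
  · simp [wc4, wb2, wb4, wb6, wa1, wa2, wa3, wa4, wa6, act, ev, dv, tri, gr, hm]
    ring
  · simp [wc6, wb2, wb4, wb6, wa1, wa2, wa3, wa4, wa6, act, ev, dv, tri, gr, hm]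
    ring

set_option maxHeartbeats 4000000 in
theorem cov_s : Cov (!![0, 1, 0; 1, 0, 0; 0, 0, 1] : Matrix (Fin 3) (Fin 3) R) := by
  intro c
  rw [Matrix.det_fin_three]
  constructor
  · simp [wc4, wb2, wb4, wb6, wa1, wa2, wa3, wa4, wa6, act, ev, dv, tri, gr, hm]
    ring
  · simp [wc6, wb2, wb4, wb6, wa1, wa2, wa3, wa4, wa6, act, ev, dv, tri, gr, hm]
    ring

set_option maxHeartbeats 4000000 in
theorem cov_z : Cov (!![0, 1, 0; 0, 0, 1; 1, 0, 0] : Matrix (Fin 3) (Fin 3) R) := by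
  intro c
  rw [Matrix.det_fin_three]
  constructor
  · simp [wc4, wb2, wb4, wb6, wa1, wa2, wa3, wa4, wa6, act, ev, dv, tri, gr, hm]
    ring
  · simp [wc6, wb2, wb4, wb6, wa1, wa2, wa3, wa4, wa6, act, ev, dv, tri, gr, hm]
    ring

set_option maxHeartbeats 4000000 in
theorem cov_d (a b d : R) : Cov (!![a, 0, 0; 0, b, 0; 0, 0, d] : Matrix (Fin 3) (Fin 3) R) := by
  intro c
  rw [Matrix.det_fin_three]
  constructor
  · simp [wc4, wb2, wb4, wb6, wa1, wa2, wa3, wa4, wa6, act, ev, dv, tri, gr, hm]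
    ring
  · simp [wc6, wb2, wb4, wb6, wa1, wa2, wa3, wa4, wa6, act, ev, dv, tri, gr, hm]
    ring

theorem cov_transv [IsDomain R] (h2 : (2 : R) ≠ 0) (i j : Fin 3) (hij : i ≠ j) (t : R) :
    Cov (Matrix.transvection i j t) := by
  let S : Matrix (Fin 3) (Fin 3) R := !![0, 1, 0; 1, 0, 0; 0, 0, 1]
  let Z : Matrix (Fin 3) (Fin 3) R := !![0, 1, 0; 0, 0, 1; 1, 0, 0]
  let T : Matrix (Fin 3) (Fin 3) R := !![1, t, 0; 0, 1, 0; 0, 0, 1]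
  have hS : Cov S := cov_s
  have hZ : Cov Z := cov_z
  have hT : Cov T := cov_t t
  have h01 : Matrix.transvection 0 1 t = T := by
    ext a b; fin_cases a <;> fin_cases b <;> simp [Matrix.transvection, Matrix.single, T]
  have h10 : Matrix.transvection 1 0 t = S * T * S := by
    ext a b; fin_cases a <;> fin_cases b <;>
      simp [Matrix.transvection, Matrix.single, T, S, Matrix.mul_apply, Fin.sum_univ_three]
  have hz : ∀ M : Matrix (Fin 3) (Fin 3) R, Cov M → Cov (Z * M * (Z * Z)) := fun M h =>
    (hZ.mul h2 h).mul h2 (hZ.mul h2 hZ)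
  have hz' : ∀ M : Matrix (Fin 3) (Fin 3) R, Cov M → Cov (Z * Z * M * Z) := fun M h =>
    ((hZ.mul h2 hZ).mul h2 h).mul h2 hZ
  have c01 : Cov (Matrix.transvection 0 1 t) := by rw [h01]; exact hT
  have c10 : Cov (Matrix.transvection 1 0 t) := by rw [h10]; exact (hS.mul h2 hT).mul h2 hS
  have h20 : Matrix.transvection 2 0 t = Z * Matrix.transvection 0 1 t * (Z * Z) := by
    rw [h01]; ext a b; fin_cases a <;> fin_cases b <;>
      simp [Matrix.transvection, Matrix.single, T, Z, Matrix.mul_apply, Fin.sum_univ_three]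
  have h12 : Matrix.transvection 1 2 t = Z * Z * Matrix.transvection 0 1 t * Z := by
    rw [h01]; ext a b; fin_cases a <;> fin_cases b <;>
      simp [Matrix.transvection, Matrix.single, T, Z, Matrix.mul_apply, Fin.sum_univ_three]
  have h02 : Matrix.transvection 0 2 t = Z * Matrix.transvection 1 0 t * (Z * Z) := by
    rw [h10]; ext a b; fin_cases a <;> fin_cases b <;>
      simp [Matrix.transvection, Matrix.single, T, S, Z, Matrix.mul_apply, Fin.sum_univ_three]
  have h21 : Matrix.transvection 2 1 t = Z * Z * Matrix.transvection 1 0 t * Z := by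
    rw [h10]; ext a b; fin_cases a <;> fin_cases b <;>
      simp [Matrix.transvection, Matrix.single, T, S, Z, Matrix.mul_apply, Fin.sum_univ_three]
  fin_cases i <;> fin_cases j <;> first | exact absurd rfl hij | skip
  · exact c01
  · show Cov (Matrix.transvection 0 2 t); rw [h02]; exact hz _ c10
  · exact c10
  · show Cov (Matrix.transvection 1 2 t); rw [h12]; exact hz' _ c01
  · show Cov (Matrix.transvection 2 0 t); rw [h20]; exact hz _ c01
  · show Cov (Matrix.transvection 2 1 t); rw [h21]; exact hz' _ c10

end invs

theorem cov_all {K : Type*} [Field K] (h2 : (2 : K) ≠ 0) (M : Matrix (Fin 3) (Fin 3) K)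
    (hM : M.det ≠ 0) : Cov M := by
  refine Matrix.diagonal_transvection_induction_of_det_ne_zero Cov M hM ?_ ?_ ?_
  · intro D _
    have : Matrix.diagonal D = !![D 0, 0, 0; 0, D 1, 0; 0, 0, D 2] := by
      ext a b; fin_cases a <;> fin_cases b <;> simp
    rw [this]; exact cov_d _ _ _
  · intro t
    exact cov_transv h2 _ _ t.hij t.c
  · intro A B _ _ hA hB
    exact hA.mul h2 hB

/-- real invariants -/
noncomputable def iI (c : Fin 10 → ℝ) : ℝ := wc4 c / 16
noncomputable def iJ (c : Fin 10 → ℝ) : ℝ := wc6 c / 32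
noncomputable def iD (c : Fin 10 → ℝ) : ℝ := (4 * iI c ^ 3 - iJ c ^ 2) / 27

theorem iI_act (M : M3 ℝ) (hM : M.det ≠ 0) (c : Fin 10 → ℝ) : iI (act M c) = M.det ^ 4 * iI c := by
  rw [iI, iI, (cov_all two_ne_zero M hM c).1]; ring
theorem iJ_act (M : M3 ℝ) (hM : M.det ≠ 0) (c : Fin 10 → ℝ) : iJ (act M c) = M.det ^ 6 * iJ c := by
  rw [iJ, iJ, (cov_all two_ne_zero M hM c).2]; ring
theorem iD_act (M : M3 ℝ) (hM : M.det ≠ 0) (c : Fin 10 → ℝ) : iD (act M c) = M.det ^ 12 * iD c := by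
  rw [iD, iD, iI_act M hM, iJ_act M hM]; ring

theorem iI_w (A B : ℝ) : iI (wcoeffs A B) = -3 * A := by
  simp [iI, wc4, wb2, wb4, wa1, wa2, wa3, wa4, wcoeffs]; ring
theorem iJ_w (A B : ℝ) : iJ (wcoeffs A B) = -27 * B := by
  simp [iJ, wc6, wb2, wb4, wb6, wa1, wa2, wa3, wa4, wa6, wcoeffs]; ring

end TC

open MvPolynomial

namespace TC
open Filter Topology MeasureTheory

/-- `g` is obtained from `f` by an invertible real substitution -/
def Eqv (f g : Fin 10 → ℝ) : Prop := ∃ M : M3 ℝ, M.det ≠ 0 ∧ act M f = g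

theorem Eqv.trans {f g h : Fin 10 → ℝ} (a : Eqv f g) (b : Eqv g h) : Eqv f h := by
  obtain ⟨M, hM, rfl⟩ := a
  obtain ⟨N, hN, rfl⟩ := b
  exact ⟨N * M, by rw [Matrix.det_mul]; exact mul_ne_zero hN hM, act_mul two_ne_zero _ _ _⟩

theorem act_inv_act (M : M3 ℝ) (hM : M.det ≠ 0) (f : Fin 10 → ℝ) : act M⁻¹ (act M f) = f := by
  rw [← act_mul two_ne_zero, Matrix.nonsing_inv_mul _ (isUnit_iff_ne_zero.2 hM), act_one two_ne_zero]

theorem Eqv.symm {f g : Fin 10 → ℝ} (a : Eqv f g) : Eqv g f := by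
  obtain ⟨M, hM, rfl⟩ := a
  exact ⟨M⁻¹, by rw [Matrix.det_nonsing_inv]; simpa using hM, act_inv_act M hM f⟩

theorem Eqv.iD {f g : Fin 10 → ℝ} (a : Eqv f g) (h : iD f ≠ 0) : iD g ≠ 0 := by
  obtain ⟨M, hM, rfl⟩ := a
  rw [iD_act M hM]; exact mul_ne_zero (pow_ne_zero _ hM) h

theorem exists_row (v : Fin 3 → ℝ) (hv : v ≠ 0) : ∃ M : M3 ℝ, M.det ≠ 0 ∧ M 1 = v := by
  by_cases h1 : v 1 = 0
  · by_cases h0 : v 0 = 0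
    · have h2 : v 2 ≠ 0 := by
        intro h2; apply hv; funext i; fin_cases i <;> assumption
      refine ⟨!![1, 0, 0; v 0, v 1, v 2; 0, 1, 0], ?_, ?_⟩
      · rw [Matrix.det_fin_three]; simp [h2]
      · funext i; fin_cases i <;> rfl
    · refine ⟨!![0, 1, 0; v 0, v 1, v 2; 0, 0, 1], ?_, ?_⟩
      · rw [Matrix.det_fin_three]; simp [h0]
      · funext i; fin_cases i <;> rfl
  · refine ⟨!![1, 0, 0; v 0, v 1, v 2; 0, 0, 1], ?_, ?_⟩
    · rw [Matrix.det_fin_three]; simp [h1]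
    · funext i; fin_cases i <;> rfl

theorem nf1 (f : Fin 10 → ℝ) : ∃ g, Eqv f g ∧ g 1 = 0 ∧ (heC g) 1 = 0 := by
  obtain ⟨v, hv, h1, h2⟩ := exists_flex f
  obtain ⟨M, hM, rfl⟩ := exists_row v hv
  refine ⟨act M f, ⟨M, hM, rfl⟩, ?_, ?_⟩
  · simpa [act] using h1
  · have : (heC (act M f)) 1 = ev (heC (act M f)) ![0, 1, 0] := by simp [ev]
    rw [this, ev_heC, he_act]
    have : Matrix.vecMul ![0, 1, 0] M = M 1 := by
      funext j; simp [Matrix.vecMul, dotProduct, Fin.sum_univ_three]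
    rw [this, h2, mul_zero]

theorem nf2 (f : Fin 10 → ℝ) (hD : iD f ≠ 0) (h1 : f 1 = 0) (hH : (heC f) 1 = 0) :
    ∃ g, Eqv f g ∧ g 1 = 0 ∧ g 5 = 0 ∧ g 3 = 0 := by
  have hH' : -8 * f 3 * f 6 ^ 2 - 8 * f 5 ^ 2 * f 8 + 8 * f 5 * f 6 * f 9 = 0 := by
    rw [← hH]; simp [heC, hm, h1, Matrix.det_fin_three]; ring
  by_cases h6 : f 6 = 0
  · by_cases h5 : f 5 = 0
    · exfalso; apply hD
      simp [iD, iI, iJ, wc4, wc6, wb2, wb4, wb6, wa1, wa2, wa3, wa4, wa6, h1, h5, h6]; ring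
    · have h8 : f 8 = 0 := by
        rw [h6] at hH'
        have : f 5 ^ 2 * f 8 = 0 := by linarith
        rcases mul_eq_zero.1 this with h | h
        · exact absurd (pow_eq_zero_iff two_ne_zero |>.1 h) h5
        · exact h
      refine ⟨_, ⟨!![0, 0, 1; 0, 1, 0; 1, 0, 0], by rw [Matrix.det_fin_three]; simp, rfl⟩, ?_, ?_, ?_⟩ <;>
        simp [act, ev, dv, tri, gr, hm, h1, h6, h8]
  · refine ⟨_, ⟨!![1, 0, - f 5 / f 6; 0, 1, 0; 0, 0, 1], by rw [Matrix.det_fin_three]; simp, rfl⟩, ?_, ?_, ?_⟩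
    · simp [act, ev, h1]
    · simp [act, ev, dv, tri, gr, hm, h1]; field_simp; ring
    · simp [act, ev, dv, tri, gr, hm, h1]; field_simp; linear_combination (-1/8) * hH'

theorem nf3 (f : Fin 10 → ℝ) (h6 : f 6 ≠ 0) (h1 : f 1 = 0) (h5 : f 5 = 0) (h3 : f 3 = 0) :
    ∃ g, Eqv f g ∧ g 0 = f 0 ∧ g 1 = 0 ∧ g 3 = 0 ∧ g 5 = 0 ∧ g 6 = f 6 ∧ g 8 = 0 ∧ g 9 = 0 := by
  refine ⟨_, ⟨!![1, -f 9 / (2 * f 6), 0; 0, 1, 0; 0, - f 8 / (2 * f 6), 1],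
    by rw [Matrix.det_fin_three]; simp, rfl⟩, ?_, ?_, ?_, ?_, ?_, ?_, ?_⟩
  · simp [act, ev, h1, h3, h5]
  · simp [act, ev, h1]
  · simp [act, dv, gr, h1, h3, h5]
  · simp [act, dv, gr, h1, h3, h5]
  · simp [act, dv, gr, h1, h3, h5]
  · simp [act, dv, gr, h1, h3, h5]; field_simp; ring
  · simp [act, tri, hm, h1, h3, h5]; field_simp; ring

theorem nf4 (g : Fin 10 → ℝ) (g0 : g 0 ≠ 0) (g1 : g 1 = 0) (g5 : g 5 = 0) (g3 : g 3 = 0)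
    (g8 : g 8 = 0) (g9 : g 9 = 0) :
    ∃ k, Eqv g k ∧ k 0 = g 0 ∧ k 1 = 0 ∧ k 3 = 0 ∧ k 4 = 0 ∧ k 5 = 0 ∧ k 6 = g 6 ∧ k 8 = 0 ∧ k 9 = 0 := by
  refine ⟨_, ⟨!![1, 0, 0; 0, 1, 0; -g 4 / (3 * g 0), 0, 1],
    by rw [Matrix.det_fin_three]; simp, rfl⟩, ?_, ?_, ?_, ?_, ?_, ?_, ?_, ?_⟩
  · simp [act, ev]
  · simp [act, ev, g1]
  · simp [act, dv, gr, g1, g3, g5]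
  · simp [act, dv, gr, g1, g3, g5]; field_simp; ring
  · simp [act, dv, gr, g1, g3, g5]
  · simp [act, dv, gr, g1, g3, g5]
  · simp [act, dv, gr, g1, g3, g5, g8, g9]
  · simp [act, tri, hm, g1, g3, g5, g9]

theorem exists_cbrt (a : ℝ) : ∃ r : ℝ, r ^ 3 = a := by
  rcases le_total 0 a with h | h
  · exact ⟨a ^ ((1:ℝ)/3), by rw [← Real.rpow_natCast, ← Real.rpow_mul h]; norm_num⟩
  · refine ⟨-(-a) ^ ((1:ℝ)/3), ?_⟩
    have : ((-a) ^ ((1:ℝ)/3)) ^ 3 = - a := by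
      rw [← Real.rpow_natCast, ← Real.rpow_mul (by linarith)]; norm_num
    rw [Odd.neg_pow (by decide), this]; ring

theorem nf5 (k : Fin 10 → ℝ) (k0 : k 0 ≠ 0) (k6 : k 6 ≠ 0) (k1 : k 1 = 0) (k5 : k 5 = 0) (k3 : k 3 = 0)
    (k4 : k 4 = 0) (k8 : k 8 = 0) (k9 : k 9 = 0) : ∃ A B, Eqv k (wcoeffs A B) := by
  obtain ⟨r, hr⟩ := exists_cbrt (k 0)
  have hr0 : r ≠ 0 := by rintro rfl; apply k0; rw [← hr]; norm_num
  refine ⟨k 7 / r * (-1 / k 6) ^ 2, k 2 * (-1 / k 6) ^ 3, ⟨!![1/r, 0, 0; 0, 1, 0; 0, 0, -1/k 6], ?_, ?_⟩⟩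
  · rw [Matrix.det_fin_three]; simp [hr0, k6]
  · funext i
    fin_cases i <;> simp [wcoeffs, act, ev, dv, tri, gr, hm, ← hr, k1, k3, k4, k5, k8, k9] <;> field_simp

theorem nf6 (f : Fin 10 → ℝ) (hD : iD f ≠ 0) : ∃ A B, Eqv f (wcoeffs A B) := by
  obtain ⟨f1, e1, a1, aH⟩ := nf1 f
  obtain ⟨f2, e2, b1, b5, b3⟩ := nf2 f1 (e1.iD hD) a1 aH
  have hD2 := (e1.trans e2).iD hD
  have h6 : f2 6 ≠ 0 := by
    intro h6; apply hD2
    simp [iD, iI, iJ, wc4, wc6, wb2, wb4, wb6, wa1, wa2, wa3, wa4, wa6, b1, b5, h6, b3]; ring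
  have h0 : f2 0 ≠ 0 := by
    intro h0; apply hD2
    simp [iD, iI, iJ, wc4, wc6, wb2, wb4, wb6, wa1, wa2, wa3, wa4, wa6, b1, b5, h0, b3]; ring
  obtain ⟨f3, e3, p0, p1, p3, p5, p6, p8, p9⟩ := nf3 f2 h6 b1 b5 b3
  obtain ⟨f4, e4, q0, q1, q3, q4, q5, q6, q8, q9⟩ := nf4 f3 (p0 ▸ h0) p1 p5 p3 p8 p9
  obtain ⟨A, B, e5⟩ := nf5 f4 (by rw [q0, p0]; exact h0) (by rw [q6, p6]; exact h6) q1 q5 q3 q4 q8 q9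
  exact ⟨A, B, (((e1.trans e2).trans e3).trans e4).trans e5⟩

theorem w_scale (A B l : ℝ) (hl : l ≠ 0) : act !![1, 0, 0; 0, l, 0; 0, 0, (l ^ 2)⁻¹] (wcoeffs A B) =
      wcoeffs (A * (l ^ 4)⁻¹) (B * (l ^ 6)⁻¹) := by
  funext i
  fin_cases i <;> simp [wcoeffs, act, ev, dv, tri, gr, hm, hl]
  · left; ring
  · left; ring

/-- every nondegenerate real cubic is `SL₃(ℝ)`-equivalent to a Weierstrass form -/
theorem exists_weier (f : Fin 10 → ℝ) (hD : iD f ≠ 0) :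
    ∃ M : M3 ℝ, M.det = 1 ∧ f = act M (wcoeffs (-iI f / 3) (-iJ f / 27)) := by
  obtain ⟨A, B, e⟩ := nf6 f hD
  obtain ⟨M, hM, rfl⟩ := e.symm
  have hl : M.det⁻¹ ≠ 0 := inv_ne_zero hM
  have hN : (!![1, 0, 0; 0, M.det⁻¹, 0; 0, 0, (M.det⁻¹ ^ 2)⁻¹] : M3 ℝ).det = M.det := by
    rw [Matrix.det_fin_three]; simp; field_simp
  have hs' : act M (wcoeffs A B) = act (M * !![1, 0, 0; 0, M.det⁻¹, 0; 0, 0, (M.det⁻¹ ^ 2)⁻¹]⁻¹)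
      (wcoeffs (A * (M.det⁻¹ ^ 4)⁻¹) (B * (M.det⁻¹ ^ 6)⁻¹)) := by
    rw [← w_scale _ _ _ hl, act_mul two_ne_zero, act_inv_act]
    rw [hN]; exact hM
  have hdet : (M * !![1, 0, 0; 0, M.det⁻¹, 0; 0, 0, (M.det⁻¹ ^ 2)⁻¹]⁻¹).det = 1 := by
    rw [Matrix.det_mul, Matrix.det_nonsing_inv, hN]; simp [hM]
  refine ⟨_, hdet, ?_⟩
  rw [iI_act M hM, iJ_act M hM, iI_w, iJ_w]
  conv_lhs => rw [hs']
  congr 2 <;> field_simp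

/-- two nondegenerate forms with the same invariants are `SL₃(ℝ)`-equivalent -/
theorem eqv_of_inv (f g : Fin 10 → ℝ) (hD : iD f ≠ 0) (h1 : iI f = iI g) (h2 : iJ f = iJ g) :
    ∃ M : M3 ℝ, M.det = 1 ∧ f = act M g := by
  have hDg : iD g ≠ 0 := by rw [iD, ← h1, ← h2]; exact hD
  obtain ⟨M, hM, hf⟩ := exists_weier f hD
  obtain ⟨N, hN, hg⟩ := exists_weier g hDg
  rw [← h1, ← h2] at hg
  refine ⟨M * N⁻¹, by rw [Matrix.det_mul, Matrix.det_nonsing_inv, hM, hN]; simp, ?_⟩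
  rw [act_mul two_ne_zero]
  conv_rhs => rw [hg]
  rw [act_inv_act N (by rw [hN]; exact one_ne_zero)]
  exact hf

/-! ### identification of `P` and `Q` -/

set_option maxHeartbeats 1000000 in
theorem map_heC {R S : Type*} [CommRing R] [CommRing S] (φ : R →+* S) (d : Fin 10 → R) :
    (fun k => φ (heC d k)) = heC (fun k => φ (d k)) := by
  funext k
  fin_cases k <;> simp [heC, hm, Matrix.det_fin_three, map_ofNat]

theorem map_wc4 {R S : Type*} [CommRing R] [CommRing S] (φ : R →+* S) (d : Fin 10 → R) :
    φ (wc4 d) = wc4 (fun k => φ (d k)) := by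
  simp [wc4, wb2, wb4, wa1, wa2, wa3, wa4, map_ofNat]

theorem map_wc6 {R S : Type*} [CommRing R] [CommRing S] (φ : R →+* S) (d : Fin 10 → R) :
    φ (wc6 d) = wc6 (fun k => φ (d k)) := by
  simp [wc6, wb2, wb4, wb6, wa1, wa2, wa3, wa4, wa6, map_ofNat]

theorem HH_real (P Q : MvPolynomial (Fin 10) ℚ) (h : IsInvariantPair ℚ P Q) (c : Fin 10 → ℝ) :
    heC (heC c) = (12288 * (aeval c P) ^ 2) • c + (512 * aeval c Q) • heC c := by
  obtain ⟨-, -, hh, -⟩ := h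
  have h1 : cubic (heC (heC (fun k => (X k : MvPolynomial (Fin 10) ℚ)))) =
      cubic ((12288 * P ^ 2) • (fun k => (X k : MvPolynomial (Fin 10) ℚ)) +
        (512 * Q) • heC (fun k => (X k : MvPolynomial (Fin 10) ℚ))) := by
    rw [← hess_cubic, ← hess_cubic]
    refine hh.trans ?_
    rw [genCubic, hess_cubic]
    apply MvPolynomial.funext; intro v
    simp only [map_add, map_mul, map_pow, eval_C, eval_cubic, map_ofNat]
    simp [ev]; ring
  have h2 := cubic_inj two_ne_zero h1
  have hm' : ∀ d : Fin 10 → MvPolynomial (Fin 10) ℚ,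
      (fun k => aeval c (heC d k)) = heC (fun k => aeval c (d k)) := by
    intro d
    exact map_heC (aeval c : MvPolynomial (Fin 10) ℚ →ₐ[ℚ] ℝ).toRingHom d
  have h4 : heC (heC c) = (fun k => aeval c (heC (heC fun k => (X k : MvPolynomial (Fin 10) ℚ)) k)) := by
    rw [hm', hm']; simp only [aeval_X]
  rw [h4, h2]
  funext k
  have h5 := congrFun (hm' (fun k => (X k : MvPolynomial (Fin 10) ℚ))) k
  simp only [aeval_X] at h5
  simp only [Pi.add_apply, Pi.smul_apply, smul_eq_mul, map_add, map_mul, map_pow, map_ofNat, aeval_X]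
  rw [h5]

theorem PQ_w (P Q : MvPolynomial (Fin 10) ℚ) (h : IsInvariantPair ℚ P Q) (M : M3 ℝ) (hM : M.det = 1)
    (A B : ℝ) : (aeval (act M (wcoeffs A B)) P) ^ 2 = (aeval (wcoeffs A B : Fin 10 → ℝ) P) ^ 2 ∧
      aeval (act M (wcoeffs A B)) Q = aeval (wcoeffs A B : Fin 10 → ℝ) Q := by
  have e1 := HH_real P Q h (act M (wcoeffs A B))
  have e2 := HH_real P Q h (wcoeffs A B)
  have hd : M.det ≠ 0 := by rw [hM]; exact one_ne_zero
  rw [heC_act two_ne_zero, hM, one_pow, one_smul, heC_act two_ne_zero, hM, one_pow, one_smul,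
    ← act_smul, ← act_smul, ← act_add] at e1
  have e3 := congrArg (act M⁻¹) e1
  rw [act_inv_act M hd, act_inv_act M hd, e2] at e3
  have i0 := congrFun e3 0
  have i5 := congrFun e3 5
  simp [wcoeffs, heC, hm, Matrix.det_fin_three] at i0 i5
  exact ⟨i0.symm, i5.symm⟩

theorem aeval_cast (P : MvPolynomial (Fin 10) ℚ) (c : Fin 10 → ℚ) :
    aeval (fun k => (c k : ℝ)) P = ((eval c P : ℚ) : ℝ) := by
  have := MvPolynomial.aeval_algebraMap_apply (R := ℚ) (A := ℚ) ℝ c P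
  simpa [Function.comp_def] using this

/-- The polynomials `P`, `Q` are the explicit invariants. -/
theorem PQ_poly (P Q : MvPolynomial (Fin 10) ℚ) (h : IsInvariantPair ℚ P Q) :
    16 * P = wc4 (fun k => X k) ∧ 32 * Q = wc6 (fun k => X k) := by
  set W4 : MvPolynomial (Fin 10) ℚ := wc4 (fun k => X k) with hW4
  set W6 : MvPolynomial (Fin 10) ℚ := wc6 (fun k => X k) with hW6
  have e4 : ∀ c : Fin 10 → ℚ, eval c W4 = wc4 c := fun c => by
    rw [hW4, map_wc4]; simp
  have e6 : ∀ c : Fin 10 → ℚ, eval c W6 = wc6 c := fun c => by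
    rw [hW6, map_wc6]; simp
  have key : ∀ c : Fin 10 → ℚ, wc4 c ^ 3 - wc6 c ^ 2 ≠ 0 →
      (16 * eval c P) ^ 2 = wc4 c ^ 2 ∧ 32 * eval c Q = wc6 c := by
    intro c hc
    let cr : Fin 10 → ℝ := fun k => (c k : ℝ)
    have r4 : wc4 cr = ((wc4 c : ℚ) : ℝ) := (map_wc4 (Rat.castHom ℝ) c).symm
    have r6 : wc6 cr = ((wc6 c : ℚ) : ℝ) := (map_wc6 (Rat.castHom ℝ) c).symm
    have hD : iD cr ≠ 0 := by
      have : iD cr = ((wc4 c ^ 3 - wc6 c ^ 2 : ℚ) : ℝ) / 1024 / 27 := by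
        rw [iD, iI, iJ, r4, r6]; push_cast; ring
      rw [this]
      have : ((wc4 c ^ 3 - wc6 c ^ 2 : ℚ) : ℝ) ≠ 0 := by exact_mod_cast hc
      simpa using this
    obtain ⟨M, hM, hf⟩ := exists_weier cr hD
    obtain ⟨p1, p2⟩ := PQ_w P Q h M hM (-iI cr / 3) (-iJ cr / 27)
    rw [← hf] at p1 p2
    have hw : (wcoeffs (-iI cr / 3) (-iJ cr / 27) : Fin 10 → ℝ) =
        fun k => ((wcoeffs (-(wc4 c / 16) / 3) (-(wc6 c / 32) / 27) : Fin 10 → ℚ) k : ℝ) := by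
      funext k; rw [iI, iJ, r4, r6]; fin_cases k <;> simp [wcoeffs]
    rw [hw, aeval_cast, aeval_cast] at p1 p2
    have hn := h.2.2.2 (-(wc4 c / 16) / 3) (-(wc6 c / 32) / 27)
    simp only [MvPolynomial.coe_aeval_eq_eval, RingHom.coe_coe, aeval_eq_eval] at hn
    rw [hn.1] at p1
    rw [hn.2] at p2
    have p1' : (eval c P) ^ 2 = (-3 * (-(wc4 c / 16) / 3)) ^ 2 := by exact_mod_cast p1
    have p2' : eval c Q = (-27 * (-(wc6 c / 32) / 27)) := by exact_mod_cast p2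
    constructor
    · rw [mul_pow, p1']; ring
    · rw [p2']; ring
  have hWD : W4 ^ 3 - W6 ^ 2 ≠ 0 := by
    intro h0
    have := congrArg (eval (wcoeffs (1 : ℚ) 0)) h0
    simp only [map_sub, map_pow, e4, e6, map_zero] at this
    simp [wc4, wc6, wb2, wb4, wb6, wa1, wa2, wa3, wa4, wa6, wcoeffs] at this
  have k1 : ((16 * P) ^ 2 - W4 ^ 2) * (W4 ^ 3 - W6 ^ 2) = 0 := by
    apply MvPolynomial.funext; intro c
    simp only [map_sub, map_mul, map_pow, e4, e6, map_zero, map_ofNat]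
    by_cases hc : wc4 c ^ 3 - wc6 c ^ 2 = 0
    · rw [hc, mul_zero]
    · rw [(key c hc).1]; ring
  have k2 : (32 * Q - W6) * (W4 ^ 3 - W6 ^ 2) = 0 := by
    apply MvPolynomial.funext; intro c
    simp only [map_sub, map_mul, map_pow, e4, e6, map_zero, map_ofNat]
    by_cases hc : wc4 c ^ 3 - wc6 c ^ 2 = 0
    · rw [hc, mul_zero]
    · rw [(key c hc).2]; ring
  refine ⟨?_, sub_eq_zero.1 ((mul_eq_zero.1 k2).resolve_right hWD)⟩
  rcases sq_eq_sq_iff_eq_or_eq_neg.1 (sub_eq_zero.1 ((mul_eq_zero.1 k1).resolve_right hWD)) with k | k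
  · exact k
  · exfalso
    have := congrArg (eval (wcoeffs (1 : ℚ) 0)) k
    have hn := (h.2.2.2 1 0).1
    simp only [MvPolynomial.coe_aeval_eq_eval, RingHom.coe_coe, aeval_eq_eval] at hn
    simp only [map_mul, map_neg, e4, map_ofNat, hn] at this
    simp [wc4, wb2, wb4, wa1, wa2, wa3, wa4, wcoeffs] at this
    norm_num at this

theorem Iinv_eq (P Q : MvPolynomial (Fin 10) ℚ) (h : IsInvariantPair ℚ P Q) (c : Fin 10 → ℤ) :
    Iinv P c = ((wc4 c : ℤ) : ℚ) / 16 := by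
  have := congrArg (eval (fun k => (c k : ℚ))) (PQ_poly P Q h).1
  rw [map_wc4, map_mul, map_ofNat] at this
  simp only [eval_X] at this
  have e : wc4 (fun k => (c k : ℚ)) = ((wc4 c : ℤ) : ℚ) := (map_wc4 (Int.castRingHom ℚ) c).symm
  rw [e] at this
  rw [Iinv, aeval_eq_eval, ← this]; simp

theorem Jinv_eq (P Q : MvPolynomial (Fin 10) ℚ) (h : IsInvariantPair ℚ P Q) (c : Fin 10 → ℤ) :
    Jinv Q c = ((wc6 c : ℤ) : ℚ) / 32 := by
  have := congrArg (eval (fun k => (c k : ℚ))) (PQ_poly P Q h).2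
  rw [map_wc6, map_mul, map_ofNat] at this
  simp only [eval_X] at this
  have e : wc6 (fun k => (c k : ℚ)) = ((wc6 c : ℤ) : ℚ) := (map_wc6 (Int.castRingHom ℚ) c).symm
  rw [e] at this
  rw [Jinv, aeval_eq_eval, ← this]; simp

/-- real coefficient vector of an integral form -/
def toR (c : Fin 10 → ℤ) : Fin 10 → ℝ := fun k => (c k : ℝ)

theorem iI_toR (c : Fin 10 → ℤ) : iI (toR c) = ((wc4 c : ℤ) : ℝ) / 16 := by
  rw [iI]; congr 1; exact (map_wc4 (Int.castRingHom ℝ) c).symm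
theorem iJ_toR (c : Fin 10 → ℤ) : iJ (toR c) = ((wc6 c : ℤ) : ℝ) / 32 := by
  rw [iJ]; congr 1; exact (map_wc6 (Int.castRingHom ℝ) c).symm

end TC

open MvPolynomial

namespace TC
open Filter Topology MeasureTheory

/-- the Hesse form `x³+y³+z³-3kxyz` -/
def hs (k : ℝ) : Fin 10 → ℝ := ![1, 1, 1, 0, 0, 0, 0, 0, 0, -3 * k]

noncomputable def hi (k : ℝ) : ℝ := 81 / 16 * k * (k ^ 3 + 8)
noncomputable def hj (k : ℝ) : ℝ := -(729 / 32) * (k ^ 6 - 20 * k ^ 3 - 8)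

theorem iI_hs (k : ℝ) : iI (hs k) = hi k := by
  simp [iI, hi, hs, wc4, wb2, wb4, wa1, wa2, wa3, wa4]; ring
theorem iJ_hs (k : ℝ) : iJ (hs k) = hj k := by
  simp [iJ, hj, hs, wc6, wb2, wb4, wb6, wa1, wa2, wa3, wa4, wa6]; ring
theorem iD_hs (k : ℝ) : iD (hs k) = 19683 / 16 * (k ^ 3 - 1) ^ 3 := by
  rw [iD, iI_hs, iJ_hs, hi, hj]; ring

theorem cube_inj {a b : ℝ} (h : a ^ 3 = b ^ 3) : a = b :=
  (Odd.strictMono_pow (R := ℝ) (n := 3) (by decide)).injective h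

theorem cube_ne_one {k : ℝ} (hk : k ≠ 1) : k ^ 3 - 1 ≠ 0 := by
  intro h; apply hk; apply cube_inj; linarith

theorem quartic_root (ρ e : ℝ) : ∃ s : ℝ, 0 < s ∧ s ^ 4 + ρ * s ^ 3 - 18 * e * s ^ 2 - 27 = 0 := by
  set R : ℝ := 1 + |ρ| + 18 * |e| + 27 with hR
  have hρ := neg_abs_le ρ
  have he := le_abs_self e
  have hρ0 := abs_nonneg ρ
  have he0 := abs_nonneg e
  have hR1 : 1 ≤ R := by linarith
  have hc : ContinuousOn (fun s : ℝ => s ^ 4 + ρ * s ^ 3 - 18 * e * s ^ 2 - 27) (Set.Icc 0 R) := by fun_prop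
  have h0 : (0:ℝ) ∈ Set.Icc ((0:ℝ) ^ 4 + ρ * 0 ^ 3 - 18 * e * 0 ^ 2 - 27)
      (R ^ 4 + ρ * R ^ 3 - 18 * e * R ^ 2 - 27) := by
    constructor
    · norm_num
    · have h3 : 1 ≤ R ^ 3 := one_le_pow₀ hR1
      have h2 : R ^ 2 ≤ R ^ 3 := pow_le_pow_right₀ hR1 (by norm_num)
      have h20 : 0 ≤ R ^ 2 := by positivity
      have a1 : -|ρ| * R ^ 3 ≤ ρ * R ^ 3 := mul_le_mul_of_nonneg_right hρ (by linarith)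
      have a2 : e * R ^ 2 ≤ |e| * R ^ 2 := mul_le_mul_of_nonneg_right he h20
      have a3 : |e| * R ^ 2 ≤ |e| * R ^ 3 := mul_le_mul_of_nonneg_left h2 he0
      have a4 : R ^ 4 = (1 + |ρ| + 18 * |e| + 27) * R ^ 3 := by rw [← hR]; ring
      nlinarith
  obtain ⟨s, hs, hs0⟩ := intermediate_value_Icc (by linarith : (0:ℝ) ≤ R) hc h0
  refine ⟨s, lt_of_le_of_ne hs.1 ?_, hs0⟩
  rintro rfl
  norm_num at hs0

/-- existence of Hesse parameters for given invariants -/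
theorem hesse_param (I J : ℝ) (hD : 4 * I ^ 3 - J ^ 2 ≠ 0) :
    ∃ d k : ℝ, 0 < d ∧ k ≠ 1 ∧ d ^ 4 * hi k = I ∧ d ^ 6 * hj k = J := by
  obtain ⟨e, he, hpos⟩ : ∃ e : ℝ, e ^ 2 = 1 ∧ 0 < e * (4 * I ^ 3 - J ^ 2) := by
    rcases lt_or_gt_of_ne hD with h | h
    · exact ⟨-1, by norm_num, by linarith⟩
    · exact ⟨1, by norm_num, by linarith⟩
  set E := Real.sqrt (e * (4 * I ^ 3 - J ^ 2) * 16 / 531441) with hE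
  have hE0 : 0 < E := Real.sqrt_pos.2 (by positivity)
  have hE2 : E ^ 2 = e * (4 * I ^ 3 - J ^ 2) * 16 / 531441 := Real.sq_sqrt (by positivity)
  obtain ⟨s, hs, hq⟩ := quartic_root (32 * J / (729 * E)) e
  obtain ⟨k, hk⟩ := exists_cbrt (1 + e * s ^ 2)
  set d := (E / s ^ 3) ^ ((1:ℝ) / 6) with hd
  have hd0 : 0 < d := Real.rpow_pos_of_pos (by positivity) _
  have hd6 : d ^ 6 = E / s ^ 3 := by
    rw [hd, ← Real.rpow_natCast, ← Real.rpow_mul (by positivity)]; norm_num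
  have hJ : d ^ 6 * hj k = J := by
    have : hj k = -(729 / 32) * (s ^ 4 - 18 * e * s ^ 2 - 27) := by
      rw [hj, show k ^ 6 = (k ^ 3) ^ 2 by ring, hk]; linear_combination (-(729/32) * s ^ 4) * he
    rw [this, hd6]
    field_simp at hq ⊢
    linear_combination (-1) * hq
  have hI : (d ^ 4 * hi k) ^ 3 = I ^ 3 := by
    have h1 : 4 * hi k ^ 3 - hj k ^ 2 = 531441 / 16 * (k ^ 3 - 1) ^ 3 := by rw [hi, hj]; ring
    have h2 : (d ^ 6) ^ 2 * (4 * hi k ^ 3 - hj k ^ 2) = 4 * I ^ 3 - J ^ 2 := by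
      rw [h1, hk, hd6]
      have : (E / s ^ 3) ^ 2 * (531441 / 16 * (1 + e * s ^ 2 - 1) ^ 3) = E ^ 2 * e * 531441 / 16 * e ^ 2 := by
        field_simp; ring
      rw [this, hE2, he]; linear_combination (4 * I ^ 3 - J ^ 2) * he
    have h3 : (d ^ 6 * hj k) ^ 2 = J ^ 2 := by rw [hJ]
    linear_combination (1/4) * h2 + (1/4) * h3
  refine ⟨d, k, hd0, ?_, cube_inj hI, hJ⟩
  rintro rfl
  have : e * s ^ 2 = 0 := by linarith
  have he0 : e ≠ 0 := by rintro rfl; norm_num at he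
  exact (mul_ne_zero he0 (by positivity)) this

theorem act_scalar (s : ℝ) (f : Fin 10 → ℝ) : act (s • (1 : M3 ℝ)) f = s ^ 3 • f := by
  rw [act_smul_mat, act_one two_ne_zero]

theorem hesse_exists (f : Fin 10 → ℝ) (hD : iD f ≠ 0) :
    ∃ (M : M3 ℝ) (k : ℝ), 0 < M.det ∧ k ≠ 1 ∧ f = act M (hs k) := by
  obtain ⟨d, k, hd, hk, h1, h2⟩ := hesse_param (iI f) (iJ f) (by
    intro h; apply hD; rw [iD, h, zero_div])
  obtain ⟨s, hs3⟩ := exists_cbrt d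
  have hdet : (s • (1 : M3 ℝ)).det = d := by simp [hs3]
  have hdet0 : (s • (1 : M3 ℝ)).det ≠ 0 := by rw [hdet]; exact hd.ne'
  obtain ⟨M, hM, hf⟩ := eqv_of_inv f (act (s • (1 : M3 ℝ)) (hs k)) hD
    (by rw [iI_act _ hdet0, hdet, iI_hs, h1]) (by rw [iJ_act _ hdet0, hdet, iJ_hs, h2])
  refine ⟨M * (s • (1 : M3 ℝ)), k, ?_, hk, ?_⟩
  · rw [Matrix.det_mul, hM, hdet, one_mul]; exact hd
  · rw [act_mul two_ne_zero]; exact hf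

theorem hesse_s_inj {e s t : ℝ} (he : e ^ 2 = 1) (hs : 0 < s) (ht : 0 < t)
    (h : (s ^ 4 - 18 * e * s ^ 2 - 27) * t ^ 3 = (t ^ 4 - 18 * e * t ^ 2 - 27) * s ^ 3) : s = t := by
  have key : (s - t) * (s ^ 3 * t ^ 3 + 18 * e * s ^ 2 * t ^ 2 + 27 * (s ^ 2 + s * t + t ^ 2)) = 0 := by
    linear_combination h
  by_contra hne
  have hst : 0 < (s - t) ^ 2 := by have := sub_ne_zero.2 hne; positivity
  have h' := (mul_eq_zero.1 key).resolve_left (sub_ne_zero.2 hne)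
  have hp : 0 < s * t := mul_pos hs ht
  have h1 : 0 ≤ s * t * ((s * t) + 9 * e) ^ 2 := by positivity
  have h2 : s * t * (s * t + 9 * e) ^ 2 =
    s ^ 3 * t ^ 3 + 18 * e * s ^ 2 * t ^ 2 + 81 * (s * t) := by linear_combination (81 * s * t) * he
  nlinarith

theorem hesse_unique {d d' k l : ℝ} (hd : 0 < d) (hd' : 0 < d') (hk : k ≠ 1)
    (h1 : d ^ 4 * hi k = d' ^ 4 * hi l) (h2 : d ^ 6 * hj k = d' ^ 6 * hj l) : k = l ∧ d = d' := by
  have a1 : (d ^ 4 * (k ^ 3 - 1)) ^ 3 = (d' ^ 4 * (l ^ 3 - 1)) ^ 3 := by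
    have e1 : ∀ k, (k ^ 3 - 1) ^ 3 = 16 / 531441 * (4 * hi k ^ 3 - hj k ^ 2) := by
      intro k; rw [hi, hj]; ring
    rw [mul_pow, mul_pow, e1, e1]
    have q1 : (d ^ 4 * hi k) ^ 3 = (d' ^ 4 * hi l) ^ 3 := by rw [h1]
    have q2 : (d ^ 6 * hj k) ^ 2 = (d' ^ 6 * hj l) ^ 2 := by rw [h2]
    linear_combination (16 * 4 / 531441) * q1 - 16 / 531441 * q2
  have a2 := cube_inj a1
  obtain ⟨e, he, hpos⟩ : ∃ e : ℝ, e ^ 2 = 1 ∧ 0 < e * (k ^ 3 - 1) := by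
    rcases lt_or_gt_of_ne (cube_ne_one hk) with h | h
    · exact ⟨-1, by norm_num, by linarith⟩
    · exact ⟨1, by norm_num, by linarith⟩
  have hpos' : 0 < e * (l ^ 3 - 1) := by
    have : 0 < d' ^ 4 * (e * (l ^ 3 - 1)) := by
      have : d' ^ 4 * (e * (l ^ 3 - 1)) = d ^ 4 * (e * (k ^ 3 - 1)) := by linear_combination (-e) * a2
      rw [this]; positivity
    exact pos_of_mul_pos_right this (by positivity)
  set s := Real.sqrt (e * (k ^ 3 - 1)) with hs
  set t := Real.sqrt (e * (l ^ 3 - 1)) with ht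
  have s0 : 0 < s := Real.sqrt_pos.2 hpos
  have t0 : 0 < t := Real.sqrt_pos.2 hpos'
  have s2 : s ^ 2 = e * (k ^ 3 - 1) := Real.sq_sqrt hpos.le
  have t2 : t ^ 2 = e * (l ^ 3 - 1) := Real.sq_sqrt hpos'.le
  have k3 : k ^ 3 = 1 + e * s ^ 2 := by rw [s2]; linear_combination (-(k ^ 3 - 1)) * he
  have l3 : l ^ 3 = 1 + e * t ^ 2 := by rw [t2]; linear_combination (-(l ^ 3 - 1)) * he
  have b1 : (d ^ 2 * s) = (d' ^ 2 * t) := by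
    have : (d ^ 2 * s) ^ 2 = (d' ^ 2 * t) ^ 2 := by
      rw [mul_pow, mul_pow, s2, t2]; linear_combination e * a2
    exact (pow_left_inj₀ (by positivity) (by positivity) two_ne_zero).1 this
  have jk : hj k = -(729 / 32) * (s ^ 4 - 18 * e * s ^ 2 - 27) := by
    rw [hj, show k ^ 6 = (k ^ 3) ^ 2 by ring, k3]; linear_combination (-(729/32) * s ^ 4) * he
  have jl : hj l = -(729 / 32) * (t ^ 4 - 18 * e * t ^ 2 - 27) := by
    rw [hj, show l ^ 6 = (l ^ 3) ^ 2 by ring, l3]; linear_combination (-(729/32) * t ^ 4) * he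
  have b3 : (d ^ 2 * s) ^ 3 = (d' ^ 2 * t) ^ 3 := by rw [b1]
  have hst : s = t := by
    apply hesse_s_inj he s0 t0
    have : d' ^ 6 * ((s ^ 4 - 18 * e * s ^ 2 - 27) * t ^ 3 - (t ^ 4 - 18 * e * t ^ 2 - 27) * s ^ 3) = 0 := by
      rw [jk, jl] at h2
      linear_combination (-(s ^ 4 - 18 * e * s ^ 2 - 27)) * b3 - (32 / 729) * s ^ 3 * h2
    have := (mul_eq_zero.1 this).resolve_left (by positivity)
    linarith
  have hkl : k = l := by apply cube_inj; rw [k3, l3, hst]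
  refine ⟨hkl, ?_⟩
  rw [hst] at b1
  have := mul_right_cancel₀ t0.ne' b1
  exact (pow_left_inj₀ hd.le hd'.le two_ne_zero).1 this

/-- cyclic permutation matrix -/
def Zc : M3 ℝ := !![0, 1, 0; 0, 0, 1; 1, 0, 0]

theorem Zc_det : Zc.det = 1 := by rw [Zc, Matrix.det_fin_three]; simp
theorem act_Zc (k : ℝ) : act Zc (hs k) = hs k := by
  funext i; fin_cases i <;> simp [Zc, act, ev, dv, tri, gr, hm, hs]

theorem heC_hs (k : ℝ) : heC (hs k) = ![-54 * k ^ 2, -54 * k ^ 2, -54 * k ^ 2, 0, 0, 0, 0, 0, 0, 216 - 54 * k ^ 3] := by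
  funext i; fin_cases i <;> simp [heC, hs, hm, Matrix.det_fin_three] <;> ring

theorem hesse_stab (M : M3 ℝ) (k : ℝ) (hk : k ≠ 1) (hM : M.det = 1) (h : act M (hs k) = hs k) :
    M = 1 ∨ M = Zc ∨ M = Zc * Zc := by
  have hH : act M (heC (hs k)) = heC (hs k) := by
    have := heC_act two_ne_zero M (hs k)
    rw [h, hM] at this; simpa using this.symm
  have hF : act M (hs 0) = hs 0 := by
    have : hs 0 = ((216 - 54 * k ^ 3) / (216 * (1 - k ^ 3))) • hs k + (3 * k / (216 * (1 - k ^ 3))) • heC (hs k) := by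
      have h1 : (1 - k ^ 3) ≠ 0 := fun h => cube_ne_one hk (by linarith)
      rw [heC_hs]; funext i; fin_cases i <;> simp [hs] <;> field_simp <;> ring
    rw [this, act_add, act_smul, act_smul, h, hH]
  have p : ∀ i, act M (hs 0) i = hs 0 i := fun i => by rw [hF]
  have p0 := p 0
  have p1 := p 1
  have p2 := p 2
  have p3 := p 3
  have p4 := p 4
  have p5 := p 5
  have p6 := p 6
  have p7 := p 7
  have p8 := p 8
  have p9 := p 9
  simp [hs, act, ev, dv, tri, gr, hm] at p0 p1 p2 p3 p4 p5 p6 p7 p8 p9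
  have z : ∀ w : Fin 3 → ℝ, M.mulVec w = 0 → w = 0 := fun w hw =>
    Matrix.eq_zero_of_mulVec_eq_zero (by rw [hM]; exact one_ne_zero) hw
  have z01 := z (fun j => M 0 j * M 1 j) (by
    funext i; simp [Matrix.mulVec, dotProduct, Fin.sum_univ_three]
    fin_cases i <;> simp
    · linear_combination (1/3) * p3
    · linear_combination (1/3) * p5
    · linear_combination (1/6) * p9)
  have z02 := z (fun j => M 0 j * M 2 j) (by
    funext i; simp [Matrix.mulVec, dotProduct, Fin.sum_univ_three]
    fin_cases i <;> simp
    · linear_combination (1/3) * p4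
    · linear_combination (1/6) * p9
    · linear_combination (1/3) * p7)
  have z12 := z (fun j => M 1 j * M 2 j) (by
    funext i; simp [Matrix.mulVec, dotProduct, Fin.sum_univ_three]
    fin_cases i <;> simp
    · linear_combination (1/6) * p9
    · linear_combination (1/3) * p6
    · linear_combination (1/3) * p8)
  have col : ∀ j, (M 0 j = 0 ∧ M 1 j = 0) ∨ (M 0 j = 0 ∧ M 2 j = 0) ∨ (M 1 j = 0 ∧ M 2 j = 0) := by
    intro j
    have a := congrFun z01 j
    have b := congrFun z02 j
    have c := congrFun z12 j
    simp at a b c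
    tauto
  have one : ∀ x : ℝ, x ^ 3 = 1 → x = 1 := fun x hx => cube_inj (by rw [hx, one_pow])
  have ext' : ∀ N : M3 ℝ, (∀ i j, M i j = N i j) → M = N := fun N h => by ext i j; exact h i j
  rw [Matrix.det_fin_three] at hM
  clear z z01 z02 z12 p p3 p4 p5 p6 p7 p8 p9 hF hH h
  rcases col 0 with ⟨a0, b0⟩ | ⟨a0, b0⟩ | ⟨a0, b0⟩ <;>
  rcases col 1 with ⟨a1, b1⟩ | ⟨a1, b1⟩ | ⟨a1, b1⟩ <;>
  rcases col 2 with ⟨a2, b2⟩ | ⟨a2, b2⟩ | ⟨a2, b2⟩ <;>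
  simp [a0, b0, a1, b1, a2, b2] at p0 p1 p2 hM <;>
  (have q0 := one _ p0
   have q1 := one _ p1
   have q2 := one _ p2
   first
   | (exfalso; rw [q0, q1, q2] at hM; norm_num at hM; done)
   | (left; apply ext'; intro i j; fin_cases i <;> fin_cases j <;> simp [a0, b0, a1, b1, a2, b2, q0, q1, q2]; done)
   | (right; left; apply ext'; intro i j
      fin_cases i <;> fin_cases j <;> simp [Zc, a0, b0, a1, b1, a2, b2, q0, q1, q2]; done)
   | (right; right; apply ext'; intro i j
      fin_cases i <;> fin_cases j <;>
        simp [Zc, Matrix.mul_apply, Fin.sum_univ_three, a0, b0, a1, b1, a2, b2, q0, q1, q2]; done))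

theorem hesse_fiber {M N : M3 ℝ} {k l : ℝ} (hM : 0 < M.det) (hN : 0 < N.det) (hk : k ≠ 1)
    (h : act M (hs k) = act N (hs l)) :
    k = l ∧ M.det = N.det ∧ (M = N ∨ M = N * Zc ∨ M = N * (Zc * Zc)) := by
  have h1 : iI (act M (hs k)) = iI (act N (hs l)) := by rw [h]
  have h2 : iJ (act M (hs k)) = iJ (act N (hs l)) := by rw [h]
  rw [iI_act M hM.ne', iI_act N hN.ne', iI_hs, iI_hs] at h1
  rw [iJ_act M hM.ne', iJ_act N hN.ne', iJ_hs, iJ_hs] at h2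
  obtain ⟨rfl, hd⟩ := hesse_unique hM hN hk h1 h2
  refine ⟨rfl, hd, ?_⟩
  have hu : IsUnit N.det := isUnit_iff_ne_zero.2 hN.ne'
  have hs1 : act (N⁻¹ * M) (hs k) = hs k := by
    rw [act_mul two_ne_zero, h, act_inv_act N hN.ne']
  have hMN : M = N * (N⁻¹ * M) := by rw [Matrix.mul_nonsing_inv_cancel_left _ _ hu]
  have hdet : (N⁻¹ * M).det = 1 := by
    rw [Matrix.det_mul, Matrix.det_nonsing_inv, hd]; simp [hN.ne']
  rcases hesse_stab _ k hk hdet hs1 with e | e | e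
  · left; rw [hMN, e, mul_one]
  · right; left; rw [hMN, e]
  · right; right; rw [hMN, e]

end TC

open MvPolynomial

namespace TC
open Filter Topology MeasureTheory

/-- the height of a real form -/
noncomputable def ht (f : Fin 10 → ℝ) : ℝ := max (|iI f| ^ 3) (iJ f ^ 2 / 4)

theorem ht_nonneg (f : Fin 10 → ℝ) : 0 ≤ ht f := le_max_of_le_left (by positivity)

theorem ht_act (M : M3 ℝ) (hM : M.det ≠ 0) (f : Fin 10 → ℝ) : ht (act M f) = M.det ^ 12 * ht f := by
  have h : 0 ≤ M.det ^ 12 := by positivity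
  rw [ht, ht, iI_act M hM, iJ_act M hM, mul_max_of_nonneg _ _ h, abs_mul, abs_of_nonneg (by positivity : 0 ≤ M.det ^ 4)]
  congr 1 <;> ring

theorem iI_cont : Continuous iI := by
  unfold iI wc4 wb2 wb4 wa1 wa2 wa3 wa4; fun_prop

theorem iJ_cont : Continuous iJ := by
  unfold iJ wc6 wb2 wb4 wb6 wa1 wa2 wa3 wa4 wa6; fun_prop

theorem iD_cont : Continuous iD := by
  have := iI_cont; have := iJ_cont
  unfold iD; fun_prop

theorem ht_cont : Continuous ht := by
  have := iI_cont; have := iJ_cont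
  unfold ht; fun_prop

theorem hs_cont : Continuous hs := by
  unfold hs
  refine continuous_pi fun i => ?_
  fin_cases i <;> simp <;> fun_prop

theorem ht_hs_pos (k : ℝ) : 0 < ht (hs k) := by
  by_cases h : hi k = 0
  · refine lt_max_of_lt_right ?_
    rw [iJ_hs]
    have h3 : k * (k ^ 3 + 8) = 0 := by unfold hi at h; linarith
    have : hj k ≠ 0 := by
      unfold hj
      rcases mul_eq_zero.1 h3 with h | h
      · rw [h]; norm_num
      · have : k ^ 3 = -8 := by linarith
        rw [show k ^ 6 = (k ^ 3) ^ 2 by ring, this]; norm_num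
    positivity
  · refine lt_max_of_lt_left ?_
    rw [iI_hs]; positivity

theorem ht_hs_lower : ∃ c : ℝ, 0 < c ∧ ∀ k, c * (1 + |k|) ^ 12 ≤ ht (hs k) := by
  obtain ⟨k0, -, hk0⟩ := (isCompact_Icc (a := (-3:ℝ)) (b := 3)).exists_isMinOn ⟨0, by simp⟩
    (ht_cont.comp hs_cont).continuousOn
  have hp := ht_hs_pos k0
  refine ⟨min 1 (ht (hs k0) / 4 ^ 12), by positivity, fun k => ?_⟩
  rcases le_or_gt |k| 3 with h | h
  · have h1 : ht (hs k0) ≤ ht (hs k) := hk0 (abs_le.1 h)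
    refine le_trans ?_ h1
    have h2 : (1 + |k|) ^ 12 ≤ 4 ^ 12 := by gcongr; linarith
    calc _ ≤ ht (hs k0) / 4 ^ 12 * 4 ^ 12 := by gcongr; exact min_le_right _ _
      _ = _ := by field_simp
  · refine le_trans ?_ (le_max_left _ _)
    rw [iI_hs]
    have h4 : (1 + |k|) ^ 4 ≤ |hi k| := by
      have e : |hi k| = 81 / 16 * |k| * |k ^ 3 + 8| := by
        unfold hi; rw [abs_mul, abs_mul]; norm_num
      have e2 : |k| ^ 3 - 8 ≤ |k ^ 3 + 8| := by
        have := abs_sub_abs_le_abs_sub (k ^ 3) (-8)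
        rw [abs_pow] at this; norm_num at this; linarith
      rw [e]
      generalize |k| = x at *
      have : (1 + x) ^ 4 ≤ 81 / 16 * x * (x ^ 3 - 8) := by
        obtain ⟨y, rfl, hy⟩ : ∃ y, x = y + 3 ∧ 0 < y := ⟨x - 3, by ring, by linarith⟩
        ring_nf; nlinarith [pow_pos hy 2, pow_pos hy 3, pow_pos hy 4]
      refine this.trans ?_
      gcongr
    calc _ ≤ 1 * (1 + |k|) ^ 12 := by gcongr; exact min_le_left _ _
      _ = ((1 + |k|) ^ 4) ^ 3 := by ring
      _ ≤ _ := by gcongr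

/-- the weight of the `j`-th coefficient -/
def wt (ρ : Fin 3 → ℝ) : Fin 10 → ℝ :=
  ![ρ 0 * ρ 0 * ρ 0, ρ 1 * ρ 1 * ρ 1, ρ 2 * ρ 2 * ρ 2, ρ 0 * ρ 0 * ρ 1, ρ 0 * ρ 0 * ρ 2, ρ 1 * ρ 1 * ρ 0,
    ρ 1 * ρ 1 * ρ 2, ρ 2 * ρ 2 * ρ 0, ρ 2 * ρ 2 * ρ 1, ρ 0 * ρ 1 * ρ 2]

theorem row_le {M : M3 ℝ} {ρ : Fin 3 → ℝ} (h0 : ∀ i, 0 ≤ ρ i) (h : ∀ i, gg M i i ≤ ρ i ^ 2) (i a : Fin 3) :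
    |M i a| ≤ ρ i := by
  apply abs_le_of_sq_le_sq _ (h0 i)
  have := h i
  unfold gg at this
  fin_cases a <;> simp <;> nlinarith [sq_nonneg (M i 0), sq_nonneg (M i 1), sq_nonneg (M i 2)]

theorem mul3_le {a b c x y z : ℝ} (ha : |a| ≤ x) (hb : |b| ≤ y) (hc : |c| ≤ z) : |a * b * c| ≤ x * y * z := by
  rw [abs_mul, abs_mul]
  have := abs_nonneg a; have := abs_nonneg b
  have hx : 0 ≤ x := by linarith
  have hy : 0 ≤ y := by linarith
  gcongr

theorem ev_hs (k : ℝ) (v : Fin 3 → ℝ) : ev (hs k) v = v 0 * v 0 * v 0 + v 1 * v 1 * v 1 + v 2 * v 2 * v 2 - 3 * k * (v 0 * v 1 * v 2) := by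
  simp [ev, hs]; ring
theorem dv_hs (k : ℝ) (v w : Fin 3 → ℝ) : dv (hs k) v w = 3 * (v 0 * v 0 * w 0 + v 1 * v 1 * w 1 + v 2 * v 2 * w 2)
    - 3 * k * (v 1 * v 2 * w 0 + v 0 * v 2 * w 1 + v 0 * v 1 * w 2) := by
  simp [dv, gr, hs]; ring
theorem tri_hs (k : ℝ) (u v w : Fin 3 → ℝ) : tri (hs k) u v w =
    6 * (u 0 * v 0 * w 0 + u 1 * v 1 * w 1 + u 2 * v 2 * w 2)
    - 3 * k * (u 0 * v 1 * w 2 + u 0 * v 2 * w 1 + u 1 * v 0 * w 2 + u 1 * v 2 * w 0 + u 2 * v 0 * w 1 + u 2 * v 1 * w 0) := by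
  simp [tri, hm, hs]; ring

theorem lin_bound {A B x : ℝ} (k a b : ℝ) (ha : |A| ≤ a * x) (hb : |B| ≤ b * x) (hx : 0 ≤ x) (h1 : a ≤ 18) (h2 : b ≤ 18) :
    |A + k * B| ≤ 18 * (1 + |k|) * x := by
  calc _ ≤ |A| + |k * B| := abs_add_le _ _
    _ = |A| + |k| * |B| := by rw [abs_mul]
    _ ≤ 18 * x + |k| * (18 * x) := by
        have e1 : a * x ≤ 18 * x := by gcongr
        have e2 : b * x ≤ 18 * x := by gcongr
        have := mul_le_mul_of_nonneg_left (hb.trans e2) (abs_nonneg k)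
        linarith
    _ = _ := by ring

theorem ev_hs_le {k : ℝ} {v : Fin 3 → ℝ} {r : ℝ} (hr : 0 ≤ r) (hv : ∀ i, |v i| ≤ r) :
    |ev (hs k) v| ≤ 18 * (1 + |k|) * (r * r * r) := by
  have h := fun a b c => mul3_le (hv a) (hv b) (hv c)
  rw [ev_hs]
  have e : v 0 * v 0 * v 0 + v 1 * v 1 * v 1 + v 2 * v 2 * v 2 - 3 * k * (v 0 * v 1 * v 2)
    = (v 0 * v 0 * v 0 + v 1 * v 1 * v 1 + v 2 * v 2 * v 2) + k * (-3 * (v 0 * v 1 * v 2)) := by ring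
  rw [e]
  refine lin_bound k 3 3 ?_ ?_ (by positivity) (by norm_num) (by norm_num) <;> rw [abs_le] <;>
  constructor <;>
  linarith [abs_le.1 (h 0 0 0), abs_le.1 (h 1 1 1), abs_le.1 (h 2 2 2), abs_le.1 (h 0 1 2)]

theorem dv_hs_le {k : ℝ} {v w : Fin 3 → ℝ} {r s : ℝ} (hr : 0 ≤ r) (hs' : 0 ≤ s) (hv : ∀ i, |v i| ≤ r) (hw : ∀ i, |w i| ≤ s) :
    |dv (hs k) v w| ≤ 18 * (1 + |k|) * (r * r * s) := by
  have h := fun a b c => mul3_le (hv a) (hv b) (hw c)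
  rw [dv_hs]
  rw [sub_eq_add_neg, show ∀ x, -(3 * k * x) = k * (-3 * x) from fun x => by ring]
  refine lin_bound k 9 9 ?_ ?_ (by positivity) (by norm_num) (by norm_num) <;> rw [abs_le] <;>
  constructor <;>
  linarith [abs_le.1 (h 0 0 0), abs_le.1 (h 1 1 1), abs_le.1 (h 2 2 2), abs_le.1 (h 1 2 0), abs_le.1 (h 0 2 1), abs_le.1 (h 0 1 2)]

theorem tri_hs_le {k : ℝ} {u v w : Fin 3 → ℝ} {q r s : ℝ} (hq : 0 ≤ q) (hr : 0 ≤ r) (hs' : 0 ≤ s) (hu : ∀ i, |u i| ≤ q) (hv : ∀ i, |v i| ≤ r) (hw : ∀ i, |w i| ≤ s) :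
    |tri (hs k) u v w| ≤ 18 * (1 + |k|) * (q * r * s) := by
  have h := fun a b c => mul3_le (hu a) (hv b) (hw c)
  rw [tri_hs]
  rw [sub_eq_add_neg, show ∀ x, -(3 * k * x) = k * (-3 * x) from fun x => by ring]
  refine lin_bound k 18 18 ?_ ?_ (by positivity) (by norm_num) (by norm_num) <;> rw [abs_le] <;>
  constructor <;>
  linarith [abs_le.1 (h 0 0 0), abs_le.1 (h 1 1 1), abs_le.1 (h 2 2 2), abs_le.1 (h 0 1 2), abs_le.1 (h 0 2 1),
    abs_le.1 (h 1 0 2), abs_le.1 (h 1 2 0), abs_le.1 (h 2 0 1), abs_le.1 (h 2 1 0)]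

theorem coef_bound {M : M3 ℝ} {ρ : Fin 3 → ℝ} (h0 : ∀ i, 0 ≤ ρ i) (h : ∀ i, gg M i i ≤ ρ i ^ 2) (k : ℝ)
    (j : Fin 10) : |act M (hs k) j| ≤ 18 * (1 + |k|) * wt ρ j := by
  have hM := row_le h0 h
  have E := fun i => ev_hs_le (k := k) (h0 i) (hM i)
  have D := fun i j => dv_hs_le (k := k) (h0 i) (h0 j) (hM i) (hM j)
  have Tr := tri_hs_le (k := k) (h0 0) (h0 1) (h0 2) (hM 0) (hM 1) (hM 2)
  fin_cases j
  exacts [E 0, E 1, E 2, D 0 1, D 0 2, D 1 0, D 1 2, D 2 0, D 2 1, Tr]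

end TC

open MvPolynomial

namespace TC
open Filter Topology MeasureTheory

theorem ncard_eq_tsum {α : Type*} (S : Set α) : (S.ncard : ℝ) = ∑' x, S.indicator (fun _ => (1:ℝ)) x := by
  classical
  by_cases h : S.Finite
  · lift S to Finset α using h
    rw [Set.ncard_coe_finset, tsum_eq_sum (s := S)]
    · rw [Finset.sum_congr rfl (g := fun _ => (1:ℝ)) (fun x hx => by simp [Set.indicator, hx])]; simp
    · intro x hx; simp [Set.indicator, hx]
  · rw [Set.Infinite.ncard h, tsum_eq_zero_of_not_summable]
    · simp
    intro hs
    have := hs.tendsto_cofinite_zero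
    have h2 := this.eventually (gt_mem_nhds (show (0:ℝ) < 1 by norm_num))
    apply h
    refine Set.Finite.subset h2 ?_
    intro x hx
    simp [Set.indicator, hx]

theorem fin_of_close {n : ℕ} (ε : Fin n → ℝ) (hε : ∀ i, 0 < ε i) (p : (Fin n → ℤ) → Fin n → ℝ) (δ : ℝ)
    (hδ : δ ≤ 1 / 2) (hp : ∀ k, ‖p k - fun i => ε i * (k i : ℝ)‖ ≤ δ * (1 + ‖fun i => ε i * (k i : ℝ)‖)) (r : ℝ) :
    {k | ‖p k‖ ≤ r}.Finite := by
  have hsub : {k | ‖p k‖ ≤ r} ⊆ Set.pi Set.univ (fun i => Set.Icc (-⌈(2 * r + 1) / ε i⌉) ⌈(2 * r + 1) / ε i⌉) := by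
    intro k hk i _
    have h1 := hp k
    have h2 : ‖fun i => ε i * (k i : ℝ)‖ ≤ 2 * r + 1 := by
      have h3 := norm_sub_norm_le (fun i => ε i * (k i : ℝ)) (p k)
      rw [norm_sub_rev] at h3
      have h4 : δ * (1 + ‖fun i => ε i * (k i : ℝ)‖) ≤ 1 / 2 * (1 + ‖fun i => ε i * (k i : ℝ)‖) := by gcongr
      have h5 : ‖p k‖ ≤ r := hk
      linarith
    have h6 := (norm_le_pi_norm (fun i => ε i * (k i : ℝ)) i).trans h2
    rw [Real.norm_eq_abs, abs_mul, abs_of_pos (hε i), ← le_div_iff₀' (hε i)] at h6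
    rw [Set.mem_Icc, ← abs_le]
    have : (|k i| : ℝ) ≤ ⌈(2 * r + 1) / ε i⌉ := h6.trans (Int.le_ceil _)
    exact_mod_cast this
  exact (Set.Finite.pi (fun i => Set.finite_Icc _ _)).subset hsub

/-- lattice point count in a bounded set with negligible boundary -/
theorem riemann_count {n : ℕ} (S : Set (Fin n → ℝ)) (hS : MeasurableSet S) (r : ℝ)
    (hr : ∀ x ∈ S, ‖x‖ ≤ r) (hc : ∀ᵐ x, ContinuousAt (S.indicator (fun _ => (1:ℝ))) x)
    {α : Type*} {l : Filter α} [l.IsCountablyGenerated] (ε : α → Fin n → ℝ)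
    (hε : ∀ᶠ a in l, ∀ i, 0 < ε a i) (hε0 : Tendsto ε l (𝓝 0))
    (p : α → (Fin n → ℤ) → (Fin n → ℝ)) (δ : α → ℝ) (hδ : Tendsto δ l (𝓝 0))
    (hp : ∀ᶠ a in l, ∀ k, ‖p a k - fun i => ε a i * (k i : ℝ)‖ ≤
      δ a * (1 + ‖fun i => ε a i * (k i : ℝ)‖)) :
    (∀ᶠ a in l, {k | p a k ∈ S}.Finite) ∧
    Tendsto (fun a => (∏ i, ε a i) * ({k | p a k ∈ S}.ncard : ℝ)) l (𝓝 (volume.real S)) := by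
  constructor
  · filter_upwards [hε, hp, hδ.eventually (ge_mem_nhds (show (0:ℝ) < 1 / 2 by norm_num))] with a h1 h2 h3
    exact (fin_of_close (ε a) h1 (p a) (δ a) h3 h2 r).subset fun k hk => hr _ hk
  · have := riemann (S.indicator (fun _ => (1:ℝ))) 1 r (fun x => by
      by_cases h : x ∈ S <;> simp [h]) (fun x hx => by
      rw [Set.indicator_of_notMem]; intro h; exact absurd (hr x h) (not_le.2 hx)) hc ε hε hε0 p δ hδ hp
    rw [integral_indicator hS] at this
    simp only [integral_const, smul_eq_mul, mul_one, MeasurableSet.univ, measureReal_restrict_apply, Set.univ_inter] at this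
    convert this using 3 with a
    rw [ncard_eq_tsum]; rfl

theorem ae_ne_of_poly {n : ℕ} (g : (Fin n → ℝ) → ℝ) (hg : Measurable g) (v : Fin n → ℝ)
    (h : ∀ y, ∃ q : Polynomial ℝ, q ≠ 0 ∧ ∀ t, g (y + t • v) = q.eval t) : ∀ᵐ y, g y ≠ 0 := by
  let L : ℝ →L[ℝ] (Fin n → ℝ) := ContinuousLinearMap.toSpanSingleton ℝ v
  refine ae_mem_of_ae_add_linearMap_mem L.toLinearMap volume volume (s := {y | g y ≠ 0})
    (hg (measurableSet_singleton 0).compl) ?_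
  intro y
  obtain ⟨q, hq, hy⟩ := h y
  rw [ae_iff]
  refine measure_mono_null ?_ ((q.roots.toFinset.finite_toSet).measure_zero volume)
  intro t ht
  simp only [Set.mem_setOf_eq, not_not, L] at ht
  have : g (y + t • v) = 0 := by simpa using ht
  rw [hy] at this
  simp [hq, this]

theorem cont_ind {X : Type*} [TopologicalSpace X] (S : Set X) (x : X) (h : x ∈ interior S ∨ x ∈ interior Sᶜ) :
    ContinuousAt (S.indicator (fun _ => (1:ℝ))) x := by
  rcases h with h | h
  · refine (continuousAt_const (y := (1:ℝ))).congr ?_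
    filter_upwards [mem_interior_iff_mem_nhds.1 h] with y hy
    simp [hy]
  · refine (continuousAt_const (y := (0:ℝ))).congr ?_
    filter_upwards [mem_interior_iff_mem_nhds.1 h] with y hy
    rw [Set.indicator_of_notMem hy]

end TC

open MvPolynomial

namespace TC
open Filter Topology MeasureTheory

def gC4 (a1 a2 a3 a4 : ℤ) : ℤ := (a1 ^ 2 + 4 * a2) ^ 2 - 24 * (2 * a4 + a1 * a3)
def gC6 (a1 a2 a3 a4 a6 : ℤ) : ℤ := -(a1 ^ 2 + 4 * a2) ^ 3 + 36 * (a1 ^ 2 + 4 * a2) * (2 * a4 + a1 * a3)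
  - 216 * (a3 ^ 2 + 4 * a6)

abbrev Cls := Fin 2 × Fin 3 × Fin 2

def cl1 (c : Cls) : ℤ := (c.1 : ℕ)
def cl2 (c : Cls) : ℤ := (c.2.1 : ℕ) - 1
def cl3 (c : Cls) : ℤ := (c.2.2 : ℕ)

def eI (x : Cls × (Fin 2 → ℤ)) : ℤ := gC4 (cl1 x.1) (cl2 x.1) (cl3 x.1) (-x.2 0)
def eJ (x : Cls × (Fin 2 → ℤ)) : ℤ := gC6 (cl1 x.1) (cl2 x.1) (cl3 x.1) (-x.2 0) (-x.2 1)

def ePsi (x : Cls × (Fin 2 → ℤ)) : ℚ × ℚ := ((eI x : ℚ) / 16, (eJ x : ℚ) / 32)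

theorem C_trans (a1 a2 a3 a4 a6 r s t : ℤ) :
    gC4 (a1 + 2 * s) (a2 - s * a1 + 3 * r - s ^ 2) (a3 + r * a1 + 2 * t)
      (a4 - s * a3 + 2 * r * a2 - (t + r * s) * a1 + 3 * r ^ 2 - 2 * s * t) = gC4 a1 a2 a3 a4 ∧
    gC6 (a1 + 2 * s) (a2 - s * a1 + 3 * r - s ^ 2) (a3 + r * a1 + 2 * t)
      (a4 - s * a3 + 2 * r * a2 - (t + r * s) * a1 + 3 * r ^ 2 - 2 * s * t)
      (a6 + r * a4 + r ^ 2 * a2 + r ^ 3 - t * a3 - t ^ 2 - r * t * a1) = gC6 a1 a2 a3 a4 a6 := by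
  constructor
  · unfold gC4; ring
  · unfold gC6; ring

theorem C_reduce (a1 a2 a3 a4 a6 : ℤ) : ∃ x, eI x = gC4 a1 a2 a3 a4 ∧ eJ x = gC6 a1 a2 a3 a4 a6 := by
  obtain ⟨s, b1, hb1, h1⟩ : ∃ s : ℤ, ∃ b : Fin 2, a1 + 2 * s = (b : ℕ) ∧ True := by
    refine ⟨-(a1 / 2), ⟨(a1 % 2).toNat, by omega⟩, ?_, trivial⟩; simp; omega
  obtain ⟨r, b2, hb2, h2⟩ : ∃ r : ℤ, ∃ b : Fin 3, a2 - s * a1 + 3 * r - s ^ 2 = (b : ℕ) - 1 ∧ True := by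
    generalize a2 - s * a1 = y
    generalize s ^ 2 = z
    refine ⟨-((y - z + 1) / 3), ⟨((y - z + 1) % 3).toNat, by omega⟩, ?_, trivial⟩; simp; omega
  obtain ⟨t, b3, hb3, h3⟩ : ∃ t : ℤ, ∃ b : Fin 2, a3 + r * a1 + 2 * t = (b : ℕ) ∧ True := by
    generalize r * a1 = y
    refine ⟨-((a3 + y) / 2), ⟨((a3 + y) % 2).toNat, by omega⟩, ?_, trivial⟩; simp; omega
  obtain ⟨e1, e2⟩ := C_trans a1 a2 a3 a4 a6 r s t
  refine ⟨((b1, b2, b3), ![-(a4 - s * a3 + 2 * r * a2 - (t + r * s) * a1 + 3 * r ^ 2 - 2 * s * t),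
    -(a6 + r * a4 + r ^ 2 * a2 + r ^ 3 - t * a3 - t ^ 2 - r * t * a1)]), ?_, ?_⟩
  · rw [← e1, hb1, hb2, hb3]; simp [eI, cl1, cl2, cl3]
  · rw [← e2, hb1, hb2, hb3]; simp [eJ, cl1, cl2, cl3]

theorem e_inj {x y : Cls × (Fin 2 → ℤ)} (h1 : eI x = eI y) (h2 : eJ x = eJ y) : x = y := by
  obtain ⟨⟨a1, a2, a3⟩, k⟩ := x
  obtain ⟨⟨b1, b2, b3⟩, l⟩ := y
  have hk : ∀ k l : Fin 2 → ℤ, k 0 = l 0 → k 1 = l 1 → k = l := by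
    intro k l h h'; funext i; fin_cases i <;> assumption
  simp only [eI, eJ, gC4, gC6] at h1 h2
  have q1 : a1 = b1 ∧ a2 = b2 := by
    have hd : (12:ℤ) ∣ (cl1 (a1, a2, a3) ^ 2 + 4 * cl2 (a1, a2, a3)) ^ 3 - (cl1 (b1, b2, b3) ^ 2 + 4 * cl2 (b1, b2, b3)) ^ 3 := by
      refine ⟨3 * (cl1 (a1, a2, a3) ^ 2 + 4 * cl2 (a1, a2, a3)) * (2 * -k 0 + cl1 (a1, a2, a3) * cl3 (a1, a2, a3))
        - 3 * (cl1 (b1, b2, b3) ^ 2 + 4 * cl2 (b1, b2, b3)) * (2 * -l 0 + cl1 (b1, b2, b3) * cl3 (b1, b2, b3))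
        - 18 * (cl3 (a1, a2, a3) ^ 2 + 4 * -k 1) + 18 * (cl3 (b1, b2, b3) ^ 2 + 4 * -l 1), ?_⟩
      linarith
    simp only [cl1, cl2] at hd
    clear h1 h2
    revert a1 a2 b1 b2
    decide
  obtain ⟨rfl, rfl⟩ := q1
  simp only [cl1, cl2] at h1 h2
  generalize ((a1 : ℕ) : ℤ) ^ 2 + 4 * (((a2 : ℕ) : ℤ) - 1) = u at h1 h2
  have h3 : 2 * -k 0 + ((a1 : ℕ) : ℤ) * cl3 (a1, a2, a3) = 2 * -l 0 + ((a1 : ℕ) : ℤ) * cl3 (a1, a2, b3) := by linarith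
  rw [h3] at h2
  have h4 : cl3 (a1, a2, a3) ^ 2 + 4 * -k 1 = cl3 (a1, a2, b3) ^ 2 + 4 * -l 1 := by linarith
  have q3 : a3 = b3 ∧ k 1 = l 1 := by
    clear h1 h2 h3
    simp only [cl3] at h4
    fin_cases a3 <;> fin_cases b3 <;> simp at h4 ⊢ <;> omega
  obtain ⟨rfl, h5⟩ := q3
  rw [hk k l (by linarith) h5]

theorem ePsi_inj : Function.Injective ePsi := by
  intro x y h
  simp only [ePsi, Prod.mk.injEq] at h
  obtain ⟨h1, h2⟩ := h
  have h1' : (eI x : ℚ) = eI y := by linarith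
  have h2' : (eJ x : ℚ) = eJ y := by linarith
  exact e_inj (by exact_mod_cast h1') (by exact_mod_cast h2')

theorem eligible_iff (P Q : MvPolynomial (Fin 10) ℚ) (h : IsInvariantPair ℚ P Q) (p : ℚ × ℚ) :
    Eligible P Q p.1 p.2 ↔ p ∈ Set.range ePsi := by
  constructor
  · rintro ⟨c, h1, h2⟩
    obtain ⟨x, hx1, hx2⟩ := C_reduce (wa1 c) (wa2 c) (wa3 c) (wa4 c) (wa6 c)
    refine ⟨x, ?_⟩
    rw [ePsi, hx1, hx2]
    ext
    · rw [← h1, Iinv_eq P Q h]; simp [gC4, wc4, wb2, wb4]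
    · rw [← h2, Jinv_eq P Q h]; simp [gC6, wc6, wb2, wb4, wb6]
  · rintro ⟨x, rfl⟩
    refine ⟨![1, 0, -x.2 1, 0, cl2 x.1, 0, -1, -x.2 0, -cl3 x.1, -cl1 x.1], ?_, ?_⟩
    · rw [Iinv_eq P Q h, ePsi, eI]
      congr 2
      simp [gC4, wc4, wb2, wb4, wa1, wa2, wa3, wa4]
    · rw [Jinv_eq P Q h, ePsi, eJ]
      congr 2
      simp [gC6, wc6, wb2, wb4, wb6, wa1, wa2, wa3, wa4, wa6]

/-- the region of invariants of height less than one -/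
def Ω (e : ℝ) : Set (Fin 2 → ℝ) := {x | max (|x 0| ^ 3) (x 1 ^ 2 / 4) < 1 ∧ 0 < e * (4 * x 0 ^ 3 - x 1 ^ 2)}

theorem Ω_open (e : ℝ) : IsOpen (Ω e) := by
  have h1 := (isOpen_lt (f := fun x : Fin 2 → ℝ => max (|x 0| ^ 3) (x 1 ^ 2 / 4)) (g := fun _ => 1) (by fun_prop) (by fun_prop))
  have h2 := (isOpen_lt (f := fun _ => (0:ℝ)) (g := fun x : Fin 2 → ℝ => e * (4 * x 0 ^ 3 - x 1 ^ 2)) (by fun_prop) (by fun_prop))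
  exact h1.inter h2

theorem Ω_bdd (e : ℝ) (x : Fin 2 → ℝ) (h : x ∈ Ω e) : ‖x‖ ≤ 2 := by
  obtain ⟨h1, -⟩ := h
  rw [max_lt_iff] at h1
  rw [pi_norm_le_iff_of_nonneg (by norm_num)]
  intro i
  fin_cases i
  · simp only [Real.norm_eq_abs, Fin.zero_eta]
    have : |x 0| < 1 := by
      by_contra hh
      push Not at hh
      have := one_le_pow₀ hh (n := 3)
      linarith [h1.1]
    linarith
  · simp only [Real.norm_eq_abs, Fin.mk_one]
    exact abs_le_of_sq_le_sq (by linarith [h1.2]) (by norm_num)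

theorem Ω_ae (e : ℝ) (he : e = 1 ∨ e = -1) : ∀ᵐ x, ContinuousAt ((Ω e).indicator (fun _ => (1:ℝ))) x := by
  have e1 : ∀ᵐ x : Fin 2 → ℝ, x 0 ^ 6 - 1 ≠ 0 := by
    refine ae_ne_of_poly _ (by fun_prop) ![1, 0] fun y => ?_
    refine ⟨(Polynomial.X + Polynomial.C (y 0)) ^ 6 - 1, ?_, fun t => by simp; ring⟩
    intro h
    have := congrArg (Polynomial.eval (2 - y 0)) h
    norm_num at this
  have e2 : ∀ᵐ x : Fin 2 → ℝ, x 1 ^ 2 - 4 ≠ 0 := by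
    refine ae_ne_of_poly _ (by fun_prop) ![0, 1] fun y => ?_
    refine ⟨(Polynomial.X + Polynomial.C (y 1)) ^ 2 - 4, ?_, fun t => by simp; ring⟩
    intro h
    have := congrArg (Polynomial.eval (3 - y 1)) h
    norm_num at this
  have e3 : ∀ᵐ x : Fin 2 → ℝ, 4 * x 0 ^ 3 - x 1 ^ 2 ≠ 0 := by
    refine ae_ne_of_poly _ (by fun_prop) ![0, 1] fun y => ?_
    refine ⟨Polynomial.C (4 * y 0 ^ 3) - (Polynomial.X + Polynomial.C (y 1)) ^ 2, ?_, fun t => by simp; ring⟩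
    intro h
    have := congrArg (Polynomial.eval ((|4 * y 0 ^ 3| + 1) - y 1)) h
    simp at this
    have h0 : 4 * y 0 ^ 3 ≤ |4 * y 0 ^ 3| := le_abs_self _
    simp [abs_mul, abs_pow] at this h0
    nlinarith [pow_nonneg (abs_nonneg (y 0)) 3]
  filter_upwards [e1, e2, e3] with x h1 h2 h3
  apply cont_ind
  by_cases hx : x ∈ Ω e
  · left; rwa [(Ω_open e).interior_eq]
  · right
    have hm : max (|x 0| ^ 3) (x 1 ^ 2 / 4) ≠ 1 := by
      intro h
      rcases max_choice (|x 0| ^ 3) (x 1 ^ 2 / 4) with hh | hh <;> rw [hh] at h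
      · apply h1
        have : |x 0| ^ 6 = 1 := by rw [show |x 0| ^ 6 = (|x 0| ^ 3) ^ 2 by ring, h]; norm_num
        rw [Even.pow_abs (by decide)] at this; linarith
      · apply h2; linarith
    have he0 : e ≠ 0 := by rcases he with rfl | rfl <;> norm_num
    have hV : IsOpen ({x : Fin 2 → ℝ | 1 < max (|x 0| ^ 3) (x 1 ^ 2 / 4)} ∪ {x | e * (4 * x 0 ^ 3 - x 1 ^ 2) < 0}) :=
      (isOpen_lt (by fun_prop) (by fun_prop)).union (isOpen_lt (by fun_prop) (by fun_prop))
    refine mem_interior.2 ⟨_, ?_, hV, ?_⟩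
    · rintro y (hy | hy) ⟨hy1, hy2⟩
      · exact absurd hy1 (not_lt.2 (le_of_lt hy))
      · exact absurd hy2 (not_lt.2 (le_of_lt hy))
    · by_contra hn
      apply hx
      simp only [Set.mem_union, Set.mem_setOf_eq, not_or, not_lt] at hn
      exact ⟨lt_of_le_of_ne hn.1 hm, lt_of_le_of_ne hn.2 (mul_ne_zero he0 h3).symm⟩

/-- rescaled invariants -/
noncomputable def ep (T : ℝ) (c : Cls) (k : Fin 2 → ℤ) : Fin 2 → ℝ := ![(eI (c, k) : ℝ) / 16 / T ^ 4, (eJ (c, k) : ℝ) / 32 / T ^ 6]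

theorem ep_mem {T : ℝ} (hT : 0 < T) (e : ℝ) (c : Cls) (k : Fin 2 → ℤ) :
    ep T c k ∈ Ω e ↔ 0 < e * (Δpair (ePsi (c, k)) : ℝ) ∧ (Hpair (ePsi (c, k)) : ℝ) < T ^ 12 := by
  have h12 : 0 < T ^ 12 := by positivity
  have e1 : max (|(eI (c, k) : ℝ) / 16 / T ^ 4| ^ 3) (((eJ (c, k) : ℝ) / 32 / T ^ 6) ^ 2 / 4)
    = (Hpair (ePsi (c, k)) : ℝ) / T ^ 12 := by
    simp only [Hpair, ePsi]
    push_cast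
    rw [← max_div_div_right h12.le]
    congr 1
    · rw [abs_div, abs_of_pos (by positivity : 0 < T ^ 4)]; field_simp
    · field_simp
  have e2 : e * (4 * ((eI (c, k) : ℝ) / 16 / T ^ 4) ^ 3 - ((eJ (c, k) : ℝ) / 32 / T ^ 6) ^ 2)
      = e * (Δpair (ePsi (c, k)) : ℝ) * (27 / T ^ 12) := by
    simp only [Δpair, ePsi]
    push_cast
    field_simp
  simp only [Ω, ep, Set.mem_setOf_eq, Matrix.cons_val_zero, Matrix.cons_val_one]
  rw [e1, e2, div_lt_one h12, and_comm, mul_pos_iff_of_pos_right (by positivity)]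

theorem ep_count (e : ℝ) (he : e = 1 ∨ e = -1) (c : Cls) :
    (∀ᶠ T in atTop, {k | ep T c k ∈ Ω e}.Finite) ∧
    Tendsto (fun T : ℝ => ({k | ep T c k ∈ Ω e}.ncard : ℝ) / T ^ 10) atTop (𝓝 (volume.real (Ω e) / 81)) := by
  obtain ⟨K, hK0, hK1, hK2, hK3⟩ : ∃ K : ℝ, 0 ≤ K ∧ |(gC4 (cl1 c) (cl2 c) (cl3 c) 0 : ℝ) / 16| ≤ K ∧
    |(gC6 (cl1 c) (cl2 c) (cl3 c) 0 0 : ℝ) / 32| ≤ K ∧ 3 / 4 * |((cl1 c : ℝ) ^ 2 + 4 * cl2 c)| ≤ K := by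
    refine ⟨|(gC4 (cl1 c) (cl2 c) (cl3 c) 0 : ℝ) / 16| + |(gC6 (cl1 c) (cl2 c) (cl3 c) 0 0 : ℝ) / 32| +
      3 / 4 * |((cl1 c : ℝ) ^ 2 + 4 * cl2 c)|, by positivity, ?_, ?_, ?_⟩
    · have := abs_nonneg ((gC6 (cl1 c) (cl2 c) (cl3 c) 0 0 : ℝ) / 32)
      have := abs_nonneg ((cl1 c : ℝ) ^ 2 + 4 * cl2 c); linarith
    · have := abs_nonneg ((gC4 (cl1 c) (cl2 c) (cl3 c) 0 : ℝ) / 16)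
      have := abs_nonneg ((cl1 c : ℝ) ^ 2 + 4 * cl2 c); linarith
    · have := abs_nonneg ((gC6 (cl1 c) (cl2 c) (cl3 c) 0 0 : ℝ) / 32)
      have := abs_nonneg ((gC4 (cl1 c) (cl2 c) (cl3 c) 0 : ℝ) / 16); linarith
  have tz : ∀ (a : ℝ) (n : ℕ), n ≠ 0 → Tendsto (fun T : ℝ => a / T ^ n) atTop (𝓝 0) := fun a n hn =>
    tendsto_const_nhds.div_atTop (tendsto_pow_atTop hn)
  obtain ⟨h1, h2⟩ := riemann_count (Ω e) (Ω_open e).measurableSet 2 (Ω_bdd e) (Ω_ae e he)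
    (l := atTop) (fun T : ℝ => ![3 / T ^ 4, 27 / T ^ 6])
    (by filter_upwards [eventually_gt_atTop 0] with T hT i
        fin_cases i <;> simp <;> positivity)
    (by rw [tendsto_pi_nhds]; intro i; fin_cases i
        · simpa using tz 3 4 (by norm_num)
        · simpa using tz 27 6 (by norm_num)) (fun T k => ep T c k) (fun T => 2 * K / T ^ 2) (tz _ 2 (by norm_num)) (by
        filter_upwards [eventually_ge_atTop 1] with T hT k
        have hT0 : 0 < T := by linarith
        have hn0 : |3 / T ^ 4 * (k 0 : ℝ)| ≤ ‖fun i => (![3 / T ^ 4, 27 / T ^ 6] : Fin 2 → ℝ) i * (k i : ℝ)‖ := by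
          simpa using norm_le_pi_norm (fun i => (![3 / T ^ 4, 27 / T ^ 6] : Fin 2 → ℝ) i * (k i : ℝ)) 0
        have hN0 := norm_nonneg (fun i => (![3 / T ^ 4, 27 / T ^ 6] : Fin 2 → ℝ) i * (k i : ℝ))
        generalize ‖fun i => (![3 / T ^ 4, 27 / T ^ 6] : Fin 2 → ℝ) i * (k i : ℝ)‖ = N at *
        rw [pi_norm_le_iff_of_nonneg (by positivity)]
        have h46 : K / T ^ 4 ≤ K / T ^ 2 := by gcongr <;> first | exact hT | norm_num
        have h66 : K / T ^ 6 ≤ K / T ^ 2 := by gcongr <;> first | exact hT | norm_num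
        have hmain : K / T ^ 2 + K / T ^ 2 * N ≤ 2 * K / T ^ 2 * (1 + N) := by
          rw [show 2 * K / T ^ 2 * (1 + N) = K / T ^ 2 + K / T ^ 2 * N + (K / T ^ 2 + K / T ^ 2 * N) by ring]
          have : 0 ≤ K / T ^ 2 + K / T ^ 2 * N := by positivity
          linarith
        have hKN : 0 ≤ K / T ^ 2 * N := by positivity
        intro i
        fin_cases i
        · have e1 : (ep T c k - fun i => (![3 / T ^ 4, 27 / T ^ 6] : Fin 2 → ℝ) i * (k i : ℝ)) 0
            = ((gC4 (cl1 c) (cl2 c) (cl3 c) 0 : ℝ) / 16) / T ^ 4 := by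
            simp [ep, eI, gC4]; ring
          simp only [Fin.zero_eta]
          rw [e1, Real.norm_eq_abs, abs_div, abs_of_pos (by positivity : 0 < T ^ 4)]
          have : |(gC4 (cl1 c) (cl2 c) (cl3 c) 0 : ℝ) / 16| / T ^ 4 ≤ K / T ^ 4 := by gcongr
          linarith
        · have e1 : (ep T c k - fun i => (![3 / T ^ 4, 27 / T ^ 6] : Fin 2 → ℝ) i * (k i : ℝ)) 1
            = ((gC6 (cl1 c) (cl2 c) (cl3 c) 0 0 : ℝ) / 32) / T ^ 6
              + (-(3 / 4 * ((cl1 c : ℝ) ^ 2 + 4 * cl2 c))) / T ^ 2 * (3 / T ^ 4 * (k 0 : ℝ)) := by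
            simp [ep, eJ, gC6]; field_simp; ring
          simp only [Fin.mk_one]
          rw [e1, Real.norm_eq_abs]
          refine (abs_add_le _ _).trans (le_trans (add_le_add ?_ ?_) hmain)
          · rw [abs_div, abs_of_pos (by positivity : 0 < T ^ 6)]
            refine le_trans ?_ h66; gcongr
          · rw [abs_mul, abs_div, abs_neg, abs_mul, abs_of_pos (by positivity : 0 < T ^ 2), abs_of_pos (by norm_num : (0:ℝ) < 3 / 4)]
            gcongr)
  refine ⟨h1, ?_⟩
  have := h2.div_const 81
  refine this.congr' ?_
  filter_upwards [eventually_gt_atTop 0] with T hT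
  simp [Fin.prod_univ_two]
  field_simp
  ring

theorem eligible_count (P Q : MvPolynomial (Fin 10) ℚ) (h : IsInvariantPair ℚ P Q) (e : ℝ) (he : e = 1 ∨ e = -1) :
    Tendsto (fun T : ℝ => (Set.ncard {p : ℚ × ℚ | Eligible P Q p.1 p.2 ∧ 0 < e * (Δpair p : ℝ) ∧
      (Hpair p : ℝ) < T ^ 12} : ℝ) / T ^ 10) atTop (𝓝 (4 / 27 * volume.real (Ω e))) := by
  have hsum := tendsto_finsetSum (Finset.univ : Finset Cls) (fun c _ => (ep_count e he c).2)
  have hv : ∑ c : Cls, volume.real (Ω e) / 81 = 4 / 27 * volume.real (Ω e) := by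
    simp; ring
  rw [hv] at hsum
  refine hsum.congr' ?_
  have hfin : ∀ᶠ T in atTop, ∀ c : Cls, {k | ep T c k ∈ Ω e}.Finite :=
    eventually_all.2 fun c => (ep_count e he c).1
  filter_upwards [hfin, eventually_gt_atTop 0] with T hf hT
  rw [← Finset.sum_div]
  congr 1
  have e1 : {p : ℚ × ℚ | Eligible P Q p.1 p.2 ∧ 0 < e * (Δpair p : ℝ) ∧ (Hpair p : ℝ) < T ^ 12}
    = ePsi '' {x | ep T x.1 x.2 ∈ Ω e} := by
    ext p
    simp only [Set.mem_setOf_eq, Set.mem_image, eligible_iff P Q h]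
    constructor
    · rintro ⟨⟨x, rfl⟩, h2⟩
      exact ⟨x, (ep_mem hT e x.1 x.2).2 h2, rfl⟩
    · rintro ⟨x, hx, rfl⟩
      exact ⟨⟨x, rfl⟩, (ep_mem hT e x.1 x.2).1 hx⟩
  rw [e1, Set.ncard_image_of_injective _ ePsi_inj, ncard_eq_tsum, Summable.tsum_prod, tsum_fintype]
  · refine Finset.sum_congr rfl fun c _ => ?_
    rw [ncard_eq_tsum]; rfl
  · apply summable_of_finite_support
    have : (⋃ c : Cls, (fun k => (c, k)) '' {k | ep T c k ∈ Ω e}).Finite :=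
      Set.finite_iUnion fun c => (hf c).image _
    refine this.subset ?_
    rintro ⟨c, k⟩ hx
    simp only [Function.mem_support, ne_eq, Set.indicator_apply_eq_zero, not_forall] at hx
    exact Set.mem_iUnion.2 ⟨c, k, hx.1, rfl⟩

end TC

open MvPolynomial

namespace TC
open Filter Topology MeasureTheory

section FF
variable {K : Type*} [Field K]

theorem dv_act (M : M3 K) (c : Fin 10 → K) (v w : Fin 3 → K) :
    dv (act M c) v w = dv c (Matrix.vecMul v M) (Matrix.vecMul w M) := by
  have h : ∀ v : Fin 3 → K, ∀ j, Matrix.vecMul v M j = v 0 * M 0 j + v 1 * M 1 j + v 2 * M 2 j := by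
    intro v j; simp [Matrix.vecMul, dotProduct, Fin.sum_univ_three]
  simp only [dv, gr, act, ev, tri, hm, h, Matrix.cons_val, Matrix.of_apply, Matrix.cons_val', Matrix.cons_val_zero, Matrix.cons_val_one]
  ring

theorem dv_self (c : Fin 10 → K) (v : Fin 3 → K) : dv c v v = 3 * ev c v := by
  simp [dv, gr, ev]; ring

theorem vecMul_inv (M : M3 K) (hM : M.det ≠ 0) (v : Fin 3 → K) :
    Matrix.vecMul (Matrix.vecMul v M⁻¹) M = v := by
  rw [Matrix.vecMul_vecMul, Matrix.nonsing_inv_mul _ (isUnit_iff_ne_zero.2 hM), Matrix.vecMul_one]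

theorem vecMul_inv' (M : M3 K) (hM : M.det ≠ 0) (v : Fin 3 → K) :
    Matrix.vecMul (Matrix.vecMul v M) M⁻¹ = v := by
  rw [Matrix.vecMul_vecMul, Matrix.mul_nonsing_inv _ (isUnit_iff_ne_zero.2 hM), Matrix.vecMul_one]

variable [Fintype K] [DecidableEq K]

/-- the nonzero flex vectors -/
def FL (f : Fin 10 → K) : Finset (Fin 3 → K) := Finset.univ.filter fun v => v ≠ 0 ∧ ev f v = 0 ∧ he f v = 0

theorem mem_FL (f : Fin 10 → K) (v : Fin 3 → K) : v ∈ FL f ↔ v ≠ 0 ∧ ev f v = 0 ∧ he f v = 0 := by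
  simp [FL]

theorem FL_act (M : M3 K) (hM : M.det ≠ 0) (f : Fin 10 → K) : (FL f).card ≤ (FL (act M f)).card := by
  refine Finset.card_le_card_of_injOn (fun v => Matrix.vecMul v M⁻¹) ?_ ?_
  · intro v hv
    simp only [Finset.mem_coe, mem_FL] at hv ⊢
    rw [ev_act, he_act, vecMul_inv M hM]
    refine ⟨fun h => hv.1 ?_, hv.2.1, by rw [hv.2.2, mul_zero]⟩
    rw [← vecMul_inv M hM v, h, Matrix.zero_vecMul]
  · intro v _ w _ h
    rw [← vecMul_inv M hM v, ← vecMul_inv M hM w]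
    simp only at h
    rw [h]

theorem weier_bound (h2 : (2:K) ≠ 0) (h3 : (3:K) ≠ 0) (f : Fin 10 → K) (f0 : f 0 ≠ 0) (f6 : f 6 ≠ 0) (f1 : f 1 = 0) (f3 : f 3 = 0)
    (f4 : f 4 = 0) (f5 : f 5 = 0) (f8 : f 8 = 0) (f9 : f 9 = 0) :
    (FL f).card ≤ 9 * (Fintype.card K - 1) := by
  let q : Polynomial K := Polynomial.C (3 * f 0 ^ 2) * Polynomial.X ^ 4 + Polynomial.C (6 * f 0 * f 7) * Polynomial.X ^ 2
    + Polynomial.C (12 * f 0 * f 2) * Polynomial.X + Polynomial.C (- f 7 ^ 2)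
  have hq4 : q.coeff 4 = 3 * f 0 ^ 2 := by
    simp only [q, Polynomial.coeff_add, Polynomial.coeff_C_mul, Polynomial.coeff_X_pow, Polynomial.coeff_X, Polynomial.coeff_C]; norm_num
  have hq0 : q ≠ 0 := by
    intro h
    rw [h] at hq4
    simp at hq4
    tauto
  have hqd : q.natDegree ≤ 4 := by simp only [q]; compute_degree
  let r : K → Polynomial K := fun x => Polynomial.C (f 6) * Polynomial.X ^ 2 + Polynomial.C (f 0 * x ^ 3 + f 7 * x + f 2)
  have hr2 : ∀ x, (r x).coeff 2 = f 6 := by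
    intro x
    simp only [r, Polynomial.coeff_add, Polynomial.coeff_C_mul, Polynomial.coeff_X_pow, Polynomial.coeff_C]; norm_num
  have hr0 : ∀ x, r x ≠ 0 := by
    intro x h
    have := hr2 x
    rw [h] at this
    exact f6 (by simpa using this.symm)
  have hrd : ∀ x, (r x).natDegree ≤ 2 := by intro x; simp only [r]; compute_degree
  let W : Finset (K × K) := q.roots.toFinset.biUnion fun x => (r x).roots.toFinset.image fun y => (x, y)
  have hW : W.card ≤ 4 * 2 := by
    refine (Finset.card_biUnion_le_card_mul _ _ 2 (fun x _ => ?_)).trans ?_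
    · refine Finset.card_image_le.trans ((Multiset.toFinset_card_le _).trans ((Polynomial.card_roots' _).trans (hrd x)))
    · gcongr
      exact ((Multiset.toFinset_card_le _).trans ((Polynomial.card_roots' _).trans hqd))
  let A : Finset (Fin 3 → K) := (Finset.univ.erase (0:K)).image fun y => ![0, y, 0]
  let B : Finset (Fin 3 → K) := (W ×ˢ Finset.univ.erase (0:K)).image fun w => ![w.1.1 * w.2, w.1.2 * w.2, w.2]
  have hA : A.card ≤ Fintype.card K - 1 := by
    refine Finset.card_image_le.trans ?_
    rw [Finset.card_erase_of_mem (Finset.mem_univ _), Finset.card_univ]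
  have hB : B.card ≤ 8 * (Fintype.card K - 1) := by
    refine Finset.card_image_le.trans ?_
    rw [Finset.card_product, Finset.card_erase_of_mem (Finset.mem_univ _), Finset.card_univ]
    gcongr
  have hsub : FL f ⊆ A ∪ B := by
    intro v hv
    rw [mem_FL] at hv
    obtain ⟨hv0, hv1, hv2⟩ := hv
    rw [Finset.mem_union]
    by_cases hz : v 2 = 0
    · left
      have hx : v 0 = 0 := by
        simp [ev, hz, f1, f3, f5] at hv1
        tauto
      refine Finset.mem_image.2 ⟨v 1, ?_, ?_⟩
      · simp only [Finset.mem_erase, Finset.mem_univ, and_true]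
        intro hy; apply hv0; funext i; fin_cases i <;> assumption
      · funext i; fin_cases i <;> simp [hx, hz]
    · right
      have e1 : f 6 * (v 1 / v 2) ^ 2 + (f 0 * (v 0 / v 2) ^ 3 + f 7 * (v 0 / v 2) + f 2) = 0 := by
        simp [ev, f1, f3, f4, f5, f8, f9] at hv1
        field_simp
        linear_combination hv1
      have e2 : 3 * f 0 ^ 2 * (v 0 / v 2) ^ 4 + 6 * f 0 * f 7 * (v 0 / v 2) ^ 2 + 12 * f 0 * f 2 * (v 0 / v 2) + - f 7 ^ 2 = 0 := by
        simp [ev, f1, f3, f4, f5, f8, f9] at hv1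
        simp [he, hm, Matrix.det_fin_three, f1, f3, f4, f5, f8, f9] at hv2
        have h8 : (8 * f 6 * v 2) * (3 * f 0 ^ 2 * v 0 ^ 4 + 6 * f 0 * f 7 * v 0 ^ 2 * v 2 ^ 2 + 12 * f 0 * f 2 * v 0 * v 2 ^ 3 - f 7 ^ 2 * v 2 ^ 4) = 0 := by
          linear_combination v 2 ^ 2 * hv2 + 24 * f 0 * f 6 * v 0 * v 2 * hv1
        have h9 := (mul_eq_zero.1 h8).resolve_left (by
          rw [show (8:K) = 2 ^ 3 by norm_num]
          exact mul_ne_zero (mul_ne_zero (pow_ne_zero _ h2) f6) hz)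
        field_simp
        linear_combination h9
      refine Finset.mem_image.2 ⟨((v 0 / v 2, v 1 / v 2), v 2), ?_, ?_⟩
      · simp only [Finset.mem_product, Finset.mem_erase, Finset.mem_univ, and_true, W, Finset.mem_biUnion, Multiset.mem_toFinset,
          Finset.mem_image]
        refine ⟨⟨v 0 / v 2, ?_, v 1 / v 2, ?_, rfl⟩, hz⟩
        · rw [Polynomial.mem_roots hq0]
          simpa [q, Polynomial.IsRoot] using e2
        · rw [Polynomial.mem_roots (hr0 _)]
          simpa [r, Polynomial.IsRoot] using e1
      · funext i; fin_cases i <;> simp [hz]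
  calc _ ≤ (A ∪ B).card := Finset.card_le_card hsub
    _ ≤ A.card + B.card := Finset.card_union_le _ _
    _ ≤ _ := by omega


theorem step2 (h2 : (2:K) ≠ 0) (h3 : (3:K) ≠ 0) (k : Fin 10 → K) (k0 : k 0 ≠ 0) (k6 : k 6 ≠ 0) (k1 : k 1 = 0) (k3 : k 3 = 0)
    (k5 : k 5 = 0) (k8 : k 8 = 0) (k9 : k 9 = 0) : (FL k).card ≤ 9 * (Fintype.card K - 1) := by
  obtain ⟨a, ha⟩ : ∃ a : K, a = -k 4 / (3 * k 0) := ⟨_, rfl⟩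
  have ha' : 3 * k 0 * a + k 4 = 0 := by rw [ha]; field_simp; ring
  have hdet' : Matrix.det !![1, 0, 0; 0, 1, 0; a, 0, 1] ≠ 0 := by
    rw [Matrix.det_fin_three]; simp
  refine (FL_act !![1, 0, 0; 0, 1, 0; a, 0, 1] hdet' k).trans ?_
  apply weier_bound h2 h3
  · simpa [act, ev] using k0
  · simpa [act, dv, gr, k1, k3, k5] using k6
  · simp [act, ev, k1]
  · simp [act, dv, gr, k1, k3, k5]
  · simp [act, dv, gr, k1, k3, k5]; linear_combination ha'
  · simp [act, dv, gr, k1, k3, k5]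
  · simp [act, dv, gr, k1, k3, k5, k8, k9]
  · simp [act, tri, hm, k1, k3, k5, k9]

theorem step1 (h2 : (2:K) ≠ 0) (h3 : (3:K) ≠ 0) (g : Fin 10 → K) (g0 : g 0 ≠ 0) (g6 : g 6 ≠ 0) (g1 : g 1 = 0) (g3 : g 3 = 0)
    (g5 : g 5 = 0) : (FL g).card ≤ 9 * (Fintype.card K - 1) := by
  obtain ⟨a, ha⟩ : ∃ a : K, a = -g 9 / (2 * g 6) := ⟨_, rfl⟩
  have ha' : 2 * g 6 * a + g 9 = 0 := by rw [ha]; field_simp; ring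
  obtain ⟨b, hb⟩ : ∃ a : K, a = -g 8 / (2 * g 6) := ⟨_, rfl⟩
  have hb' : 2 * g 6 * b + g 8 = 0 := by rw [hb]; field_simp; ring
  have hdet' : Matrix.det !![1, a, 0; 0, 1, 0; 0, b, 1] ≠ 0 := by
    rw [Matrix.det_fin_three]; simp
  refine (FL_act !![1, a, 0; 0, 1, 0; 0, b, 1] hdet' g).trans ?_
  apply step2 h2 h3
  · simpa [act, ev, g1, g3, g5] using g0
  · simpa [act, dv, gr, g1, g3, g5] using g6
  · simp [act, ev, g1]
  · simp [act, dv, gr, g1, g3, g5]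
  · simp [act, dv, gr, g1, g3, g5]
  · simp [act, dv, gr, g1, g3, g5]; linear_combination hb'
  · simp [act, tri, hm, g1, g3, g5]; linear_combination ha'

/-- `v` is a flex with tangent line not contained in the curve -/
def gd (f : Fin 10 → K) (v : Fin 3 → K) : Prop := (∃ u, dv f v u ≠ 0) ∧ ∃ w, dv f v w = 0 ∧ ev f w ≠ 0

theorem good_det (f : Fin 10 → K) (v u w : Fin 3 → K) (v0 : v ≠ 0) (hv1 : ev f v = 0) (hu : dv f v u ≠ 0)
    (hw : dv f v w = 0) (hw' : ev f w ≠ 0) (M : M3 K) (M0 : M 0 = w) (M1 : M 1 = v) (M2 : M 2 = u) : M.det ≠ 0 := by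
  intro h
  obtain ⟨x, hx, hxM⟩ := Matrix.exists_vecMul_eq_zero_iff.2 h
  have e : ∀ j, x 0 * w j + x 1 * v j + x 2 * u j = 0 := by
    intro j
    have := congrFun hxM j
    simpa [Matrix.vecMul, dotProduct, Fin.sum_univ_three, M0, M1, M2] using this
  have d1 : x 2 * dv f v u = 0 := by
    have l : x 0 * dv f v w + x 1 * dv f v v + x 2 * dv f v u = 0 := by
      simp only [dv]
      linear_combination gr f v 0 * e 0 + gr f v 1 * e 1 + gr f v 2 * e 2
    rw [hw, dv_self, hv1] at l
    linear_combination l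
  have x2 : x 2 = 0 := by rcases mul_eq_zero.1 d1 with h | h <;> tauto
  have x0 : x 0 = 0 := by
    have : x 0 • w = (-x 1) • v := by
      funext j; have := e j; rw [x2] at this
      simp only [Pi.smul_apply, smul_eq_mul]; linear_combination this
    have := congrArg (ev f) this
    rw [ev_smul_vec, ev_smul_vec, hv1, mul_zero] at this
    rcases mul_eq_zero.1 this with h | h
    · exact pow_eq_zero_iff (by norm_num) |>.1 h
    · tauto
  have x1 : x 1 = 0 := by
    by_contra hx1
    apply v0
    funext j
    have := e j
    rw [x0, x2] at this
    simp at this; tauto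
  apply hx; funext i; fin_cases i <;> assumption

theorem flex3 (h2 : (2:K) ≠ 0) (g : Fin 10 → K) (g1 : g 1 = 0) (g5 : g 5 = 0) (g6 : g 6 ≠ 0) (h : he g ![0, 1, 0] = 0) : g 3 = 0 := by
  simp [he, hm, Matrix.det_fin_three, g1, g5] at h
  tauto

theorem good_bound (h2 : (2:K) ≠ 0) (h3 : (3:K) ≠ 0) (f : Fin 10 → K) (v : Fin 3 → K) (hv : v ∈ FL f) (hg : gd f v) :
    (FL f).card ≤ 9 * (Fintype.card K - 1) := by
  rw [mem_FL] at hv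
  obtain ⟨v0, hv1, hv2⟩ := hv
  obtain ⟨⟨u, hu⟩, w, hw, hw'⟩ := hg
  obtain ⟨M, M0, M1, M2⟩ : ∃ M : M3 K, M 0 = w ∧ M 1 = v ∧ M 2 = u := ⟨Matrix.of ![w, v, u], rfl, rfl, rfl⟩
  have hM := good_det f v u w v0 hv1 hu hw hw' M M0 M1 M2
  refine (FL_act M hM f).trans ?_
  have e0 : act M f 0 = ev f (M 0) := rfl
  have e1 : act M f 1 = ev f (M 1) := rfl
  have e5 : act M f 5 = dv f (M 1) (M 0) := rfl
  have e6 : act M f 6 = dv f (M 1) (M 2) := rfl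
  have g1 : act M f 1 = 0 := by rw [e1, M1, hv1]
  have g5 : act M f 5 = 0 := by rw [e5, M1, M0, hw]
  have g6 : act M f 6 ≠ 0 := by rw [e6, M1, M2]; exact hu
  apply step1 h2 h3 _ (by rw [e0, M0]; exact hw') g6 g1 (flex3 h2 _ g1 g5 g6 ?_) g5
  have : Matrix.vecMul ![0, 1, 0] M = v := by
    funext j; simp [Matrix.vecMul, dotProduct, Fin.sum_univ_three, M1]
  rw [he_act, this, hv2, mul_zero]

end FF
end TC

open MvPolynomial

namespace TC
open Filter Topology MeasureTheory

section FF
variable {K : Type*} [Field K]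

theorem exists_third (v w : Fin 3 → K) (hv : v ≠ 0) (hw : ∀ t : K, w ≠ t • v) :
    ∃ M : M3 K, M.det ≠ 0 ∧ M 0 = v ∧ M 1 = w := by
  by_contra hcon
  push Not at hcon
  have key : ∀ u : Fin 3 → K, Matrix.det (Matrix.of ![v, w, u]) = 0 := by
    intro u; by_contra h; exact hcon _ h rfl rfl
  have k0 := key ![1, 0, 0]
  have k1 := key ![0, 1, 0]
  have k2 := key ![0, 0, 1]
  simp [Matrix.det_fin_three] at k0 k1 k2
  apply hv
  by_contra hv'
  have : ∃ i, v i ≠ 0 := by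
    by_contra h; push Not at h; exact hv (funext h)
  obtain ⟨i, hi⟩ := this
  refine hw (w i / v i) ?_
  funext j
  simp only [Pi.smul_apply, smul_eq_mul]
  field_simp
  fin_cases i <;> fin_cases j <;> simp <;> first | (ring; done) | linear_combination k0 | linear_combination k1 | linear_combination k2 | linear_combination -k0 | linear_combination -k1 | linear_combination -k2

variable [Fintype K] [DecidableEq K]

theorem card_le_pow (S : Finset (Fin 10 → K)) (J : Finset (Fin 10))
    (h : ∀ f ∈ S, ∀ g ∈ S, (∀ j ∈ J, f j = g j) → f = g) : S.card ≤ Fintype.card K ^ J.card := by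
  have : S.card ≤ (Finset.univ : Finset (J → K)).card := by
    refine Finset.card_le_card_of_injOn (fun f j => f j) (fun _ _ => Finset.mem_univ _) ?_
    intro f hf g hg hfg
    exact h f hf g hg fun j hj => congrFun hfg ⟨j, hj⟩
  simpa using this

theorem flex_e0 (h2 : (2:K) ≠ 0) (f : Fin 10 → K) : (ev f ![1,0,0] = 0 ∧ he f ![1,0,0] = 0) ↔
    f 0 = 0 ∧ f 3 ^ 2 * f 7 - f 3 * f 4 * f 9 + f 4 ^ 2 * f 5 = 0 := by
  have e1 : ev f ![1,0,0] = f 0 := by simp [ev]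
  rw [e1]
  refine and_congr_right fun h0 => ?_
  have e2 : he f ![1,0,0] = - (2 * 2 * 2) * (f 3 ^ 2 * f 7 - f 3 * f 4 * f 9 + f 4 ^ 2 * f 5) := by
    simp [he, hm, Matrix.det_fin_three, h0]; ring
  rw [e2, mul_eq_zero]
  simp [h2]

theorem flex_e1 (h2 : (2:K) ≠ 0) (f : Fin 10 → K) : (ev f ![0,1,0] = 0 ∧ he f ![0,1,0] = 0) ↔
    f 1 = 0 ∧ f 5 ^ 2 * f 8 - f 5 * f 6 * f 9 + f 6 ^ 2 * f 3 = 0 := by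
  have e1 : ev f ![0,1,0] = f 1 := by simp [ev]
  rw [e1]
  refine and_congr_right fun h0 => ?_
  have e2 : he f ![0,1,0] = - (2 * 2 * 2) * (f 5 ^ 2 * f 8 - f 5 * f 6 * f 9 + f 6 ^ 2 * f 3) := by
    simp [he, hm, Matrix.det_fin_three, h0]; ring
  rw [e2, mul_eq_zero]
  simp [h2]

theorem count_e0 (h2 : (2:K) ≠ 0) : (Finset.univ.filter fun f : Fin 10 → K => ![1,0,0] ∈ FL f).card ≤
    Fintype.card K ^ 8 + 2 * Fintype.card K ^ 7 := by
  let A : Finset (Fin 10 → K) := Finset.univ.filter fun f => f 0 = 0 ∧ f 3 ≠ 0 ∧ f 3 ^ 2 * f 7 - f 3 * f 4 * f 9 + f 4 ^ 2 * f 5 = 0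
  let B : Finset (Fin 10 → K) := Finset.univ.filter fun f => f 0 = 0 ∧ f 3 = 0 ∧ f 4 = 0
  let C : Finset (Fin 10 → K) := Finset.univ.filter fun f => f 0 = 0 ∧ f 3 = 0 ∧ f 5 = 0
  have hA : A.card ≤ Fintype.card K ^ 8 := by
    refine card_le_pow A {1,2,3,4,5,6,8,9} ?_
    intro f hf g hg h
    simp only [A, Finset.mem_filter, Finset.mem_univ, true_and] at hf hg
    have h' : ∀ j ∈ [1,2,3,4,5,6,8,9], f j = g j := by simpa using h
    simp only [List.forall_mem_cons] at h'
    obtain ⟨a1, a2, a3, a4, a5, a6, a8, a9, _⟩ := h'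
    have h7 : f 7 = g 7 := by
      have h1 := hf.2.2
      rw [a3, a4, a9, a5] at h1
      have : g 3 ^ 2 * (f 7 - g 7) = 0 := by linear_combination h1 - hg.2.2
      rcases mul_eq_zero.1 this with h | h
      · exact absurd (pow_eq_zero_iff (by norm_num) |>.1 h) hg.2.1
      · exact sub_eq_zero.1 h
    have h0 : f 0 = g 0 := by rw [hf.1, hg.1]
    funext i; fin_cases i <;> assumption
  have hB : B.card ≤ Fintype.card K ^ 7 := by
    refine card_le_pow B {1,2,5,6,7,8,9} ?_
    intro f hf g hg h
    simp only [B, Finset.mem_filter, Finset.mem_univ, true_and] at hf hg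
    have h' : ∀ j ∈ [1,2,5,6,7,8,9], f j = g j := by simpa using h
    simp only [List.forall_mem_cons] at h'
    obtain ⟨a1, a2, a5, a6, a7, a8, a9, _⟩ := h'
    have h0 : f 0 = g 0 := by rw [hf.1, hg.1]
    have h3 : f 3 = g 3 := by rw [hf.2.1, hg.2.1]
    have h4 : f 4 = g 4 := by rw [hf.2.2, hg.2.2]
    funext i; fin_cases i <;> assumption
  have hC : C.card ≤ Fintype.card K ^ 7 := by
    refine card_le_pow C {1,2,4,6,7,8,9} ?_
    intro f hf g hg h
    simp only [C, Finset.mem_filter, Finset.mem_univ, true_and] at hf hg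
    have h' : ∀ j ∈ [1,2,4,6,7,8,9], f j = g j := by simpa using h
    simp only [List.forall_mem_cons] at h'
    obtain ⟨a1, a2, a4, a6, a7, a8, a9, _⟩ := h'
    have h0 : f 0 = g 0 := by rw [hf.1, hg.1]
    have h3 : f 3 = g 3 := by rw [hf.2.1, hg.2.1]
    have h5 : f 5 = g 5 := by rw [hf.2.2, hg.2.2]
    funext i; fin_cases i <;> assumption
  have hsub : (Finset.univ.filter fun f : Fin 10 → K => ![1,0,0] ∈ FL f) ⊆ (A ∪ B) ∪ C := by
    intro f hf
    simp only [Finset.mem_filter, Finset.mem_univ, true_and, mem_FL] at hf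
    have h := (flex_e0 h2 f).1 hf.2
    simp only [A, B, C, Finset.mem_union, Finset.mem_filter, Finset.mem_univ, true_and]
    by_cases h3 : f 3 = 0
    · have h4 := h.2
      simp [h3] at h4
      tauto
    · tauto
  have := Finset.card_le_card hsub
  have h1 := Finset.card_union_le (A ∪ B) C
  have h2 := Finset.card_union_le A B
  omega

theorem act_inj' (h2 : (2:K) ≠ 0) (M : M3 K) (hM : M.det ≠ 0) : Function.Injective (act (R := K) M) := by
  intro f g h
  have := congrArg (act M⁻¹) h
  rwa [← act_mul h2, ← act_mul h2, Matrix.nonsing_inv_mul _ (isUnit_iff_ne_zero.2 hM), act_one h2, act_one h2] at this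

theorem count_v (h2 : (2:K) ≠ 0) (v : Fin 3 → K) (hv : v ≠ 0) : (Finset.univ.filter fun f : Fin 10 → K => v ∈ FL f).card ≤
    Fintype.card K ^ 8 + 2 * Fintype.card K ^ 7 := by
  refine le_trans ?_ (count_e0 (K := K) h2)
  obtain ⟨M, hM, hM0⟩ : ∃ M : M3 K, M.det ≠ 0 ∧ M 0 = v := by
    have : ∃ w : Fin 3 → K, ∀ t : K, w ≠ t • v := by
      by_contra h
      push Not at h
      obtain ⟨s, hs⟩ := h ![1,0,0]
      obtain ⟨t, ht⟩ := h ![0,1,0]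
      clear h2
      have a0 := congrFun hs 0
      have a1 := congrFun hs 1
      have b0 := congrFun ht 0
      have b1 := congrFun ht 1
      simp at a0 a1 b0 b1
      have c : (s * v 0) * (t * v 1) = (s * v 1) * (t * v 0) := by ring
      rw [← a0, ← b1, mul_one] at c
      rcases a1 with h | h <;> simp [h] at c
    obtain ⟨w, hw⟩ := this
    obtain ⟨M, a, b, c⟩ := exists_third v w hv hw
    exact ⟨M, a, b⟩
  refine Finset.card_le_card_of_injOn (act M) ?_ ((act_inj' h2 M hM).injOn)
  intro f hf
  simp only [Finset.coe_filter, Finset.mem_univ, true_and, Set.mem_setOf_eq, mem_FL] at hf ⊢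
  have e : Matrix.vecMul ![1,0,0] M = v := by
    funext j; simp [Matrix.vecMul, dotProduct, Fin.sum_univ_three, hM0]
  rw [ev_act, he_act, e, hf.2.1, hf.2.2]
  simp

/-- parametrisation of forms with flexes at e0, e1 -/
def Fp (e : (Fin 3 → Kˣ) × (Fin 3 → K)) : Fin 10 → K :=
  let c3 : K := e.1 0
  let c5 : K := e.1 1
  let u : K := e.1 2
  let c4 := e.2 0
  let c6 := e.2 1
  let c9 := e.2 2
  let c7 := (c3 * c4 * c9 - c4 ^ 2 * c5) / c3 ^ 2
  let c8 := (c5 * c6 * c9 - c3 * c6 ^ 2) / c5 ^ 2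
  ![0, 0, (u - c6 * c4 ^ 2 * c3 + c8 * c4 * c3 ^ 2) / c3 ^ 3, c3, c4, c5, c6, c7, c8, c9]

theorem Fp_inj : Function.Injective (Fp (K := K)) := by
  rintro ⟨a, b⟩ ⟨c, d⟩ h
  have h3 := congrFun h 3
  have h5 := congrFun h 5
  have h4 := congrFun h 4
  have h6 := congrFun h 6
  have h9 := congrFun h 9
  have h8 := congrFun h 8
  have hh2 := congrFun h 2
  have e3 : (a 0 : K) = c 0 := h3
  have e5 : (a 1 : K) = c 1 := h5
  have e4 : b 0 = d 0 := h4
  have e6 : b 1 = d 1 := h6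
  have e9 : b 2 = d 2 := h9
  have e2 : (a 2 : K) = c 2 := by
    simp only [Fp, Matrix.cons_val, e3, e4, e5, e6, e9] at hh2
    have hc := (c 0).ne_zero
    rw [div_left_inj' (pow_ne_zero _ hc)] at hh2
    linear_combination hh2
  have : a = c := by
    funext i; apply Units.ext; fin_cases i <;> assumption
  have : b = d := by
    funext i; fin_cases i <;> assumption
  simp_all

theorem Fp_gd (e : (Fin 3 → Kˣ) × (Fin 3 → K)) : gd (Fp e) ![1,0,0] := by
  have hc := (e.1 0).ne_zero
  have hu := (e.1 2).ne_zero
  refine ⟨⟨![0,1,0], ?_⟩, ![0, - e.2 0, e.1 0], ?_, ?_⟩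
  · simp [dv, gr, Fp]
  · simp [dv, gr, Fp]; ring
  · have : ev (Fp e) ![0, - e.2 0, e.1 0] = e.1 2 := by
      simp [ev, Fp]; field_simp; ring
    rw [this]; exact hu

theorem Fp_flex (h2 : (2:K) ≠ 0) (e : (Fin 3 → Kˣ) × (Fin 3 → K)) :
    (ev (Fp e) ![1,0,0] = 0 ∧ he (Fp e) ![1,0,0] = 0) ∧ (ev (Fp e) ![0,1,0] = 0 ∧ he (Fp e) ![0,1,0] = 0) := by
  have hc := (e.1 0).ne_zero
  have hu := (e.1 1).ne_zero
  rw [flex_e0 h2, flex_e1 h2]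
  refine ⟨⟨rfl, ?_⟩, rfl, ?_⟩
  · simp [Fp]; field_simp; ring
  · simp [Fp]; field_simp; ring

open Classical in
theorem count_vw (h2 : (2:K) ≠ 0) (v w : Fin 3 → K) (hv : v ≠ 0) (hw : ∀ t : K, w ≠ t • v) :
    (Fintype.card K - 1) ^ 3 * Fintype.card K ^ 3 ≤
    (Finset.univ.filter fun f : Fin 10 → K => v ∈ FL f ∧ w ∈ FL f ∧ gd f v).card := by
  obtain ⟨M, hM, hM0, hM1⟩ := exists_third v w hv hw
  have e0 : Matrix.vecMul v M⁻¹ = ![1,0,0] := by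
    have : Matrix.vecMul ![1,0,0] M = v := by
      funext j; simp [Matrix.vecMul, dotProduct, Fin.sum_univ_three, hM0]
    rw [← this, vecMul_inv' M hM]
  have e1 : Matrix.vecMul w M⁻¹ = ![0,1,0] := by
    have : Matrix.vecMul ![0,1,0] M = w := by
      funext j; simp [Matrix.vecMul, dotProduct, Fin.sum_univ_three, hM1]
    rw [← this, vecMul_inv' M hM]
  have hc : (Fintype.card K - 1) ^ 3 * Fintype.card K ^ 3 = (Finset.univ : Finset ((Fin 3 → Kˣ) × (Fin 3 → K))).card := by
    rw [Finset.card_univ, Fintype.card_prod, Fintype.card_fun, Fintype.card_fun, Fintype.card_units]; simp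
  rw [hc]
  have hMi : (M⁻¹).det ≠ 0 := by
    rw [Matrix.det_nonsing_inv]; simpa using hM
  refine Finset.card_le_card_of_injOn (fun e => act M⁻¹ (Fp e)) ?_ (((act_inj' h2 _ hMi).comp Fp_inj).injOn)
  intro e _
  have hw0 : w ≠ 0 := by have := hw 0; simpa using this
  obtain ⟨⟨a1, a2⟩, a3, a4⟩ := Fp_flex h2 e
  simp only [Finset.coe_filter, Finset.mem_univ, true_and, Set.mem_setOf_eq, mem_FL]
  rw [ev_act, he_act, ev_act, he_act, e0, e1, a1, a2, a3, a4]
  refine ⟨⟨hv, rfl, mul_zero _⟩, ⟨hw0, rfl, mul_zero _⟩, ?_⟩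
  obtain ⟨⟨u, hu⟩, x, hx, hx'⟩ := Fp_gd e
  refine ⟨⟨Matrix.vecMul u M, ?_⟩, Matrix.vecMul x M, ?_, ?_⟩
  · rwa [dv_act, e0, vecMul_inv' M hM]
  · rwa [dv_act, e0, vecMul_inv' M hM]
  · rwa [ev_act, vecMul_inv' M hM]

open Classical in
/-- good independent pairs -/
noncomputable def GP (f : Fin 10 → K) : Finset ((Fin 3 → K) × (Fin 3 → K)) :=
  Finset.univ.filter fun p => p.1 ∈ FL f ∧ p.2 ∈ FL f ∧ gd f p.1 ∧ ∀ t : K, p.2 ≠ t • p.1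

theorem per_f1 (f : Fin 10 → K) : (GP f).card + (FL f).card * (Fintype.card K - 1) ≤ (FL f).card ^ 2 := by
  let D : Finset ((Fin 3 → K) × (Fin 3 → K)) := (FL f ×ˢ (Finset.univ.erase (0:K))).image fun p => (p.1, p.2 • p.1)
  have hD : D.card = (FL f).card * (Fintype.card K - 1) := by
    rw [Finset.card_image_of_injOn, Finset.card_product, Finset.card_erase_of_mem (Finset.mem_univ _), Finset.card_univ]
    rintro ⟨v, s⟩ hv ⟨w, t⟩ hw h
    simp only [Prod.mk.injEq] at h
    obtain ⟨rfl, h⟩ := h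
    simp only [Finset.coe_product, Set.mem_prod, Finset.mem_coe, mem_FL] at hv
    have : s = t := by
      by_contra hst
      apply hv.1.1
      have : (s - t) • v = 0 := by rw [sub_smul, h, sub_self]
      exact (smul_eq_zero.1 this).resolve_left (sub_ne_zero.2 hst)
    rw [this]
  have hdis : Disjoint (GP f) D := by
    rw [Finset.disjoint_left]
    rintro p hp hp'
    simp only [GP, Finset.mem_filter, Finset.mem_univ, true_and] at hp
    obtain ⟨⟨v, t⟩, _, rfl⟩ := Finset.mem_image.1 hp'
    exact hp.2.2.2 t rfl
  rw [← hD, ← Finset.card_union_of_disjoint hdis, sq, ← Finset.card_product]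
  apply Finset.card_le_card
  intro p hp
  rw [Finset.mem_product]
  rcases Finset.mem_union.1 hp with h | h
  · simp only [GP, Finset.mem_filter, Finset.mem_univ, true_and] at h
    exact ⟨h.1, h.2.1⟩
  · obtain ⟨⟨v, t⟩, h', rfl⟩ := Finset.mem_image.1 h
    clear h
    have h := h'
    simp only [Finset.mem_product, mem_FL, Finset.mem_erase] at h ⊢
    refine ⟨h.1, smul_ne_zero h.2.1 h.1.1, ?_, ?_⟩
    · rw [ev_smul_vec, h.1.2.1, mul_zero]
    · rw [he_smul_vec, h.1.2.2, mul_zero]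

theorem per_f (h2 : (2:K) ≠ 0) (h3 : (3:K) ≠ 0) (f : Fin 10 → K) (hf : (FL f).Nonempty) :
    9 * (Fintype.card K - 1) ^ 2 + (GP f).card ≤ 9 * (Fintype.card K - 1) * (FL f).card := by
  have h1 := per_f1 f
  have hN : 0 < (FL f).card := hf.card_pos
  rcases (GP f).eq_empty_or_nonempty with h | ⟨p, hp⟩
  · rw [h, Finset.card_empty, zero_add] at h1
    rw [h, Finset.card_empty]
    have : Fintype.card K - 1 ≤ (FL f).card := by
      rw [sq] at h1; exact Nat.le_of_mul_le_mul_left h1 hN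
    nlinarith
  · simp only [GP, Finset.mem_filter, Finset.mem_univ, true_and] at hp
    have hb := good_bound h2 h3 f p.1 hp.1 hp.2.2.1
    have : Fintype.card K - 1 ≤ (FL f).card := by
      have : (FL f).card * (Fintype.card K - 1) ≤ (FL f).card ^ 2 := by omega
      rw [sq] at this; exact Nat.le_of_mul_le_mul_left this hN
    generalize (FL f).card = N at *
    generalize Fintype.card K - 1 = r at *
    obtain ⟨s, rfl⟩ := Nat.exists_eq_add_of_le this
    nlinarith

theorem sum_N (h2 : (2:K) ≠ 0) : ∑ f : Fin 10 → K, (FL f).card ≤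
    (Fintype.card K ^ 3 - 1) * (Fintype.card K ^ 8 + 2 * Fintype.card K ^ 7) := by
  have e : ∑ f : Fin 10 → K, (FL f).card = ∑ v : Fin 3 → K, (Finset.univ.filter fun f : Fin 10 → K => v ∈ FL f).card := by
    simp only [Finset.card_eq_sum_ones, Finset.sum_filter]
    rw [Finset.sum_comm]
    refine Finset.sum_congr rfl fun f _ => ?_
    rw [← Finset.sum_filter]
    congr 1; ext v; simp
  rw [e, ← Finset.add_sum_erase _ _ (Finset.mem_univ (0 : Fin 3 → K))]
  have z : (Finset.univ.filter fun f : Fin 10 → K => 0 ∈ FL f).card = 0 := by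
    rw [Finset.card_eq_zero, Finset.filter_eq_empty_iff]
    intro f _ h; rw [mem_FL] at h; exact h.1 rfl
  rw [z, zero_add]
  refine (Finset.sum_le_card_nsmul _ _ _ fun v hv => count_v h2 v (Finset.ne_of_mem_erase hv)).trans ?_
  rw [Finset.card_erase_of_mem (Finset.mem_univ _), Finset.card_univ, Fintype.card_fun, Fintype.card_fin, smul_eq_mul]

theorem sum_G (h2 : (2:K) ≠ 0) : (Fintype.card K ^ 3 - 1) * (Fintype.card K ^ 3 - Fintype.card K) *
    ((Fintype.card K - 1) ^ 3 * Fintype.card K ^ 3) ≤ ∑ f : Fin 10 → K, (GP f).card := by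
  classical
  let I : Finset ((Fin 3 → K) × (Fin 3 → K)) := Finset.univ.filter fun p => p.1 ≠ 0 ∧ ∀ t : K, p.2 ≠ t • p.1
  have hI : (Fintype.card K ^ 3 - 1) * (Fintype.card K ^ 3 - Fintype.card K) ≤ I.card := by
    have : I = ((Finset.univ.erase (0 : Fin 3 → K)).sigma (fun v => Finset.univ \ Finset.univ.image fun t : K => t • v)).image fun s => (s.1, s.2) := by
      ext p
      simp only [I, Finset.mem_filter, Finset.mem_univ, true_and, Finset.mem_image, Finset.mem_sigma, Finset.mem_erase, Finset.mem_sdiff, and_true]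
      constructor
      · intro h
        refine ⟨⟨p.1, p.2⟩, ⟨h.1, ?_⟩, rfl⟩
        rintro ⟨t, ht⟩; exact h.2 t ht.symm
      · rintro ⟨⟨v, w⟩, h, rfl⟩
        refine ⟨h.1, fun t ht => h.2 ⟨t, ht.symm⟩⟩
    rw [this, Finset.card_image_of_injective, Finset.card_sigma]
    · have hc : (Finset.univ.erase (0 : Fin 3 → K)).card = Fintype.card K ^ 3 - 1 := by
        rw [Finset.card_erase_of_mem (Finset.mem_univ _), Finset.card_univ, Fintype.card_fun, Fintype.card_fin]
      rw [← hc, ← smul_eq_mul]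
      apply Finset.card_nsmul_le_sum
      intro v _
      have h1 := Finset.le_card_sdiff (Finset.univ.image fun t : K => t • v) Finset.univ
      have h2 : (Finset.univ.image fun t : K => t • v).card ≤ Fintype.card K := Finset.card_image_le
      have h3 : (Finset.univ : Finset (Fin 3 → K)).card = Fintype.card K ^ 3 := by
        rw [Finset.card_univ, Fintype.card_fun, Fintype.card_fin]
      omega
    · rintro ⟨a, b⟩ ⟨c, d⟩ h
      simp only [Prod.mk.injEq] at h
      obtain ⟨rfl, rfl⟩ := h; rfl
  have e : ∑ f : Fin 10 → K, (GP f).card = ∑ p ∈ I, (Finset.univ.filter fun f : Fin 10 → K => p.1 ∈ FL f ∧ p.2 ∈ FL f ∧ gd f p.1).card := by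
    simp only [Finset.card_eq_sum_ones, Finset.sum_filter]
    rw [Finset.sum_comm]
    refine Finset.sum_congr rfl fun f _ => ?_
    rw [← Finset.sum_filter]
    refine Finset.sum_congr ?_ fun _ _ => rfl
    ext p
    simp only [GP, I, Finset.mem_filter, Finset.mem_univ, true_and]
    constructor
    · intro h; exact ⟨⟨((mem_FL _ _).1 h.1).1, h.2.2.2⟩, h.1, h.2.1, h.2.2.1⟩
    · intro h; exact ⟨h.2.1, h.2.2.1, h.2.2.2, h.1.2⟩
  rw [e]
  refine (Nat.mul_le_mul_right _ hI).trans ?_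
  rw [← smul_eq_mul]
  apply Finset.card_nsmul_le_sum
  intro p hp
  simp only [I, Finset.mem_filter, Finset.mem_univ, true_and] at hp
  convert count_vw h2 p.1 p.2 hp.1 hp.2

theorem flex_density (h2 : (2:K) ≠ 0) (h3 : (3:K) ≠ 0) (hq : 1000 ≤ Fintype.card K) :
    ((Finset.univ.filter fun f : Fin 10 → K => (FL f).Nonempty).card : ℝ) ≤ 19 / 20 * (Fintype.card K : ℝ) ^ 10 := by
  have hs : 9 * (Fintype.card K - 1) ^ 2 * (Finset.univ.filter fun f : Fin 10 → K => (FL f).Nonempty).card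
      + ∑ f : Fin 10 → K, (GP f).card ≤ 9 * (Fintype.card K - 1) * ∑ f : Fin 10 → K, (FL f).card := by
    rw [Finset.card_eq_sum_ones, Finset.sum_filter, Finset.mul_sum, Finset.mul_sum, ← Finset.sum_add_distrib]
    refine Finset.sum_le_sum fun f _ => ?_
    by_cases hf : (FL f).Nonempty
    · rw [if_pos hf, mul_one]; exact per_f h2 h3 f hf
    · rw [if_neg hf, mul_zero, zero_add]
      have : GP f = ∅ := by
        rw [Finset.not_nonempty_iff_eq_empty] at hf
        rw [Finset.eq_empty_iff_forall_notMem]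
        intro p h; simp only [GP, Finset.mem_filter, Finset.mem_univ, true_and] at h; rw [hf] at h; exact absurd h.1 (Finset.notMem_empty _)
      rw [this]; simp
  have hA := sum_N (K := K) h2
  have hB := sum_G (K := K) h2
  generalize (Finset.univ.filter fun f : Fin 10 → K => (FL f).Nonempty).card = Z at *
  generalize ∑ f : Fin 10 → K, (FL f).card = A at *
  generalize ∑ f : Fin 10 → K, (GP f).card = B at *
  generalize Fintype.card K = q at *
  have q3 : 1 ≤ q ^ 3 := Nat.one_le_pow _ _ (by omega)
  have q4 : q ≤ q ^ 3 := Nat.le_self_pow (by norm_num) _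
  have hs' : (9 * ((q:ℝ) - 1) ^ 2 * Z + B : ℝ) ≤ 9 * (q - 1) * A := by
    have := (Nat.cast_le (α := ℝ)).2 hs
    push_cast [Nat.cast_sub (show 1 ≤ q by omega)] at this
    exact this
  have hA' : (A:ℝ) ≤ ((q:ℝ) ^ 3 - 1) * (q ^ 8 + 2 * q ^ 7) := by
    have := (Nat.cast_le (α := ℝ)).2 hA
    push_cast [Nat.cast_sub q3] at this
    exact this
  have hB' : ((q:ℝ) ^ 3 - 1) * (q ^ 3 - q) * ((q - 1) ^ 3 * q ^ 3) ≤ B := by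
    have := (Nat.cast_le (α := ℝ)).2 hB
    push_cast [Nat.cast_sub q3, Nat.cast_sub q4, Nat.cast_sub (show 1 ≤ q by omega)] at this
    exact this
  have hqr : (1000:ℝ) ≤ q := by exact_mod_cast hq
  clear hs hA hB
  generalize (Z:ℝ) = z at *
  generalize (A:ℝ) = a at *
  generalize (B:ℝ) = b at *
  generalize (q:ℝ) = x at *
  obtain ⟨t, rfl⟩ : ∃ t, x = t + 1000 := ⟨x - 1000, by ring⟩
  have ht : 0 ≤ t := by linarith
  have h1 : 9 * (t + 1000 - 1) ^ 2 * z ≤ 9 * (t + 1000 - 1) * (((t+1000) ^ 3 - 1) * ((t+1000) ^ 8 + 2 * (t+1000) ^ 7)) -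
      ((t+1000) ^ 3 - 1) * ((t+1000) ^ 3 - (t+1000)) * ((t+1000 - 1) ^ 3 * (t+1000) ^ 3) := by
    have : 9 * (t + 1000 - 1) * a ≤ 9 * (t + 1000 - 1) * (((t+1000) ^ 3 - 1) * ((t+1000) ^ 8 + 2 * (t+1000) ^ 7)) := by
      apply mul_le_mul_of_nonneg_left hA'; linarith
    linarith
  have h4 : 9 * (t + 1000 - 1) * (((t+1000) ^ 3 - 1) * ((t+1000) ^ 8 + 2 * (t+1000) ^ 7)) -
      ((t+1000) ^ 3 - 1) * ((t+1000) ^ 3 - (t+1000)) * ((t+1000 - 1) ^ 3 * (t+1000) ^ 3) ≤ 9 * (t + 1000 - 1) ^ 2 * (19 / 20 * (t+1000)^10) := by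
    rw [← sub_nonneg]
    ring_nf
    positivity
  exact le_of_mul_le_mul_left (h1.trans h4) (by rw [show t + 1000 - 1 = t + 999 by ring]; positivity)

end FF
end TC

open MvPolynomial

namespace TC
open Filter Topology MeasureTheory

/-- a rational flex gives a flex mod every prime -/
theorem flex_mod (c : Fin 10 → ℤ) (hc : ¬ StronglyIrred c) (p : ℕ) [Fact p.Prime] :
    (FL (fun k => (c k : ZMod p))).Nonempty := by
  rw [stronglyIrred_iff, not_not] at hc
  obtain ⟨v, hv, h1, h2⟩ := hc
  -- clear denominators
  obtain ⟨d, hd, w, hw⟩ : ∃ d : ℤ, d ≠ 0 ∧ ∃ w : Fin 3 → ℤ, ∀ i, (d : ℚ) * v i = w i := by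
    refine ⟨∏ i, ((v i).den : ℤ), ?_, fun i => (∏ j ∈ Finset.univ.erase i, ((v j).den : ℤ)) * (v i).num, fun i => ?_⟩
    · exact Finset.prod_ne_zero_iff.2 fun i _ => by exact_mod_cast (v i).den_nz
    · rw [← Finset.mul_prod_erase _ _ (Finset.mem_univ i)]
      push_cast
      have := Rat.den_mul_eq_num (v i)
      rw [← this]; ring
  have w0 : w ≠ 0 := by
    rintro rfl
    apply hv
    funext i
    have := hw i
    simp only [Pi.zero_apply, Int.cast_zero, mul_eq_zero, Int.cast_eq_zero] at this
    exact this.resolve_left hd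
  obtain ⟨i0, hi0⟩ : ∃ i, w i ≠ 0 := by
    by_contra h; push Not at h; exact w0 (funext h)
  obtain ⟨u, hu1, hu2⟩ := Finset.extract_gcd w (Finset.univ_nonempty (α := Fin 3))
  set g := Finset.univ.gcd w with hg
  have hg0 : g ≠ 0 := by
    intro h
    rw [Finset.gcd_eq_zero_iff] at h
    exact hi0 (h i0 (Finset.mem_univ _))
  have hvu : v = fun i => ((g:ℚ) / d) * (u i : ℚ) := by
    funext i
    have hd' : (d:ℚ) ≠ 0 := by exact_mod_cast hd
    have := hw i
    rw [hu1 i (Finset.mem_univ _)] at this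
    push_cast at this
    field_simp
    linarith
  have hgd : ((g:ℚ) / d) ≠ 0 := div_ne_zero (by exact_mod_cast hg0) (by exact_mod_cast hd)
  have e1 : ev c u = 0 := by
    rw [hvu] at h1
    have : (fun i => ((g:ℚ) / d) * (u i : ℚ)) = ((g:ℚ) / d) • fun i => (u i : ℚ) := rfl
    rw [this, ev_smul_vec] at h1
    have h3 := (mul_eq_zero.1 h1).resolve_left (pow_ne_zero _ hgd)
    have h4 := map_ev (Int.castRingHom ℚ) c u
    simp only [eq_intCast] at h4
    rw [h3] at h4
    exact_mod_cast h4
  have e2 : he c u = 0 := by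
    rw [hvu] at h2
    have : (fun i => ((g:ℚ) / d) * (u i : ℚ)) = ((g:ℚ) / d) • fun i => (u i : ℚ) := rfl
    rw [this, he_smul_vec] at h2
    have h3 := (mul_eq_zero.1 h2).resolve_left (pow_ne_zero _ hgd)
    have h4 := map_he (Int.castRingHom ℚ) c u
    simp only [eq_intCast] at h4
    rw [h3] at h4
    exact_mod_cast h4
  refine ⟨fun i => (u i : ZMod p), ?_⟩
  rw [mem_FL]
  refine ⟨?_, ?_, ?_⟩
  · intro h
    have hdvd : (p:ℤ) ∣ Finset.univ.gcd u := by
      refine Finset.dvd_gcd fun i _ => ?_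
      have := congrFun h i
      exact (ZMod.intCast_zmod_eq_zero_iff_dvd _ _).1 this
    rw [hu2] at hdvd
    have := Int.isUnit_iff.1 (isUnit_of_dvd_one hdvd)
    have hp := (Fact.out : p.Prime).two_le
    omega
  · have h4 := map_ev (Int.castRingHom (ZMod p)) c u
    simp only [eq_intCast] at h4
    rw [← h4, e1]; simp
  · have h4 := map_he (Int.castRingHom (ZMod p)) c u
    simp only [eq_intCast] at h4
    rw [← h4, e2]; simp

open Classical in
/-- residues mod `∏ P` having a flex mod every prime of `P` -/
noncomputable def badRes (P : Finset ℕ) : Finset (Fin 10 → Fin (∏ p ∈ P, p)) :=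
  Finset.univ.filter fun ρ => ∀ p ∈ P, ∀ _ : Fact p.Prime, (FL (fun k => (((ρ k : ℕ) : ℤ) : ZMod p))).Nonempty

theorem badRes_card (P : Finset ℕ) (hP : ∀ p ∈ P, p.Prime ∧ 1000 ≤ p) :
    ((badRes P).card : ℝ) ≤ (19 / 20) ^ P.card * ((∏ p ∈ P, p : ℕ) : ℝ) ^ 10 := by
  classical
  haveI : ∀ p : P, Fact (p : ℕ).Prime := fun p => ⟨(hP p p.2).1⟩
  let B : (p : P) → Finset (Fin 10 → ZMod p) := fun p => Finset.univ.filter fun f => (FL f).Nonempty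
  have h1 : (badRes P).card ≤ (Fintype.piFinset B).card := by
    refine Finset.card_le_card_of_injOn (fun ρ p k => ((ρ k : ℕ) : ZMod p)) ?_ ?_
    · intro ρ hρ
      simp only [badRes, Finset.coe_filter, Finset.mem_univ, true_and, Set.mem_setOf_eq] at hρ
      rw [Finset.mem_coe, Fintype.mem_piFinset]
      intro p
      have := hρ p p.2 inferInstance
      simp only [B, Finset.mem_filter, Finset.mem_univ, true_and]
      simpa using this
    · intro ρ _ σ _ h
      funext k
      apply Fin.ext
      have hd : ∀ p ∈ P, p ∣ (((ρ k : ℕ) : ℤ) - ((σ k : ℕ):ℤ)).natAbs := by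
        intro p hp
        have := congrFun (congrFun h ⟨p, hp⟩) k
        simp only at this
        rw [← Int.natCast_dvd, ← ZMod.intCast_zmod_eq_zero_iff_dvd]
        push_cast
        rw [this, sub_self]
      have hm : (∏ p ∈ P, p) ∣ (((ρ k : ℕ) : ℤ) - ((σ k : ℕ):ℤ)).natAbs := by
        refine Finset.prod_primes_dvd _ (fun p hp => (hP p hp).1.prime) hd
      have hlt : (((ρ k : ℕ) : ℤ) - ((σ k : ℕ):ℤ)).natAbs < ∏ p ∈ P, p := by
        have a := (ρ k).2
        have b := (σ k).2
        omega
      have := Nat.eq_zero_of_dvd_of_lt hm hlt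
      omega
  have h2 : ((Fintype.piFinset B).card : ℝ) ≤ ∏ p : P, (19 / 20 * ((p : ℕ) : ℝ) ^ 10) := by
    rw [Fintype.card_piFinset]
    push_cast
    refine Finset.prod_le_prod (fun _ _ => by positivity) fun p _ => ?_
    have hp1000 := (hP p p.2).2
    have hne : ∀ n : ℕ, 0 < n → n < 1000 → ((n : ℕ) : ZMod p) ≠ 0 := by
      intro n hn hn' h
      rw [ZMod.natCast_eq_zero_iff] at h
      exact absurd (Nat.le_of_dvd hn h) (by omega)
    have := flex_density (K := ZMod p) (by exact_mod_cast hne 2 (by norm_num) (by norm_num))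
      (by exact_mod_cast hne 3 (by norm_num) (by norm_num)) (by rw [ZMod.card]; exact hp1000)
    rw [ZMod.card] at this
    exact this
  calc ((badRes P).card : ℝ) ≤ ((Fintype.piFinset B).card : ℝ) := by exact_mod_cast h1
    _ ≤ _ := h2
    _ = _ := by
      rw [Finset.prod_mul_distrib, Finset.prod_const, Finset.prod_pow, Finset.card_univ, Fintype.card_coe, Finset.prod_coe_sort P (fun p => (p:ℝ))]
      push_cast; rfl

theorem closedBall_ae (n : ℕ) [NeZero n] (r : ℝ) (hr : 0 < r) :
    ∀ᵐ x : Fin n → ℝ, ContinuousAt ((Metric.closedBall (0 : Fin n → ℝ) r).indicator (fun _ => (1:ℝ))) x := by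
  have : volume (Metric.sphere (0 : Fin n → ℝ) r) = 0 := Measure.addHaar_sphere_of_ne_zero _ _ hr.ne'
  have h2 : ∀ᵐ x : Fin n → ℝ, x ∉ Metric.sphere (0 : Fin n → ℝ) r := measure_eq_zero_iff_ae_notMem.1 this
  filter_upwards [h2] with x hx
  apply cont_ind
  rcases lt_trichotomy (dist x 0) r with h | h | h
  · left
    have hb : x ∈ interior (Metric.ball (0 : Fin n → ℝ) r) := by rw [Metric.isOpen_ball.interior_eq]; exact h
    exact interior_mono Metric.ball_subset_closedBall hb
  · exact absurd h hx
  · right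
    rw [(Metric.isClosed_closedBall.isOpen_compl).interior_eq]
    simpa using h

theorem box_finite (r T : ℝ) : {c : Fin 10 → ℤ | ‖toR c‖ ≤ r * T}.Finite := by
  have := fin_of_close (n := 10) (fun _ => (1:ℝ)) (fun _ => one_pos) toR 0 (by norm_num) (by
    intro k
    have : (toR k - fun i => (1:ℝ) * (k i : ℝ)) = 0 := by funext i; simp [toR]
    rw [this]; simp) (r * T)
  exact this

/-- the count of integral forms in a residue class -/
theorem res_count (m : ℕ) (hm : 0 < m) (r : ℝ) (hr : 0 < r) (ρ : Fin 10 → Fin m) :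
    Tendsto (fun T : ℝ => ((m:ℝ) / T) ^ 10 * (Set.ncard {k : Fin 10 → ℤ | ‖fun i => (((ρ i : ℕ) : ℝ) + m * (k i : ℝ)) / T‖ ≤ r} : ℝ)) atTop
      (𝓝 (volume.real (Metric.closedBall (0 : Fin 10 → ℝ) r))) := by
  have := (riemann_count (n := 10) (Metric.closedBall (0 : Fin 10 → ℝ) r) measurableSet_closedBall r
    (fun x hx => by simpa using hx) (closedBall_ae 10 r hr) (l := atTop) (fun T : ℝ => fun _ => (m:ℝ) / T)
    (by filter_upwards [eventually_gt_atTop 0] with T hT; intro i; positivity)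
    (by
      rw [tendsto_pi_nhds]; intro i
      exact tendsto_const_nhds.div_atTop tendsto_id)
    (fun T k i => (((ρ i : ℕ) : ℝ) + m * (k i : ℝ)) / T) (fun T => m / T) (tendsto_const_nhds.div_atTop tendsto_id)
    (by
      filter_upwards [eventually_gt_atTop 0] with T hT
      intro k
      have h1 : ‖((fun i => (((ρ i : ℕ) : ℝ) + m * (k i : ℝ)) / T) - fun i => (m:ℝ) / T * (k i : ℝ))‖ ≤ m / T := by
        rw [pi_norm_le_iff_of_nonneg (by positivity)]
        intro i
        have : (((fun i => (((ρ i : ℕ) : ℝ) + m * (k i : ℝ)) / T) - fun i => (m:ℝ) / T * (k i : ℝ)) : Fin 10 → ℝ) i = ((ρ i : ℕ) : ℝ) / T := by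
          simp only [Pi.sub_apply]; ring
        rw [this, Real.norm_eq_abs, abs_of_nonneg (by positivity)]
        gcongr
        exact (ρ i).2.le
      refine h1.trans ?_
      have : 0 ≤ (m:ℝ) / T := by positivity
      nlinarith [norm_nonneg (fun i => (m:ℝ) / T * (k i : ℝ))])).2
  simpa [div_pow] using this

theorem red_bound (P : Finset ℕ) (hP : ∀ p ∈ P, p.Prime ∧ 1000 ≤ p) (r : ℝ) (hr : 0 < r) (ε : ℝ) (hε : 0 < ε) :
    ∀ᶠ T : ℝ in atTop, (Set.ncard {c : Fin 10 → ℤ | ‖toR c‖ ≤ r * T ∧ ¬ StronglyIrred c} : ℝ) / T ^ 10 ≤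
      (19 / 20) ^ P.card * volume.real (Metric.closedBall (0 : Fin 10 → ℝ) r) + ε := by
  set m := ∏ p ∈ P, p with hm
  have hm0 : 0 < m := Finset.prod_pos fun p hp => (hP p hp).1.pos
  have hm0' : (0:ℝ) < m := by exact_mod_cast hm0
  have hsum := tendsto_finsetSum (badRes P) (fun ρ _ => (res_count m hm0 r hr ρ).div_const ((m:ℝ) ^ 10))
  rw [Finset.sum_const, nsmul_eq_mul] at hsum
  have hlim : ((badRes P).card : ℝ) * (volume.real (Metric.closedBall (0 : Fin 10 → ℝ) r) / (m:ℝ) ^ 10) <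
      (19 / 20) ^ P.card * volume.real (Metric.closedBall (0 : Fin 10 → ℝ) r) + ε := by
    have := badRes_card P hP
    change _ ≤ _ * (m:ℝ) ^ 10 at this
    calc _ ≤ ((19 / 20) ^ P.card * (m : ℝ) ^ 10) * (volume.real (Metric.closedBall (0 : Fin 10 → ℝ) r) / (m:ℝ) ^ 10) := by
          gcongr
      _ = (19 / 20) ^ P.card * volume.real (Metric.closedBall (0 : Fin 10 → ℝ) r) := by field_simp
      _ < _ := by linarith
  filter_upwards [hsum.eventually (gt_mem_nhds hlim), eventually_gt_atTop 0] with T h1 hT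
  refine le_trans ?_ h1.le
  rw [div_le_iff₀ (by positivity), Finset.sum_mul]
  have hsub : {c : Fin 10 → ℤ | ‖toR c‖ ≤ r * T ∧ ¬ StronglyIrred c} ⊆
      ⋃ ρ ∈ badRes P, (fun (k : Fin 10 → ℤ) i => ((ρ i : ℕ) : ℤ) + m * k i) '' {k : Fin 10 → ℤ | ‖fun i => (((ρ i : ℕ) : ℝ) + m * (k i : ℝ)) / T‖ ≤ r} := by
    rintro c ⟨h1, h2⟩
    have hmz : (0:ℤ) < m := by exact_mod_cast hm0
    have e : ∀ i, (((c i % m).toNat : ℕ) : ℤ) = c i % m := fun i => Int.toNat_of_nonneg (Int.emod_nonneg _ hmz.ne')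
    let ρ : Fin 10 → Fin m := fun i => ⟨(c i % m).toNat, by
      have := Int.emod_lt_of_pos (c i) hmz
      have := e i; omega⟩
    have hc : ∀ i, ((ρ i : ℕ) : ℤ) + m * (c i / m) = c i := by
      intro i
      have := Int.emod_add_mul_ediv (c i) m
      simp only [ρ, e]; exact this
    refine Set.mem_iUnion₂.2 ⟨ρ, ?_, fun i => c i / m, ?_, funext hc⟩
    · simp only [badRes, Finset.mem_filter, Finset.mem_univ, true_and]
      intro p hp _
      have := flex_mod c h2 p
      convert this using 3 with k
      have hpm : (p:ℤ) ∣ m := by exact_mod_cast Finset.dvd_prod_of_mem _ hp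
      have hk := hc k
      rw [← hk]
      have : ((m:ℤ) : ZMod p) = 0 := (ZMod.intCast_zmod_eq_zero_iff_dvd _ _).2 hpm
      push_cast at this ⊢
      rw [this]; simp
    · simp only [Set.mem_setOf_eq]
      have : (fun i => (((ρ i : ℕ) : ℝ) + m * ((c i / m : ℤ) : ℝ)) / T) = T⁻¹ • toR c := by
        funext i
        have := hc i
        simp only [toR, Pi.smul_apply, smul_eq_mul]
        rw [← this]
        push_cast
        rw [this]
        ring
      rw [this, norm_smul, Real.norm_eq_abs, abs_of_pos (by positivity), inv_mul_le_iff₀ hT]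
      linarith
  have hfin : ∀ ρ : Fin 10 → Fin m, {k : Fin 10 → ℤ | ‖fun i => (((ρ i : ℕ) : ℝ) + m * (k i : ℝ)) / T‖ ≤ r}.Finite := by
    intro ρ
    have hinj : Function.Injective (fun (k : Fin 10 → ℤ) i => ((ρ i : ℕ) : ℤ) + m * k i) := by
      intro k l h
      funext i
      have := congrFun h i
      simp only at this
      have hmz : (m:ℤ) ≠ 0 := by exact_mod_cast hm0.ne'
      exact mul_left_cancel₀ hmz (add_left_cancel this)
    refine Set.Finite.of_finite_image ((box_finite r T).subset ?_) (hinj.injOn)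
    rintro _ ⟨k, hk, rfl⟩
    simp only [Set.mem_setOf_eq] at hk ⊢
    have : (fun i => (((ρ i : ℕ) : ℝ) + m * (k i : ℝ)) / T) = T⁻¹ • toR (fun i => ((ρ i : ℕ) : ℤ) + m * k i) := by
      funext i
      simp only [toR, Pi.smul_apply, smul_eq_mul]
      push_cast; ring
    rw [this, norm_smul, Real.norm_eq_abs, abs_of_pos (by positivity), inv_mul_le_iff₀ hT] at hk
    linarith
  calc (Set.ncard {c : Fin 10 → ℤ | ‖toR c‖ ≤ r * T ∧ ¬ StronglyIrred c} : ℝ)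
      ≤ (Set.ncard (⋃ ρ ∈ badRes P, (fun (k : Fin 10 → ℤ) i => ((ρ i : ℕ) : ℤ) + m * k i) '' {k : Fin 10 → ℤ | ‖fun i => (((ρ i : ℕ) : ℝ) + m * (k i : ℝ)) / T‖ ≤ r}) : ℝ) := by
        exact_mod_cast Set.ncard_le_ncard hsub ((badRes P).finite_toSet.biUnion fun ρ _ => (hfin ρ).image _)
    _ ≤ ((∑ ρ ∈ badRes P, Set.ncard {k : Fin 10 → ℤ | ‖fun i => (((ρ i : ℕ) : ℝ) + m * (k i : ℝ)) / T‖ ≤ r} : ℕ) : ℝ) := by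
        have := Finset.set_ncard_biUnion_le (badRes P) (fun ρ => (fun (k : Fin 10 → ℤ) i => ((ρ i : ℕ) : ℤ) + m * k i) '' {k : Fin 10 → ℤ | ‖fun i => (((ρ i : ℕ) : ℝ) + m * (k i : ℝ)) / T‖ ≤ r})
        exact_mod_cast this.trans (Finset.sum_le_sum fun ρ _ => Set.ncard_image_le (hfin ρ))
    _ = _ := by
        push_cast
        refine Finset.sum_congr rfl fun ρ _ => ?_
        field_simp

theorem red_count (r : ℝ) (hr : 0 < r) :
    Tendsto (fun T : ℝ => (Set.ncard {c : Fin 10 → ℤ | ‖toR c‖ ≤ r * T ∧ ¬ StronglyIrred c} : ℝ) / T ^ 10) atTop (𝓝 0) := by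
  rw [Metric.tendsto_nhds]
  intro ε hε
  set V := volume.real (Metric.closedBall (0 : Fin 10 → ℝ) r)
  have hV : 0 ≤ V := measureReal_nonneg
  obtain ⟨j, hj⟩ := exists_pow_lt_of_lt_one (show 0 < ε / 2 / (V + 1) by positivity) (show (19 / 20 : ℝ) < 1 by norm_num)
  have hinf : {p : ℕ | p.Prime ∧ 1000 ≤ p}.Infinite := by
    rw [Set.infinite_iff_exists_gt]
    intro a
    obtain ⟨p, h1, h2⟩ := Nat.exists_infinite_primes (max (a + 1) 1000)
    exact ⟨p, ⟨h2, by omega⟩, by omega⟩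
  obtain ⟨P, hP, hPc⟩ := hinf.exists_subset_card_eq j
  have h1 := red_bound P (fun p hp => hP hp) r hr (ε / 3) (by positivity)
  filter_upwards [h1, eventually_gt_atTop 0] with T h2 hT
  rw [Real.dist_eq, sub_zero, abs_of_nonneg (by positivity)]
  refine h2.trans_lt ?_
  rw [hPc]
  have : (19 / 20 : ℝ) ^ j * V ≤ ε / 2 := by
    rw [lt_div_iff₀ (by positivity)] at hj
    nlinarith [show (0:ℝ) ≤ (19/20)^j by positivity]
  linarith

end TC

open MvPolynomial

namespace TC
open Filter Topology MeasureTheory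

/-- Hermite normal form -/
def IsHNF (H : M3 ℤ) : Prop := H 1 0 = 0 ∧ H 2 0 = 0 ∧ H 2 1 = 0 ∧ 0 < H 0 0 ∧ 0 < H 1 1 ∧ 0 < H 2 2 ∧
  0 ≤ H 0 1 ∧ H 0 1 < H 1 1 ∧ 0 ≤ H 0 2 ∧ H 0 2 < H 2 2 ∧ 0 ≤ H 1 2 ∧ H 1 2 < H 2 2

theorem bez (x y : ℤ) : ∃ p q r s : ℤ, p * s - q * r = 1 ∧ r * x + s * y = 0 ∧ 0 ≤ p * x + q * y := by
  by_cases h : Int.gcd x y = 0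
  · rw [Int.gcd_eq_zero_iff] at h
    exact ⟨1, 0, 0, 1, by norm_num, by simp [h], by simp [h]⟩
  · have hg : ((Int.gcd x y : ℕ) : ℤ) ≠ 0 := by exact_mod_cast h
    obtain ⟨x', hx⟩ := Int.gcd_dvd_left x y
    obtain ⟨y', hy⟩ := Int.gcd_dvd_right x y
    have hb := Int.gcd_eq_gcd_ab x y
    refine ⟨Int.gcdA x y, Int.gcdB x y, -y', x', ?_, ?_, ?_⟩
    · apply mul_left_cancel₀ hg
      linear_combination -hb - Int.gcdA x y * hx - Int.gcdB x y * hy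
    · linear_combination -y' * hx + x' * hy
    · rw [mul_comm _ x, mul_comm _ y, ← hb]; positivity

theorem hnf_exists (M : M3 ℤ) (hM : 0 < M.det) : ∃ γ : Γ3, IsHNF ((γ : M3 ℤ) * M) := by
  -- clear the first column
  obtain ⟨p, q, r, s, h1, h2, h3⟩ := bez (M 1 0) (M 2 0)
  let g1 : Γ3 := slmk !![1,0,0; 0,p,q; 0,r,s] (by simp [Matrix.det_fin_three]; linarith)
  obtain ⟨M1, hM1⟩ : ∃ M1, M1 = (g1 : M3 ℤ) * M := ⟨_, rfl⟩
  have M1a : M1 2 0 = 0 := by rw [hM1]; simp [g1, slmk, Matrix.mul_apply, Fin.sum_univ_three]; linarith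
  obtain ⟨p', q', r', s', h1', h2', h3'⟩ := bez (M1 0 0) (M1 1 0)
  let g2 : Γ3 := slmk !![p',q',0; r',s',0; 0,0,1] (by simp [Matrix.det_fin_three]; linarith)
  obtain ⟨M2, hM2⟩ : ∃ M2, M2 = (g2 : M3 ℤ) * M1 := ⟨_, rfl⟩
  have M2a : M2 2 0 = 0 := by rw [hM2]; simp [g2, slmk, Matrix.mul_apply, Fin.sum_univ_three, M1a]
  have M2b : M2 1 0 = 0 := by rw [hM2]; simp [g2, slmk, Matrix.mul_apply, Fin.sum_univ_three]; linarith
  have M2c : 0 ≤ M2 0 0 := by rw [hM2]; simp [g2, slmk, Matrix.mul_apply, Fin.sum_univ_three]; linarith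
  obtain ⟨p'', q'', r'', s'', h1'', h2'', h3''⟩ := bez (M2 1 1) (M2 2 1)
  let g3 : Γ3 := slmk !![1,0,0; 0,p'',q''; 0,r'',s''] (by simp [Matrix.det_fin_three]; linarith)
  obtain ⟨N, hN⟩ : ∃ N, N = (g3 : M3 ℤ) * M2 := ⟨_, rfl⟩
  have N20 : N 2 0 = 0 := by rw [hN]; simp [g3, slmk, Matrix.mul_apply, Fin.sum_univ_three, M2a, M2b]
  have N10 : N 1 0 = 0 := by rw [hN]; simp [g3, slmk, Matrix.mul_apply, Fin.sum_univ_three, M2a, M2b]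
  have N21 : N 2 1 = 0 := by rw [hN]; simp [g3, slmk, Matrix.mul_apply, Fin.sum_univ_three]; linarith
  have N00 : 0 ≤ N 0 0 := by rw [hN]; simp [g3, slmk, Matrix.mul_apply, Fin.sum_univ_three, M2c]
  have N11 : 0 ≤ N 1 1 := by rw [hN]; simp [g3, slmk, Matrix.mul_apply, Fin.sum_univ_three]; linarith
  have hNM : N = ((g3 * g2 * g1 : Γ3) : M3 ℤ) * M := by
    rw [hN, hM2, hM1]; simp [Matrix.mul_assoc]
  have hNdet : N.det = M.det := by rw [hNM, Matrix.det_mul, (g3 * g2 * g1).2, one_mul]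
  have hdet : N.det = N 0 0 * N 1 1 * N 2 2 := by
    rw [Matrix.det_fin_three, N10, N20, N21]; ring
  rw [hdet] at hNdet
  have hpos : 0 < N 0 0 * N 1 1 * N 2 2 := by rw [hNdet]; exact hM
  have N00' : 0 < N 0 0 := lt_of_le_of_ne N00 (by rintro h; rw [← h] at hpos; simp at hpos)
  have N11' : 0 < N 1 1 := lt_of_le_of_ne N11 (by rintro h; rw [← h] at hpos; simp at hpos)
  have N22' : 0 < N 2 2 := by
    by_contra h; push Not at h
    nlinarith [mul_pos N00' N11']
  -- reduce
  let a := N 0 1 / N 1 1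
  let b := N 1 2 / N 2 2
  let d := (N 0 2 - a * N 1 2) / N 2 2
  let g4 : Γ3 := slmk !![1,-a,-d; 0,1,-b; 0,0,1] (by simp [Matrix.det_fin_three])
  refine ⟨g4 * (g3 * g2 * g1), ?_⟩
  have e : ((g4 * (g3 * g2 * g1) : Γ3) : M3 ℤ) * M = (g4 : M3 ℤ) * N := by
    rw [hNM, Matrix.SpecialLinearGroup.coe_mul, Matrix.mul_assoc]
  rw [e]
  have q1 := Int.emod_nonneg (N 0 1) N11'.ne'
  have q2 := Int.emod_lt_of_pos (N 0 1) N11'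
  have q3 := Int.emod_nonneg (N 1 2) N22'.ne'
  have q4 := Int.emod_lt_of_pos (N 1 2) N22'
  have q5 := Int.emod_nonneg (N 0 2 - a * N 1 2) N22'.ne'
  have q6 := Int.emod_lt_of_pos (N 0 2 - a * N 1 2) N22'
  rw [Int.emod_def] at q1 q2 q3 q4 q5 q6
  simp only [IsHNF, g4, slmk, Matrix.mul_apply, Fin.sum_univ_three, Matrix.of_apply, Matrix.cons_val', Matrix.cons_val, Matrix.cons_val_zero,
    Matrix.cons_val_one, N20, N10, N21]
  refine ⟨by ring, by ring, by ring, by linarith, by linarith, by linarith, ?_, ?_, ?_, ?_, ?_, ?_⟩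
  · simp only [a]; linarith
  · simp only [a]; linarith
  · simp only [d]; linarith
  · simp only [d]; linarith
  · simp only [b]; linarith
  · simp only [b]; linarith

theorem lt_aux (n a b x y : ℤ) (hx0 : 0 ≤ x) (hx : x < b) (hy0 : 0 ≤ y) (hy : y < b) (h : y = x + n * b) : n = 0 := by
  by_contra hn
  rcases lt_or_gt_of_ne hn with h' | h'
  · nlinarith
  · nlinarith

theorem hnf_unique (H : M3 ℤ) (γ : Γ3) (h : IsHNF H) (h' : IsHNF ((γ : M3 ℤ) * H)) : γ = 1 := by
  obtain ⟨a1, a2, a3, a4, a5, a6, a7, a8, a9, a10, a11, a12⟩ := h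
  simp only [IsHNF, Matrix.mul_apply, Fin.sum_univ_three, a1, a2, a3, mul_zero, add_zero] at h'
  obtain ⟨b1, b2, b3, b4, b5, b6, b7, b8, b9, b10, b11, b12⟩ := h'
  have hdet := γ.2
  rw [Matrix.det_fin_three] at hdet
  obtain ⟨g, hg⟩ : ∃ g : M3 ℤ, g = γ := ⟨_, rfl⟩
  rw [← hg] at b1 b2 b3 b4 b5 b6 b7 b8 b9 b10 b11 b12 hdet
  have g10 : g 1 0 = 0 := (mul_eq_zero.1 b1).resolve_right a4.ne'
  have g20 : g 2 0 = 0 := (mul_eq_zero.1 b2).resolve_right a4.ne'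
  rw [g20, zero_mul, zero_add] at b3
  have g21 : g 2 1 = 0 := (mul_eq_zero.1 b3).resolve_right a5.ne'
  rw [g10, zero_mul, zero_add] at b5
  rw [g20, g21, zero_mul, zero_mul, zero_add, zero_add] at b6
  have p0 : 0 < g 0 0 := (pos_iff_pos_of_mul_pos b4).2 a4
  have p1 : 0 < g 1 1 := (pos_iff_pos_of_mul_pos b5).2 a5
  have p2 : 0 < g 2 2 := (pos_iff_pos_of_mul_pos b6).2 a6
  have hd : g 0 0 * g 1 1 * g 2 2 = 1 := by rw [g10, g20, g21] at hdet; linarith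
  have i0 : g 0 0 = 1 := by
    have := Int.eq_one_or_neg_one_of_mul_eq_one (show g 0 0 * (g 1 1 * g 2 2) = 1 by linarith)
    omega
  have i1 : g 1 1 = 1 := by
    have := Int.eq_one_or_neg_one_of_mul_eq_one (show g 1 1 * (g 0 0 * g 2 2) = 1 by linarith)
    omega
  have i2 : g 2 2 = 1 := by
    have := Int.eq_one_or_neg_one_of_mul_eq_one (show g 2 2 * (g 0 0 * g 1 1) = 1 by linarith)
    omega
  simp only [i0, i1, i2, g10, g20, g21, one_mul, zero_mul, zero_add, add_zero] at b7 b8 b9 b10 b11 b12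
  have g01 : g 0 1 = 0 := lt_aux _ 0 _ _ _ a7 a8 b7 b8 rfl
  have g12 : g 1 2 = 0 := lt_aux _ 0 _ _ _ a11 a12 b11 b12 rfl
  rw [g01, zero_mul, add_zero] at b9 b10
  have g02 : g 0 2 = 0 := lt_aux _ 0 _ _ _ a9 a10 b9 b10 rfl
  apply Matrix.SpecialLinearGroup.ext
  intro i j
  rw [← hg]
  clear hg
  fin_cases i <;> fin_cases j <;> simp [g01, g02, g12, g10, g20, g21, i0, i1, i2]

/-- parameters `(a,b),(c,u,v,w)` of a matrix in Hermite normal form -/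
def hnfMat (x : (ℕ × ℕ) × (ℕ × ℕ × ℕ × ℕ)) : M3 ℤ :=
  !![(x.1.1 : ℤ) + 1, x.2.2.1, x.2.2.2.1; 0, (x.1.2 : ℤ) + 1, x.2.2.2.2; 0, 0, x.2.1]

theorem hnfMat_inj : Function.Injective hnfMat := by
  rintro ⟨⟨a, b⟩, c, u, v, w⟩ ⟨⟨a', b'⟩, c', u', v', w'⟩ h
  have e : ∀ i j, hnfMat ((a, b), c, u, v, w) i j = hnfMat ((a', b'), c', u', v', w') i j := fun i j => by rw [h]
  have e1 := e 0 0
  have e2 := e 0 1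
  have e3 := e 0 2
  have e4 := e 1 1
  have e5 := e 1 2
  have e6 := e 2 2
  simp [hnfMat] at e1 e2 e3 e4 e5 e6
  simp [*]

/-- Hermite normal forms of determinant `< T` -/
def HN (T : ℝ) : Set (M3 ℤ) := {H | IsHNF H ∧ (H.det : ℝ) < T}

def hnfPar (T : ℝ) : Set ((ℕ × ℕ) × (ℕ × ℕ × ℕ × ℕ)) :=
  {x | x.2.1 < ⌈T / ((x.1.1 + 1) * (x.1.2 + 1))⌉₊ ∧ x.2.2.1 < x.1.2 + 1 ∧ x.2.2.2.1 < x.2.1 ∧ x.2.2.2.2 < x.2.1}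

theorem HN_eq (T : ℝ) : HN T = hnfMat '' hnfPar T := by
  ext H
  constructor
  · rintro ⟨⟨a1, a2, a3, a4, a5, a6, a7, a8, a9, a10, a11, a12⟩, hT⟩
    obtain ⟨a, ha⟩ := Int.eq_ofNat_of_zero_le (show 0 ≤ H 0 0 - 1 by omega)
    obtain ⟨b, hb⟩ := Int.eq_ofNat_of_zero_le (show 0 ≤ H 1 1 - 1 by omega)
    obtain ⟨c, hc⟩ := Int.eq_ofNat_of_zero_le a6.le
    obtain ⟨u, hu⟩ := Int.eq_ofNat_of_zero_le a7
    obtain ⟨v, hv⟩ := Int.eq_ofNat_of_zero_le a9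
    obtain ⟨w, hw⟩ := Int.eq_ofNat_of_zero_le a11
    have e0 : H 0 0 = a + 1 := by omega
    have e1 : H 1 1 = b + 1 := by omega
    refine ⟨((a, b), c, u, v, w), ⟨?_, ?_, ?_, ?_⟩, ?_⟩
    · rw [Nat.lt_ceil, lt_div_iff₀ (by positivity)]
      have : H.det = c * ((a + 1) * (b + 1)) := by
        rw [Matrix.det_fin_three, a1, a2, a3, e0, e1, hc]; ring
      rw [this] at hT
      push_cast at hT
      exact hT
    · simp only; omega
    · simp only; omega
    · simp only; omega
    · ext i j; fin_cases i <;> fin_cases j <;> simp [hnfMat, *]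
  · rintro ⟨⟨⟨a, b⟩, c, u, v, w⟩, ⟨h1, h2, h3, h4⟩, rfl⟩
    simp only at h1 h2 h3 h4
    refine ⟨?_, ?_⟩
    · simp only [IsHNF, hnfMat]
      simp
      omega
    · rw [Nat.lt_ceil, lt_div_iff₀ (by positivity)] at h1
      have : (hnfMat ((a, b), c, u, v, w)).det = c * ((a + 1) * (b + 1)) := by
        rw [Matrix.det_fin_three]; simp [hnfMat]; ring
      rw [this]; push_cast; exact h1

theorem hnfPar_finite (T : ℝ) : (hnfPar T).Finite := by
  let n := ⌈T⌉₊
  have : hnfPar T ⊆ (Set.Iio n ×ˢ Set.Iio n) ×ˢ (Set.Iio n ×ˢ Set.Iio n ×ˢ Set.Iio n ×ˢ Set.Iio n) := by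
    rintro ⟨⟨a, b⟩, c, u, v, w⟩ ⟨h1, h2, h3, h4⟩
    simp only at h1 h2 h3 h4
    rw [Nat.lt_ceil, lt_div_iff₀ (by positivity)] at h1
    have hc : (1:ℝ) ≤ c := by exact_mod_cast (by omega : 1 ≤ c)
    have a0 : (0:ℝ) ≤ a := by positivity
    have b0 : (0:ℝ) ≤ b := by positivity
    have h5 : (a:ℝ) < T := by nlinarith [mul_nonneg a0 b0, mul_nonneg (sub_nonneg.2 hc) (add_nonneg (mul_nonneg a0 b0) (add_nonneg a0 b0))]
    have h6 : (b:ℝ) + 1 ≤ T := by nlinarith [mul_nonneg a0 b0, mul_nonneg (sub_nonneg.2 hc) (add_nonneg (mul_nonneg a0 b0) (add_nonneg a0 b0))]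
    have h7 : (c:ℝ) < T := by
      have : (c:ℝ) * 1 ≤ c * ((a+1) * (b+1)) := by
        apply mul_le_mul_of_nonneg_left _ (by linarith); nlinarith [mul_nonneg a0 b0]
      nlinarith
    have i5 : a < n := Nat.lt_ceil.2 h5
    have i6 : b < n := Nat.lt_ceil.2 (by linarith)
    have i6' : b + 1 ≤ n := i6
    have i7 : c < n := Nat.lt_ceil.2 h7
    simp only [Set.mem_prod, Set.mem_Iio]
    omega
  have fi := Set.finite_Iio n
  exact ((fi.prod fi).prod (fi.prod (fi.prod (fi.prod fi)))).subset this

theorem HN_finite (T : ℝ) : (HN T).Finite := by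
  rw [HN_eq]; exact (hnfPar_finite T).image _

theorem HN_card (T : ℝ) : ((HN T).ncard : ℝ) = hnfCount T := by
  rw [HN_eq, Set.ncard_image_of_injective _ hnfMat_inj, ncard_eq_tsum, Summable.tsum_prod, hnfCount]
  · congr 1
    funext ab
    have e : (fun c => (hnfPar T).indicator (fun _ => (1:ℝ)) (ab, c)) =
      ({c | (ab, c) ∈ hnfPar T}).indicator (fun _ => (1:ℝ)) := by
      funext c; rfl
    rw [e, ← ncard_eq_tsum]
    have e2 : {c | (ab, c) ∈ hnfPar T} =
      (fun s : (_ : ℕ) × (ℕ × ℕ × ℕ) => (s.1, s.2)) ''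
        ((Finset.range ⌈T / ((ab.1 + 1) * (ab.2 + 1))⌉₊).sigma fun c => Finset.range (ab.2 + 1) ×ˢ Finset.range c ×ˢ Finset.range c : Finset _) := by
      ext ⟨c, u, v, w⟩
      simp only [Set.mem_setOf_eq, hnfPar, Set.mem_image, Finset.mem_coe, Finset.mem_sigma, Finset.mem_product, Finset.mem_range]
      constructor
      · intro h; exact ⟨⟨c, u, v, w⟩, h, rfl⟩
      · rintro ⟨⟨c', x⟩, h, h'⟩
        simp only [Prod.mk.injEq] at h'
        obtain ⟨rfl, rfl⟩ := h'
        exact h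
    rw [e2, Set.ncard_image_of_injective, Set.ncard_coe_finset, Finset.card_sigma, sqs, Finset.mul_sum]
    · push_cast
      refine Finset.sum_congr rfl fun c _ => ?_
      simp; ring_nf; left; trivial
    · rintro ⟨a, b⟩ ⟨c, d⟩ h
      simp only [Prod.mk.injEq] at h
      obtain ⟨rfl, rfl⟩ := h; rfl
  · apply summable_of_finite_support
    refine (hnfPar_finite T).subset ?_
    intro x hx
    simp only [Function.mem_support, ne_eq, Set.indicator_apply_eq_zero, not_forall] at hx
    exact hx.1

end TC

open MvPolynomial

namespace TC
open Filter Topology MeasureTheory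

/-- squared Frobenius norm -/
def fr (M : M3 ℝ) : ℝ := gg M 0 0 + gg M 1 1 + gg M 2 2

theorem gg_nonneg (M : M3 ℝ) (i : Fin 3) : 0 ≤ gg M i i := by
  unfold gg; nlinarith [sq_nonneg (M i 0), sq_nonneg (M i 1), sq_nonneg (M i 2)]

theorem fr_nonneg (M : M3 ℝ) : 0 ≤ fr M := by
  have := gg_nonneg M 0; have := gg_nonneg M 1; have := gg_nonneg M 2
  unfold fr; linarith

theorem gg_le_fr (M : M3 ℝ) (i : Fin 3) : gg M i i ≤ fr M := by
  have := gg_nonneg M 0; have := gg_nonneg M 1; have := gg_nonneg M 2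
  unfold fr; fin_cases i <;> simp <;> linarith

theorem entry_le (M : M3 ℝ) (i j : Fin 3) : |M i j| ≤ √(fr M) :=
  row_le (ρ := fun _ => √(fr M)) (fun _ => Real.sqrt_nonneg _)
    (fun i => by rw [Real.sq_sqrt (fr_nonneg M)]; exact gg_le_fr M i) i j

theorem fr_smul (t : ℝ) (M : M3 ℝ) : fr (t • M) = t ^ 2 * fr M := by
  simp [fr, gg]; ring

theorem fr_Zc (M : M3 ℝ) : fr (M * Zc) = fr M := by
  simp [fr, gg, Zc, Matrix.mul_apply, Fin.sum_univ_three]; ring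

theorem fr_cont : Continuous fr := by
  unfold fr gg
  have : ∀ i j, Continuous fun M : M3 ℝ => M i j := fun i j => by fun_prop
  fun_prop

theorem det_cont : Continuous fun M : M3 ℝ => M.det := Continuous.matrix_det continuous_id

/-- bump function of level `R` -/
noncomputable def bb (R : ℝ) (M : M3 ℝ) : ℝ := if 0 < M.det then max 0 (2 * R - √(fr M) ^ 3 / M.det) else 0

theorem bb_nonneg (R : ℝ) (M : M3 ℝ) : 0 ≤ bb R M := by unfold bb; split_ifs <;> simp

theorem bb_of_pos {R : ℝ} {M : M3 ℝ} (h : 0 < M.det) : bb R M = max 0 (2 * R - √(fr M) ^ 3 / M.det) := if_pos h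

theorem bb_supp {R : ℝ} {M : M3 ℝ} (h : bb R M ≠ 0) : 0 < M.det ∧ √(fr M) ^ 3 < 2 * R * M.det := by
  by_cases hd : 0 < M.det
  · refine ⟨hd, ?_⟩
    rw [bb_of_pos hd] at h
    have : 0 < 2 * R - √(fr M) ^ 3 / M.det := by
      by_contra h'
      exact h (max_eq_left (not_lt.1 h'))
    rw [sub_pos, div_lt_iff₀ hd] at this
    exact this
  · exact absurd (if_neg hd) h

theorem bb_cont (R : ℝ) {M : M3 ℝ} (h : 0 < M.det) : ContinuousAt (bb R) M := by
  have : (fun M : M3 ℝ => max 0 (2 * R - √(fr M) ^ 3 / M.det)) =ᶠ[𝓝 M] bb R := by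
    filter_upwards [det_cont.continuousAt.eventually (lt_mem_nhds h)] with N hN
    exact (bb_of_pos hN).symm
  refine ContinuousAt.congr ?_ this
  refine continuousAt_const.max (continuousAt_const.sub (ContinuousAt.div ?_ det_cont.continuousAt h.ne'))
  exact ((Real.continuous_sqrt.comp fr_cont).pow 3).continuousAt

theorem bb_smul (R : ℝ) (M : M3 ℝ) {t : ℝ} (ht : 0 < t) : bb R (t • M) = bb R M := by
  have hd : (t • M).det = t ^ 3 * M.det := by rw [Matrix.det_smul]; simp
  have h3 : (0:ℝ) < t ^ 3 := by positivity
  unfold bb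
  rw [hd, fr_smul, Real.sqrt_mul (by positivity), Real.sqrt_sq ht.le, mul_pow, mul_div_mul_left _ _ h3.ne']
  simp only [mul_pos_iff_of_pos_left h3]

theorem bb_Zc (R : ℝ) (M : M3 ℝ) : bb R (M * Zc) = bb R M := by
  unfold bb; rw [Matrix.det_mul, Zc_det, mul_one, fr_Zc]

theorem gamma_finite (N : ℝ) : {γ : Γ3 | ∀ i j, |((γ : M3 ℤ) i j : ℝ)| ≤ N}.Finite := by
  have hf : {g : Fin 3 → Fin 3 → ℤ | ∀ i, g i ∈ {v : Fin 3 → ℤ | ‖fun i => (v i : ℝ)‖ ≤ max N 0}}.Finite :=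
    Set.Finite.pi' fun _ => int_vec_finite _
  refine Set.Finite.of_finite_image (f := fun γ : Γ3 => fun i j => (γ : M3 ℤ) i j) (hf.subset ?_) ?_
  · rintro _ ⟨γ, h, rfl⟩ i
    simp only [Set.mem_setOf_eq] at h ⊢
    rw [pi_norm_le_iff_of_nonneg (le_max_right _ _)]
    intro j
    exact (h i j).trans (le_max_left _ _)
  · intro γ _ δ _ h
    apply Matrix.SpecialLinearGroup.ext
    intro i j
    exact congrFun (congrFun h i) j

theorem gamma_bound {R : ℝ} {M : M3 ℝ} (γ : Γ3) (h : bb R (rM γ * M) ≠ 0) (i j : Fin 3) :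
    |((γ : M3 ℤ) i j : ℝ)| ≤ (1 + 2 * R * M.det) * (∑ i, ∑ j, |M.adjugate i j|) / M.det := by
  obtain ⟨h1, h2⟩ := bb_supp h
  rw [Matrix.det_mul, rM_det_SL, one_mul] at h1 h2
  set u := √(fr (rM γ * M)) with hu
  have hu0 : 0 ≤ u := Real.sqrt_nonneg _
  have hu1 : u ≤ 1 + 2 * R * M.det := by
    by_contra hh
    push Not at hh
    have : 0 < 2 * R * M.det := lt_of_le_of_lt (by positivity) h2
    have h3 : 1 < u := by linarith
    nlinarith [mul_pos (show (0:ℝ) < u by linarith) (show (0:ℝ) < u - 1 by linarith), mul_pos (mul_pos (show (0:ℝ) < u by linarith) (show (0:ℝ) < u by linarith)) (show (0:ℝ) < u - 1 by linarith)]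
  rw [le_div_iff₀ h1]
  have e : rM γ * M * M.adjugate = M.det • rM γ := by
    rw [Matrix.mul_assoc, Matrix.mul_adjugate]; simp
  have e2 := congrFun (congrFun e i) j
  rw [Matrix.smul_apply, rM_apply, smul_eq_mul, Matrix.mul_apply] at e2
  calc |((γ : M3 ℤ) i j : ℝ)| * M.det = |M.det * ((γ : M3 ℤ) i j : ℝ)| := by rw [abs_mul, abs_of_pos h1, mul_comm]
    _ = |∑ k, (rM γ * M) i k * M.adjugate k j| := by rw [e2]
    _ ≤ ∑ k, |(rM γ * M) i k * M.adjugate k j| := Finset.abs_sum_le_sum_abs _ _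
    _ ≤ ∑ k, (1 + 2 * R * M.det) * ∑ j, |M.adjugate k j| := by
        refine Finset.sum_le_sum fun k _ => ?_
        rw [abs_mul]
        refine mul_le_mul ((entry_le _ _ _).trans hu1) ?_ (abs_nonneg _) (hu0.trans hu1)
        exact Finset.single_le_sum (f := fun j => |M.adjugate k j|) (fun _ _ => abs_nonneg _) (Finset.mem_univ j)
    _ = _ := by rw [Finset.mul_sum]

theorem bb_unif (R : ℝ) (M₀ : M3 ℝ) (h : 0 < M₀.det) : ∃ F : Finset Γ3, ∀ᶠ M in 𝓝 M₀, 0 < M.det ∧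
    ∀ γ ∉ F, bb R (rM γ * M) = 0 := by
  let β : M3 ℝ → ℝ := fun M => (1 + 2 * R * M.det) * (∑ i, ∑ j, |M.adjugate i j|) / M.det
  have hβ : ContinuousAt β M₀ := by
    refine ContinuousAt.div (Continuous.continuousAt ?_) det_cont.continuousAt h.ne'
    refine Continuous.mul (continuous_const.add (continuous_const.mul det_cont)) ?_
    refine continuous_finset_sum _ fun i _ => continuous_finset_sum _ fun j _ => ?_
    exact ((Continuous.matrix_adjugate continuous_id).matrix_elem i j).abs
  refine ⟨(gamma_finite (β M₀ + 1)).toFinset, ?_⟩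
  filter_upwards [det_cont.continuousAt.eventually (lt_mem_nhds h),
    hβ.eventually (gt_mem_nhds (show β M₀ < β M₀ + 1 by linarith))] with M hM hM2
  refine ⟨hM, fun γ hγ => ?_⟩
  by_contra hne
  apply hγ
  rw [Set.Finite.mem_toFinset]
  intro i j
  exact (gamma_bound γ hne i j).trans hM2.le

theorem bb_fin (R : ℝ) (M : M3 ℝ) (h : 0 < M.det) : (Function.support fun γ : Γ3 => bb R (rM γ * M)).Finite := by
  obtain ⟨F, hF⟩ := bb_unif R M h
  refine F.finite_toSet.subset fun γ hγ => ?_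
  by_contra hne
  exact hγ (hF.self_of_nhds.2 γ hne)

noncomputable def BB (R : ℝ) (M : M3 ℝ) : ℝ := ∑' γ : Γ3, bb R (rM γ * M)

theorem BB_nonneg (R : ℝ) (M : M3 ℝ) : 0 ≤ BB R M := tsum_nonneg fun _ => bb_nonneg _ _

theorem bb_le_BB (R : ℝ) (M : M3 ℝ) (h : 0 < M.det) (γ : Γ3) : bb R (rM γ * M) ≤ BB R M :=
  (summable_of_finite_support (bb_fin R M h)).le_tsum γ fun _ _ => bb_nonneg _ _

theorem BB_mul (R : ℝ) (M : M3 ℝ) (δ : Γ3) : BB R (rM δ * M) = BB R M := by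
  unfold BB
  rw [← (Equiv.mulRight δ).tsum_eq (fun γ : Γ3 => bb R (rM γ * M))]
  congr 1; funext γ
  simp [rM_mul, Matrix.mul_assoc]

theorem BB_smul (R : ℝ) (M : M3 ℝ) {t : ℝ} (ht : 0 < t) : BB R (t • M) = BB R M := by
  unfold BB; congr 1; funext γ; rw [Matrix.mul_smul, bb_smul R _ ht]

theorem BB_Zc (R : ℝ) (M : M3 ℝ) : BB R (M * Zc) = BB R M := by
  unfold BB; congr 1; funext γ; rw [← Matrix.mul_assoc, bb_Zc]

theorem BB_cont (R : ℝ) (M₀ : M3 ℝ) (h : 0 < M₀.det) : ContinuousAt (BB R) M₀ := by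
  obtain ⟨F, hF⟩ := bb_unif R M₀ h
  have : (fun M => ∑ γ ∈ F, bb R (rM γ * M)) =ᶠ[𝓝 M₀] BB R := by
    filter_upwards [hF] with M hM
    exact (tsum_eq_sum fun γ hγ => hM.2 γ hγ).symm
  refine ContinuousAt.congr ?_ this
  refine tendsto_finset_sum _ fun γ _ => ?_
  have h1 : 0 < (rM γ * M₀).det := by rw [Matrix.det_mul, rM_det_SL, one_mul]; exact h
  exact ContinuousAt.comp (f := fun M => rM γ * M) (bb_cont R h1) (continuous_const.matrix_mul continuous_id).continuousAt

/-- smooth cutoff of level `R` -/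
noncomputable def psi (R : ℝ) (M : M3 ℝ) : ℝ := bb R M / max (BB R M) R

/-- sum of the cutoff over an orbit -/
noncomputable def ww (R : ℝ) (M : M3 ℝ) : ℝ := ∑' γ : Γ3, psi R (rM γ * M)

theorem psi_nonneg (R : ℝ) (M : M3 ℝ) : 0 ≤ psi R M :=
  div_nonneg (bb_nonneg _ _) (le_max_of_le_left (BB_nonneg _ _))

theorem psi_supp {R : ℝ} {M : M3 ℝ} (h : psi R M ≠ 0) : 0 < M.det ∧ √(fr M) ^ 3 < 2 * R * M.det :=
  bb_supp fun h' => h (by rw [psi, h', zero_div])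

theorem psi_le_one {R : ℝ} (hR : 0 < R) (M : M3 ℝ) : psi R M ≤ 1 := by
  by_cases h : psi R M = 0
  · rw [h]; exact zero_le_one
  · have hd := (psi_supp h).1
    rw [psi, div_le_one (lt_max_of_lt_right hR)]
    have := bb_le_BB R M hd 1
    simp [rM_one] at this
    exact le_max_of_le_left this

theorem psi_smul (R : ℝ) (M : M3 ℝ) {t : ℝ} (ht : 0 < t) : psi R (t • M) = psi R M := by
  rw [psi, psi, bb_smul R M ht, BB_smul R M ht]

theorem psi_Zc (R : ℝ) (M : M3 ℝ) : psi R (M * Zc) = psi R M := by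
  rw [psi, psi, bb_Zc, BB_Zc]

theorem psi_cont {R : ℝ} (hR : 0 < R) {M : M3 ℝ} (h : 0 < M.det) : ContinuousAt (psi R) M :=
  (bb_cont R h).div ((BB_cont R M h).max continuousAt_const) (lt_max_of_lt_right hR).ne'

theorem psi_cont' {R : ℝ} (hR : 0 < R) {M : M3 ℝ} (h : M.det ≠ 0) : ContinuousAt (psi R) M := by
  rcases lt_or_gt_of_ne h with h | h
  · have : (fun _ => (0:ℝ)) =ᶠ[𝓝 M] psi R := by
      filter_upwards [det_cont.continuousAt.eventually (gt_mem_nhds h)] with N hN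
      by_contra hne
      exact absurd (psi_supp (Ne.symm hne)).1 (not_lt.2 hN.le)
    exact continuousAt_const.congr this
  · exact psi_cont hR h

theorem psi_fin (R : ℝ) (M : M3 ℝ) (h : 0 < M.det) : (Function.support fun γ : Γ3 => psi R (rM γ * M)).Finite := by
  refine (bb_fin R M h).subset fun γ hγ h' => hγ ?_
  have h'' : bb R (rM γ * M) = 0 := h'
  simp only [psi]; rw [h'', zero_div]

theorem ww_eq (R : ℝ) (M : M3 ℝ) : ww R M = BB R M / max (BB R M) R := by
  unfold ww psi
  simp only [BB_mul]
  rw [tsum_div_const]; rfl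

theorem ww_nonneg (R : ℝ) (M : M3 ℝ) : 0 ≤ ww R M := tsum_nonneg fun _ => psi_nonneg _ _

theorem ww_le_one {R : ℝ} (hR : 0 < R) (M : M3 ℝ) : ww R M ≤ 1 := by
  rw [ww_eq, div_le_one (lt_max_of_lt_right hR)]; exact le_max_left _ _

theorem ww_eq_one {R : ℝ} (hR : 0 < R) (M : M3 ℝ) (h : 0 < M.det) (γ : Γ3) (hγ : √(fr (rM γ * M)) ^ 3 ≤ R * M.det) : ww R M = 1 := by
  have h2 : R ≤ BB R M := by
    refine le_trans ?_ (bb_le_BB R M h γ)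
    have h1 : (rM γ * M).det = M.det := by rw [Matrix.det_mul, rM_det_SL, one_mul]
    rw [bb_of_pos (by rw [h1]; exact h), h1]
    refine le_max_of_le_right ?_
    rw [← div_le_iff₀ h] at hγ
    linarith
  rw [ww_eq, max_eq_left h2, div_self]
  linarith

theorem ww_mul (R : ℝ) (M : M3 ℝ) (δ : Γ3) : ww R (rM δ * M) = ww R M := by
  rw [ww_eq, ww_eq, BB_mul]

end TC

open MvPolynomial

namespace TC
open Filter Topology MeasureTheory

/-- disjoint sets, each with at least `w` points in a finite set -/
theorem cell_count {ι α : Type*} (S : Set ι) (O : ι → Set α) (hd : S.PairwiseDisjoint O) (Bx : Set α) (hB : Bx.Finite)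
    (w : ℝ) (hw : 0 < w) (h : ∀ i ∈ S, w ≤ ((O i ∩ Bx).ncard : ℝ)) : S.Finite ∧ w * (S.ncard : ℝ) ≤ (Bx.ncard : ℝ) := by
  classical
  have hne : ∀ i ∈ S, (O i ∩ Bx).Nonempty := by
    intro i hi
    rw [← Set.ncard_pos (hB.subset Set.inter_subset_right)]
    have := lt_of_lt_of_le hw (h i hi)
    exact_mod_cast this
  have hfin : S.Finite := by
    refine Set.Finite.of_finite_image (f := fun i => O i ∩ Bx) (hB.finite_subsets.subset ?_) ?_
    · rintro _ ⟨i, _, rfl⟩; exact Set.inter_subset_right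
    · intro i hi j hj hij
      by_contra hne'
      obtain ⟨a, ha⟩ := hne i hi
      have hij' : O i ∩ Bx = O j ∩ Bx := hij
      have ha' : a ∈ O j ∩ Bx := hij' ▸ ha
      exact Set.disjoint_left.1 (hd hi hj hne') ha.1 ha'.1
  refine ⟨hfin, ?_⟩
  lift S to Finset ι using hfin
  lift Bx to Finset α using hB
  rw [Set.ncard_coe_finset, Set.ncard_coe_finset]
  have h1 : ∀ i ∈ S, w ≤ ((Bx.filter (· ∈ O i)).card : ℝ) := by
    intro i hi
    have := h i hi
    rw [show O i ∩ (Bx : Set α) = ((Bx.filter (· ∈ O i) : Finset α) : Set α) by ext; simp [and_comm], Set.ncard_coe_finset] at this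
    exact this
  have h2 : (S.biUnion fun i => Bx.filter (· ∈ O i)).card = ∑ i ∈ S, (Bx.filter (· ∈ O i)).card := by
    apply Finset.card_biUnion
    intro i hi j hj hij
    refine Finset.disjoint_left.2 fun a ha hb => ?_
    exact Set.disjoint_left.1 (hd hi hj hij) (Finset.mem_filter.1 ha).2 (Finset.mem_filter.1 hb).2
  have h3 : (S.biUnion fun i => Bx.filter (· ∈ O i)).card ≤ Bx.card :=
    Finset.card_le_card (Finset.biUnion_subset.2 fun i _ => Finset.filter_subset _ _)
  calc w * (S.card : ℝ) = ∑ i ∈ S, w := by simp [mul_comm]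
    _ ≤ ∑ i ∈ S, ((Bx.filter (· ∈ O i)).card : ℝ) := Finset.sum_le_sum h1
    _ = ((S.biUnion fun i => Bx.filter (· ∈ O i)).card : ℝ) := by rw [h2]; push_cast; rfl
    _ ≤ _ := by exact_mod_cast h3

theorem cells_sum {ι κ : Type*} (S : Set ι) (C : κ → Set ι) (hcov : ∀ i ∈ S, ∃ k, i ∈ C k) (b : κ → ℝ)
    (h : ∀ k, (C k).Finite ∧ ((C k).ncard : ℝ) ≤ b k) (hb : Summable b) : S.Finite ∧ (S.ncard : ℝ) ≤ ∑' k, b k := by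
  classical
  have hb0 : ∀ k, 0 ≤ b k := fun k => le_trans (by positivity) (h k).2
  have key : ∀ F : Finset ι, (F : Set ι) ⊆ S → (F.card : ℝ) ≤ ∑' k, b k := by
    intro F hF
    by_cases hne : F = ∅
    · rw [hne]; simp; exact tsum_nonneg hb0
    obtain ⟨i0, hi0⟩ := Finset.nonempty_iff_ne_empty.2 hne
    obtain ⟨k0, -⟩ := hcov i0 (hF hi0)
    have : ∃ k : ι → κ, ∀ i ∈ S, i ∈ C (k i) := by
      choose k hk using hcov
      exact ⟨fun i => if hi : i ∈ S then k i hi else k0, fun i hi => by simp [hi, hk i hi]⟩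
    obtain ⟨k, hk⟩ := this
    have h1 : F ⊆ (F.image k).biUnion fun j => (h j).1.toFinset := by
      intro i hi
      rw [Finset.mem_biUnion]
      exact ⟨k i, Finset.mem_image_of_mem _ hi, by simpa using hk i (hF hi)⟩
    calc (F.card : ℝ) ≤ (((F.image k).biUnion fun j => (h j).1.toFinset).card : ℝ) := by exact_mod_cast Finset.card_le_card h1
      _ ≤ ∑ j ∈ F.image k, ((h j).1.toFinset.card : ℝ) := by exact_mod_cast Finset.card_biUnion_le
      _ ≤ ∑ j ∈ F.image k, b j := by
          refine Finset.sum_le_sum fun j _ => ?_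
          rw [← Set.ncard_eq_toFinset_card _ (h j).1]; exact (h j).2
      _ ≤ _ := hb.sum_le_tsum _ fun j _ => hb0 j
  have hfin : S.Finite := by
    by_contra hinf
    obtain ⟨F, hF, hc⟩ := Set.Infinite.exists_subset_card_eq hinf (⌈∑' k, b k⌉₊ + 1)
    have h1 := key F hF
    rw [hc] at h1
    have := Nat.le_ceil (∑' k, b k)
    push_cast at h1
    linarith
  refine ⟨hfin, ?_⟩
  lift S to Finset ι using hfin
  rw [Set.ncard_coe_finset]; exact key S subset_rfl

theorem box_card {ι : Type*} [Fintype ι] [DecidableEq ι] (W : ι → ℝ) (hW : ∀ j, 0 ≤ W j) :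
    {c : ι → ℤ | ∀ j, |(c j : ℝ)| ≤ W j}.Finite ∧
    ({c : ι → ℤ | ∀ j, |(c j : ℝ)| ≤ W j}.ncard : ℝ) ≤ ∏ j, (2 * W j + 1) := by
  have e : {c : ι → ℤ | ∀ j, |(c j : ℝ)| ≤ W j} = ((Fintype.piFinset fun j => Finset.Icc (-⌊W j⌋) ⌊W j⌋ : Finset (ι → ℤ)) : Set _) := by
    ext c
    simp only [Set.mem_setOf_eq, Finset.mem_coe, Fintype.mem_piFinset, Finset.mem_Icc]
    refine forall_congr' fun j => ?_
    rw [← abs_le, Int.le_floor]; push_cast; rfl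
  rw [e]
  refine ⟨Finset.finite_toSet _, ?_⟩
  rw [Set.ncard_coe_finset, Fintype.card_piFinset]
  push_cast
  refine Finset.prod_le_prod (fun _ _ => by positivity) fun j _ => ?_
  rw [Int.card_Icc]
  have h0 : (0:ℤ) ≤ ⌊W j⌋ := Int.floor_nonneg.2 (hW j)
  have h1 : (((⌊W j⌋ + 1 - -⌊W j⌋).toNat : ℤ) : ℝ) = 2 * ⌊W j⌋ + 1 := by
    rw [Int.toNat_of_nonneg (by linarith)]; push_cast; ring
  have h2 := Int.floor_le (W j)
  have h3 : (((⌊W j⌋ + 1 - -⌊W j⌋).toNat : ℕ) : ℝ) = 2 * ⌊W j⌋ + 1 := by rw [← h1]; exact (Int.cast_natCast _).symm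
  rw [h3]; linarith

/-- lower unipotent matrices -/
noncomputable def uni (x y : ℕ) : Finset (ℤ × ℤ × ℤ) := Finset.Ico 0 (4 ^ x) ×ˢ Finset.Ico 0 (4 ^ (x + y)) ×ˢ Finset.Ico 0 (4 ^ y)

theorem uni_card (x y : ℕ) : (uni x y).card = 16 ^ (x + y) := by
  simp only [uni, Finset.card_product, Int.card_Ico, sub_zero]
  have : ∀ n : ℕ, ((4:ℤ) ^ n).toNat = 4 ^ n := fun n => by
    rw [show ((4:ℤ) ^ n) = ((4 ^ n : ℕ) : ℤ) by push_cast; rfl, Int.toNat_natCast]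
  rw [this, this, this, show 16 = 4 * 4 by norm_num, mul_pow, pow_add]; ring

def unm (n : ℤ × ℤ × ℤ) : Γ3 := slmk !![1,0,0; n.1,1,0; n.2.1,n.2.2,1] (by simp [Matrix.det_fin_three])

theorem unm_inj : Function.Injective unm := by
  rintro ⟨a, b, c⟩ ⟨a', b', c'⟩ h
  have e : ∀ i j, (unm (a, b, c) : M3 ℤ) i j = (unm (a', b', c') : M3 ℤ) i j := fun i j => by rw [h]
  have e1 := e 1 0
  have e2 := e 2 0
  have e3 := e 2 1
  simp [unm, slmk] at e1 e2 e3
  simp [*]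

/-- cell radii -/
def rad (t : ℝ) (x y : ℕ) : Fin 3 → ℝ := ![t ^ 2, 4 ^ x * t ^ 2, 4 ^ (x + y) * t ^ 2]

theorem gg_add_aux {a b c x y z r s : ℝ} (hr : 0 ≤ r) (hs : 0 ≤ s) (h1 : a * a + b * b + c * c ≤ r ^ 2) (h2 : x * x + y * y + z * z ≤ s ^ 2) :
    (a + x) * (a + x) + (b + y) * (b + y) + (c + z) * (c + z) ≤ (r + s) ^ 2 := by
  have h3 : a * x + b * y + c * z ≤ r * s := by
    refine le_trans (le_abs_self _) (abs_le_of_sq_le_sq ?_ (mul_nonneg hr hs))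
    calc (a * x + b * y + c * z) ^ 2 ≤ (a * a + b * b + c * c) * (x * x + y * y + z * z) := by
          nlinarith [sq_nonneg (a * y - b * x), sq_nonneg (a * z - c * x), sq_nonneg (b * z - c * y)]
      _ ≤ r ^ 2 * s ^ 2 := by
          apply mul_le_mul h1 h2 _ (by positivity)
          nlinarith [sq_nonneg x, sq_nonneg y, sq_nonneg z]
      _ = _ := by ring
  nlinarith

theorem unm_rows (t : ℝ) (x y : ℕ) (M : M3 ℝ) (h : ∀ i, gg M i i ≤ rad t x y i ^ 2) (n : ℤ × ℤ × ℤ) (hn : n ∈ uni x y) (i : Fin 3) :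
    gg (rM (unm n) * M) i i ≤ (3 * rad t x y i) ^ 2 := by
  obtain ⟨a, b, c⟩ := n
  simp only [uni, Finset.mem_product, Finset.mem_Ico] at hn
  obtain ⟨⟨a0, a1⟩, ⟨b0, b1⟩, c0, c1⟩ := hn
  have a0' : (0:ℝ) ≤ a := by exact_mod_cast a0
  have b0' : (0:ℝ) ≤ b := by exact_mod_cast b0
  have c0' : (0:ℝ) ≤ c := by exact_mod_cast c0
  have a1' : (a:ℝ) ≤ 4 ^ x := by exact_mod_cast a1.le
  have b1' : (b:ℝ) ≤ 4 ^ (x + y) := by exact_mod_cast b1.le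
  have c1' : (c:ℝ) ≤ 4 ^ y := by exact_mod_cast c1.le
  have sc : ∀ (u : ℝ) (i : Fin 3) (r : ℝ), 0 ≤ u → gg M i i ≤ r ^ 2 →
      (u * M i 0) * (u * M i 0) + (u * M i 1) * (u * M i 1) + (u * M i 2) * (u * M i 2) ≤ (u * r) ^ 2 := by
    intro u i r _ h
    have : (u * M i 0) * (u * M i 0) + (u * M i 1) * (u * M i 1) + (u * M i 2) * (u * M i 2) = u ^ 2 * gg M i i := by
      unfold gg; ring
    rw [this, mul_pow]; gcongr
  have t2 : 0 ≤ t ^ 2 := sq_nonneg t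
  have h0 := h 0
  have h1 := h 1
  have h2 := h 2
  simp only [rad, Matrix.cons_val_zero, Matrix.cons_val_one, Matrix.cons_val] at h0 h1 h2
  fin_cases i
  · simp [gg, unm, slmk, rM, Matrix.mul_apply, Fin.sum_univ_three, rad]
    unfold gg at h0
    nlinarith [sq_nonneg (t ^ 2)]
  · have := gg_add_aux (r := 4 ^ x * t ^ 2) (s := a * t ^ 2) (by positivity) (by positivity) h1 (sc a 0 _ a0' h0)
    have e : 4 ^ x * t ^ 2 + a * t ^ 2 ≤ 3 * (4 ^ x * t ^ 2) := by nlinarith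
    have := this.trans (pow_le_pow_left₀ (by positivity) e 2)
    simp [gg, unm, slmk, rM, Matrix.mul_apply, Fin.sum_univ_three, rad]
    linarith
  · have q1 := gg_add_aux (r := 4 ^ (x + y) * t ^ 2) (s := b * t ^ 2) (by positivity) (by positivity) h2 (sc b 0 _ b0' h0)
    have q2 := gg_add_aux (by positivity) (s := c * (4 ^ x * t ^ 2)) (by positivity) q1 (sc c 1 _ c0' h1)
    have e : 4 ^ (x + y) * t ^ 2 + b * t ^ 2 + c * (4 ^ x * t ^ 2) ≤ 3 * (4 ^ (x + y) * t ^ 2) := by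
      have e1 : b * t ^ 2 ≤ 4 ^ (x + y) * t ^ 2 := by gcongr
      have e2 : c * (4 ^ x * t ^ 2) ≤ 4 ^ y * (4 ^ x * t ^ 2) := by gcongr
      have e3 : (4:ℝ) ^ (x + y) = 4 ^ y * 4 ^ x := by rw [pow_add]; ring
      rw [e3] at e1 ⊢
      linarith
    have := q2.trans (pow_le_pow_left₀ (by positivity) e 2)
    simp [gg, unm, slmk, rM, Matrix.mul_apply, Fin.sum_univ_three, rad]
    linarith

theorem pow_bracket {z : ℝ} (hz : 1 ≤ z) : ∃ n : ℕ, z ≤ 4 ^ n ∧ (4:ℝ) ^ n ≤ 4 * z := by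
  obtain ⟨n, h1, h2⟩ := exists_nat_pow_near hz (show (1:ℝ) < 4 by norm_num)
  exact ⟨n + 1, h2.le, by rw [pow_succ]; linarith⟩

/-- every reduced triple lies in a cell -/
theorem exists_cell (ρ : Fin 3 → ℝ) (h0 : 0 < ρ 0) (h1 : ρ 0 ≤ ρ 1) (h2 : ρ 1 ≤ ρ 2) (B : ℝ) (hB : 0 < B) (h : 64 * (ρ 0 * ρ 1 * ρ 2) ≤ B ^ 2) :
    ∃ (x y : ℕ), ρ 2 / ρ 0 ≤ 4 ^ (x + y) ∧ ∀ t, 0 < t → t ^ 3 * (4 ^ x * 2 ^ y) = B → ∀ i, ρ i ≤ rad t x y i := by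
  have p1 : 0 < ρ 1 := h0.trans_le h1
  have p2 : 0 < ρ 2 := p1.trans_le h2
  obtain ⟨x, x1, x2⟩ := pow_bracket ((one_le_div h0).2 h1)
  obtain ⟨y, y1, y2⟩ := pow_bracket ((one_le_div p1).2 h2)
  refine ⟨x, y, ?_, ?_⟩
  · calc ρ 2 / ρ 0 = (ρ 1 / ρ 0) * (ρ 2 / ρ 1) := by field_simp
      _ ≤ 4 ^ x * 4 ^ y := by gcongr
      _ = _ := by rw [pow_add]
  intro t ht hB2
  have key : ρ 0 ≤ t ^ 2 := by
    have e : (t ^ 2) ^ 3 * ((4 ^ x) ^ 2 * 4 ^ y) = B ^ 2 := by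
      rw [← hB2, show (4:ℝ) ^ y = 2 ^ y * 2 ^ y by rw [← mul_pow]; norm_num]; ring
    have e2 : ρ 0 ^ 3 * ((4 ^ x) ^ 2 * 4 ^ y) ≤ B ^ 2 := by
      calc ρ 0 ^ 3 * ((4 ^ x) ^ 2 * 4 ^ y) ≤ ρ 0 ^ 3 * ((4 * (ρ 1 / ρ 0)) ^ 2 * (4 * (ρ 2 / ρ 1))) := by gcongr
        _ = 64 * (ρ 0 * ρ 1 * ρ 2) := by field_simp; ring
        _ ≤ _ := h
    rw [← e] at e2
    have := le_of_mul_le_mul_right e2 (by positivity)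
    exact le_of_pow_le_pow_left₀ (by norm_num) (by positivity) this
  rw [div_le_iff₀ h0] at x1
  rw [div_le_iff₀ p1] at y1
  have k1 : ρ 1 ≤ 4 ^ x * t ^ 2 := x1.trans (by gcongr)
  intro i
  fin_cases i
  · exact key
  · exact k1
  · show ρ 2 ≤ 4 ^ (x + y) * t ^ 2
    calc ρ 2 ≤ 4 ^ y * ρ 1 := y1
      _ ≤ 4 ^ y * (4 ^ x * t ^ 2) := by gcongr
      _ = _ := by rw [pow_add]; ring

theorem exists_rad (B : ℝ) (hB : 0 < B) (x y : ℕ) : ∃ t : ℝ, 0 < t ∧ t ^ 3 * (4 ^ x * 2 ^ y) = B := by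
  obtain ⟨s, hs⟩ := exists_cbrt (B / (4 ^ x * 2 ^ y))
  refine ⟨s, ?_, ?_⟩
  · by_contra h
    push Not at h
    have : s ^ 3 ≤ 0 := by
      have := pow_nonneg (neg_nonneg.2 h) 3
      nlinarith
    have h2 : 0 < B / (4 ^ x * 2 ^ y) := by positivity
    rw [← hs] at h2; linarith
  · rw [hs]; field_simp

/-- the tail of the cell sum -/
noncomputable def tl (R : ℝ) : ℝ := ∑' k : ℕ × ℕ, if R ≤ 11 * 16 ^ (k.1 + k.2) then (1 / 2 : ℝ) ^ (k.1 + k.2) else 0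

theorem geo2 : Summable fun k : ℕ × ℕ => (1 / 2 : ℝ) ^ (k.1 + k.2) := by
  have h : Summable fun n : ℕ => (1 / 2 : ℝ) ^ n := summable_geometric_two
  have := h.mul_of_nonneg h (fun _ => by positivity) (fun _ => by positivity)
  simpa [pow_add] using this

theorem tl_summable (R : ℝ) : Summable fun k : ℕ × ℕ => if R ≤ 11 * 16 ^ (k.1 + k.2) then (1 / 2 : ℝ) ^ (k.1 + k.2) else 0 := by
  refine Summable.of_nonneg_of_le (fun k => by split_ifs <;> positivity) (fun k => ?_) geo2
  split_ifs
  · exact le_rfl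
  · positivity

theorem tl_tendsto : Tendsto tl atTop (𝓝 0) := by
  have := tendsto_tsum_of_dominated_convergence (𝓕 := (atTop : Filter ℝ)) (f := fun (R : ℝ) (k : ℕ × ℕ) =>
    if R ≤ 11 * 16 ^ (k.1 + k.2) then (1 / 2 : ℝ) ^ (k.1 + k.2) else 0) (g := fun _ => (0:ℝ)) geo2 ?_ ?_
  · rw [tsum_zero] at this; exact this
  · intro k
    refine tendsto_const_nhds.congr' ?_
    filter_upwards [eventually_gt_atTop (11 * 16 ^ (k.1 + k.2))] with R hR
    rw [if_neg (not_le.2 hR)]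
  · refine Eventually.of_forall fun R k => ?_
    rw [Real.norm_of_nonneg (by split_ifs <;> positivity)]
    split_ifs
    · exact le_rfl
    · positivity

end TC

open MvPolynomial

namespace TC
open Filter Topology MeasureTheory

theorem skew {R : ℝ} (hR : 0 < R) (M : M3 ℝ) (hM : 0 < M.det) (hw : ww R M ≠ 1) (γ : Γ3) (ρ : Fin 3 → ℝ) (h0 : 0 < ρ 0) (h1 : ρ 0 ≤ ρ 1)
    (h2 : ρ 1 ≤ ρ 2) (h : ∀ i, gg (rM γ * M) i i ≤ ρ i ^ 2) (hP : ρ 0 * ρ 1 * ρ 2 ≤ 2 * M.det) : R ≤ 11 * (ρ 2 / ρ 0) ^ 2 := by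
  have p1 : 0 < ρ 1 := h0.trans_le h1
  have p2 : 0 < ρ 2 := p1.trans_le h2
  have h3 : R * M.det < √(fr (rM γ * M)) ^ 3 := by
    by_contra hh
    exact hw (ww_eq_one hR M hM γ (not_lt.1 hh))
  set u := √(fr (rM γ * M)) with hu
  have hu0 : 0 ≤ u := Real.sqrt_nonneg _
  have hu2 : u ^ 2 ≤ 3 * ρ 2 ^ 2 := by
    rw [hu, Real.sq_sqrt (fr_nonneg _), fr]
    have := h 0; have := h 1; have := h 2
    nlinarith
  have hu1 : u ≤ 7 / 4 * ρ 2 := by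
    apply le_of_sq_le_sq _ (by positivity)
    nlinarith
  have hu3 : u ^ 3 ≤ 21 / 4 * ρ 2 ^ 3 := by
    calc u ^ 3 = u * u ^ 2 := by ring
      _ ≤ (7 / 4 * ρ 2) * (3 * ρ 2 ^ 2) := by gcongr
      _ = _ := by ring
  have h4 : R * (ρ 0 * ρ 0 * ρ 2) ≤ R * (2 * M.det) := by
    apply mul_le_mul_of_nonneg_left _ hR.le
    refine le_trans ?_ hP
    gcongr
  have h5 : R * ρ 0 ^ 2 ≤ 11 * ρ 2 ^ 2 := by
    have : (R * ρ 0 ^ 2) * ρ 2 ≤ (11 * ρ 2 ^ 2) * ρ 2 := by nlinarith [pow_pos p2 3]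
    exact le_of_mul_le_mul_right this p2
  rw [div_pow, mul_div_assoc', le_div_iff₀ (by positivity)]
  exact h5

theorem mbox (W : Fin 3 → ℝ) (hW : ∀ i, 0 ≤ W i) : {N : M3 ℤ | ∀ i j, |(N i j : ℝ)| ≤ W i}.Finite ∧
    ({N : M3 ℤ | ∀ i j, |(N i j : ℝ)| ≤ W i}.ncard : ℝ) ≤ ∏ i, (2 * W i + 1) ^ 3 := by
  have e : {N : M3 ℤ | ∀ i j, |(N i j : ℝ)| ≤ W i} = (fun c : Fin 3 × Fin 3 → ℤ => Matrix.of fun i j => c (i, j)) ''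
      {c | ∀ j, |(c j : ℝ)| ≤ W j.1} := by
    ext N
    simp only [Set.mem_setOf_eq, Set.mem_image]
    constructor
    · intro h; exact ⟨fun p => N p.1 p.2, fun p => h _ _, rfl⟩
    · rintro ⟨c, hc, rfl⟩ i j; exact hc (i, j)
  have hinj : Function.Injective (fun c : Fin 3 × Fin 3 → ℤ => Matrix.of fun i j => c (i, j)) := by
    intro c d h
    funext p
    exact congrFun (congrFun h p.1) p.2
  have hb := box_card (fun p : Fin 3 × Fin 3 => W p.1) (fun p => hW _)
  rw [e]
  refine ⟨hb.1.image _, ?_⟩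
  rw [Set.ncard_image_of_injective _ hinj]
  refine hb.2.trans (le_of_eq ?_)
  rw [Fintype.prod_prod_type]
  simp

theorem rad_nonneg (t : ℝ) (x y : ℕ) (i : Fin 3) : 0 ≤ rad t x y i := by
  fin_cases i <;> simp [rad] <;> positivity

theorem rad_mono (t : ℝ) (x y : ℕ) (i : Fin 3) : rad t x y 0 ≤ rad t x y i := by
  have h : ∀ n : ℕ, t ^ 2 ≤ 4 ^ n * t ^ 2 := fun n => le_mul_of_one_le_left (sq_nonneg t) (one_le_pow₀ (by norm_num))
  fin_cases i
  · exact le_rfl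
  · exact h x
  · exact h (x + y)

theorem rad_prod (t : ℝ) (x y : ℕ) : rad t x y 0 * rad t x y 1 * rad t x y 2 = (t ^ 3 * (4 ^ x * 2 ^ y)) ^ 2 := by
  simp only [rad, Matrix.cons_val_zero, Matrix.cons_val_one, Matrix.cons_val]
  rw [pow_add, show (4:ℝ) ^ y = 2 ^ y * 2 ^ y by rw [← mul_pow]; norm_num]; ring

def Hcell (R T t : ℝ) (x y : ℕ) : Set (M3 ℤ) :=
  {H | H ∈ HN T ∧ R ≤ 11 * 16 ^ (x + y) ∧ ∃ γ : Γ3, ∀ i, gg (rM γ * rM H) i i ≤ rad t x y i ^ 2}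

theorem IsHNF.det_pos {H : M3 ℤ} (h : IsHNF H) : 0 < H.det := by
  obtain ⟨a1, a2, a3, a4, a5, a6, a7, a8, a9, a10, a11, a12⟩ := h
  have : H.det = H 0 0 * H 1 1 * H 2 2 := by rw [Matrix.det_fin_three, a1, a2, a3]; ring
  rw [this]; positivity

theorem Hcell_card (R T t : ℝ) (x y : ℕ) (B : ℝ) (hB : t ^ 3 * (4 ^ x * 2 ^ y) = B) : (Hcell R T t x y).Finite ∧
    ((Hcell R T t x y).ncard : ℝ) ≤ 7 ^ 9 * (B ^ 2) ^ 3 * (if R ≤ 11 * 16 ^ (x + y) then (1 / 2 : ℝ) ^ (x + y) else 0) := by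
  by_cases hne : Hcell R T t x y = ∅
  · rw [hne]; simp; split_ifs <;> positivity
  obtain ⟨H0, hH0⟩ := Set.nonempty_iff_ne_empty.2 hne
  have hR := hH0.2.1
  have hr0 : 1 ≤ rad t x y 0 := by
    obtain ⟨hN, _, γ, hγ⟩ := hH0
    have hd : ((γ : M3 ℤ) * H0).det ≠ 0 := by rw [Matrix.det_mul, γ.2, one_mul]; exact hN.1.det_pos.ne'
    have : ∃ j, ((γ : M3 ℤ) * H0) 0 j ≠ 0 := by
      by_contra hh
      push Not at hh
      exact hd (Matrix.det_eq_zero_of_row_eq_zero 0 hh)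
    obtain ⟨j, hj⟩ := this
    have h1 : (1:ℝ) ≤ |(((γ : M3 ℤ) * H0) 0 j : ℝ)| := by exact_mod_cast Int.one_le_abs hj
    have h2 := row_le (rad_nonneg t x y) hγ 0 j
    rw [← rM_mul, rM_apply] at h2
    exact h1.trans h2
  have hW : ∀ i, 0 ≤ 3 * rad t x y i := fun i => mul_nonneg (by norm_num) (rad_nonneg t x y i)
  obtain ⟨b1, b2⟩ := mbox (fun i => 3 * rad t x y i) hW
  have key := cell_count (Hcell R T t x y) (fun H => {N | ∃ γ : Γ3, N = (γ : M3 ℤ) * H}) ?_ _ b1 (16 ^ (x + y)) (by positivity) ?_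
  · obtain ⟨c1, c2⟩ := key
    refine ⟨c1, ?_⟩
    rw [if_pos hR]
    have h3 : ∏ i, (2 * (3 * rad t x y i) + 1) ^ 3 ≤ 7 ^ 9 * (B ^ 2) ^ 3 := by
      calc ∏ i, (2 * (3 * rad t x y i) + 1) ^ 3 ≤ ∏ i, (7 * rad t x y i) ^ 3 := by
            refine Finset.prod_le_prod (fun i _ => by have := hW i; positivity) fun i _ => ?_
            have := hW i
            have := rad_mono t x y i
            gcongr
            linarith
        _ = 7 ^ 9 * (rad t x y 0 * rad t x y 1 * rad t x y 2) ^ 3 := by rw [Fin.prod_univ_three]; ring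
        _ = _ := by rw [rad_prod, hB]
    have h4 := c2.trans (b2.trans h3)
    have h5 : ((1:ℝ) / 2) ^ (x + y) * 2 ^ (x + y) = 1 := by rw [← mul_pow]; norm_num
    have h6 : (2:ℝ) ^ (x + y) ≤ 16 ^ (x + y) := by gcongr; norm_num
    set n := ((Hcell R T t x y).ncard : ℝ) with hn
    have hn0 : 0 ≤ n := by positivity
    calc n = (2 ^ (x + y) * n) * (1 / 2) ^ (x + y) := by linear_combination (-n) * h5
      _ ≤ (16 ^ (x + y) * n) * (1 / 2) ^ (x + y) := by gcongr
      _ ≤ _ := by gcongr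
  · intro H hH H' hH' hne'
    refine Set.disjoint_left.2 ?_
    rintro N ⟨γ, h1⟩ ⟨δ, h2⟩
    apply hne'
    have e : H' = ((δ⁻¹ * γ : Γ3) : M3 ℤ) * H := by
      rw [Matrix.SpecialLinearGroup.coe_mul, Matrix.mul_assoc, ← h1, h2, ← Matrix.mul_assoc, ← Matrix.SpecialLinearGroup.coe_mul]
      simp
    have := hnf_unique H (δ⁻¹ * γ) hH.1.1 (by rw [← e]; exact hH'.1.1)
    rw [this] at e
    simpa using e.symm
  · rintro H ⟨hN, _, γ, hγ⟩
    have hd : ((γ : M3 ℤ) * H).det ≠ 0 := by rw [Matrix.det_mul, γ.2, one_mul]; exact hN.1.det_pos.ne'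
    have hsub : (fun n => ((unm n : Γ3) : M3 ℤ) * ((γ : M3 ℤ) * H)) '' (uni x y : Set (ℤ × ℤ × ℤ)) ⊆
        {N | ∃ γ : Γ3, N = (γ : M3 ℤ) * H} ∩ {N : M3 ℤ | ∀ i j, |(N i j : ℝ)| ≤ 3 * rad t x y i} := by
      rintro _ ⟨n, hn, rfl⟩
      refine ⟨⟨unm n * γ, by simp [Matrix.mul_assoc]⟩, fun i j => ?_⟩
      have h1 := unm_rows t x y (rM γ * rM H) hγ n hn
      have h2 := row_le hW h1 i j
      rw [← rM_mul, ← rM_mul, rM_apply] at h2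
      exact h2
    have hc := Set.ncard_le_ncard hsub (b1.subset Set.inter_subset_right)
    rw [Set.ncard_image_of_injOn, Set.ncard_coe_finset, uni_card] at hc
    · exact_mod_cast hc
    · intro a _ b _ hab
      apply unm_inj
      apply Subtype.ext
      have hab' : ((unm a : Γ3) : M3 ℤ) * ((γ : M3 ℤ) * H) = ((unm b : Γ3) : M3 ℤ) * ((γ : M3 ℤ) * H) := hab
      have := congrArg (· * ((γ : M3 ℤ) * H).adjugate) hab'
      simp only [Matrix.mul_assoc _ ((γ : M3 ℤ) * H) _, Matrix.mul_adjugate, Matrix.mul_smul, Matrix.mul_one] at this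
      exact smul_right_injective _ hd this

/-- the matrix tail -/
theorem mtail (R T : ℝ) (hR : 0 < R) (hT : 0 < T) :
    ({H | H ∈ HN T ∧ ww R (rM H) ≠ 1}.ncard : ℝ) ≤ 7 ^ 9 * 128 ^ 3 * T ^ 3 * tl R := by
  set B := √(128 * T) with hB
  have hB0 : 0 < B := Real.sqrt_pos.2 (by positivity)
  have hB2 : B ^ 2 = 128 * T := Real.sq_sqrt (by positivity)
  choose t ht0 ht using fun k : ℕ × ℕ => exists_rad B hB0 k.1 k.2
  have := (cells_sum {H | H ∈ HN T ∧ ww R (rM H) ≠ 1} (fun k : ℕ × ℕ => Hcell R T (t k) k.1 k.2) ?_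
    (fun k => 7 ^ 9 * (B ^ 2) ^ 3 * (if R ≤ 11 * 16 ^ (k.1 + k.2) then (1 / 2 : ℝ) ^ (k.1 + k.2) else 0))
    (fun k => Hcell_card R T (t k) k.1 k.2 B (ht k)) ((tl_summable R).mul_left _)).2
  · rw [tsum_mul_left, hB2] at this
    refine this.trans (le_of_eq ?_)
    rw [tl]; ring
  · rintro H ⟨hH, hw⟩
    have hd : 0 < (rM H).det := by rw [rM_det]; exact_mod_cast hH.1.det_pos
    obtain ⟨γ, ρ, h0, h1, h2, h3, h4⟩ := reduction (rM H) hd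
    have hdT : (rM H).det < T := by rw [rM_det]; exact hH.2
    obtain ⟨x, y, hxy, hc⟩ := exists_cell ρ h0 h1 h2 B hB0 (by rw [hB2]; linarith)
    have hsk := skew hR (rM H) hd hw γ ρ h0 h1 h2 h3 h4
    refine ⟨(x, y), hH, ?_, γ, fun i => (h3 i).trans ?_⟩
    · refine hsk.trans ?_
      have p2 : 0 < ρ 2 := h0.trans_le (h1.trans h2)
      have := pow_le_pow_left₀ (by positivity) hxy 2
      rw [← pow_mul, mul_comm _ 2, pow_mul] at this
      norm_num at this ⊢
      exact this
    · have hi : 0 ≤ ρ i := by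
        fin_cases i
        · exact h0.le
        · exact (h0.trans_le h1).le
        · exact (h0.trans_le (h1.trans h2)).le
      exact pow_le_pow_left₀ hi (hc (t (x, y)) (ht0 _) (ht (x, y)) i) 2

end TC

open MvPolynomial

namespace TC
open Filter Topology MeasureTheory

theorem toR_act (γ : M3 ℤ) (c : Fin 10 → ℤ) : toR (act γ c) = act (rM γ) (toR c) :=
  map_act (Int.castRingHom ℝ) γ c

theorem toR_inj {c d : Fin 10 → ℤ} (h : toR c = toR d) : c = d := by
  funext k; have := congrFun h k; simpa [toR] using this

theorem irr_act (γ : Γ3) (c : Fin 10 → ℤ) (h : StronglyIrred c) : StronglyIrred (act (γ : M3 ℤ) c) := by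
  rw [stronglyIrred_iff] at h ⊢
  rintro ⟨v, hv, h1, h2⟩
  apply h
  set g : M3 ℚ := (γ : M3 ℤ).map (Int.castRingHom ℚ) with hg
  have hd : g.det = 1 := by
    rw [hg, ← RingHom.mapMatrix_apply, ← RingHom.map_det, γ.2, map_one]
  have e : (fun k => ((act (γ : M3 ℤ) c k : ℤ) : ℚ)) = act g (fun k => (c k : ℚ)) := map_act (Int.castRingHom ℚ) γ c
  rw [e] at h1 h2
  rw [ev_act] at h1
  rw [he_act, hd] at h2
  refine ⟨Matrix.vecMul v g, fun h0 => hv ?_, h1, by simpa using h2⟩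
  exact Matrix.eq_zero_of_vecMul_eq_zero (by rw [hd]; exact one_ne_zero) h0

theorem irr_cases (c : Fin 10 → ℤ) (h : StronglyIrred c) : c 0 ≠ 0 ∨ c 3 ≠ 0 ∨ (c 4 ≠ 0 ∧ c 5 ≠ 0) := by
  rw [stronglyIrred_iff] at h
  by_contra hh
  push Not at hh
  obtain ⟨h0, h3, h4⟩ := hh
  apply h
  refine ⟨![1, 0, 0], fun h => by simpa using congrFun h 0, ?_⟩
  have q0 : (c 0 : ℚ) = 0 := by exact_mod_cast h0
  have q3 : (c 3 : ℚ) = 0 := by exact_mod_cast h3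
  have q4 : (c 4 : ℚ) ^ 2 * c 5 = 0 := by
    by_cases h4' : c 4 = 0
    · simp [h4']
    · simp [h4 h4']
  refine ⟨by simp [ev, q0], ?_⟩
  have e2 : he (fun k => (c k : ℚ)) ![1,0,0] = - 8 * ((c 4 : ℚ) ^ 2 * c 5) := by
    simp [he, hm, Matrix.det_fin_three, q0, q3]; ring
  rw [e2, q4, mul_zero]

theorem orbit_eq {c c' d : Fin 10 → ℤ} (h : d ∈ orbitZ c) (h' : d ∈ orbitZ c') : orbitZ c = orbitZ c' := by
  have key : ∀ c c' : Fin 10 → ℤ, d ∈ orbitZ c → d ∈ orbitZ c' → orbitZ c ⊆ orbitZ c' := by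
    intro c c' h h' a ha
    rw [mem_orbitZ] at *
    obtain ⟨γ, h⟩ := h
    obtain ⟨γ', h'⟩ := h'
    obtain ⟨δ, ha⟩ := ha
    refine ⟨δ * γ⁻¹ * γ', ?_⟩
    rw [Matrix.SpecialLinearGroup.coe_mul, act_mul two_ne_zero, h', ← h, ← act_mul two_ne_zero, ← Matrix.SpecialLinearGroup.coe_mul]
    simpa using ha
  exact subset_antisymm (key c c' h h') (key c' c h' h)

theorem orbit_self (c : Fin 10 → ℤ) : c ∈ orbitZ c := by
  rw [mem_orbitZ]; exact ⟨1, by simpa using act_one two_ne_zero c⟩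

theorem wt_three (ρ : Fin 3 → ℝ) (j : Fin 10) : wt (fun i => 3 * ρ i) j = 27 * wt ρ j := by
  fin_cases j <;> simp [wt] <;> ring

theorem b3 {w : ℝ} (h : 1 ≤ w) : 2 * w + 1 ≤ 3 * w := by linarith

theorem fbox {a b c : ℝ} (ha : 0 < a) (hab : a ≤ b) (hbc : b ≤ c) :
    {f : Fin 10 → ℤ | (∀ j, |(f j : ℝ)| ≤ 27 * wt ![a ^ 2, b ^ 2, c ^ 2] j) ∧ (f 0 ≠ 0 ∨ f 3 ≠ 0 ∨ (f 4 ≠ 0 ∧ f 5 ≠ 0))}.Finite ∧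
    ({f : Fin 10 → ℤ | (∀ j, |(f j : ℝ)| ≤ 27 * wt ![a ^ 2, b ^ 2, c ^ 2] j) ∧ (f 0 ≠ 0 ∨ f 3 ≠ 0 ∨ (f 4 ≠ 0 ∧ f 5 ≠ 0))}.ncard : ℝ)
      ≤ 3 * (81 ^ 10 * (a ^ 17 * b ^ 20 * c ^ 23)) := by
  have hb : 0 < b := ha.trans_le hab
  have hc : 0 < c := hb.trans_le hbc
  have hac : a ≤ c := hab.trans hbc
  set ρ : Fin 3 → ℝ := ![a ^ 2, b ^ 2, c ^ 2] with hρ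
  set X := 81 ^ 10 * (a ^ 17 * b ^ 20 * c ^ 23) with hX
  have hX0 : 0 ≤ X := by positivity
  have w0 : ∀ j, 0 ≤ 27 * wt ρ j := by
    intro j; fin_cases j <;> simp [wt, ρ] <;> positivity
  have one : ∀ z : ℤ, z ≠ 0 → (1:ℝ) ≤ |(z:ℝ)| := fun z hz => by exact_mod_cast Int.one_le_abs hz
  -- the three boxes
  have case1 : {f : Fin 10 → ℤ | (∀ j, |(f j : ℝ)| ≤ 27 * wt ρ j) ∧ f 0 ≠ 0}.Finite ∧
      ({f : Fin 10 → ℤ | (∀ j, |(f j : ℝ)| ≤ 27 * wt ρ j) ∧ f 0 ≠ 0}.ncard : ℝ) ≤ X := by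
    obtain ⟨f1, f2⟩ := box_card (fun j => 27 * wt ρ j) w0
    have hsub : {f : Fin 10 → ℤ | (∀ j, |(f j : ℝ)| ≤ 27 * wt ρ j) ∧ f 0 ≠ 0} ⊆ {f | ∀ j, |(f j : ℝ)| ≤ 27 * wt ρ j} := fun f hf => hf.1
    refine ⟨f1.subset hsub, ?_⟩
    by_cases hne : {f : Fin 10 → ℤ | (∀ j, |(f j : ℝ)| ≤ 27 * wt ρ j) ∧ f 0 ≠ 0} = ∅
    · rw [hne]; simpa using hX0
    obtain ⟨f, hf, hf0⟩ := Set.nonempty_iff_ne_empty.2 hne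
    have k0 : 1 ≤ 27 * wt ρ 0 := (one _ hf0).trans (hf 0)
    have hm : ∀ j, 1 ≤ 27 * wt ρ j := by
      intro j
      refine k0.trans (mul_le_mul_of_nonneg_left ?_ (by norm_num))
      fin_cases j <;> simp [wt, ρ] <;> gcongr
    calc _ ≤ ({f : Fin 10 → ℤ | ∀ j, |(f j : ℝ)| ≤ 27 * wt ρ j}.ncard : ℝ) := by exact_mod_cast Set.ncard_le_ncard hsub f1
      _ ≤ _ := f2
      _ ≤ ∏ j, (3 * (27 * wt ρ j)) := Finset.prod_le_prod (fun j _ => by linarith [w0 j]) fun j _ => b3 (hm j)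
      _ = 81 ^ 10 * (a ^ 17 * b ^ 20 * (c ^ 20 * a ^ 3)) := by
          simp [Fin.prod_univ_succ, wt, ρ]; ring
      _ ≤ 81 ^ 10 * (a ^ 17 * b ^ 20 * (c ^ 20 * c ^ 3)) := by gcongr
      _ = X := by rw [hX]; ring
  have case2 : {f : Fin 10 → ℤ | (∀ j, |(f j : ℝ)| ≤ 27 * wt ρ j) ∧ f 0 = 0 ∧ f 3 ≠ 0}.Finite ∧
      ({f : Fin 10 → ℤ | (∀ j, |(f j : ℝ)| ≤ 27 * wt ρ j) ∧ f 0 = 0 ∧ f 3 ≠ 0}.ncard : ℝ) ≤ X := by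
    set W : Fin 10 → ℝ := fun j => if j = 0 then 0 else 27 * wt ρ j with hW
    have W0 : ∀ j, 0 ≤ W j := by intro j; rw [hW]; dsimp only; split_ifs; exacts [le_rfl, w0 j]
    obtain ⟨f1, f2⟩ := box_card W W0
    have hsub : {f : Fin 10 → ℤ | (∀ j, |(f j : ℝ)| ≤ 27 * wt ρ j) ∧ f 0 = 0 ∧ f 3 ≠ 0} ⊆ {f | ∀ j, |(f j : ℝ)| ≤ W j} := by
      rintro f ⟨h1, h2, -⟩ j
      rw [hW]; dsimp only
      split_ifs with h
      · rw [h, h2]; simp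
      · exact h1 j
    refine ⟨f1.subset hsub, ?_⟩
    by_cases hne : {f : Fin 10 → ℤ | (∀ j, |(f j : ℝ)| ≤ 27 * wt ρ j) ∧ f 0 = 0 ∧ f 3 ≠ 0} = ∅
    · rw [hne]; simpa using hX0
    obtain ⟨f, hf, hf0, hf3⟩ := Set.nonempty_iff_ne_empty.2 hne
    have k0 : 1 ≤ 27 * wt ρ 3 := (one _ hf3).trans (hf 3)
    have k0' : 1 ≤ 27 * (a ^ 4 * b ^ 2) := by
      have e : wt ρ 3 = a ^ 2 * a ^ 2 * b ^ 2 := rfl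
      rw [e] at k0
      refine k0.trans (le_of_eq ?_); ring
    have hm : ∀ j, j ≠ 0 → 1 ≤ 27 * wt ρ j := by
      intro j hj
      refine k0.trans (mul_le_mul_of_nonneg_left ?_ (by norm_num))
      fin_cases j
      · exact absurd rfl hj
      · show a ^ 2 * a ^ 2 * b ^ 2 ≤ b ^ 2 * b ^ 2 * b ^ 2
        gcongr
      · show a ^ 2 * a ^ 2 * b ^ 2 ≤ c ^ 2 * c ^ 2 * c ^ 2
        gcongr
      · exact le_rfl
      · show a ^ 2 * a ^ 2 * b ^ 2 ≤ a ^ 2 * a ^ 2 * c ^ 2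
        gcongr
      · show a ^ 2 * a ^ 2 * b ^ 2 ≤ b ^ 2 * b ^ 2 * a ^ 2
        calc a ^ 2 * a ^ 2 * b ^ 2 ≤ a ^ 2 * b ^ 2 * b ^ 2 := by gcongr
          _ = b ^ 2 * b ^ 2 * a ^ 2 := by ring
      · show a ^ 2 * a ^ 2 * b ^ 2 ≤ b ^ 2 * b ^ 2 * c ^ 2
        gcongr
      · show a ^ 2 * a ^ 2 * b ^ 2 ≤ c ^ 2 * c ^ 2 * a ^ 2
        calc a ^ 2 * a ^ 2 * b ^ 2 ≤ a ^ 2 * c ^ 2 * c ^ 2 := by gcongr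
          _ = c ^ 2 * c ^ 2 * a ^ 2 := by ring
      · show a ^ 2 * a ^ 2 * b ^ 2 ≤ c ^ 2 * c ^ 2 * b ^ 2
        gcongr
      · show a ^ 2 * a ^ 2 * b ^ 2 ≤ a ^ 2 * b ^ 2 * c ^ 2
        calc a ^ 2 * a ^ 2 * b ^ 2 ≤ a ^ 2 * c ^ 2 * b ^ 2 := by gcongr
          _ = a ^ 2 * b ^ 2 * c ^ 2 := by ring
    calc _ ≤ ({f : Fin 10 → ℤ | ∀ j, |(f j : ℝ)| ≤ W j}.ncard : ℝ) := by exact_mod_cast Set.ncard_le_ncard hsub f1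
      _ ≤ _ := f2
      _ ≤ ∏ j, (if j = 0 then 1 else 3 * (27 * wt ρ j)) := Finset.prod_le_prod (fun j _ => by linarith [W0 j]) fun j _ => by
          rw [hW]; dsimp only
          split_ifs with h
          · simp
          · exact b3 (hm j h)
      _ = 81 ^ 9 * (a ^ 14 * b ^ 20 * c ^ 20) * 1 := by
          simp [Fin.prod_univ_succ, wt, ρ]; ring
      _ ≤ 81 ^ 9 * (a ^ 14 * b ^ 20 * c ^ 20) * (81 * (a * a * a * c * c * c)) := by
          apply mul_le_mul_of_nonneg_left _ (by positivity)
          refine k0'.trans ?_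
          have : a ^ 4 * b ^ 2 ≤ a * a * a * c * c * c := by
            calc a ^ 4 * b ^ 2 = a * a * a * a * b * b := by ring
              _ ≤ _ := by gcongr
          have h2 : 0 ≤ a * a * a * c * c * c := by positivity
          linarith
      _ = X := by rw [hX]; ring
  have case3 : {f : Fin 10 → ℤ | (∀ j, |(f j : ℝ)| ≤ 27 * wt ρ j) ∧ f 0 = 0 ∧ f 3 = 0 ∧ f 4 ≠ 0 ∧ f 5 ≠ 0}.Finite ∧
      ({f : Fin 10 → ℤ | (∀ j, |(f j : ℝ)| ≤ 27 * wt ρ j) ∧ f 0 = 0 ∧ f 3 = 0 ∧ f 4 ≠ 0 ∧ f 5 ≠ 0}.ncard : ℝ) ≤ X := by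
    set W : Fin 10 → ℝ := fun j => if j = 0 ∨ j = 3 then 0 else 27 * wt ρ j with hW
    have W0 : ∀ j, 0 ≤ W j := by intro j; rw [hW]; dsimp only; split_ifs; exacts [le_rfl, w0 j]
    obtain ⟨f1, f2⟩ := box_card W W0
    have hsub : {f : Fin 10 → ℤ | (∀ j, |(f j : ℝ)| ≤ 27 * wt ρ j) ∧ f 0 = 0 ∧ f 3 = 0 ∧ f 4 ≠ 0 ∧ f 5 ≠ 0} ⊆ {f | ∀ j, |(f j : ℝ)| ≤ W j} := by
      rintro f ⟨h1, h2, h3, -⟩ j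
      rw [hW]; dsimp only
      split_ifs with h
      · rcases h with h | h
        · rw [h, h2]; simp
        · rw [h, h3]; simp
      · exact h1 j
    refine ⟨f1.subset hsub, ?_⟩
    by_cases hne : {f : Fin 10 → ℤ | (∀ j, |(f j : ℝ)| ≤ 27 * wt ρ j) ∧ f 0 = 0 ∧ f 3 = 0 ∧ f 4 ≠ 0 ∧ f 5 ≠ 0} = ∅
    · rw [hne]; simpa using hX0
    obtain ⟨f, hf, hf0, hf3, hf4, hf5⟩ := Set.nonempty_iff_ne_empty.2 hne
    have k4 : 1 ≤ 27 * wt ρ 4 := (one _ hf4).trans (hf 4)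
    have k5 : 1 ≤ 27 * wt ρ 5 := (one _ hf5).trans (hf 5)
    have k4' : 1 ≤ 6 * (a ^ 2 * c) := by
      apply le_of_sq_le_sq _ (by positivity)
      have e : wt ρ 4 = (a ^ 2 * c) ^ 2 := by simp [wt, ρ]; ring
      rw [e] at k4
      nlinarith [sq_nonneg (a ^ 2 * c)]
    have k5' : 1 ≤ 6 * (a * b ^ 2) := by
      apply le_of_sq_le_sq _ (by positivity)
      have e : wt ρ 5 = (a * b ^ 2) ^ 2 := by simp [wt, ρ]; ring
      rw [e] at k5
      nlinarith [sq_nonneg (a * b ^ 2)]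
    have hm : ∀ j, ¬ (j = 0 ∨ j = 3) → 1 ≤ 27 * wt ρ j := by
      intro j hj
      have v4 : wt ρ 4 = a ^ 2 * a ^ 2 * c ^ 2 := rfl
      have v5 : wt ρ 5 = b ^ 2 * b ^ 2 * a ^ 2 := rfl
      rw [v4] at k4
      rw [v5] at k5
      fin_cases j
      · exact absurd (Or.inl rfl) hj
      · refine k5.trans (mul_le_mul_of_nonneg_left ?_ (by norm_num)); simp [wt, ρ]; gcongr
      · refine k4.trans (mul_le_mul_of_nonneg_left ?_ (by norm_num)); simp [wt, ρ]; gcongr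
      · exact absurd (Or.inr rfl) hj
      · exact k4
      · exact k5
      · refine k5.trans (mul_le_mul_of_nonneg_left ?_ (by norm_num)); simp [wt, ρ]; gcongr
      · refine k5.trans (mul_le_mul_of_nonneg_left ?_ (by norm_num)); simp [wt, ρ]; gcongr
      · refine k5.trans (mul_le_mul_of_nonneg_left ?_ (by norm_num)); simp [wt, ρ]; gcongr
      · refine k4.trans (mul_le_mul_of_nonneg_left ?_ (by norm_num)); simp [wt, ρ]; gcongr
    calc _ ≤ ({f : Fin 10 → ℤ | ∀ j, |(f j : ℝ)| ≤ W j}.ncard : ℝ) := by exact_mod_cast Set.ncard_le_ncard hsub f1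
      _ ≤ _ := f2
      _ ≤ ∏ j, (if j = 0 ∨ j = 3 then 1 else 3 * (27 * wt ρ j)) := Finset.prod_le_prod (fun j _ => by linarith [W0 j]) fun j _ => by
          rw [hW]; dsimp only
          split_ifs with h
          · simp
          · exact b3 (hm j h)
      _ = 81 ^ 8 * (a ^ 10 * b ^ 18 * c ^ 20) * 1 := by
          have d : (fun j : Fin 10 => if j = 0 ∨ j = 3 then (1:ℝ) else 3 * (27 * wt ρ j)) =
              ![1, 3 * (27 * wt ρ 1), 3 * (27 * wt ρ 2), 1, 3 * (27 * wt ρ 4), 3 * (27 * wt ρ 5), 3 * (27 * wt ρ 6),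
                3 * (27 * wt ρ 7), 3 * (27 * wt ρ 8), 3 * (27 * wt ρ 9)] := by
            funext j; fin_cases j <;> rfl
          rw [d]
          simp [Fin.prod_univ_succ, wt, ρ]; ring
      _ ≤ 81 ^ 8 * (a ^ 10 * b ^ 18 * c ^ 20) * ((6 * (a ^ 2 * c)) ^ 3 * (6 * (a * b ^ 2))) := by
          apply mul_le_mul_of_nonneg_left _ (by positivity)
          exact one_le_mul_of_one_le_of_one_le (one_le_pow₀ k4') k5'
      _ = (81 ^ 8 * 6 ^ 4) * (a ^ 17 * b ^ 20 * c ^ 23) := by ring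
      _ ≤ X := by rw [hX]; apply mul_le_mul_of_nonneg_right _ (by positivity); norm_num
  set A1 := {f : Fin 10 → ℤ | (∀ j, |(f j : ℝ)| ≤ 27 * wt ρ j) ∧ f 0 ≠ 0} with hA1
  set A2 := {f : Fin 10 → ℤ | (∀ j, |(f j : ℝ)| ≤ 27 * wt ρ j) ∧ f 0 = 0 ∧ f 3 ≠ 0} with hA2
  set A3 := {f : Fin 10 → ℤ | (∀ j, |(f j : ℝ)| ≤ 27 * wt ρ j) ∧ f 0 = 0 ∧ f 3 = 0 ∧ f 4 ≠ 0 ∧ f 5 ≠ 0} with hA3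
  have hsub : {f : Fin 10 → ℤ | (∀ j, |(f j : ℝ)| ≤ 27 * wt ρ j) ∧ (f 0 ≠ 0 ∨ f 3 ≠ 0 ∨ (f 4 ≠ 0 ∧ f 5 ≠ 0))} ⊆ (A1 ∪ A2) ∪ A3 := by
    rintro f ⟨h1, h2⟩
    by_cases q0 : f 0 = 0
    · by_cases q3 : f 3 = 0
      · exact Or.inr ⟨h1, q0, q3, by tauto⟩
      · exact Or.inl (Or.inr ⟨h1, q0, q3⟩)
    · exact Or.inl (Or.inl ⟨h1, q0⟩)
  have hfin := (case1.1.union case2.1).union case3.1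
  refine ⟨hfin.subset hsub, ?_⟩
  have u1 := Set.ncard_le_ncard hsub hfin
  have u2 := Set.ncard_union_le (A1 ∪ A2) A3
  have u3 := Set.ncard_union_le A1 A2
  have u4 : (({f : Fin 10 → ℤ | (∀ j, |(f j : ℝ)| ≤ 27 * wt ρ j) ∧ (f 0 ≠ 0 ∨ f 3 ≠ 0 ∨ (f 4 ≠ 0 ∧ f 5 ≠ 0))}.ncard : ℕ) : ℝ) ≤ A1.ncard + A2.ncard + A3.ncard := by
    exact_mod_cast u1.trans (u2.trans (by omega))
  have := case1.2; have := case2.2; have := case3.2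
  linarith

end TC

open MvPolynomial

namespace TC
open Filter Topology MeasureTheory

theorem ww_smul (R : ℝ) (M : M3 ℝ) {t : ℝ} (ht : 0 < t) : ww R (t • M) = ww R M := by
  simp only [ww, Matrix.mul_smul, psi_smul R _ ht]

theorem coef_bound' {M : M3 ℝ} {ρ : Fin 3 → ℝ} (h0 : ∀ i, 0 ≤ ρ i) (k : ℝ) {s : ℝ} (hs0 : 0 < s) (hs3 : s ^ 3 = 18 * (1 + |k|))
    (h : ∀ i, gg (s • M) i i ≤ ρ i ^ 2) (j : Fin 10) : |act M (hs k) j| ≤ wt ρ j := by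
  have := coef_bound h0 h k j
  rw [act_smul_mat, Pi.smul_apply, smul_eq_mul, abs_mul, abs_of_pos (by positivity : 0 < s ^ 3), ← hs3] at this
  exact le_of_mul_le_mul_left this (by positivity)

/-- orbits of forms lying in a cell -/
def Fcell (R t : ℝ) (x y : ℕ) : Set (Set (Fin 10 → ℤ)) :=
  {O | ∃ c, StronglyIrred c ∧ O = orbitZ c ∧ R ≤ 11 * 16 ^ (x + y) ∧ ∃ (M : M3 ℝ) (k s : ℝ) (γ : Γ3), 0 < M.det ∧ k ≠ 1 ∧
    toR c = act M (hs k) ∧ 0 < s ∧ s ^ 3 = 18 * (1 + |k|) ∧ ∀ i, gg (rM γ * (s • M)) i i ≤ rad t x y i ^ 2}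

theorem fiber3 (M : M3 ℝ) (hM : 0 < M.det) (k : ℝ) (hk : k ≠ 1) (F : Finset (ℤ × ℤ × ℤ)) (g : Fin 10 → ℝ)
    (h : ∀ n ∈ F, act (rM (unm n) * M) (hs k) = g) : F.card ≤ 3 := by
  classical
  by_cases hF : F = ∅
  · simp [hF]
  obtain ⟨n0, hn0⟩ := Finset.nonempty_iff_ne_empty.2 hF
  have hd : ∀ n, 0 < (rM (unm n) * M).det := fun n => by rw [Matrix.det_mul, rM_det_SL, one_mul]; exact hM
  set N := rM (unm n0) * M with hN
  have : F.card ≤ ({N, N * Zc, N * (Zc * Zc)} : Finset (M3 ℝ)).card := by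
    refine Finset.card_le_card_of_injOn (fun n => rM (unm n) * M) ?_ ?_
    · intro n hn
      have := (hesse_fiber (hd n) (hd n0) hk ((h n hn).trans (h n0 hn0).symm)).2.2
      simpa using this
    · intro a _ b _ hab
      apply unm_inj
      apply Subtype.ext
      apply rM_inj
      have hu : IsUnit M.det := isUnit_iff_ne_zero.2 hM.ne'
      have := congrArg (· * M⁻¹) hab
      simpa [Matrix.mul_nonsing_inv_cancel_right _ _ hu] using this
  exact this.trans Finset.card_le_three

theorem Fcell_card (R t : ℝ) (ht : 0 < t) (x y : ℕ) (B : ℝ) (hB : t ^ 3 * (4 ^ x * 2 ^ y) = B) : (Fcell R t x y).Finite ∧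
    ((Fcell R t x y).ncard : ℝ) ≤ 9 * 81 ^ 10 * B ^ 20 * (if R ≤ 11 * 16 ^ (x + y) then (1 / 2 : ℝ) ^ (x + y) else 0) := by
  classical
  by_cases hne : Fcell R t x y = ∅
  · rw [hne]; simp; split_ifs <;> positivity
  obtain ⟨H0, c0, -, -, hR, -⟩ := Set.nonempty_iff_ne_empty.2 hne
  have hrad : rad t x y = ![t ^ 2, (2 ^ x * t) ^ 2, (2 ^ (x + y) * t) ^ 2] := by
    rw [rad, mul_pow, mul_pow, ← pow_mul, ← pow_mul, mul_comm x 2, mul_comm (x + y) 2, pow_mul, pow_mul]; norm_num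
  have o1 : (1:ℝ) ≤ 2 ^ x := one_le_pow₀ (by norm_num)
  have o2 : (2:ℝ) ^ x ≤ 2 ^ (x + y) := pow_le_pow_right₀ (by norm_num) (by omega)
  obtain ⟨b1, b2⟩ := fbox (a := t) (b := 2 ^ x * t) (c := 2 ^ (x + y) * t) ht (by nlinarith) (by nlinarith)
  rw [← hrad] at b1 b2
  have key := cell_count (Fcell R t x y) (fun O => O) ?_ _ b1 (16 ^ (x + y) / 3) (by positivity) ?_
  · obtain ⟨c1, c2⟩ := key
    refine ⟨c1, ?_⟩
    rw [if_pos hR]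
    have h3 : t ^ 17 * (2 ^ x * t) ^ 20 * (2 ^ (x + y) * t) ^ 23 = B ^ 20 * 8 ^ (x + y) := by
      have e4 : (4:ℝ) ^ x = (2 ^ x) ^ 2 := by rw [← pow_mul, mul_comm, pow_mul]; norm_num
      have e8 : (8:ℝ) ^ (x + y) = (2 ^ x * 2 ^ y) ^ 3 := by rw [← pow_add, ← pow_mul, mul_comm, pow_mul]; norm_num
      rw [← hB, e4, e8, pow_add]
      generalize (2:ℝ) ^ x = p
      generalize (2:ℝ) ^ y = q
      ring
    rw [h3] at b2
    have h4 := c2.trans b2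
    have h5 : ((1:ℝ) / 2) ^ (x + y) * 16 ^ (x + y) = 8 ^ (x + y) := by rw [← mul_pow]; norm_num
    set n := ((Fcell R t x y).ncard : ℝ) with hn
    have p : (0:ℝ) < 16 ^ (x + y) / 3 := by positivity
    refine le_of_mul_le_mul_left (h4.trans (le_of_eq ?_)) p
    rw [← h5]; ring
  · rintro _ ⟨c, -, rfl, -⟩ _ ⟨c', -, rfl, -⟩ hne'
    refine Set.disjoint_left.2 ?_
    intro d h1 h2
    exact hne' (orbit_eq h1 h2)
  · rintro _ ⟨c, hc, rfl, -, M, k, s, γ, hM, hk, hcM, hs0, hs3, hγ⟩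
    set G : ℤ × ℤ × ℤ → (Fin 10 → ℤ) := fun n => act ((unm n * γ : Γ3) : M3 ℤ) c with hG
    have hGR : ∀ n, toR (G n) = act (rM (unm n) * (rM γ * M)) (hs k) := by
      intro n
      rw [hG]; dsimp only
      rw [toR_act, hcM, Matrix.SpecialLinearGroup.coe_mul, rM_mul, ← act_mul two_ne_zero, Matrix.mul_assoc]
    have hsub : G '' (uni x y : Set (ℤ × ℤ × ℤ)) ⊆ orbitZ c ∩ {f : Fin 10 → ℤ | (∀ j, |(f j : ℝ)| ≤ 27 * wt (rad t x y) j) ∧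
        (f 0 ≠ 0 ∨ f 3 ≠ 0 ∨ (f 4 ≠ 0 ∧ f 5 ≠ 0))} := by
      rintro _ ⟨n, hn, rfl⟩
      refine ⟨(mem_orbitZ _ _).2 ⟨_, rfl⟩, fun j => ?_, irr_cases _ (irr_act _ _ hc)⟩
      have h1 := unm_rows t x y _ hγ n hn
      have h2 := coef_bound' (M := rM (unm n) * (rM γ * M)) (ρ := fun i => 3 * rad t x y i)
        (fun i => mul_nonneg (by norm_num) (rad_nonneg t x y i)) k hs0 hs3 (fun i => by
          have := h1 i
          rwa [Matrix.mul_smul, Matrix.mul_smul] at this) j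
      rw [← hGR, wt_three] at h2
      exact h2
    have hc := Set.ncard_le_ncard hsub (b1.subset Set.inter_subset_right)
    rw [← Finset.coe_image, Set.ncard_coe_finset] at hc
    have h3 := Finset.card_le_mul_card_image (f := G) (uni x y) 3 (by
      intro a _
      refine fiber3 (rM γ * M) (by rw [Matrix.det_mul, rM_det_SL, one_mul]; exact hM) k hk _ (toR a) ?_
      intro n hn
      rw [← hGR, (Finset.mem_filter.1 hn).2])
    rw [uni_card] at h3
    have h4 : (16:ℝ) ^ (x + y) ≤ 3 * ((uni x y).image G).card := by exact_mod_cast h3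
    have h5 : (((uni x y).image G).card : ℝ) ≤ _ := Nat.cast_le.2 hc
    rw [div_le_iff₀ (by norm_num)]
    linarith

/-- orbits of irreducible forms of bounded height that are not well balanced -/
def Skew (R T : ℝ) : Set (Set (Fin 10 → ℤ)) :=
  {O | ∃ c, StronglyIrred c ∧ ht (toR c) < T ^ 12 ∧ O = orbitZ c ∧ ∃ (M : M3 ℝ) (k : ℝ), 0 < M.det ∧ k ≠ 1 ∧
    toR c = act M (hs k) ∧ (ww R M ≠ 1 ∨ R ≤ 11)}

/-- the tail estimate for forms -/
theorem ftail : ∃ C : ℝ, 0 < C ∧ ∀ R T : ℝ, 0 < R → 0 < T → (Skew R T).Finite ∧ ((Skew R T).ncard : ℝ) ≤ C * T ^ 10 * tl R := by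
  obtain ⟨c0, hc0, hlow⟩ := ht_hs_lower
  set κ := min c0 1 with hκ
  have κ0 : 0 < κ := lt_min hc0 one_pos
  have κ1 : κ ≤ 1 := min_le_right _ _
  refine ⟨9 * 81 ^ 10 * (2304 / κ) ^ 10, by positivity, fun R T hR hT => ?_⟩
  set B := √(2304 * T / κ) with hB
  have hB0 : 0 < B := Real.sqrt_pos.2 (by positivity)
  have hB2 : B ^ 2 = 2304 * T / κ := Real.sq_sqrt (by positivity)
  choose t ht0 ht' using fun k : ℕ × ℕ => exists_rad B hB0 k.1 k.2
  have := cells_sum (Skew R T) (fun k : ℕ × ℕ => Fcell R (t k) k.1 k.2) ?_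
    (fun k => 9 * 81 ^ 10 * B ^ 20 * (if R ≤ 11 * 16 ^ (k.1 + k.2) then (1 / 2 : ℝ) ^ (k.1 + k.2) else 0))
    (fun k => Fcell_card R (t k) (ht0 k) k.1 k.2 B (ht' k)) ((tl_summable R).mul_left _)
  · refine ⟨this.1, this.2.trans (le_of_eq ?_)⟩
    rw [tsum_mul_left, show B ^ 20 = (B ^ 2) ^ 10 by ring, hB2, ← tl]; ring
  · rintro _ ⟨c, hirr, hht, rfl, M, k, hM, hk, hcM, hw⟩
    obtain ⟨s, hs3⟩ := exists_cbrt (18 * (1 + |k|))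
    have hs0 : 0 < s := by
      by_contra h
      push Not at h
      have h1 := pow_nonneg (neg_nonneg.2 h) 3
      have h2 := abs_nonneg k
      nlinarith
    have hd : 0 < (s • M).det := by rw [Matrix.det_smul]; simp; positivity
    obtain ⟨γ, ρ, h0, h1, h2, h3, h4⟩ := reduction (s • M) hd
    have hdT : κ * (M.det * (1 + |k|)) < T := by
      rw [hcM, ht_act M hM.ne'] at hht
      have hk0 := abs_nonneg k
      refine lt_of_pow_lt_pow_left₀ 12 hT.le (lt_of_le_of_lt ?_ hht)
      calc (κ * (M.det * (1 + |k|))) ^ 12 = κ ^ 12 * (M.det ^ 12 * (1 + |k|) ^ 12) := by ring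
        _ ≤ c0 * (M.det ^ 12 * (1 + |k|) ^ 12) := by
            gcongr
            exact (pow_le_of_le_one κ0.le κ1 (by norm_num)).trans (min_le_left _ _)
        _ = M.det ^ 12 * (c0 * (1 + |k|) ^ 12) := by ring
        _ ≤ _ := by gcongr; exact hlow k
    have hds : (s • M).det = 18 * (M.det * (1 + |k|)) := by
      rw [Matrix.det_smul]; simp [hs3]; ring
    obtain ⟨x, y, hxy, hc⟩ := exists_cell ρ h0 h1 h2 B hB0 (by
      rw [hB2, le_div_iff₀ κ0]; rw [hds] at h4; nlinarith)
    refine ⟨(x, y), c, hirr, rfl, ?_, M, k, s, γ, hM, hk, hcM, hs0, hs3, fun i => (h3 i).trans ?_⟩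
    · rcases hw with hw | hw
      · have hsk := skew hR (s • M) hd (by rwa [ww_smul R M hs0]) γ ρ h0 h1 h2 h3 h4
        refine hsk.trans ?_
        have p2 : 0 < ρ 2 := h0.trans_le (h1.trans h2)
        have := pow_le_pow_left₀ (by positivity) hxy 2
        rw [← pow_mul, mul_comm _ 2, pow_mul] at this
        norm_num at this ⊢
        exact this
      · refine hw.trans ?_
        have : (1:ℝ) ≤ 16 ^ (x + y) := one_le_pow₀ (by norm_num)
        linarith
    · have hi : 0 ≤ ρ i := by
        fin_cases i
        · exact h0.le
        · exact (h0.trans_le h1).le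
        · exact (h0.trans_le (h1.trans h2)).le
      exact pow_le_pow_left₀ hi (hc (t (x, y)) (ht0 _) (ht' (x, y)) i) 2

end TC

open MvPolynomial

namespace TC
open Filter Topology MeasureTheory

/-- the matrix with given entries, ordered to match the coefficients of cubic forms -/
def Mt {R : Type*} (p : Fin 9 → R) : M3 R := !![p 0, p 5, p 7; p 3, p 1, p 8; p 4, p 6, p 2]

def unMt {R : Type*} (M : M3 R) : Fin 9 → R := ![M 0 0, M 1 1, M 2 2, M 1 0, M 2 0, M 0 1, M 2 1, M 0 2, M 1 2]

theorem Mt_unMt {R : Type*} (M : M3 R) : Mt (unMt M) = M := by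
  ext i j; fin_cases i <;> fin_cases j <;> rfl

theorem unMt_Mt {R : Type*} (p : Fin 9 → R) : unMt (Mt p) = p := by
  funext i; fin_cases i <;> rfl

theorem Mt_smul (t : ℝ) (p : Fin 9 → ℝ) : Mt (t • p) = t • Mt p := by
  ext i j; fin_cases i <;> fin_cases j <;> rfl

theorem rM_Mt (k : Fin 9 → ℤ) : rM (Mt k) = Mt (fun i => (k i : ℝ)) := by
  ext i j; fin_cases i <;> fin_cases j <;> rfl

theorem Mt_cont : Continuous (Mt : (Fin 9 → ℝ) → M3 ℝ) := by
  refine continuous_matrix fun i j => ?_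
  fin_cases i <;> fin_cases j <;> exact continuous_apply _

theorem Mt_det_ae (c : ℝ) : ∀ᵐ p : Fin 9 → ℝ, (Mt p).det ≠ c := by
  have := ae_ne_of_poly (fun p : Fin 9 → ℝ => (Mt p).det - c) ((det_cont.comp Mt_cont).measurable.sub_const c)
    ![1,1,1,0,0,0,0,0,0] (by
      intro y
      refine ⟨Polynomial.X ^ 3 + Polynomial.C (y 0 + y 1 + y 2) * Polynomial.X ^ 2 + Polynomial.C
        (y 0 * y 1 + y 0 * y 2 + y 1 * y 2 - y 5 * y 3 - y 7 * y 4 - y 8 * y 6) * Polynomial.X + Polynomial.C ((Mt y).det - c), ?_, ?_⟩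
      · intro h
        have := congrArg (fun q => Polynomial.coeff q 3) h
        simp [Polynomial.coeff_X, Polynomial.coeff_C, -map_add, Polynomial.coeff_C_mul, Polynomial.coeff_X_pow] at this
      · intro t
        simp [Mt, Matrix.det_fin_three]; ring)
  filter_upwards [this] with p hp
  exact fun h => hp (by simp [h])

theorem norm_le_of_psi {R : ℝ} (hR : 0 < R) (p : Fin 9 → ℝ) (h : psi R (Mt p) ≠ 0) (h1 : (Mt p).det < 1) : ‖p‖ ≤ 2 * R + 1 := by
  obtain ⟨h2, h3⟩ := psi_supp h
  set u := √(fr (Mt p)) with hu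
  have hu0 : 0 ≤ u := Real.sqrt_nonneg _
  have h4 : u ≤ 2 * R + 1 := by
    by_contra hh
    push Not at hh
    have : u ≤ u ^ 3 := le_self_pow₀ (by linarith) (by norm_num)
    nlinarith
  rw [pi_norm_le_iff_of_nonneg (by positivity)]
  intro i
  rw [Real.norm_eq_abs]
  refine le_trans ?_ h4
  have := entry_le (Mt p)
  fin_cases i
  · exact this 0 0
  · exact this 1 1
  · exact this 2 2
  · exact this 1 0
  · exact this 2 0
  · exact this 0 1
  · exact this 2 1
  · exact this 0 2
  · exact this 1 2

noncomputable def gF (R : ℝ) (p : Fin 9 → ℝ) : ℝ := if (Mt p).det < 1 then psi R (Mt p) else 0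

noncomputable def gI (R : ℝ) : ℝ := ∫ p, gF R p

theorem gF_nonneg (R : ℝ) (p : Fin 9 → ℝ) : 0 ≤ gF R p := by
  rw [gF]; split_ifs; exacts [psi_nonneg _ _, le_rfl]

theorem gF_le {R : ℝ} (hR : 0 < R) (p : Fin 9 → ℝ) : gF R p ≤ 1 := by
  rw [gF]; split_ifs; exacts [psi_le_one hR _, zero_le_one]

theorem gF_supp {R : ℝ} (hR : 0 < R) (p : Fin 9 → ℝ) (h : 2 * R + 1 < ‖p‖) : gF R p = 0 := by
  rw [gF]; split_ifs with h1
  · by_contra h2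
    exact absurd (norm_le_of_psi hR p h2 h1) (not_le.2 h)
  · rfl

theorem gF_cont {R : ℝ} (hR : 0 < R) : ∀ᵐ p, ContinuousAt (gF R) p := by
  filter_upwards [Mt_det_ae 0, Mt_det_ae 1] with p h0 h1
  have hd : ContinuousAt (fun p => (Mt p).det) p := (det_cont.comp Mt_cont).continuousAt
  rcases lt_or_gt_of_ne h1 with h | h
  · have h2 : ContinuousAt (fun p => psi R (Mt p)) p :=
      ContinuousAt.comp (f := Mt) (g := psi R) (psi_cont' hR h0) Mt_cont.continuousAt
    refine h2.congr ?_
    filter_upwards [hd.eventually (gt_mem_nhds h)] with q hq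
    rw [gF, if_pos hq]
  · refine (continuousAt_const (y := (0:ℝ))).congr ?_
    filter_upwards [hd.eventually (lt_mem_nhds h)] with q hq
    rw [gF, if_neg (not_lt.2 hq.le)]

theorem gsum {R : ℝ} (s : ℝ) (hs : 0 < s) :
    ∑' k : Fin 9 → ℤ, gF R (fun i => s⁻¹ * (k i : ℝ)) = ∑' H : HN (s ^ 3), ww R (rM H) := by
  have hF : ∀ k : Fin 9 → ℤ, gF R (fun i => s⁻¹ * (k i : ℝ)) = if ((Mt k).det : ℝ) < s ^ 3 then psi R (rM (Mt k)) else 0 := by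
    intro k
    have e : (fun i => s⁻¹ * (k i : ℝ)) = s⁻¹ • (fun i => (k i : ℝ)) := rfl
    rw [gF, e, Mt_smul, psi_smul R _ (inv_pos.2 hs), ← rM_Mt]
    congr 1
    rw [Matrix.det_smul, rM_det]
    simp only [Fintype.card_fin, eq_iff_iff, inv_pow]
    rw [inv_mul_lt_iff₀ (by positivity), mul_one]
  let g : HN (s ^ 3) × Γ3 → (Fin 9 → ℤ) := fun x => unMt ((x.2 : M3 ℤ) * x.1)
  have hinj : Function.Injective g := by
    rintro ⟨⟨H, hH⟩, γ⟩ ⟨⟨H', hH'⟩, γ'⟩ h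
    have h1 : (γ : M3 ℤ) * H = (γ' : M3 ℤ) * H' := by
      have := congrArg Mt h
      simpa only [g, Mt_unMt] using this
    have h2 : H' = ((γ'⁻¹ * γ : Γ3) : M3 ℤ) * H := by
      rw [Matrix.SpecialLinearGroup.coe_mul, Matrix.mul_assoc, h1, ← Matrix.mul_assoc, ← Matrix.SpecialLinearGroup.coe_mul]
      simp
    have h3 := hnf_unique H (γ'⁻¹ * γ) hH.1 (by rw [← h2]; exact hH'.1)
    rw [h3] at h2
    have h4 : γ = γ' := by
      rw [inv_mul_eq_one] at h3; exact h3.symm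
    subst h4
    have h5 : H' = H := by simpa using h2
    subst h5
    rfl
  haveI : Fintype (HN (s ^ 3)) := (HN_finite (s ^ 3)).fintype
  have hval : ∀ x : HN (s ^ 3) × Γ3, gF R (fun i => s⁻¹ * (g x i : ℝ)) = psi R (rM x.2 * rM x.1) := by
    rintro ⟨⟨H, hH⟩, γ⟩
    rw [hF, if_pos]
    · simp only [g, Mt_unMt, rM_mul]
    · simp only [g, Mt_unMt, Matrix.det_mul, γ.2, one_mul]; exact hH.2
  have hpos : ∀ H : HN (s ^ 3), 0 < (rM (H : M3 ℤ)).det := fun H => by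
    rw [rM_det]; exact_mod_cast H.2.1.det_pos
  rw [← hinj.tsum_eq (f := fun k : Fin 9 → ℤ => gF R (fun i => s⁻¹ * (k i : ℝ)))]
  · simp only [hval]
    rw [Summable.tsum_prod]
    · rfl
    · apply summable_of_finite_support
      have : (⋃ H : HN (s ^ 3), (fun γ => (H, γ)) '' (Function.support fun γ : Γ3 => psi R (rM γ * rM H))).Finite :=
        Set.finite_iUnion fun H => (psi_fin R (rM H) (hpos H)).image _
      refine this.subset ?_
      rintro ⟨H, γ⟩ hx
      exact Set.mem_iUnion.2 ⟨H, γ, hx, rfl⟩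
  · intro k hk
    have hk' : gF R (fun i => s⁻¹ * (k i : ℝ)) ≠ 0 := hk
    rw [hF] at hk'
    split_ifs at hk' with h1
    · have h2 := (psi_supp hk').1
      rw [rM_det] at h2
      have h3 : 0 < (Mt k).det := by exact_mod_cast h2
      obtain ⟨γ, hγ⟩ := hnf_exists (Mt k) h3
      refine ⟨(⟨(γ : M3 ℤ) * Mt k, hγ, ?_⟩, γ⁻¹), ?_⟩
      · rw [Matrix.det_mul, γ.2, one_mul]; exact h1
      · have : ((γ⁻¹ : Γ3) : M3 ℤ) * ((γ : M3 ℤ) * Mt k) = Mt k := by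
          rw [← Matrix.mul_assoc, ← Matrix.SpecialLinearGroup.coe_mul]; simp
        simp only [g, this, unMt_Mt]
    · exact absurd rfl hk'

theorem gI_lim {R : ℝ} (hR : 0 < R) : Tendsto (fun s : ℝ => (∑' H : HN (s ^ 3), ww R (rM H)) / s ^ 9) atTop (𝓝 (gI R)) := by
  have := riemann (gF R) 1 (2 * R + 1) (fun p => by rw [abs_of_nonneg (gF_nonneg R p)]; exact gF_le hR p)
    (gF_supp hR) (gF_cont hR) (l := (atTop : Filter ℝ)) (fun s _ => s⁻¹)
    (by filter_upwards [eventually_gt_atTop 0] with s hs i; exact inv_pos.2 hs)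
    (tendsto_pi_nhds.2 fun i => tendsto_inv_atTop_zero) (fun s k i => s⁻¹ * (k i : ℝ)) (fun _ => 0) tendsto_const_nhds
    (by simp)
  refine this.congr' ?_
  filter_upwards [eventually_gt_atTop 0] with s hs
  rw [gsum s hs]
  simp [Finset.prod_const]; field_simp

theorem gI_close {R : ℝ} (hR : 0 < R) : |gI R - zeta2 * zeta3 / 3| ≤ 7 ^ 9 * 128 ^ 3 * tl R := by
  have h1 : Tendsto (fun s : ℝ => hnfCount (s ^ 3) / s ^ 9) atTop (𝓝 (zeta2 * zeta3 / 3)) := by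
    have := hnfCount_tendsto.comp (tendsto_pow_atTop (α := ℝ) (n := 3) (by norm_num))
    refine this.congr fun s => ?_
    simp only [Function.comp]; rw [← pow_mul]
  refine le_of_tendsto ((gI_lim hR).sub h1).abs ?_
  filter_upwards [eventually_gt_atTop 0] with s hs
  rw [← sub_div, abs_div, abs_of_pos (by positivity : 0 < s ^ 9), div_le_iff₀ (by positivity), ← HN_card]
  have hm := mtail R (s ^ 3) hR (by positivity)
  rw [← pow_mul] at hm
  refine le_trans ?_ (hm.trans (le_of_eq (by ring)))
  haveI : Fintype (HN (s ^ 3)) := (HN_finite (s ^ 3)).fintype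
  classical
  have hpos : ∀ H : HN (s ^ 3), 0 < (rM (H : M3 ℤ)).det := fun H => by
    rw [rM_det]; exact_mod_cast H.2.1.det_pos
  have e1 : ((HN (s ^ 3)).ncard : ℝ) = ∑ H : HN (s ^ 3), (1:ℝ) := by
    rw [Set.ncard_eq_toFinset_card']; simp
  have e2 : ({H | H ∈ HN (s ^ 3) ∧ ww R (rM H) ≠ 1}.ncard : ℝ) = ∑ H : HN (s ^ 3), if ww R (rM H) ≠ 1 then (1:ℝ) else 0 := by
    rw [Finset.sum_boole]
    have : {H | H ∈ HN (s ^ 3) ∧ ww R (rM H) ≠ 1} = Subtype.val '' ({H : HN (s ^ 3) | ww R (rM H) ≠ 1}) := by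
      ext H; simp [and_comm]
    rw [this, Set.ncard_image_of_injective _ Subtype.val_injective, Set.ncard_eq_toFinset_card']
    simp
  rw [tsum_fintype, e1, e2, ← Finset.sum_sub_distrib]
  refine (Finset.abs_sum_le_sum_abs _ _).trans (Finset.sum_le_sum fun H _ => ?_)
  split_ifs with h
  · have a1 := ww_nonneg R (rM (H : M3 ℤ))
    have a2 := ww_le_one hR (rM (H : M3 ℤ))
    rw [abs_le]; constructor <;> linarith
  · push Not at h
    rw [h]; simp

theorem gI_tendsto : Tendsto gI atTop (𝓝 (zeta2 * zeta3 / 3)) := by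
  rw [tendsto_iff_dist_tendsto_zero]
  have := tl_tendsto.const_mul (7 ^ 9 * 128 ^ 3)
  rw [mul_zero] at this
  refine squeeze_zero' (Eventually.of_forall fun _ => dist_nonneg) ?_ this
  filter_upwards [eventually_gt_atTop 0] with R hR
  exact gI_close hR

end TC

open MvPolynomial

namespace TC
open Filter Topology MeasureTheory

/-- a multiplicative function is a power of the determinant once this holds on diagonal matrices -/
theorem char_eq (χ : M3 ℝ →* ℝ) (n : ℕ) (h : ∀ D : Fin 3 → ℝ, χ (Matrix.diagonal D) = (∏ i, D i) ^ n) (M : M3 ℝ) (hM : M.det ≠ 0) :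
    χ M = M.det ^ n := by
  refine Matrix.diagonal_transvection_induction_of_det_ne_zero (fun M => χ M = M.det ^ n) M hM ?_ ?_ ?_
  · intro D _; rw [h, Matrix.det_diagonal]
  · rintro ⟨i, j, hij, c⟩
    simp only [Matrix.TransvectionStruct.toMatrix_mk, Matrix.det_transvection_of_ne _ _ hij, one_pow]
    have h1 : Matrix.diagonal (Function.update (1 : Fin 3 → ℝ) i 2) * Matrix.transvection i j c =
        Matrix.transvection i j (c + c) * Matrix.diagonal (Function.update (1 : Fin 3 → ℝ) i 2) := by
      ext a b
      rw [Matrix.diagonal_mul, Matrix.mul_diagonal, Matrix.transvection, Matrix.transvection]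
      by_cases ha : a = i
      · subst ha
        by_cases hb : b = j
        · subst hb; simp [hij, hij.symm, Matrix.one_apply]; ring
        · by_cases hb' : b = a
          · subst hb'; simp [hij, hij.symm]
          · simp [hb, Ne.symm hb, Ne.symm hb', hb', Matrix.one_apply]
      · by_cases hb' : b = a
        · subst hb'; simp [ha, Ne.symm ha, Matrix.one_apply]
        · simp [ha, Ne.symm ha, hb', Ne.symm hb', Matrix.one_apply]
    have h2 := congrArg χ h1
    rw [← Matrix.transvection_mul_transvection_same i j hij, map_mul, map_mul, map_mul] at h2
    have h3 : χ (Matrix.diagonal (Function.update (1 : Fin 3 → ℝ) i 2)) ≠ 0 := by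
      rw [h]; apply pow_ne_zero
      rw [Finset.prod_ne_zero_iff]
      intro a _
      by_cases ha : a = i
      · subst ha; simp
      · simp [ha]
    have h4 : χ (Matrix.transvection i j c) ≠ 0 := by
      intro h0
      have := congrArg χ (Matrix.transvection_mul_transvection_same i j hij c (-c))
      rw [map_mul, h0] at this
      simp at this
    set u := χ (Matrix.transvection i j c)
    have h5 : u * (χ (Matrix.diagonal (Function.update (1 : Fin 3 → ℝ) i 2))) * (1 - u) = 0 := by linear_combination h2
    have h6 := (mul_eq_zero.1 h5).resolve_left (mul_ne_zero h4 h3)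
    linarith
  · intro A B _ _ h1 h2
    rw [map_mul, h1, h2, Matrix.det_mul, mul_pow]

def Mp (p : Fin 10 → ℝ) : M3 ℝ := !![p 0, p 5, p 7; p 3, p 1, p 8; p 4, p 6, p 2]

/-- the Hesse parametrisation -/
def Phi (p : Fin 10 → ℝ) : Fin 10 → ℝ := act (Mp p) (hs (p 9))

def pk (M : M3 ℝ) (k : ℝ) : Fin 10 → ℝ := ![M 0 0, M 1 1, M 2 2, M 1 0, M 2 0, M 0 1, M 2 1, M 0 2, M 1 2, k]

theorem Mp_pk (M : M3 ℝ) (k : ℝ) : Mp (pk M k) = M := by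
  ext i j; fin_cases i <;> fin_cases j <;> rfl

theorem pk_Mp (p : Fin 10 → ℝ) : pk (Mp p) (p 9) = p := by
  funext i; fin_cases i <;> rfl

theorem Phi_pk (M : M3 ℝ) (k : ℝ) : Phi (pk M k) = act M (hs k) := by
  rw [Phi, Mp_pk]; rfl

theorem pk_add (M N : M3 ℝ) (k l : ℝ) : pk (M + N) (k + l) = pk M k + pk N l := by
  funext i; fin_cases i <;> rfl

theorem pk_smul (t : ℝ) (M : M3 ℝ) (k : ℝ) : pk (t • M) (t * k) = t • pk M k := by
  funext i; fin_cases i <;> rfl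

theorem Mp_add (p q : Fin 10 → ℝ) : Mp (p + q) = Mp p + Mp q := by
  ext i j; fin_cases i <;> fin_cases j <;> rfl

theorem Mp_smul (t : ℝ) (p : Fin 10 → ℝ) : Mp (t • p) = t • Mp p := by
  ext i j; fin_cases i <;> fin_cases j <;> rfl

theorem Mp_cont : Continuous Mp := by
  refine continuous_matrix fun i j => ?_
  fin_cases i <;> fin_cases j <;> exact continuous_apply _

/-- left translation -/
def Lt (M : M3 ℝ) : (Fin 10 → ℝ) →ₗ[ℝ] (Fin 10 → ℝ) where
  toFun p := pk (M * Mp p) (p 9)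
  map_add' p q := by rw [Mp_add, Matrix.mul_add, Pi.add_apply, pk_add]
  map_smul' t p := by rw [Mp_smul, Matrix.mul_smul, Pi.smul_apply, smul_eq_mul, pk_smul]; rfl

def Rt (M : M3 ℝ) : (Fin 10 → ℝ) →ₗ[ℝ] (Fin 10 → ℝ) where
  toFun := act M
  map_add' := act_add M
  map_smul' := act_smul M

theorem Phi_Lt (M : M3 ℝ) (p : Fin 10 → ℝ) : Phi (Lt M p) = Rt M (Phi p) := by
  show Phi (pk (M * Mp p) (p 9)) = act M (Phi p)
  rw [Phi_pk, act_mul two_ne_zero, Phi]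

noncomputable def chiL : M3 ℝ →* ℝ := LinearMap.det.comp
  { toFun := Lt
    map_one' := by
      apply LinearMap.ext; intro p
      show pk (1 * Mp p) (p 9) = p
      rw [Matrix.one_mul, pk_Mp]
    map_mul' := fun M N => by
      apply LinearMap.ext; intro p
      show pk (M * N * Mp p) (p 9) = pk (M * Mp (pk (N * Mp p) (p 9))) (pk (N * Mp p) (p 9) 9)
      rw [Mp_pk, Matrix.mul_assoc]; rfl }

noncomputable def chiR : M3 ℝ →* ℝ := LinearMap.det.comp
  { toFun := Rt
    map_one' := LinearMap.ext fun p => act_one two_ne_zero p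
    map_mul' := fun M N => LinearMap.ext fun p => act_mul two_ne_zero M N p }

theorem det_diag_aux (f : (Fin 10 → ℝ) →ₗ[ℝ] (Fin 10 → ℝ)) (w : Fin 10 → ℝ) (h : ∀ p j, f p j = w j * p j) :
    LinearMap.det f = ∏ j, w j := by
  have : f = Matrix.toLin' (Matrix.diagonal w) := by
    apply LinearMap.ext; intro p
    funext j
    rw [h, Matrix.toLin'_apply, Matrix.mulVec_diagonal]
  rw [this, LinearMap.det_toLin', Matrix.det_diagonal]

theorem det_Lt (M : M3 ℝ) (hM : M.det ≠ 0) : LinearMap.det (Lt M) = M.det ^ 3 := by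
  refine char_eq chiL 3 (fun D => ?_) M hM
  show LinearMap.det (Lt (Matrix.diagonal D)) = _
  rw [det_diag_aux _ ![D 0, D 1, D 2, D 1, D 2, D 0, D 2, D 0, D 1, 1]]
  · simp [Fin.prod_univ_succ]; ring
  · intro p j
    show pk (Matrix.diagonal D * Mp p) (p 9) j = _
    fin_cases j <;> simp [pk, Mp, Matrix.diagonal_mul]

theorem det_Rt (M : M3 ℝ) (hM : M.det ≠ 0) : LinearMap.det (Rt M) = M.det ^ 10 := by
  refine char_eq chiR 10 (fun D => ?_) M hM
  show LinearMap.det (Rt (Matrix.diagonal D)) = _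
  rw [det_diag_aux _ ![D 0 ^ 3, D 1 ^ 3, D 2 ^ 3, D 0 ^ 2 * D 1, D 0 ^ 2 * D 2, D 1 ^ 2 * D 0, D 1 ^ 2 * D 2, D 2 ^ 2 * D 0, D 2 ^ 2 * D 1, D 0 * D 1 * D 2]]
  · simp [Fin.prod_univ_succ]; ring
  · intro p j
    show act (Matrix.diagonal D) p j = _
    fin_cases j <;> simp [act, ev, dv, tri, gr, hm, Matrix.diagonal] <;> ring

theorem Phi_contDiff : ContDiff ℝ 1 Phi := by
  have h : ∀ i, ContDiff ℝ 1 fun p : Fin 10 → ℝ => p i := fun i => contDiff_apply ℝ ℝ i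
  rw [contDiff_pi]
  intro i
  fin_cases i <;> simp [Phi, act, ev_hs, dv_hs, tri_hs, Mp] <;> fun_prop

theorem Phi_deriv (p : Fin 10 → ℝ) : HasStrictFDerivAt Phi (fderiv ℝ Phi p) p :=
  Phi_contDiff.contDiffAt.hasStrictFDerivAt one_ne_zero

theorem cub_deriv {E : Type*} [NormedAddCommGroup E] [NormedSpace ℝ E] (F : ℝ → E) (a b c d : E)
    (h : ∀ t, F t = a + t • b + t ^ 2 • c + t ^ 3 • d) : HasDerivAt F b 0 := by
  have e : F = fun t => a + t • b + t ^ 2 • c + t ^ 3 • d := funext h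
  rw [e]
  have h1 := (((hasDerivAt_id (0:ℝ)).smul_const b).const_add a)
  have h2 := ((hasDerivAt_pow 2 (0:ℝ)).smul_const c)
  have h3 := ((hasDerivAt_pow 3 (0:ℝ)).smul_const d)
  have := (h1.add h2).add h3
  refine HasDerivAt.congr_deriv this ?_
  simp

def Acol (k : ℝ) : Fin 10 → Fin 10 → ℝ := ![![3,0,0,0,0,0,0,0,0,-3*k], ![0,3,0,0,0,0,0,0,0,-3*k], ![0,0,3,0,0,0,0,0,0,-3*k],
  ![0,0,0,3,0,0,-3*k,0,0,0], ![0,0,0,0,3,0,0,0,-3*k,0], ![0,0,0,0,-3*k,3,0,0,0,0], ![0,0,0,0,0,0,3,-3*k,0,0],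
  ![0,0,0,-3*k,0,0,0,3,0,0], ![0,0,0,0,0,-3*k,0,0,3,0], ![0,0,0,0,0,0,0,0,0,-3]]

def E1 (k x y z : ℝ) : ℝ := x * x * x + y * y * y + z * z * z - 3 * k * (x * y * z)
def E2 (k x y z a b c : ℝ) : ℝ := 3 * (x * x * a + y * y * b + z * z * c) - 3 * k * (y * z * a + x * z * b + x * y * c)
def E3 (k x y z a b c u v w : ℝ) : ℝ := 6 * (x * a * u + y * b * v + z * c * w)
  - 3 * k * (x * b * w + x * c * v + y * a * w + y * c * u + z * a * v + z * b * u)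

theorem Phi_vec (a0 a1 a2 a3 a4 a5 a6 a7 a8 k : ℝ) : Phi ![a0,a1,a2,a3,a4,a5,a6,a7,a8,k] =
    ![E1 k a0 a5 a7, E1 k a3 a1 a8, E1 k a4 a6 a2, E2 k a0 a5 a7 a3 a1 a8, E2 k a0 a5 a7 a4 a6 a2,
      E2 k a3 a1 a8 a0 a5 a7, E2 k a3 a1 a8 a4 a6 a2, E2 k a4 a6 a2 a0 a5 a7, E2 k a4 a6 a2 a3 a1 a8,
      E3 k a0 a5 a7 a3 a1 a8 a4 a6 a2] := by
  have h9 : (![a0,a1,a2,a3,a4,a5,a6,a7,a8,k] : Fin 10 → ℝ) 9 = k := rfl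
  have hM : Mp ![a0,a1,a2,a3,a4,a5,a6,a7,a8,k] = !![a0,a5,a7;a3,a1,a8;a4,a6,a2] := rfl
  rw [Phi, h9, hM]
  simp only [act, ev_hs, dv_hs, tri_hs]
  funext i
  fin_cases i <;> simp [E1, E2, E3] <;> ring

theorem Phi_col (k : ℝ) (j : Fin 10) : fderiv ℝ Phi (pk 1 k) (Pi.single j 1) = Acol k j := by
  have key : ∀ q : ℝ → Fin 10 → ℝ, ∀ c d : Fin 10 → ℝ, (∀ t i, (pk 1 k) i + t * (Pi.single j (1:ℝ) : Fin 10 → ℝ) i = q t i) →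
      (∀ (t : ℝ) i, Phi (q t) i = hs k i + t * Acol k j i + t ^ 2 * c i + t ^ 3 * d i) →
      fderiv ℝ Phi (pk 1 k) (Pi.single j 1) = Acol k j := by
    intro q c d h0 h
    have h' : ∀ t : ℝ, Phi (pk 1 k + t • Pi.single j 1) = hs k + t • Acol k j + t ^ 2 • c + t ^ 3 • d := by
      intro t
      have : pk 1 k + t • Pi.single j 1 = q t := funext fun i => h0 t i
      rw [this]; exact funext fun i => h t i
    have h1 := cub_deriv _ _ _ _ _ h'
    have h2 := ((Phi_deriv (pk 1 k)).hasFDerivAt.hasLineDerivAt (Pi.single j 1))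
    exact HasDerivAt.unique h2 h1
  have p1 : pk 1 k = ![1,1,1,0,0,0,0,0,0,k] := by funext i; fin_cases i <;> rfl
  rw [p1] at key ⊢
  fin_cases j
  · refine key (fun t => ![1+t,1,1,0,0,0,0,0,0,k]) ![3,0,0,0,0,0,0,0,0,0] ![1,0,0,0,0,0,0,0,0,0] (fun t i => ?_) fun t i => ?_
    · fin_cases i <;> simp
    · rw [Phi_vec]; fin_cases i <;> simp [E1, E2, E3, hs, Acol] <;> ring
  · refine key (fun t => ![1,1+t,1,0,0,0,0,0,0,k]) ![0,3,0,0,0,0,0,0,0,0] ![0,1,0,0,0,0,0,0,0,0] (fun t i => ?_) fun t i => ?_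
    · fin_cases i <;> simp
    · rw [Phi_vec]; fin_cases i <;> simp [E1, E2, E3, hs, Acol] <;> ring
  · refine key (fun t => ![1,1,1+t,0,0,0,0,0,0,k]) ![0,0,3,0,0,0,0,0,0,0] ![0,0,1,0,0,0,0,0,0,0] (fun t i => ?_) fun t i => ?_
    · fin_cases i <;> simp
    · rw [Phi_vec]; fin_cases i <;> simp [E1, E2, E3, hs, Acol] <;> ring
  · refine key (fun t => ![1,1,1,t,0,0,0,0,0,k]) ![0,0,0,0,0,3,0,0,0,0] ![0,1,0,0,0,0,0,0,0,0] (fun t i => ?_) fun t i => ?_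
    · fin_cases i <;> simp
    · rw [Phi_vec]; fin_cases i <;> simp [E1, E2, E3, hs, Acol] <;> ring
  · refine key (fun t => ![1,1,1,0,t,0,0,0,0,k]) ![0,0,0,0,0,0,0,3,0,0] ![0,0,1,0,0,0,0,0,0,0] (fun t i => ?_) fun t i => ?_
    · fin_cases i <;> simp
    · rw [Phi_vec]; fin_cases i <;> simp [E1, E2, E3, hs, Acol] <;> ring
  · refine key (fun t => ![1,1,1,0,0,t,0,0,0,k]) ![0,0,0,3,0,0,0,0,0,0] ![1,0,0,0,0,0,0,0,0,0] (fun t i => ?_) fun t i => ?_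
    · fin_cases i <;> simp
    · rw [Phi_vec]; fin_cases i <;> simp [E1, E2, E3, hs, Acol] <;> ring
  · refine key (fun t => ![1,1,1,0,0,0,t,0,0,k]) ![0,0,0,0,0,0,0,0,3,0] ![0,0,1,0,0,0,0,0,0,0] (fun t i => ?_) fun t i => ?_
    · fin_cases i <;> simp
    · rw [Phi_vec]; fin_cases i <;> simp [E1, E2, E3, hs, Acol] <;> ring
  · refine key (fun t => ![1,1,1,0,0,0,0,t,0,k]) ![0,0,0,0,3,0,0,0,0,0] ![1,0,0,0,0,0,0,0,0,0] (fun t i => ?_) fun t i => ?_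
    · fin_cases i <;> simp
    · rw [Phi_vec]; fin_cases i <;> simp [E1, E2, E3, hs, Acol] <;> ring
  · refine key (fun t => ![1,1,1,0,0,0,0,0,t,k]) ![0,0,0,0,0,0,3,0,0,0] ![0,1,0,0,0,0,0,0,0,0] (fun t i => ?_) fun t i => ?_
    · fin_cases i <;> simp
    · rw [Phi_vec]; fin_cases i <;> simp [E1, E2, E3, hs, Acol] <;> ring
  · refine key (fun t => ![1,1,1,0,0,0,0,0,0,k+t]) ![0,0,0,0,0,0,0,0,0,0] ![0,0,0,0,0,0,0,0,0,0] (fun t i => ?_) fun t i => ?_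
    · fin_cases i <;> simp
    · rw [Phi_vec]; fin_cases i <;> simp [E1, E2, E3, hs, Acol] <;> ring

end TC

open MvPolynomial

namespace TC
open Filter Topology MeasureTheory

def gperm : Fin 4 ⊕ (Fin 3 ⊕ Fin 3) → Fin 10 := Sum.elim ![0,1,2,9] (Sum.elim ![3,6,7] ![4,8,5])

theorem gperm_bij : Function.Bijective gperm := by decide

theorem Acol_det (k : ℝ) : (Matrix.of (Acol k)).det = -59049 * (1 - k ^ 3) ^ 2 := by
  rw [← Matrix.det_submatrix_equiv_self (Equiv.ofBijective gperm gperm_bij)]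
  have h : (Matrix.of (Acol k)).submatrix (Equiv.ofBijective gperm gperm_bij) (Equiv.ofBijective gperm gperm_bij) =
      Matrix.fromBlocks !![3,0,0,-3*k;0,3,0,-3*k;0,0,3,-3*k;0,0,0,-3] 0 0
        (Matrix.fromBlocks !![3,-3*k,0;0,3,-3*k;-3*k,0,3] 0 0 !![3,-3*k,0;0,3,-3*k;-3*k,0,3]) := by
    ext i j
    rcases i with i | i | i <;> rcases j with j | j | j <;> fin_cases i <;> fin_cases j <;> rfl
  rw [h, Matrix.det_fromBlocks_zero₂₁, Matrix.det_fromBlocks_zero₂₁]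
  have h4 : (!![3,0,0,-3*k;0,3,0,-3*k;0,0,3,-3*k;0,0,0,-3] : Matrix (Fin 4) (Fin 4) ℝ).det = -81 := by
    rw [Matrix.det_of_upperTriangular]
    · simp [Fin.prod_univ_succ]; norm_num
    · intro i j hij
      fin_cases i <;> fin_cases j <;> simp at hij ⊢
  rw [h4, Matrix.det_fin_three]
  simp; ring

theorem det_Phi_one (k : ℝ) : (fderiv ℝ Phi (pk 1 k)).det = -59049 * (1 - k ^ 3) ^ 2 := by
  rw [← Acol_det, ← Matrix.det_transpose]
  show LinearMap.det (fderiv ℝ Phi (pk 1 k) : (Fin 10 → ℝ) →ₗ[ℝ] (Fin 10 → ℝ)) = _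
  rw [← LinearMap.det_toMatrix']
  congr 1
  ext i j
  rw [LinearMap.toMatrix'_apply, Matrix.transpose_apply, Matrix.of_apply, ← Phi_col k j]
  congr 2

theorem det_Phi (p : Fin 10 → ℝ) (hp : (Mp p).det ≠ 0) :
    (fderiv ℝ Phi p).det = -59049 * (1 - (p 9) ^ 3) ^ 2 * (Mp p).det ^ 7 := by
  set M := Mp p with hM
  set k := p 9
  have e1 : Lt M (pk 1 k) = p := by
    show pk (M * Mp (pk 1 k)) k = p
    rw [Mp_pk, mul_one]; exact pk_Mp p
  have d1 : HasFDerivAt (fun q => Phi (Lt M q)) ((fderiv ℝ Phi p).comp (LinearMap.toContinuousLinearMap (Lt M))) (pk 1 k) := by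
    refine HasFDerivAt.comp (g := Phi) (pk 1 k) ?_ (LinearMap.toContinuousLinearMap (Lt M)).hasFDerivAt
    have := (Phi_deriv p).hasFDerivAt
    show HasFDerivAt Phi (fderiv ℝ Phi p) (Lt M (pk 1 k))
    rw [e1]; exact this
  have d2 : HasFDerivAt (fun q => Rt M (Phi q)) ((LinearMap.toContinuousLinearMap (Rt M)).comp (fderiv ℝ Phi (pk 1 k))) (pk 1 k) :=
    HasFDerivAt.comp (pk 1 k) (LinearMap.toContinuousLinearMap (Rt M)).hasFDerivAt (Phi_deriv _).hasFDerivAt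
  have e2 : (fun q => Phi (Lt M q)) = fun q => Rt M (Phi q) := funext (Phi_Lt M)
  rw [e2] at d1
  have e3 := d1.unique d2
  have e4 := congrArg (fun A : (Fin 10 → ℝ) →L[ℝ] (Fin 10 → ℝ) => LinearMap.det (A : (Fin 10 → ℝ) →ₗ[ℝ] (Fin 10 → ℝ))) e3
  have e5 : LinearMap.det ((fderiv ℝ Phi p : (Fin 10 → ℝ) →ₗ[ℝ] (Fin 10 → ℝ)) ∘ₗ Lt M) =
    LinearMap.det (Rt M ∘ₗ (fderiv ℝ Phi (pk 1 k) : (Fin 10 → ℝ) →ₗ[ℝ] (Fin 10 → ℝ))) := e4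
  rw [LinearMap.det_comp, LinearMap.det_comp, det_Lt M hp, det_Rt M hp] at e5
  have e6 := det_Phi_one k
  change LinearMap.det (fderiv ℝ Phi (pk 1 k) : (Fin 10 → ℝ) →ₗ[ℝ] (Fin 10 → ℝ)) = _ at e6
  rw [e6] at e5
  show LinearMap.det (fderiv ℝ Phi p : (Fin 10 → ℝ) →ₗ[ℝ] (Fin 10 → ℝ)) = _
  have : M.det ^ 3 ≠ 0 := pow_ne_zero _ hp
  apply mul_right_cancel₀ this
  rw [e5]; ring

end TC

open MvPolynomial

namespace TC
open Filter Topology MeasureTheory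

def VV : Set (Fin 10 → ℝ) := {p | 0 < (Mp p).det ∧ p 9 ≠ 1}
def UU (i : Fin 3) : Set (Fin 10 → ℝ) := {p | (0 < (Mp p).det ∧ p 9 ≠ 1) ∧ ∀ j, j ≠ i → Mp p 0 j < Mp p 0 i}
def ties : Set (Fin 10 → ℝ) := {p | p 0 = p 5 ∨ p 0 = p 7 ∨ p 5 = p 7}

theorem detMp_cont : Continuous fun p => (Mp p).det := det_cont.comp Mp_cont
theorem Mp_entry_cont (i j : Fin 3) : Continuous fun p => Mp p i j := (continuous_apply_apply i j).comp Mp_cont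

theorem VV_open : IsOpen VV :=
  (isOpen_lt continuous_const detMp_cont).inter (isOpen_ne_fun (continuous_apply 9) continuous_const)

theorem UU_open (i : Fin 3) : IsOpen (UU i) := by
  refine VV_open.inter ?_
  have : {p : Fin 10 → ℝ | ∀ j, j ≠ i → Mp p 0 j < Mp p 0 i} = ⋂ j, {p | j ≠ i → Mp p 0 j < Mp p 0 i} := by
    ext p; simp
  show IsOpen {p : Fin 10 → ℝ | ∀ j, j ≠ i → Mp p 0 j < Mp p 0 i}
  rw [this]
  refine isOpen_iInter_of_finite fun j => ?_
  by_cases h : j = i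
  · simp [h]
  · simp only [ne_eq, h, not_false_eq_true, forall_true_left]
    exact isOpen_lt (Mp_entry_cont _ _) (Mp_entry_cont _ _)

theorem coord_ne_ae (i j : Fin 10) (h : i ≠ j) : ∀ᵐ p : Fin 10 → ℝ, p i ≠ p j := by
  have := ae_ne_of_poly (fun p : Fin 10 → ℝ => p i - p j) ((measurable_pi_apply i).sub (measurable_pi_apply j))
    (Pi.single i 1) (by
      intro y
      refine ⟨Polynomial.X + Polynomial.C (y i - y j), Polynomial.X_add_C_ne_zero _, fun t => ?_⟩
      simp [h.symm]; ring)
  filter_upwards [this] with p hp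
  exact fun h => hp (by simp [h])

theorem ties_null : volume ties = 0 := by
  rw [← compl_compl ties, ← mem_ae_iff]
  filter_upwards [coord_ne_ae 0 5 (by decide), coord_ne_ae 0 7 (by decide), coord_ne_ae 5 7 (by decide)] with p h1 h2 h3
  simp [ties, h1, h2, h3]

theorem iD_Phi {p : Fin 10 → ℝ} (hp : (Mp p).det ≠ 0) : iD (Phi p) = (Mp p).det ^ 12 * (19683 / 16 * ((p 9) ^ 3 - 1) ^ 3) := by
  rw [Phi, iD_act _ hp, iD_hs]

theorem iD_Phi_ne {p : Fin 10 → ℝ} (hp : p ∈ VV) : iD (Phi p) ≠ 0 := by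
  rw [iD_Phi hp.1.ne']
  have := cube_ne_one hp.2
  have := hp.1.ne'
  positivity

theorem mulZc0 (M : M3 ℝ) : (M * Zc) 0 0 = M 0 2 ∧ (M * Zc) 0 1 = M 0 0 ∧ (M * Zc) 0 2 = M 0 1 := by
  simp [Zc, Matrix.mul_apply, Fin.sum_univ_three]

theorem mulZcZc (M : M3 ℝ) : M * (Zc * Zc) = M * Zc * Zc := by rw [mul_assoc]

theorem forall_ne_fin3 (P : Fin 3 → Prop) (i : Fin 3) : (∀ j, j ≠ i → P j) ↔ (i ≠ 0 → P 0) ∧ (i ≠ 1 → P 1) ∧ (i ≠ 2 → P 2) := by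
  constructor
  · intro h; exact ⟨fun a => h 0 a.symm, fun a => h 1 a.symm, fun a => h 2 a.symm⟩
  · rintro ⟨h0, h1, h2⟩ j hj
    fin_cases j
    exacts [h0 hj.symm, h1 hj.symm, h2 hj.symm]

theorem UU_inj (i : Fin 3) : Set.InjOn Phi (UU i) := by
  intro p hp q hq h
  obtain ⟨hk, -, hM⟩ := hesse_fiber hp.1.1 hq.1.1 hp.1.2 h
  have e : Mp p = Mp q := by
    have a := (forall_ne_fin3 _ _).1 hp.2
    have b := (forall_ne_fin3 _ _).1 hq.2
    have z := mulZc0 (Mp q)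
    have z2 := mulZc0 (Mp q * Zc)
    rw [mulZcZc] at hM
    rcases hM with hM | hM | hM
    · exact hM
    · exfalso
      rw [hM] at a
      rw [z.1, z.2.1, z.2.2] at a
      fin_cases i <;> simp [z.1, z.2.1, z.2.2] at a b <;> linarith
    · exfalso
      rw [hM] at a
      rw [z2.1, z2.2.1, z2.2.2, z.1, z.2.1, z.2.2] at a
      fin_cases i <;> simp [z2.1, z2.2.1, z2.2.2, z.1, z.2.1, z.2.2] at a b <;> linarith
  rw [← pk_Mp p, ← pk_Mp q, e, hk]

theorem UU_sub (i : Fin 3) : UU i ⊆ VV := fun _ hp => hp.1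

theorem cyc_max {x y w : ℝ} (h1 : x ≠ y) (h2 : x ≠ w) (h3 : y ≠ w) (i : Fin 3) :
    (∀ j, j ≠ i → ![x, y, w] j < ![x, y, w] i) ∨ (∀ j, j ≠ i → ![w, x, y] j < ![w, x, y] i) ∨
    (∀ j, j ≠ i → ![y, w, x] j < ![y, w, x] i) := by
  simp only [forall_ne_fin3]
  fin_cases i <;> simp <;> grind

theorem UU_surj (i : Fin 3) (f : Fin 10 → ℝ) (hf : iD f ≠ 0) : f ∈ Phi '' UU i ∪ Phi '' ties := by
  obtain ⟨M, k, hM, hk, rfl⟩ := hesse_exists f hf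
  by_cases ht : pk M k ∈ ties
  · exact Or.inr ⟨_, ht, Phi_pk M k⟩
  have h1 : M 0 0 ≠ M 0 1 := fun e => ht (Or.inl e)
  have h2 : M 0 0 ≠ M 0 2 := fun e => ht (Or.inr (Or.inl e))
  have h3 : M 0 1 ≠ M 0 2 := fun e => ht (Or.inr (Or.inr e))
  left
  have key : ∀ N : M3 ℝ, 0 < N.det → act N (hs k) = act M (hs k) → (∀ j, j ≠ i → N 0 j < N 0 i) →
      act M (hs k) ∈ Phi '' UU i := fun N hN he h => ⟨pk N k, by
        refine ⟨⟨?_, hk⟩, ?_⟩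
        · rw [Mp_pk]; exact hN
        · rw [Mp_pk]; exact h, by rw [Phi_pk, he]⟩
  have k0 := key M hM rfl
  have k1 := key (M * Zc) (by rw [Matrix.det_mul, Zc_det, mul_one]; exact hM) (by rw [act_mul two_ne_zero, act_Zc])
  have k2 := key (M * Zc * Zc) (by rw [Matrix.det_mul, Matrix.det_mul, Zc_det, mul_one, mul_one]; exact hM)
    (by rw [act_mul two_ne_zero, act_Zc, act_mul two_ne_zero, act_Zc])
  have z := mulZc0 M
  have z2 := mulZc0 (M * Zc)
  have r0 : M 0 = ![M 0 0, M 0 1, M 0 2] := by funext j; fin_cases j <;> rfl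
  have r1 : (M * Zc) 0 = ![M 0 2, M 0 0, M 0 1] := by
    funext j; fin_cases j; exacts [z.1, z.2.1, z.2.2]
  have r2 : (M * Zc * Zc) 0 = ![M 0 1, M 0 2, M 0 0] := by
    funext j; fin_cases j; exacts [z2.1.trans z.2.2, z2.2.1.trans z.1, z2.2.2.trans z.2.1]
  rw [r1] at k1
  rw [r2] at k2
  rcases cyc_max h1 h2 h3 i with h | h | h
  · exact k0 (by rw [r0]; exact h)
  · exact k1 h
  · exact k2 h

theorem UU_int (i : Fin 3) (F : (Fin 10 → ℝ) → ENNReal) :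
    ∫⁻ f in {f | iD f ≠ 0}, F f = ∫⁻ p in UU i, ENNReal.ofReal |(fderiv ℝ Phi p).det| * F (Phi p) := by
  rw [← lintegral_image_eq_lintegral_abs_det_fderiv_mul volume (UU_open i).measurableSet
    (fun p _ => (Phi_deriv p).hasFDerivAt.hasFDerivWithinAt) (UU_inj i)]
  apply setLIntegral_congr
  have hn : volume (Phi '' ties) = 0 :=
    addHaar_image_eq_zero_of_differentiableOn_of_addHaar_eq_zero volume
      (Phi_contDiff.differentiable one_ne_zero).differentiableOn ties_null
  refine (ae_le_set.2 (measure_mono_null ?_ hn)).antisymm (HasSubset.Subset.eventuallyLE ?_)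
  · intro f hf
    exact (UU_surj i f hf.1).resolve_left hf.2
  · rintro _ ⟨p, hp, rfl⟩
    exact iD_Phi_ne hp.1

theorem VV_eq : VV =ᵐ[volume] ⋃ i, UU i := by
  refine (ae_le_set.2 (measure_mono_null ?_ ties_null)).antisymm (HasSubset.Subset.eventuallyLE (Set.iUnion_subset UU_sub))
  intro p hp
  by_contra ht
  apply hp.2
  have h1 : Mp p 0 0 ≠ Mp p 0 1 := fun e => ht (Or.inl e)
  have h2 : Mp p 0 0 ≠ Mp p 0 2 := fun e => ht (Or.inr (Or.inl e))
  have h3 : Mp p 0 1 ≠ Mp p 0 2 := fun e => ht (Or.inr (Or.inr e))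
  rw [Set.mem_iUnion]
  by_contra hc
  push Not at hc
  have hc' : ∀ i, ¬ (∀ j, j ≠ i → Mp p 0 j < Mp p 0 i) := fun i h => hc i ⟨hp.1, h⟩
  simp only [forall_ne_fin3] at hc'
  have k0 := hc' 0
  have k1 := hc' 1
  have k2 := hc' 2
  simp at k0 k1 k2
  rcases lt_or_gt_of_ne h1 with a | a <;> rcases lt_or_gt_of_ne h2 with b | b <;> rcases lt_or_gt_of_ne h3 with c | c <;> grind

theorem VV_int (F : (Fin 10 → ℝ) → ENNReal) :
    3 * ∫⁻ f in {f | iD f ≠ 0}, F f = ∫⁻ p in VV, ENNReal.ofReal |(fderiv ℝ Phi p).det| * F (Phi p) := by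
  rw [setLIntegral_congr VV_eq, lintegral_iUnion (fun i => (UU_open i).measurableSet), tsum_fintype, Fin.sum_univ_three,
    ← UU_int, ← UU_int, ← UU_int]
  · ring
  · intro i j hij
    refine Set.disjoint_left.2 fun p hp hq => ?_
    exact lt_asymm (hp.2 j hij.symm) (hq.2 i hij)

end TC

open MvPolynomial

namespace TC
open Filter Topology MeasureTheory

/-- the weight on real cubic forms -/
noncomputable def psf (R : ℝ) (f : Fin 10 → ℝ) : ℝ :=
  open Classical in if h : iD f ≠ 0 then psi R (Classical.choose (hesse_exists f h)) else 0

theorem iD_act_hs_ne {M : M3 ℝ} {k : ℝ} (hM : 0 < M.det) (hk : k ≠ 1) : iD (act M (hs k)) ≠ 0 := by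
  rw [iD_act _ hM.ne', iD_hs]
  have := cube_ne_one hk
  have := hM.ne'
  positivity

theorem psf_act (R : ℝ) {M : M3 ℝ} {k : ℝ} (hM : 0 < M.det) (hk : k ≠ 1) : psf R (act M (hs k)) = psi R M := by
  have h := iD_act_hs_ne hM hk
  rw [psf, dif_pos h]
  obtain ⟨l, h1, h2, h3⟩ := Classical.choose_spec (hesse_exists _ h)
  set N := Classical.choose (hesse_exists _ h)
  obtain ⟨-, -, e | e | e⟩ := hesse_fiber hM h1 hk h3
  · rw [e]
  · rw [e, psi_Zc]
  · rw [e, mulZcZc, psi_Zc, psi_Zc]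

theorem psf_nonneg (R : ℝ) (f : Fin 10 → ℝ) : 0 ≤ psf R f := by
  rw [psf]; split_ifs; exacts [psi_nonneg _ _, le_rfl]

theorem psf_le {R : ℝ} (hR : 0 < R) (f : Fin 10 → ℝ) : psf R f ≤ 1 := by
  rw [psf]; split_ifs; exacts [psi_le_one hR _, zero_le_one]

theorem psf_cont {R : ℝ} (hR : 0 < R) {f : Fin 10 → ℝ} (hf : iD f ≠ 0) : ContinuousAt (psf R) f := by
  obtain ⟨M, k, hM, hk, rfl⟩ := hesse_exists f hf
  rw [← Phi_pk]
  set p := pk M k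
  have hp : p ∈ VV := ⟨by rw [Mp_pk]; exact hM, hk⟩
  have hd : (fderiv ℝ Phi p).det ≠ 0 := by
    rw [det_Phi p hp.1.ne']
    have h1 := cube_ne_one hp.2
    have h2 : 1 - (p 9) ^ 3 ≠ 0 := fun h => h1 (by linarith)
    have h3 := hp.1.ne'
    simp [h2, h3]
  have hs := Phi_deriv p
  rw [← ContinuousLinearMap.coe_toContinuousLinearEquivOfDetNeZero _ hd] at hs
  rw [ContinuousAt, ← hs.map_nhds_eq_of_equiv, tendsto_map'_iff]
  have h4 : ∀ᶠ q in 𝓝 p, psi R (Mp q) = (psf R ∘ Phi) q := by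
    filter_upwards [VV_open.mem_nhds hp] with q hq
    exact (psf_act R hq.1 hq.2).symm
  refine Tendsto.congr' h4 ?_
  rw [Phi, psf_act R hp.1 hp.2]
  exact ContinuousAt.comp (f := Mp) (g := psi R) (psi_cont' hR hp.1.ne') Mp_cont.continuousAt

theorem scal_aux {t : ℝ} (ht : t ≠ 0) : ∃ a : ℝ, (a • (1 : M3 ℝ)).det = t ∧ ∀ f, act (a • (1 : M3 ℝ)) f = t • f := by
  obtain ⟨a, ha⟩ := exists_cbrt t
  refine ⟨a, ?_, fun f => ?_⟩
  · rw [Matrix.det_smul, Matrix.det_one]; simp [ha]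
  · rw [act_scalar, ha]

theorem iI_smul {t : ℝ} (h : t ≠ 0) (f : Fin 10 → ℝ) : iI (t • f) = t ^ 4 * iI f := by
  obtain ⟨a, h1, h2⟩ := scal_aux h
  rw [← h2, iI_act _ (by rwa [h1]), h1]
theorem iJ_smul {t : ℝ} (h : t ≠ 0) (f : Fin 10 → ℝ) : iJ (t • f) = t ^ 6 * iJ f := by
  obtain ⟨a, h1, h2⟩ := scal_aux h
  rw [← h2, iJ_act _ (by rwa [h1]), h1]
theorem iD_smul {t : ℝ} (h : t ≠ 0) (f : Fin 10 → ℝ) : iD (t • f) = t ^ 12 * iD f := by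
  obtain ⟨a, h1, h2⟩ := scal_aux h
  rw [← h2, iD_act _ (by rwa [h1]), h1]
theorem ht_smul {t : ℝ} (h : t ≠ 0) (f : Fin 10 → ℝ) : ht (t • f) = t ^ 12 * ht f := by
  obtain ⟨a, h1, h2⟩ := scal_aux h
  rw [← h2, ht_act _ (by rwa [h1]), h1]

theorem psf_smul (R : ℝ) {t : ℝ} (h : 0 < t) (f : Fin 10 → ℝ) : psf R (t • f) = psf R f := by
  by_cases hf : iD f = 0
  · rw [psf, psf, dif_neg (by simp [iD_smul h.ne', hf]), dif_neg (by simp [hf])]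
  · obtain ⟨M, k, hM, hk, rfl⟩ := hesse_exists f hf
    obtain ⟨a, ha⟩ := exists_cbrt t
    have ha0 : 0 < a := by
      by_contra hc
      have : a ^ 3 ≤ 0 := Odd.pow_nonpos (by decide) (not_lt.1 hc)
      linarith
    rw [← ha, ← act_smul_mat, psf_act R _ hk, psf_act R hM hk, psi_smul R M ha0]
    rw [Matrix.det_smul]; positivity

theorem ae_ne_hom (g : (Fin 10 → ℝ) → ℝ) (m : ℕ) (hm : m ≠ 0) (hc : Continuous g) (hh : ∀ t : ℝ, t ≠ 0 → ∀ f, g (t • f) = t ^ m * g f)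
    (v : Fin 10 → ℝ) (hv : g v ≠ 0) (hp : ∀ y, ∃ q : Polynomial ℝ, ∀ t, g (y + t • v) = q.eval t) (c : ℝ) : ∀ᵐ f, g f ≠ c := by
  have := ae_ne_of_poly (fun f => g f - c) (hc.measurable.sub_const c) v (by
    intro y
    obtain ⟨q, hq⟩ := hp y
    refine ⟨q - Polynomial.C c, ?_, fun t => by simp [hq]⟩
    intro h0
    rw [sub_eq_zero] at h0
    have h1 : ∀ t, g (y + t • v) = c := fun t => by rw [hq, h0, Polynomial.eval_C]
    have h2 : ∀ᶠ s in 𝓝[≠] (0:ℝ), s ^ m * c = g (v + s • y) := by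
      filter_upwards [self_mem_nhdsWithin] with s hs
      have hs : s ≠ 0 := hs
      rw [← h1 s⁻¹, ← hh s hs, smul_add, smul_smul, mul_inv_cancel₀ hs, one_smul, add_comm]
    have h3 : Tendsto (fun s : ℝ => g (v + s • y)) (𝓝[≠] 0) (𝓝 (g (v + (0:ℝ) • y))) :=
      Tendsto.mono_left (Continuous.tendsto (f := fun s : ℝ => g (v + s • y)) (by fun_prop) 0) nhdsWithin_le_nhds
    have h4 : Tendsto (fun s : ℝ => s ^ m * c) (𝓝[≠] 0) (𝓝 ((0:ℝ) ^ m * c)) :=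
      Tendsto.mono_left (Continuous.tendsto (f := fun s : ℝ => s ^ m * c) (by fun_prop) 0) nhdsWithin_le_nhds
    have := tendsto_nhds_unique (h4.congr' h2) h3
    rw [zero_smul, add_zero, zero_pow hm, zero_mul] at this
    exact hv this.symm)
  filter_upwards [this] with f hf
  exact fun h => hf (by simp [h])

theorem iI_poly (y v : Fin 10 → ℝ) : ∃ q : Polynomial ℝ, ∀ t, iI (y + t • v) = q.eval t := by
  refine ⟨wc4 (fun i => Polynomial.C (y i) + Polynomial.X * Polynomial.C (v i)) * Polynomial.C (1 / 16), fun t => ?_⟩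
  rw [Polynomial.eval_mul, ← Polynomial.coe_evalRingHom, map_wc4, iI]
  simp only [Polynomial.coe_evalRingHom, Polynomial.eval_add, Polynomial.eval_mul, Polynomial.eval_C, Polynomial.eval_X]
  rw [div_eq_mul_one_div]; rfl

theorem iJ_poly (y v : Fin 10 → ℝ) : ∃ q : Polynomial ℝ, ∀ t, iJ (y + t • v) = q.eval t := by
  refine ⟨wc6 (fun i => Polynomial.C (y i) + Polynomial.X * Polynomial.C (v i)) * Polynomial.C (1 / 32), fun t => ?_⟩
  rw [Polynomial.eval_mul, ← Polynomial.coe_evalRingHom, map_wc6, iJ]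
  simp only [Polynomial.coe_evalRingHom, Polynomial.eval_add, Polynomial.eval_mul, Polynomial.eval_C, Polynomial.eval_X]
  rw [div_eq_mul_one_div]; rfl

theorem iD_poly (y v : Fin 10 → ℝ) : ∃ q : Polynomial ℝ, ∀ t, iD (y + t • v) = q.eval t := by
  obtain ⟨a, ha⟩ := iI_poly y v
  obtain ⟨b, hb⟩ := iJ_poly y v
  refine ⟨(4 * a ^ 3 - b ^ 2) * Polynomial.C (1 / 27), fun t => ?_⟩
  rw [iD, ha, hb]
  simp; ring

theorem iD_ae : ∀ᵐ f, iD f ≠ 0 :=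
  ae_ne_hom iD 12 (by norm_num) iD_cont (fun t h f => iD_smul h f) (hs 2) (by rw [iD_hs]; norm_num) (fun y => iD_poly y _) 0

theorem ht_ae : ∀ᵐ f, ht f ≠ 1 := by
  have h1 := ae_ne_hom iI 4 (by norm_num) iI_cont (fun t h f => iI_smul h f) (hs 2) (by rw [iI_hs, hi]; norm_num) (fun y => iI_poly y _)
  have h2 := ae_ne_hom iJ 6 (by norm_num) iJ_cont (fun t h f => iJ_smul h f) (hs 2) (by rw [iJ_hs, hj]; norm_num) (fun y => iJ_poly y _)
  filter_upwards [h1 1, h1 (-1), h2 2, h2 (-2)] with f a b c d h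
  rw [ht] at h
  rcases max_choice (|iI f| ^ 3) (iJ f ^ 2 / 4) with e | e
  · rw [e] at h
    have : |iI f| = 1 := cube_inj (by rw [h]; norm_num)
    rcases abs_eq (zero_le_one) |>.1 this with h | h
    exacts [a h, b h]
  · rw [e] at h
    have : (iJ f - 2) * (iJ f + 2) = 0 := by linarith
    rcases mul_eq_zero.1 this with h | h
    · exact c (by linarith)
    · exact d (by linarith)

noncomputable def phi (R e : ℝ) (f : Fin 10 → ℝ) : ℝ :=
  open Classical in if ht f < 1 ∧ 0 < e * iD f then psf R f else 0

theorem phi_nonneg (R e : ℝ) (f : Fin 10 → ℝ) : 0 ≤ phi R e f := by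
  rw [phi]; split_ifs; exacts [psf_nonneg _ _, le_rfl]

theorem phi_le {R : ℝ} (hR : 0 < R) (e : ℝ) (f : Fin 10 → ℝ) : phi R e f ≤ 1 := by
  rw [phi]; split_ifs; exacts [psf_le hR _, zero_le_one]

theorem phi_contAt {R e : ℝ} (hR : 0 < R) (he : e ≠ 0) {f : Fin 10 → ℝ} (h1 : iD f ≠ 0) (h2 : ht f ≠ 1) : ContinuousAt (phi R e) f := by
  have hD : ContinuousAt (fun f => e * iD f) f := (continuous_const.mul iD_cont).continuousAt
  have h3 : e * iD f ≠ 0 := mul_ne_zero he h1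
  by_cases h : ht f < 1 ∧ 0 < e * iD f
  · refine (psf_cont hR h1).congr ?_
    filter_upwards [ht_cont.continuousAt.eventually (gt_mem_nhds h.1), hD.eventually (lt_mem_nhds h.2)] with q a b
    rw [phi, if_pos ⟨a, b⟩]
  · refine (continuousAt_const (y := (0:ℝ))).congr ?_
    rcases lt_or_gt_of_ne h2 with h4 | h4
    · rcases lt_or_gt_of_ne h3 with h5 | h5
      · filter_upwards [hD.eventually (gt_mem_nhds h5)] with q b
        rw [phi, if_neg (fun h => lt_asymm h.2 b)]
      · exact absurd ⟨h4, h5⟩ h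
    · filter_upwards [ht_cont.continuousAt.eventually (lt_mem_nhds h4)] with q b
      rw [phi, if_neg (fun h => lt_asymm h.1 b)]

theorem phi_cont {R e : ℝ} (hR : 0 < R) (he : e ≠ 0) : ∀ᵐ f, ContinuousAt (phi R e) f := by
  filter_upwards [iD_ae, ht_ae] with f h1 h2
  exact phi_contAt hR he h1 h2

theorem psf_meas {R : ℝ} (hR : 0 < R) : Measurable (psf R) := by
  have ho : IsOpen {f : Fin 10 → ℝ | iD f ≠ 0} := isOpen_ne_fun iD_cont continuous_const
  have hc : ContinuousOn (psf R) {f | iD f ≠ 0} := fun f hf => (psf_cont hR hf).continuousWithinAt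
  classical
  have := hc.measurable_piecewise (g := fun _ => (0:ℝ)) continuousOn_const ho.measurableSet
  convert this using 1
  funext f
  by_cases hf : f ∈ {f : Fin 10 → ℝ | iD f ≠ 0}
  · rw [Set.piecewise_eq_of_mem _ _ _ hf]
  · rw [Set.piecewise_eq_of_notMem _ _ _ hf, psf, dif_neg (show ¬ (iD f ≠ 0) from hf)]

theorem phi_meas {R : ℝ} (hR : 0 < R) (e : ℝ) : Measurable (phi R e) := by
  classical
  have h1 : MeasurableSet {f : Fin 10 → ℝ | ht f < 1 ∧ 0 < e * iD f} :=
    (isOpen_lt ht_cont continuous_const).measurableSet.inter (isOpen_lt continuous_const (continuous_const.mul iD_cont)).measurableSet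
  exact Measurable.ite (p := fun f => ht f < 1 ∧ 0 < e * iD f) h1 (psf_meas hR) measurable_const

/-- the support of `phi` is bounded -/
theorem phi_supp {R : ℝ} (hR : 0 < R) : ∃ r : ℝ, 0 < r ∧ ∀ e f, r < ‖f‖ → phi R e f = 0 := by
  obtain ⟨c, hc, hl⟩ := ht_hs_lower
  obtain ⟨b, hb, hbc⟩ : ∃ b : ℝ, 0 < b ∧ b ^ 12 = c := ⟨c ^ (1 / 12 : ℝ), by positivity, by
    rw [← Real.rpow_natCast, ← Real.rpow_mul hc.le]; norm_num⟩
  refine ⟨36 * R / b, by positivity, fun e f hf => ?_⟩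
  by_contra h
  rw [phi] at h
  split_ifs at h with h1
  · have hD : iD f ≠ 0 := fun h0 => by simp [h0] at h1
    obtain ⟨M, k, hM, hk, rfl⟩ := hesse_exists f hD
    rw [psf_act R hM hk] at h
    obtain ⟨-, h2⟩ := psi_supp h
    have h3 := h1.1
    rw [ht_act _ hM.ne'] at h3
    have h4 : (M.det * (b * (1 + |k|))) ^ 12 < 1 ^ 12 := by
      rw [mul_pow, mul_pow, hbc, one_pow]
      exact lt_of_le_of_lt (mul_le_mul_of_nonneg_left (hl k) (by positivity)) h3
    have h5 := lt_of_pow_lt_pow_left₀ 12 zero_le_one h4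
    have h6 := fun j => coef_bound (M := M) (ρ := fun _ => √(fr M)) (fun _ => Real.sqrt_nonneg _)
      (fun i => by rw [Real.sq_sqrt (fr_nonneg M)]; exact gg_le_fr M i) k j
    have h7 : ‖act M (hs k)‖ ≤ 36 * R / b := by
      rw [pi_norm_le_iff_of_nonneg (by positivity)]
      intro j
      rw [Real.norm_eq_abs]
      have h8 : wt (fun _ => √(fr M)) j = √(fr M) ^ 3 := by
        fin_cases j <;> simp [wt] <;> ring
      have h9 := h6 j
      rw [h8] at h9
      rw [le_div_iff₀ hb]
      have : (1 + |k|) * √(fr M) ^ 3 ≤ (1 + |k|) * (2 * R * M.det) := by gcongr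
      calc _ ≤ 18 * (1 + |k|) * √(fr M) ^ 3 * b := by gcongr
        _ = 18 * b * ((1 + |k|) * √(fr M) ^ 3) := by ring
        _ ≤ 18 * b * ((1 + |k|) * (2 * R * M.det)) := by gcongr
        _ = 36 * R * (M.det * (b * (1 + |k|))) := by ring
        _ ≤ 36 * R * 1 := by gcongr
        _ = _ := mul_one _
    exact absurd h7 (not_le.2 hf)
  · exact h rfl

end TC

open MvPolynomial

namespace TC
open Filter Topology MeasureTheory

theorem Mt_det_cont : Continuous fun q : Fin 9 → ℝ => (Mt q).det := det_cont.comp Mt_cont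

theorem psiMt_meas {R : ℝ} (hR : 0 < R) : Measurable fun q : Fin 9 → ℝ => psi R (Mt q) := by
  have ho : IsOpen {q : Fin 9 → ℝ | (Mt q).det ≠ 0} := isOpen_ne_fun Mt_det_cont continuous_const
  have hc : ContinuousOn (fun q : Fin 9 → ℝ => psi R (Mt q)) {q | (Mt q).det ≠ 0} := fun q hq =>
    (ContinuousAt.comp (f := Mt) (g := psi R) (psi_cont' hR hq) Mt_cont.continuousAt).continuousWithinAt
  classical
  have := hc.measurable_piecewise (g := fun _ => (0:ℝ)) continuousOn_const ho.measurableSet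
  convert this using 1
  funext f
  by_cases hf : f ∈ {q : Fin 9 → ℝ | (Mt q).det ≠ 0}
  · rw [Set.piecewise_eq_of_mem _ _ _ hf]
  · rw [Set.piecewise_eq_of_notMem _ _ _ hf]
    by_contra h
    exact hf (psi_supp h).1.ne'

noncomputable def pe (R : ℝ) (q : Fin 9 → ℝ) : ENNReal := ENNReal.ofReal (psi R (Mt q))

theorem pe_meas {R : ℝ} (hR : 0 < R) : Measurable (pe R) := (psiMt_meas hR).ennreal_ofReal

def Ls (s : ℝ) : Set (Fin 9 → ℝ) := {q | (Mt q).det < s}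
theorem Ls_meas (s : ℝ) : MeasurableSet (Ls s) := (isOpen_lt Mt_det_cont continuous_const).measurableSet

theorem scale_int (F : (Fin 9 → ℝ) → ENNReal) {t : ℝ} (ht : 0 < t) :
    ∫⁻ q, F q = ENNReal.ofReal (t ^ 9) * ∫⁻ q, F (t • q) := by
  have h1 := Measure.map_addHaar_smul (volume : Measure (Fin 9 → ℝ)) ht.ne'
  have h2 := lintegral_map_equiv (μ := (volume : Measure (Fin 9 → ℝ))) F (Homeomorph.smulOfNeZero t ht.ne').toMeasurableEquiv
  have h3 : Measure.map (Homeomorph.smulOfNeZero t ht.ne').toMeasurableEquiv (volume : Measure (Fin 9 → ℝ)) = 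
    ENNReal.ofReal (abs (t ^ 9)⁻¹) • volume := by
    have : ((Homeomorph.smulOfNeZero t ht.ne').toMeasurableEquiv : (Fin 9 → ℝ) → (Fin 9 → ℝ)) = (t • ·) := rfl
    rw [this, h1]; simp
  rw [h3, lintegral_smul_measure] at h2
  have h4 : ∫⁻ q, F (t • q) = ENNReal.ofReal (abs (t ^ 9)⁻¹) • ∫⁻ q, F q := h2.symm
  rw [h4, smul_eq_mul, ← mul_assoc, ← ENNReal.ofReal_mul (by positivity), abs_of_pos (by positivity), mul_inv_cancel₀ (by positivity)]
  simp

theorem scale_gen (R : ℝ) (n : ℕ) {s : ℝ} (hs : 0 < s) :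
    ∫⁻ q in Ls s, pe R q * ENNReal.ofReal ((Mt q).det ^ n) = ENNReal.ofReal (s ^ (3 + n)) * ∫⁻ q in Ls 1, pe R q * ENNReal.ofReal ((Mt q).det ^ n) := by
  obtain ⟨t, ht0, ht⟩ : ∃ t : ℝ, 0 < t ∧ t ^ 3 = s := ⟨s ^ (1 / 3 : ℝ), by positivity, by
    rw [← Real.rpow_natCast, ← Real.rpow_mul hs.le]; norm_num⟩
  rw [← lintegral_indicator (Ls_meas _), ← lintegral_indicator (Ls_meas _), scale_int _ ht0]
  have e : ∀ q : Fin 9 → ℝ, (Ls s).indicator (fun q => pe R q * ENNReal.ofReal ((Mt q).det ^ n)) (t • q) =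
      ENNReal.ofReal (s ^ n) * (Ls 1).indicator (fun q => pe R q * ENNReal.ofReal ((Mt q).det ^ n)) q := by
    intro q
    have hd : (Mt (t • q)).det = s * (Mt q).det := by
      rw [Mt_smul, Matrix.det_smul, Fintype.card_fin, ht]
    have hp : pe R (t • q) = pe R q := by rw [pe, Mt_smul, psi_smul R _ ht0, pe]
    have hm : t • q ∈ Ls s ↔ q ∈ Ls 1 := by
      simp only [Ls, Set.mem_setOf_eq, hd]
      rw [mul_lt_iff_lt_one_right hs]
    by_cases h : q ∈ Ls 1
    · rw [Set.indicator_of_mem h, Set.indicator_of_mem (hm.2 h), hp, hd, mul_pow, ENNReal.ofReal_mul (by positivity)]; ring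
    · rw [Set.indicator_of_notMem h, Set.indicator_of_notMem (fun a => h (hm.1 a)), mul_zero]
  simp_rw [e]
  rw [lintegral_const_mul' _ _ ENNReal.ofReal_ne_top, ← mul_assoc, ← ENNReal.ofReal_mul (by positivity), ← ht]
  congr 2; ring

noncomputable def gs (R s : ℝ) : ENNReal := ∫⁻ q in Ls s, pe R q
noncomputable def Gs (R s : ℝ) : ENNReal := ∫⁻ q in Ls s, pe R q * ENNReal.ofReal ((Mt q).det ^ 7)

theorem gs_eq (R : ℝ) {s : ℝ} (hs : 0 < s) : gs R s = ENNReal.ofReal (s ^ 3) * gs R 1 := by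
  have := scale_gen R 0 hs
  simpa [gs] using this

theorem Gs_eq (R : ℝ) {s : ℝ} (hs : 0 < s) : Gs R s = ENNReal.ofReal (s ^ 10) * Gs R 1 := scale_gen R 7 hs

theorem gs_one {R : ℝ} (hR : 0 < R) : gs R 1 = ENNReal.ofReal (gI R) := by
  have e : gs R 1 = ∫⁻ q, ENNReal.ofReal (gF R q) := by
    rw [gs, ← lintegral_indicator (Ls_meas _)]
    congr 1; funext q
    by_cases h : q ∈ Ls 1
    · rw [Set.indicator_of_mem h, pe, gF, if_pos (show (Mt q).det < 1 from h)]
    · rw [Set.indicator_of_notMem h, gF, if_neg (show ¬ (Mt q).det < 1 from h)]; simp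
  have hm : Measurable (gF R) := by
    unfold gF
    exact Measurable.ite (Ls_meas 1) (psiMt_meas hR) measurable_const
  have hfin : ∫⁻ q, ENNReal.ofReal (gF R q) ≠ ⊤ := by
    have : ∫⁻ q, ENNReal.ofReal (gF R q) ≤ ∫⁻ q, (Metric.closedBall (0 : Fin 9 → ℝ) (2 * R + 1)).indicator 1 q := by
      apply lintegral_mono; intro q
      by_cases h : q ∈ Metric.closedBall (0 : Fin 9 → ℝ) (2 * R + 1)
      · rw [Set.indicator_of_mem h]; exact ENNReal.ofReal_le_one.2 (gF_le hR q)
      · show ENNReal.ofReal (gF R q) ≤ _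
        rw [gF_supp hR q (by simpa using h)]; simp
    refine (lt_of_le_of_lt this ?_).ne
    rw [lintegral_indicator_one measurableSet_closedBall]
    exact measure_closedBall_lt_top
  rw [gI, integral_eq_lintegral_of_nonneg_ae (ae_of_all _ (gF_nonneg R)) hm.aestronglyMeasurable, ENNReal.ofReal_toReal hfin, e]

theorem lint_pow {a b : ℝ} (h0 : 0 ≤ a) (hab : a ≤ b) (n : ℕ) :
    ∫⁻ t in Set.Ioo a b, ENNReal.ofReal (t ^ n) = ENNReal.ofReal ((b ^ (n + 1) - a ^ (n + 1)) / (n + 1)) := by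
  rw [← integral_pow, intervalIntegral.integral_of_le hab, restrict_Ioo_eq_restrict_Ioc, ofReal_integral_eq_lintegral_ofReal]
  · have := (intervalIntegral.intervalIntegrable_pow (μ := volume) (a := a) (b := b) n)
    rwa [intervalIntegrable_iff_integrableOn_Ioc_of_le hab] at this
  · filter_upwards [ae_restrict_mem measurableSet_Ioc] with t ht
    have : 0 ≤ t := h0.trans ht.1.le
    positivity

theorem Gs_gs {R : ℝ} (hR : 0 < R) : (∫⁻ t in Set.Ioo (0:ℝ) 1, 7 * ENNReal.ofReal (t ^ 6) * gs R t) + Gs R 1 = gs R 1 := by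
  have hm : Measurable (Function.uncurry fun (t : ℝ) (q : Fin 9 → ℝ) => {x : ℝ × (Fin 9 → ℝ) | (Mt x.2).det < x.1}.indicator
      (fun x => 7 * ENNReal.ofReal (x.1 ^ 6) * pe R x.2) (t, q)) := by
    refine Measurable.indicator ?_ ?_
    · have : Measurable fun x : ℝ × (Fin 9 → ℝ) => pe R x.2 := (pe_meas hR).comp measurable_snd
      have h2 : Measurable fun x : ℝ × (Fin 9 → ℝ) => 7 * ENNReal.ofReal (x.1 ^ 6) := by fun_prop
      exact h2.mul this
    · exact (isOpen_lt (Mt_det_cont.comp continuous_snd) continuous_fst).measurableSet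
  have e1 : ∫⁻ t in Set.Ioo (0:ℝ) 1, 7 * ENNReal.ofReal (t ^ 6) * gs R t = ∫⁻ t in Set.Ioo (0:ℝ) 1, ∫⁻ q,
      {x : ℝ × (Fin 9 → ℝ) | (Mt x.2).det < x.1}.indicator (fun x => 7 * ENNReal.ofReal (x.1 ^ 6) * pe R x.2) (t, q) := by
    apply lintegral_congr; intro t
    rw [gs, ← lintegral_indicator (Ls_meas _), ← lintegral_const_mul' _ _ (ENNReal.mul_ne_top (by simp) ENNReal.ofReal_ne_top)]
    apply lintegral_congr; intro q
    by_cases h : (Mt q).det < t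
    · rw [Set.indicator_of_mem (show q ∈ Ls t from h), Set.indicator_of_mem (show (t, q) ∈ {x : ℝ × (Fin 9 → ℝ) | (Mt x.2).det < x.1} from h)]
    · rw [Set.indicator_of_notMem (show q ∉ Ls t from h), Set.indicator_of_notMem (show (t, q) ∉ {x : ℝ × (Fin 9 → ℝ) | (Mt x.2).det < x.1} from h), mul_zero]
  rw [e1, lintegral_lintegral_swap hm.aemeasurable, Gs, gs, ← lintegral_indicator (Ls_meas _), ← lintegral_indicator (Ls_meas _),
    ← lintegral_add_right]
  · apply lintegral_congr; intro q
    by_cases hp : psi R (Mt q) = 0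
    · have hp : pe R q = 0 := by rw [pe, hp]; simp
      have : ∀ t, {x : ℝ × (Fin 9 → ℝ) | (Mt x.2).det < x.1}.indicator (fun x => 7 * ENNReal.ofReal (x.1 ^ 6) * pe R x.2) (t, q) = 0 := by
        intro t; rw [Set.indicator_apply_eq_zero]; intro; simp [hp]
      simp [this, Set.indicator, hp]
    have hd := (psi_supp hp).1
    set d := (Mt q).det with hdd
    have e2 : ∫⁻ t in Set.Ioo (0:ℝ) 1, {x : ℝ × (Fin 9 → ℝ) | (Mt x.2).det < x.1}.indicator (fun x => 7 * ENNReal.ofReal (x.1 ^ 6) * pe R x.2) (t, q)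
        = ∫⁻ t in Set.Ioo d 1, 7 * ENNReal.ofReal (t ^ 6) * pe R q := by
      rw [← lintegral_indicator measurableSet_Ioo, ← lintegral_indicator measurableSet_Ioo]
      apply lintegral_congr; intro t
      simp only [Set.indicator, Set.mem_Ioo, Set.mem_setOf_eq]
      by_cases h1 : d < t
      · have : 0 < t := hd.trans h1
        simp [h1, this, ← hdd]
      · simp [h1, ← hdd]
    rw [e2]
    by_cases h1 : d < 1
    · rw [Set.indicator_of_mem (show q ∈ Ls 1 from h1), Set.indicator_of_mem (show q ∈ Ls 1 from h1)]
      rw [lintegral_mul_const' _ _ (by rw [pe]; exact ENNReal.ofReal_ne_top), lintegral_const_mul' _ _ (by simp), lint_pow hd.le h1.le]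
      have : (7 : ENNReal) = ENNReal.ofReal 7 := by simp
      have h7 : d ^ 7 ≤ 1 := pow_le_one₀ hd.le h1.le
      rw [this, ← ENNReal.ofReal_mul (by norm_num), mul_comm, ← mul_add, ← ENNReal.ofReal_add (by norm_num; linarith) (by positivity)]
      norm_num
      rw [mul_div_cancel₀ _ (by norm_num)]
      rw [← hdd, sub_add_cancel, ENNReal.ofReal_one, mul_one]
    · rw [Set.indicator_of_notMem (show q ∉ Ls 1 from h1), Set.indicator_of_notMem (show q ∉ Ls 1 from h1), Set.Ioo_eq_empty h1]
      simp
  · refine Measurable.indicator ?_ (Ls_meas 1)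
    refine (pe_meas hR).mul ?_
    exact ((Mt_det_cont.pow 7).measurable).ennreal_ofReal

theorem Gs_one {R : ℝ} (hR : 0 < R) : Gs R 1 = ENNReal.ofReal (3 / 10 * gI R) := by
  have h := Gs_gs hR
  have hg : 0 ≤ gI R := integral_nonneg (gF_nonneg R)
  have e : ∫⁻ t in Set.Ioo (0:ℝ) 1, 7 * ENNReal.ofReal (t ^ 6) * gs R t = ENNReal.ofReal (7 / 10 * gI R) := by
    have : ∫⁻ t in Set.Ioo (0:ℝ) 1, 7 * ENNReal.ofReal (t ^ 6) * gs R t = ∫⁻ t in Set.Ioo (0:ℝ) 1, ENNReal.ofReal (t ^ 9) * (7 * gs R 1) := by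
      refine setLIntegral_congr_fun measurableSet_Ioo fun t ht => ?_
      have h0 : 0 < t := ht.1
      rw [gs_eq R ht.1, show t ^ 9 = t ^ 6 * t ^ 3 by ring, ENNReal.ofReal_mul (by positivity)]; ring
    rw [this, lintegral_mul_const' _ _ (ENNReal.mul_ne_top (by simp) (by rw [gs_one hR]; exact ENNReal.ofReal_ne_top)), lint_pow le_rfl zero_le_one,
      gs_one hR, show (7 : ENNReal) = ENNReal.ofReal 7 by simp, ← ENNReal.ofReal_mul (by norm_num), ← ENNReal.ofReal_mul (by norm_num)]
    congr 1; norm_num; ring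
  rw [e, gs_one hR] at h
  have h2 : ENNReal.ofReal (7 / 10 * gI R) + Gs R 1 = ENNReal.ofReal (7 / 10 * gI R) + ENNReal.ofReal (3 / 10 * gI R) := by
    rw [h, ← ENNReal.ofReal_add (by positivity) (by positivity)]; congr 1; ring
  exact (ENNReal.add_right_inj ENNReal.ofReal_ne_top).1 h2

end TC

open MvPolynomial

namespace TC
open Filter Topology MeasureTheory

noncomputable def sk (k : ℝ) : ℝ := (ht (hs k)) ^ (-(1 / 12) : ℝ)

theorem sk_pos (k : ℝ) : 0 < sk k := Real.rpow_pos_of_pos (ht_hs_pos k) _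

theorem sk_pow (k : ℝ) : sk k ^ 12 * ht (hs k) = 1 := by
  have h := ht_hs_pos k
  rw [sk, ← Real.rpow_natCast, ← Real.rpow_mul h.le]
  norm_num
  rw [Real.rpow_neg_one, inv_mul_cancel₀ h.ne']

theorem sk_cont : Continuous sk :=
  (ht_cont.comp hs_cont).rpow_const fun k => Or.inl (ht_hs_pos k).ne'

theorem lt_sk {d k : ℝ} (hd : 0 < d) : d ^ 12 * ht (hs k) < 1 ↔ d < sk k := by
  rw [← sk_pow k, mul_lt_mul_iff_left₀ (ht_hs_pos k)]
  exact pow_lt_pow_iff_left₀ hd.le (sk_pos k).le (by norm_num)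

open Classical in
noncomputable def wk (e k : ℝ) : ENNReal := if 0 < e * (k ^ 3 - 1) then ENNReal.ofReal (59049 * (1 - k ^ 3) ^ 2) else 0

theorem wk_meas (e : ℝ) : Measurable (wk e) := by
  unfold wk
  refine Measurable.ite ?_ (by fun_prop) measurable_const
  exact (isOpen_lt continuous_const (by fun_prop)).measurableSet

theorem wk_top (e k : ℝ) : wk e k ≠ ⊤ := by
  rw [wk]; split_ifs; exacts [ENNReal.ofReal_ne_top, ENNReal.zero_ne_top]

theorem sgn_iff (e k : ℝ) {d : ℝ} (hd : 0 < d) {a : ℝ} (ha : 0 < a) : 0 < e * (d ^ 12 * (a * (k ^ 3 - 1) ^ 3)) ↔ 0 < e * (k ^ 3 - 1) := by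
  by_cases h0 : k ^ 3 - 1 = 0
  · simp [h0]
  have h1 : 0 < d ^ 12 * a * (k ^ 3 - 1) ^ 2 := by positivity
  rw [show e * (d ^ 12 * (a * (k ^ 3 - 1) ^ 3)) = (d ^ 12 * a * (k ^ 3 - 1) ^ 2) * (e * (k ^ 3 - 1)) by ring]
  exact mul_pos_iff_of_pos_left h1

noncomputable def HH (R e : ℝ) (x : ℝ × (Fin 9 → ℝ)) : ENNReal :=
  wk e x.1 * {x : ℝ × (Fin 9 → ℝ) | (Mt x.2).det < sk x.1}.indicator (fun x => pe R x.2 * ENNReal.ofReal ((Mt x.2).det ^ 7)) x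

theorem HH_meas {R : ℝ} (hR : 0 < R) (e : ℝ) : Measurable (HH R e) := by
  have h1 : Measurable fun x : ℝ × (Fin 9 → ℝ) => wk e x.1 := (wk_meas e).comp measurable_fst
  have h2 : Measurable fun x : ℝ × (Fin 9 → ℝ) => pe R x.2 := (pe_meas hR).comp measurable_snd
  have h3 : Measurable fun x : ℝ × (Fin 9 → ℝ) => ENNReal.ofReal ((Mt x.2).det ^ 7) :=
    (((Mt_det_cont.comp continuous_snd).pow 7).measurable).ennreal_ofReal
  exact h1.mul ((h2.mul h3).indicator (isOpen_lt (Mt_det_cont.comp continuous_snd) (sk_cont.comp continuous_fst)).measurableSet)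

theorem HH_int (R e : ℝ) (k : ℝ) : ∫⁻ q, HH R e (k, q) = wk e k * (ENNReal.ofReal (sk k ^ 10) * Gs R 1) := by
  rw [← Gs_eq R (sk_pos k), Gs, ← lintegral_indicator (Ls_meas _), ← lintegral_const_mul']
  · rfl
  · exact wk_top e k

theorem Mp_Mt (p : Fin 10 → ℝ) : Mp p = Mt (fun j => p ((Fin.last 9).succAbove j)) := by
  rw [Mp, Mt]; rfl

theorem HH_eq (R e : ℝ) (p : Fin 10 → ℝ) :
    VV.indicator (fun p => ENNReal.ofReal |(fderiv ℝ Phi p).det| * ENNReal.ofReal (phi R e (Phi p))) p =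
      HH R e (p 9, fun j => p ((Fin.last 9).succAbove j)) := by
  rw [HH]
  simp only
  set q : Fin 9 → ℝ := fun j => p ((Fin.last 9).succAbove j) with hq
  by_cases hp : p ∈ VV
  · rw [Set.indicator_of_mem hp, det_Phi p hp.1.ne']
    obtain ⟨hd, hk⟩ := hp
    rw [Mp_Mt, ← hq] at hd ⊢
    have hphi : phi R e (Phi p) = if (Mt q).det < sk (p 9) ∧ 0 < e * ((p 9) ^ 3 - 1) then psi R (Mt q) else 0 := by
      have e1 : ht (Phi p) < 1 ↔ (Mt q).det < sk (p 9) := by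
        rw [Phi, ht_act _ (by rw [Mp_Mt]; exact hd.ne'), Mp_Mt, ← hq, lt_sk hd]
      have e2 : 0 < e * iD (Phi p) ↔ 0 < e * ((p 9) ^ 3 - 1) := by
        rw [iD_Phi (by rw [Mp_Mt]; exact hd.ne'), Mp_Mt, ← hq, sgn_iff e _ hd (by norm_num)]
      have e3 : psf R (Phi p) = psi R (Mt q) := by
        rw [Phi, psf_act R (by rw [Mp_Mt]; exact hd) hk, Mp_Mt]
      rw [phi, e3]
      by_cases h : (Mt q).det < sk (p 9) ∧ 0 < e * ((p 9) ^ 3 - 1)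
      · rw [if_pos h, if_pos ⟨e1.2 h.1, e2.2 h.2⟩]
      · rw [if_neg h, if_neg (fun h' => h ⟨e1.1 h'.1, e2.1 h'.2⟩)]
    rw [hphi]
    by_cases h1 : (Mt q).det < sk (p 9)
    · rw [Set.indicator_of_mem (show (p 9, q) ∈ {x : ℝ × (Fin 9 → ℝ) | (Mt x.2).det < sk x.1} from h1)]
      by_cases h2 : 0 < e * ((p 9) ^ 3 - 1)
      · rw [if_pos ⟨h1, h2⟩, wk, if_pos h2, pe, show |-59049 * (1 - p 9 ^ 3) ^ 2 * (Mt q).det ^ 7| = 59049 * (1 - p 9 ^ 3) ^ 2 * (Mt q).det ^ 7 by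
          rw [neg_mul, neg_mul, abs_neg, abs_of_nonneg (by positivity)], ENNReal.ofReal_mul (by positivity)]
        ring
      · rw [if_neg (fun h => h2 h.2), wk, if_neg h2]; simp
    · rw [Set.indicator_of_notMem (show (p 9, q) ∉ {x : ℝ × (Fin 9 → ℝ) | (Mt x.2).det < sk x.1} from h1), if_neg (fun h => h1 h.1)]
      simp
  · rw [Set.indicator_of_notMem hp]
    symm
    rw [mul_eq_zero]
    by_cases h : p 9 = 1
    · left; rw [wk, h]; simp
    · right
      rw [Set.indicator_apply_eq_zero]; intro
      have : psi R (Mt q) = 0 := by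
        by_contra hc
        exact hp ⟨by rw [Mp_Mt]; exact (psi_supp hc).1, h⟩
      simp [pe, this]

theorem phi_A {R : ℝ} (hR : 0 < R) (e : ℝ) :
    3 * ∫⁻ f, ENNReal.ofReal (phi R e f) = (∫⁻ k, wk e k * ENNReal.ofReal (sk k ^ 10)) * Gs R 1 := by
  have h1 : ∫⁻ f, ENNReal.ofReal (phi R e f) = ∫⁻ f in {f | iD f ≠ 0}, ENNReal.ofReal (phi R e f) := by
    have : ∀ᵐ f, f ∈ {f : Fin 10 → ℝ | iD f ≠ 0} := iD_ae
    rw [← setLIntegral_univ]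
    exact setLIntegral_congr (eventuallyEq_univ.2 this).symm
  rw [h1, VV_int, ← lintegral_indicator VV_open.measurableSet]
  simp_rw [HH_eq]
  have h2 := (volume_preserving_piFinSuccAbove (fun _ : Fin 10 => ℝ) (Fin.last 9)).lintegral_comp (HH_meas hR e)
  have h3 : ∀ p : Fin 10 → ℝ, HH R e (p 9, fun j => p ((Fin.last 9).succAbove j)) = HH R e (MeasurableEquiv.piFinSuccAbove (fun _ : Fin 10 => ℝ) (Fin.last 9) p) := fun p => rfl
  simp_rw [h3]
  rw [h2, Measure.volume_eq_prod, lintegral_prod _ (HH_meas hR e).aemeasurable]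
  simp_rw [HH_int, ← mul_assoc]
  rw [lintegral_mul_const' _ _ (by rw [Gs_one hR]; exact ENNReal.ofReal_ne_top)]

/-! ### the volume of `Ω e` -/

noncomputable def Ps (p : Fin 2 → ℝ) : Fin 2 → ℝ := ![p 0 ^ 4 * hi (p 1), p 0 ^ 6 * hj (p 1)]
noncomputable def hi' (k : ℝ) : ℝ := 81 / 16 * (4 * k ^ 3 + 8)
noncomputable def hj' (k : ℝ) : ℝ := -(729 / 32) * (6 * k ^ 5 - 60 * k ^ 2)
noncomputable def Pm (p : Fin 2 → ℝ) : Matrix (Fin 2) (Fin 2) ℝ :=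
  !![4 * p 0 ^ 3 * hi (p 1), p 0 ^ 4 * hi' (p 1); 6 * p 0 ^ 5 * hj (p 1), p 0 ^ 6 * hj' (p 1)]
noncomputable def Pd (p : Fin 2 → ℝ) : (Fin 2 → ℝ) →L[ℝ] (Fin 2 → ℝ) := LinearMap.toContinuousLinearMap (Matrix.toLin' (Pm p))

theorem Pd_det (p : Fin 2 → ℝ) : (Pd p).det = -(3 / 4) * (59049 * (1 - p 1 ^ 3) ^ 2) * p 0 ^ 9 := by
  have : (Pd p).det = (Pm p).det := by
    rw [Pd, ContinuousLinearMap.det, LinearMap.coe_toContinuousLinearMap, LinearMap.det_toLin']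
  rw [this, Pm, Matrix.det_fin_two_of, hi, hi', hj, hj']; ring

theorem hi_deriv (k : ℝ) : HasDerivAt hi (hi' k) k := by
  have : HasDerivAt (fun k : ℝ => 81 / 16 * (k ^ 4 + 8 * k)) (81 / 16 * (4 * k ^ 3 + 8 * 1)) k := by
    exact (((hasDerivAt_pow 4 k).congr_deriv (by norm_num)).add ((hasDerivAt_id k).const_mul 8)).const_mul _
  convert this using 1
  · funext k; rw [hi]; ring
  · rw [hi']; ring
theorem hj_deriv (k : ℝ) : HasDerivAt hj (hj' k) k := by
  have : HasDerivAt (fun k : ℝ => -(729 / 32) * (k ^ 6 - 20 * k ^ 3 - 8)) (-(729 / 32) * (6 * k ^ 5 - 20 * (3 * k ^ 2))) k := by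
    exact ((((hasDerivAt_pow 6 k).congr_deriv (by norm_num)).sub (((hasDerivAt_pow 3 k).congr_deriv (by norm_num)).const_mul 20)).sub_const _).const_mul _
  refine this.congr_deriv ?_
  rw [hj']; ring

theorem Ps_deriv (p : Fin 2 → ℝ) : HasFDerivAt Ps (Pd p) p := by
  have h0 : HasFDerivAt (fun p : Fin 2 → ℝ => p 0) (ContinuousLinearMap.proj (R := ℝ) (φ := fun _ : Fin 2 => ℝ) 0) p := hasFDerivAt_apply 0 p
  have h1 : HasFDerivAt (fun p : Fin 2 → ℝ => p 1) (ContinuousLinearMap.proj (R := ℝ) (φ := fun _ : Fin 2 => ℝ) 1) p := hasFDerivAt_apply 1 p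
  have hI := (hi_deriv (p 1)).comp_hasFDerivAt p h1
  have hJ := (hj_deriv (p 1)).comp_hasFDerivAt p h1
  have a4 := ((hasDerivAt_pow 4 (p 0)).comp_hasFDerivAt p h0).mul hI
  have a6 := ((hasDerivAt_pow 6 (p 0)).comp_hasFDerivAt p h0).mul hJ
  rw [hasFDerivAt_pi']
  intro i
  fin_cases i
  · refine a4.congr_fderiv ?_
    ext v
    simp [Pd, Pm, Matrix.mulVec, dotProduct, Fin.sum_univ_two]; ring
  · refine a6.congr_fderiv ?_
    ext v
    simp [Pd, Pm, Matrix.mulVec, dotProduct, Fin.sum_univ_two]; ring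

def Sd (e : ℝ) : Set (Fin 2 → ℝ) := {p | 0 < p 0 ∧ p 0 < sk (p 1) ∧ 0 < e * (p 1 ^ 3 - 1)}

theorem Sd_meas (e : ℝ) : MeasurableSet (Sd e) := by
  have h := sk_cont
  have h1 : IsOpen {p : Fin 2 → ℝ | 0 < p 0} := isOpen_lt continuous_const (by fun_prop)
  have h2 : IsOpen {p : Fin 2 → ℝ | p 0 < sk (p 1)} := isOpen_lt (by fun_prop) (by fun_prop)
  have h3 : IsOpen {p : Fin 2 → ℝ | 0 < e * (p 1 ^ 3 - 1)} := isOpen_lt continuous_const (by fun_prop)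
  exact (h1.inter (h2.inter h3)).measurableSet

theorem ne_one_of {e k : ℝ} (h : 0 < e * (k ^ 3 - 1)) : k ≠ 1 := by
  rintro rfl; simp at h

theorem Ps_mem {e d k : ℝ} (hd : 0 < d) : ![d ^ 4 * hi k, d ^ 6 * hj k] ∈ Ω e ↔ d < sk k ∧ 0 < e * (k ^ 3 - 1) := by
  have h1 : 4 * (d ^ 4 * hi k) ^ 3 - (d ^ 6 * hj k) ^ 2 = d ^ 12 * (531441 / 16 * (k ^ 3 - 1) ^ 3) := by rw [hi, hj]; ring
  have h2 : max (|d ^ 4 * hi k| ^ 3) ((d ^ 6 * hj k) ^ 2 / 4) = d ^ 12 * ht (hs k) := by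
    rw [ht, iI_hs, iJ_hs, mul_max_of_nonneg _ _ (by positivity), abs_mul, abs_of_nonneg (by positivity : 0 ≤ d ^ 4)]
    congr 1 <;> ring
  simp only [Ω, Set.mem_setOf_eq, Matrix.cons_val_zero, Matrix.cons_val_one]
  rw [h1, h2, sgn_iff e k hd (by norm_num), lt_sk hd]

theorem Ps_image (e : ℝ) : Ps '' Sd e = Ω e := by
  ext x
  constructor
  · rintro ⟨p, hp, rfl⟩
    exact (Ps_mem hp.1).2 hp.2
  · intro hx
    have h0 : 4 * x 0 ^ 3 - x 1 ^ 2 ≠ 0 := fun h => by have := hx.2; simp [h] at this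
    obtain ⟨d, k, hd, hk, h1, h2⟩ := hesse_param _ _ h0
    have hx' : x = ![d ^ 4 * hi k, d ^ 6 * hj k] := by
      ext i; fin_cases i <;> simp [h1, h2]
    rw [hx'] at hx ⊢
    exact ⟨![d, k], ⟨hd, (Ps_mem hd).1 hx⟩, by simp [Ps]⟩

theorem Ps_inj (e : ℝ) : Set.InjOn Ps (Sd e) := by
  intro p hp q hq h
  have h1 := congrFun h 0
  have h2 := congrFun h 1
  simp only [Ps, Matrix.cons_val_zero, Matrix.cons_val_one] at h1 h2
  obtain ⟨a, b⟩ := hesse_unique hp.1 hq.1 (ne_one_of hp.2.2) h1 h2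
  ext i; fin_cases i; exacts [b, a]

theorem vol_Ω (e : ℝ) : volume (Ω e) = ENNReal.ofReal (3 / 40) * ∫⁻ k, wk e k * ENNReal.ofReal (sk k ^ 10) := by
  rw [← Ps_image, ← lintegral_abs_det_fderiv_eq_addHaar_image volume (Sd_meas e) (fun p _ => (Ps_deriv p).hasFDerivWithinAt) (Ps_inj e),
    ← lintegral_indicator (Sd_meas e)]
  let K : ℝ × ℝ → ENNReal := fun x => wk e x.2 * ({x : ℝ × ℝ | 0 < x.1 ∧ x.1 < sk x.2}.indicator (fun x => ENNReal.ofReal (3 / 4) * ENNReal.ofReal (x.1 ^ 9)) x)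
  have hK : Measurable K := by
    have h1 : Measurable fun x : ℝ × ℝ => wk e x.2 := (wk_meas e).comp measurable_snd
    have h := sk_cont
    refine h1.mul (Measurable.indicator (by fun_prop) ?_)
    have h1 : IsOpen {x : ℝ × ℝ | 0 < x.1} := isOpen_lt continuous_const (by fun_prop)
    have h2 : IsOpen {x : ℝ × ℝ | x.1 < sk x.2} := isOpen_lt (by fun_prop) (by fun_prop)
    exact (h1.inter h2).measurableSet
  have e1 : ∀ p, (Sd e).indicator (fun p => ENNReal.ofReal |(Pd p).det|) p = K (MeasurableEquiv.finTwoArrow p) := by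
    intro p
    show _ = wk e (p 1) * ({x : ℝ × ℝ | 0 < x.1 ∧ x.1 < sk x.2}.indicator (fun x => ENNReal.ofReal (3 / 4) * ENNReal.ofReal (x.1 ^ 9)) (p 0, p 1))
    by_cases h1 : 0 < p 0 ∧ p 0 < sk (p 1)
    · rw [Set.indicator_of_mem (show (p 0, p 1) ∈ {x : ℝ × ℝ | 0 < x.1 ∧ x.1 < sk x.2} from h1)]
      by_cases h2 : 0 < e * (p 1 ^ 3 - 1)
      · have h3 := h1.1
        rw [Set.indicator_of_mem (show p ∈ Sd e from ⟨h1.1, h1.2, h2⟩), Pd_det, wk, if_pos h2, neg_mul, neg_mul, abs_neg, abs_of_nonneg (by positivity),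
          ENNReal.ofReal_mul (by positivity), ENNReal.ofReal_mul (by positivity)]
        ring
      · rw [Set.indicator_of_notMem (show p ∉ Sd e from fun h => h2 h.2.2), wk, if_neg h2, zero_mul]
    · rw [Set.indicator_of_notMem (show (p 0, p 1) ∉ {x : ℝ × ℝ | 0 < x.1 ∧ x.1 < sk x.2} from h1),
        Set.indicator_of_notMem (show p ∉ Sd e from fun h => h1 ⟨h.1, h.2.1⟩), mul_zero]
  simp_rw [e1]
  rw [(volume_preserving_finTwoArrow ℝ).lintegral_comp hK, Measure.volume_eq_prod, lintegral_prod_symm _ hK.aemeasurable,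
    ← lintegral_const_mul' _ _ ENNReal.ofReal_ne_top]
  apply lintegral_congr; intro k
  show ∫⁻ t, wk e k * ((Set.Ioo 0 (sk k)).indicator (fun x => ENNReal.ofReal (3 / 4) * ENNReal.ofReal (x ^ 9)) t) = _
  rw [lintegral_const_mul' _ _ (wk_top e k), lintegral_indicator measurableSet_Ioo, lintegral_const_mul' _ _ ENNReal.ofReal_ne_top,
    lint_pow le_rfl (sk_pos k).le, ← ENNReal.ofReal_mul (by norm_num)]
  have : (3 / 4 * ((sk k ^ (9 + 1) - 0 ^ (9 + 1)) / ((9 : ℕ) + 1)) : ℝ) = 3 / 40 * sk k ^ 10 := by norm_num; ring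
  rw [this, ENNReal.ofReal_mul (by norm_num)]; ring

theorem phi_int {R : ℝ} (hR : 0 < R) (e : ℝ) : ∫ f, phi R e f = 4 / 3 * gI R * volume.real (Ω e) := by
  rw [integral_eq_lintegral_of_nonneg_ae (ae_of_all _ (phi_nonneg R e)) (phi_meas hR e).aestronglyMeasurable]
  have h1 := congrArg ENNReal.toReal (phi_A hR e)
  have h2 := congrArg ENNReal.toReal (vol_Ω e)
  have hg : 0 ≤ gI R := integral_nonneg (gF_nonneg R)
  rw [Gs_one hR, ENNReal.toReal_mul, ENNReal.toReal_mul, ENNReal.toReal_ofReal (by positivity)] at h1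
  rw [ENNReal.toReal_mul, ENNReal.toReal_ofReal (by norm_num)] at h2
  rw [Measure.real, h2]
  rw [show ENNReal.toReal 3 = 3 by simp] at h1
  linear_combination h1 / 3

end TC

open MvPolynomial

namespace TC
open Filter Topology MeasureTheory

theorem inv_smul_toR (T : ℝ) (c : Fin 10 → ℤ) : T⁻¹ • toR c = fun i => T⁻¹ * (c i : ℝ) := rfl

theorem eps_tendsto : Tendsto (fun T : ℝ => (fun _ : Fin 10 => T⁻¹)) atTop (𝓝 0) := by
  rw [tendsto_pi_nhds]; intro i; exact tendsto_inv_atTop_zero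

/-- the weighted count of integral forms -/
theorem phi_sum {R e : ℝ} (hR : 0 < R) (he : e ≠ 0) :
    Tendsto (fun T : ℝ => (∑' c : Fin 10 → ℤ, phi R e (T⁻¹ • toR c)) / T ^ 10) atTop (𝓝 (4 / 3 * gI R * volume.real (Ω e))) := by
  obtain ⟨r, hr, hs⟩ := phi_supp hR
  have := riemann (phi R e) 1 r (fun x => by rw [abs_of_nonneg (phi_nonneg _ _ _)]; exact phi_le hR e x) (hs e) (phi_cont hR he)
    (l := (atTop : Filter ℝ)) (fun T _ => T⁻¹) (by filter_upwards [eventually_gt_atTop 0] with T hT i; positivity) eps_tendsto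
    (fun T c => T⁻¹ • toR c) (fun _ => 0) tendsto_const_nhds (Eventually.of_forall fun T c => by simp [inv_smul_toR])
  rw [phi_int hR] at this
  refine this.congr fun T => ?_
  rw [Finset.prod_const, Finset.card_univ, Fintype.card_fin, inv_pow, inv_mul_eq_div]

theorem toR_ball_finite (r : ℝ) : {c : Fin 10 → ℤ | ‖toR c‖ ≤ r}.Finite :=
  fin_of_close (fun _ => 1) (fun _ => one_pos) toR 0 (by norm_num) (fun c => by simp; funext i; simp [toR]) r

theorem null_count (S : Set (Fin 10 → ℝ)) (hS : IsClosed S) (r : ℝ) (hr : ∀ x ∈ S, ‖x‖ ≤ r) (h0 : volume S = 0) :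
    Tendsto (fun T : ℝ => ({c : Fin 10 → ℤ | T⁻¹ • toR c ∈ S}.ncard : ℝ) / T ^ 10) atTop (𝓝 0) := by
  have hc : ∀ᵐ x, ContinuousAt (S.indicator (fun _ => (1:ℝ))) x := by
    have : ∀ᵐ x, x ∉ S := measure_eq_zero_iff_ae_notMem.1 h0
    filter_upwards [this] with x hx
    exact cont_ind S x (Or.inr (by rw [hS.isOpen_compl.interior_eq]; exact hx))
  have := (riemann_count S hS.measurableSet r hr hc
    (l := (atTop : Filter ℝ)) (fun T _ => T⁻¹) (by filter_upwards [eventually_gt_atTop 0] with T hT i; positivity) eps_tendsto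
    (fun T c => T⁻¹ • toR c) (fun _ => 0) tendsto_const_nhds (Eventually.of_forall fun T c => by simp [inv_smul_toR])).2
  rw [Measure.real, h0, ENNReal.toReal_zero] at this
  refine this.congr fun T => ?_
  rw [Finset.prod_const, Finset.card_univ, Fintype.card_fin, inv_pow, inv_mul_eq_div]

theorem act_nontriv (γ : Γ3) (h : γ ≠ 1) : ∃ x : Fin 10 → ℝ, act (rM γ) x ≠ x := by
  by_contra! hc
  have hZ : ∀ x : Fin 10 → ℝ, x 0 ≠ x 1 → x 1 ≠ x 2 → x 2 ≠ x 0 → act Zc x ≠ x ∧ act (Zc * Zc) x ≠ x := by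
    intro x h1 h2 h3
    constructor
    · intro h; have := congrFun h 0; have := congrFun h 1; have := congrFun h 2
      simp [act, Zc, ev] at *; grind
    · intro h; have := congrFun h 0; have := congrFun h 1; have := congrFun h 2
      simp [act, Zc, ev, Matrix.mul_apply, Fin.sum_univ_three] at *; grind
  obtain ⟨z1, z2⟩ := hZ ![1, 2, 3, 0, 0, 0, 0, 0, 0, 0] (by simp) (by simp) (by simp)
  rcases hesse_stab (rM γ) 0 (by norm_num) (rM_det_SL γ) (hc _) with h1 | h1 | h1
  · apply h
    apply Subtype.ext
    exact rM_inj (by rw [h1, Matrix.SpecialLinearGroup.coe_one, rM_one])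
  · exact z1 (by rw [← h1]; exact hc _)
  · exact z2 (by rw [← h1]; exact hc _)

theorem fix_count (γ : Γ3) (h : γ ≠ 1) (r : ℝ) :
    Tendsto (fun T : ℝ => ({c : Fin 10 → ℤ | T⁻¹ • toR c ∈ {x : Fin 10 → ℝ | act (rM γ) x = x} ∩ Metric.closedBall 0 r}.ncard : ℝ) / T ^ 10) atTop (𝓝 0) := by
  have hc : Continuous fun x => act (rM γ) x := (Rt (rM γ)).continuous_of_finiteDimensional
  have h1 : IsClosed {x : Fin 10 → ℝ | act (rM γ) x = x} := isClosed_eq hc continuous_id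
  refine null_count _ (h1.inter Metric.isClosed_closedBall) r (fun x hx => by simpa using hx.2) ?_
  refine measure_mono_null Set.inter_subset_left ?_
  obtain ⟨x, hx⟩ := act_nontriv γ h
  have : {x : Fin 10 → ℝ | act (rM γ) x = x} = (LinearMap.ker (Rt (rM γ) - LinearMap.id) : Set (Fin 10 → ℝ)) := by
    ext y
    simp [sub_eq_zero, Rt]
  rw [this]
  apply Measure.addHaar_submodule
  intro ht
  have : x ∈ LinearMap.ker (Rt (rM γ) - LinearMap.id) := by rw [ht]; trivial
  simp [sub_eq_zero, Rt] at this
  exact hx this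

theorem stab_bound (R : ℝ) (hR : 0 < R) : ∃ G : Finset Γ3, ∀ (c : Fin 10 → ℤ) (γ : Γ3), psf R (toR c) ≠ 0 → act (γ : M3 ℤ) c = c → γ ∈ G := by
  set B := 1 + 2 * R with hB
  refine ⟨(gamma_finite ((1 + 2 * R) * (18 * B ^ 2))).toFinset, fun c γ hp hγ => ?_⟩
  rw [Set.Finite.mem_toFinset]
  have hD : iD (toR c) ≠ 0 := fun h0 => hp (by rw [psf, dif_neg (by simp [h0])])
  obtain ⟨M0, k, hM0, hk, hc⟩ := hesse_exists _ hD
  rw [hc, psf_act R hM0 hk] at hp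
  obtain ⟨t, ht⟩ := exists_cbrt (M0.det⁻¹)
  have ht0 : 0 < t := by
    by_contra hcc
    have h1 : t ^ 3 ≤ 0 := Odd.pow_nonpos (by decide) (not_lt.1 hcc)
    have h2 : 0 < M0.det⁻¹ := by positivity
    linarith
  set M := t • M0 with hM
  have hdet : M.det = 1 := by rw [hM, Matrix.det_smul, Fintype.card_fin, ht, inv_mul_cancel₀ hM0.ne']
  have hp' : psi R M ≠ 0 := by rwa [hM, psi_smul R _ ht0]
  have hbb : bb R M ≠ 0 := fun h => hp' (by rw [psi, h, zero_div])
  have hf : act (rM γ * M0) (hs k) = act M0 (hs k) := by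
    rw [act_mul two_ne_zero, ← hc, ← toR_act, hγ]
  have hdd : 0 < (rM γ * M0).det := by rw [Matrix.det_mul, rM_det_SL, one_mul]; exact hM0
  have hbb2 : bb R (rM γ * M) = bb R M := by
    rw [hM, Matrix.mul_smul, bb_smul R _ ht0, bb_smul R _ ht0]
    obtain ⟨-, -, h | h | h⟩ := hesse_fiber hdd hM0 hk hf
    · rw [h]
    · rw [h, bb_Zc]
    · rw [h, ← Matrix.mul_assoc, bb_Zc, bb_Zc]
  intro i j
  have h1 := gamma_bound (R := R) (M := M) γ (by rwa [hbb2]) i j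
  rw [hdet, mul_one, div_one] at h1
  refine h1.trans ?_
  have h2 := (psi_supp hp').2
  rw [hdet, mul_one] at h2
  have h3 : √(fr M) ≤ B := by
    by_contra hlt
    push Not at hlt
    have : (1:ℝ) ≤ √(fr M) := by linarith
    have : √(fr M) ≤ √(fr M) ^ 3 := le_self_pow₀ this (by norm_num)
    linarith
  have hB0 : 0 ≤ B := by positivity
  have h4 : ∀ i j, |M i j| ≤ B := fun i j => (entry_le M i j).trans h3
  have h5 : ∀ a b c d : ℝ, |a| ≤ B → |b| ≤ B → |c| ≤ B → |d| ≤ B → |a * b - c * d| ≤ 2 * B ^ 2 := by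
    intro a b c d ha hb hc hd
    calc |a * b - c * d| ≤ |a * b| + |c * d| := abs_sub _ _
      _ = |a| * |b| + |c| * |d| := by rw [abs_mul, abs_mul]
      _ ≤ B * B + B * B := by gcongr
      _ = _ := by ring
  have h6 : ∀ i j, |M.adjugate i j| ≤ 2 * B ^ 2 := by
    intro i j
    rw [Matrix.adjugate_fin_three]
    have h7 : ∀ a b c d : ℝ, |a| ≤ B → |b| ≤ B → |c| ≤ B → |d| ≤ B → |-(a * b) + c * d| ≤ 2 * B ^ 2 := by
      intro a b c d ha hb hc hd
      rw [neg_add_eq_sub]; exact h5 _ _ _ _ hc hd ha hb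
    fin_cases i <;> fin_cases j <;>
      first
      | exact h5 _ _ _ _ (h4 _ _) (h4 _ _) (h4 _ _) (h4 _ _)
      | exact h7 _ _ _ _ (h4 _ _) (h4 _ _) (h4 _ _) (h4 _ _)
  have h8 : ∑ i, ∑ j, |M.adjugate i j| ≤ 18 * B ^ 2 := by
    calc ∑ i, ∑ j, |M.adjugate i j| ≤ ∑ i : Fin 3, ∑ j : Fin 3, 2 * B ^ 2 := Finset.sum_le_sum fun i _ => Finset.sum_le_sum fun j _ => h6 i j
      _ = _ := by simp; ring
  gcongr

def Bad (R e T : ℝ) : Set (Fin 10 → ℤ) := {c | phi R e (T⁻¹ • toR c) ≠ 0 ∧ ∃ γ : Γ3, γ ≠ 1 ∧ act (γ : M3 ℤ) c = c}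

theorem phi_toR {R e T : ℝ} (hT : 0 < T) (c : Fin 10 → ℤ) :
    phi R e (T⁻¹ • toR c) = open Classical in if ht (toR c) < T ^ 12 ∧ 0 < e * iD (toR c) then psf R (toR c) else 0 := by
  have h0 : 0 < T⁻¹ := by positivity
  have e1 : ht (T⁻¹ • toR c) < 1 ↔ ht (toR c) < T ^ 12 := by
    rw [ht_smul h0.ne', inv_pow, inv_mul_lt_iff₀ (by positivity), mul_one]
  have e2 : 0 < e * iD (T⁻¹ • toR c) ↔ 0 < e * iD (toR c) := by
    rw [iD_smul h0.ne', mul_left_comm]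
    exact mul_pos_iff_of_pos_left (by positivity)
  rw [phi, psf_smul R h0]
  by_cases h : ht (toR c) < T ^ 12 ∧ 0 < e * iD (toR c)
  · rw [if_pos h, if_pos ⟨e1.2 h.1, e2.2 h.2⟩]
  · rw [if_neg h, if_neg (fun h' => h ⟨e1.1 h'.1, e2.1 h'.2⟩)]

theorem phi_ne {R e T : ℝ} (hT : 0 < T) {c : Fin 10 → ℤ} (h : phi R e (T⁻¹ • toR c) ≠ 0) :
    ht (toR c) < T ^ 12 ∧ 0 < e * iD (toR c) ∧ psf R (toR c) ≠ 0 := by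
  rw [phi_toR hT] at h
  split_ifs at h with h1
  · exact ⟨h1.1, h1.2, h⟩
  · exact absurd rfl h

theorem bad_count {R : ℝ} (hR : 0 < R) (e : ℝ) : Tendsto (fun T : ℝ => ((Bad R e T).ncard : ℝ) / T ^ 10) atTop (𝓝 0) := by
  obtain ⟨r, hr, hsup⟩ := phi_supp hR
  obtain ⟨G, hG⟩ := stab_bound R hR
  classical
  have hsum := tendsto_finsetSum (G.erase 1) (fun γ hγ => fix_count γ (Finset.ne_of_mem_erase hγ) r)
  rw [Finset.sum_const_zero] at hsum
  refine squeeze_zero' ?_ ?_ hsum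
  · filter_upwards [eventually_gt_atTop 0] with T hT; positivity
  · filter_upwards [eventually_gt_atTop 0] with T hT
    rw [← Finset.sum_div]
    gcongr
    let A : Γ3 → Set (Fin 10 → ℤ) := fun γ => {c : Fin 10 → ℤ | T⁻¹ • toR c ∈ {x : Fin 10 → ℝ | act (rM γ) x = x} ∩ Metric.closedBall 0 r}
    have hfin : ∀ γ, (A γ).Finite := fun γ => (toR_ball_finite (T * r)).subset fun c hc => by
      have := hc.2
      rw [mem_closedBall_zero_iff, norm_smul, norm_inv, Real.norm_of_nonneg hT.le, inv_mul_le_iff₀ hT] at this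
      exact this
    have hsub : Bad R e T ⊆ ⋃ γ ∈ G.erase 1, A γ := by
      rintro c ⟨h1, γ, h2, h3⟩
      have h4 := phi_ne hT h1
      refine Set.mem_biUnion (Finset.mem_coe.2 (Finset.mem_erase.2 ⟨h2, hG c γ h4.2.2 h3⟩)) ⟨?_, ?_⟩
      · show act (rM γ) (T⁻¹ • toR c) = T⁻¹ • toR c
        rw [act_smul, ← toR_act, h3]
      · rw [mem_closedBall_zero_iff]
        by_contra hlt
        exact h1 (hsup e _ (not_le.1 hlt))
    have h5 : (Bad R e T).ncard ≤ ∑ γ ∈ G.erase 1, (A γ).ncard :=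
      (Set.ncard_le_ncard hsub (Set.Finite.biUnion (Finset.finite_toSet _) fun γ _ => hfin γ)).trans (Finset.set_ncard_biUnion_le _ _)
    exact_mod_cast h5

end TC

open MvPolynomial

namespace TC
open Filter Topology MeasureTheory

def Orb (e T : ℝ) : Set (Set (Fin 10 → ℤ)) :=
  {O | ∃ c, StronglyIrred c ∧ ht (toR c) < T ^ 12 ∧ 0 < e * iD (toR c) ∧ O = orbitZ c}

theorem Orb_finite (e : ℝ) {T : ℝ} (hT : 0 < T) : (Orb e T).Finite := by
  obtain ⟨C, hC, h⟩ := ftail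
  refine (h 1 T one_pos hT).1.subset ?_
  rintro O ⟨c, h1, h2, h3, h4⟩
  have hD : iD (toR c) ≠ 0 := fun h0 => by simp [h0] at h3
  obtain ⟨M, k, hM, hk, hc⟩ := hesse_exists _ hD
  exact ⟨c, h1, h2, h4, M, k, hM, hk, hc, Or.inr (by norm_num)⟩

theorem inv_orbit (γ : Γ3) (c : Fin 10 → ℤ) : ht (toR (act (γ : M3 ℤ) c)) = ht (toR c) ∧ iD (toR (act (γ : M3 ℤ) c)) = iD (toR c)
    ∧ iI (toR (act (γ : M3 ℤ) c)) = iI (toR c) ∧ iJ (toR (act (γ : M3 ℤ) c)) = iJ (toR c) := by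
  have h : (rM (γ : M3 ℤ)).det ≠ 0 := by rw [rM_det_SL]; exact one_ne_zero
  rw [toR_act, ht_act _ h, iD_act _ h, iI_act _ h, iJ_act _ h, rM_det_SL]; simp

theorem psf_orbit (R : ℝ) (γ : Γ3) {c : Fin 10 → ℤ} {M : M3 ℝ} {k : ℝ} (hM : 0 < M.det) (hk : k ≠ 1) (hc : toR c = act M (hs k)) :
    psf R (toR (act (γ : M3 ℤ) c)) = psi R (rM γ * M) := by
  rw [toR_act, hc, ← act_mul two_ne_zero, psf_act R _ hk]
  rw [Matrix.det_mul, rM_det_SL, one_mul]; exact hM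

/-- each orbit contributes at most one -/
theorem orb_le {R : ℝ} (hR : 0 < R) {e T : ℝ} (hT : 0 < T) {c : Fin 10 → ℤ} {M : M3 ℝ} {k : ℝ} (hM : 0 < M.det) (hk : k ≠ 1)
    (hc : toR c = act M (hs k)) (F : Finset (Fin 10 → ℤ)) (hF : ∀ d ∈ F, d ∈ orbitZ c) :
    ∑ d ∈ F, phi R e (T⁻¹ • toR d) ≤ 1 := by
  classical
  have hex : ∀ d : Fin 10 → ℤ, ∃ γ : Γ3, d ∈ F → act (γ : M3 ℤ) c = d := by
    intro d
    by_cases h : d ∈ F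
    · obtain ⟨γ, h1⟩ := (mem_orbitZ c d).1 (hF d h)
      exact ⟨γ, fun _ => h1⟩
    · exact ⟨1, fun h' => absurd h' h⟩
  choose g hg using hex
  have hinj : Set.InjOn g F := by
    intro a ha b hb hab
    rw [← hg a ha, ← hg b hb, hab]
  calc ∑ d ∈ F, phi R e (T⁻¹ • toR d) ≤ ∑ d ∈ F, psi R (rM (g d) * M) := by
        refine Finset.sum_le_sum fun d hd => ?_
        rw [← psf_orbit R (g d) hM hk hc, hg d hd, phi_toR hT]
        split_ifs
        · exact le_rfl
        · exact psf_nonneg _ _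
    _ = ∑ γ ∈ F.image g, psi R (rM γ * M) := (Finset.sum_image (f := fun γ : Γ3 => psi R (rM γ * M)) hinj).symm
    _ ≤ ww R M := (summable_of_finite_support (psi_fin R M hM)).sum_le_tsum _ fun _ _ => psi_nonneg _ _
    _ ≤ 1 := ww_le_one hR M

theorem orb_ge {R e T : ℝ} (hT : 0 < T) {c : Fin 10 → ℤ} {M : M3 ℝ} {k : ℝ} (hM : 0 < M.det) (hk : k ≠ 1)
    (hc : toR c = act M (hs k)) (hht : ht (toR c) < T ^ 12) (hD : 0 < e * iD (toR c))
    (hw : ww R M = 1) (hst : ∀ γ : Γ3, act (γ : M3 ℤ) c = c → γ = 1) (S : Finset (Fin 10 → ℤ))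
    (hS : ∀ d, phi R e (T⁻¹ • toR d) ≠ 0 → d ∈ orbitZ c → d ∈ S) :
    1 ≤ ∑ d ∈ S, phi R e (T⁻¹ • toR d) := by
  classical
  set G := (psi_fin R M hM).toFinset with hG
  have h1 : ww R M = ∑ γ ∈ G, psi R (rM γ * M) := tsum_eq_sum fun γ hγ => by
    by_contra h; exact hγ ((Set.Finite.mem_toFinset _).2 h)
  have hinj : Function.Injective fun γ : Γ3 => act (γ : M3 ℤ) c := by
    intro a b hab
    have h2 : act ((a⁻¹ * b : Γ3) : M3 ℤ) c = c := by
      rw [Matrix.SpecialLinearGroup.coe_mul, act_mul two_ne_zero]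
      have h3 : act (b : M3 ℤ) c = act (a : M3 ℤ) c := hab.symm
      rw [h3, ← act_mul two_ne_zero, ← Matrix.SpecialLinearGroup.coe_mul, inv_mul_cancel, Matrix.SpecialLinearGroup.coe_one, act_one two_ne_zero]
    have h4 := hst _ h2
    exact (inv_mul_eq_one.1 h4)
  have h2 : ∀ γ : Γ3, phi R e (T⁻¹ • toR (act (γ : M3 ℤ) c)) = psi R (rM γ * M) := by
    intro γ
    obtain ⟨a, b, -, -⟩ := inv_orbit γ c
    rw [phi_toR hT, if_pos ⟨by rwa [a], by rwa [b]⟩, psf_orbit R γ hM hk hc]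
  calc 1 = ∑ γ ∈ G, psi R (rM γ * M) := by rw [← h1, hw]
    _ = ∑ d ∈ G.image (fun γ : Γ3 => act (γ : M3 ℤ) c), phi R e (T⁻¹ • toR d) := by
        rw [Finset.sum_image hinj.injOn]
        exact Finset.sum_congr rfl fun γ _ => (h2 γ).symm
    _ ≤ _ := by
        refine Finset.sum_le_sum_of_subset_of_nonneg ?_ fun _ _ _ => phi_nonneg _ _ _
        intro d hd
        obtain ⟨γ, h3, rfl⟩ := Finset.mem_image.1 hd
        refine hS _ ?_ ((mem_orbitZ _ _).2 ⟨γ, rfl⟩)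
        rw [h2]
        exact (Set.Finite.mem_toFinset _).1 h3

theorem orb_compare {R : ℝ} (hR : 0 < R) (e : ℝ) {r : ℝ} (hr : 0 < r) (hsup : ∀ e f, r < ‖f‖ → phi R e f = 0) {T : ℝ} (hT : 0 < T) :
    |((Orb e T).ncard : ℝ) - ∑' c : Fin 10 → ℤ, phi R e (T⁻¹ • toR c)| ≤
      (Skew R T).ncard + (Bad R e T).ncard + Set.ncard {c : Fin 10 → ℤ | ‖toR c‖ ≤ r * T ∧ ¬ StronglyIrred c} := by
  classical
  set W : (Fin 10 → ℤ) → ℝ := fun c => phi R e (T⁻¹ • toR c) with hW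
  have hball : ∀ c, W c ≠ 0 → ‖toR c‖ ≤ r * T := by
    intro c hc
    by_contra h
    refine hc (hsup e _ ?_)
    rw [norm_smul, norm_inv, Real.norm_of_nonneg hT.le, lt_inv_mul_iff₀ hT]
    linarith [not_le.1 h]
  have hfin : {c | W c ≠ 0}.Finite := (toR_ball_finite (r * T)).subset hball
  set S := hfin.toFinset with hSdef
  have hSm : ∀ c, c ∈ S ↔ W c ≠ 0 := fun c => Set.Finite.mem_toFinset _
  have hsum : ∑' c, W c = ∑ c ∈ S, W c := tsum_eq_sum fun c hc => by
    by_contra h; exact hc ((hSm c).2 h)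
  have hW0 : ∀ c, 0 ≤ W c := fun c => phi_nonneg _ _ _
  have hO := Orb_finite e hT
  obtain ⟨C, hC, hsk⟩ := ftail
  have hskf := (hsk R T hR hT).1
  rw [hsum, abs_le]
  constructor
  · -- upper bound of the sum
    have h1 : ∑ c ∈ S, W c = ∑ c ∈ S with StronglyIrred c, W c + ∑ c ∈ S with ¬ StronglyIrred c, W c :=
      (Finset.sum_filter_add_sum_filter_not S _ _).symm
    have h2 : ∑ c ∈ S with ¬ StronglyIrred c, W c ≤ Set.ncard {c : Fin 10 → ℤ | ‖toR c‖ ≤ r * T ∧ ¬ StronglyIrred c} := by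
      calc ∑ c ∈ S with ¬ StronglyIrred c, W c ≤ ∑ c ∈ S with ¬ StronglyIrred c, (1:ℝ) := Finset.sum_le_sum fun c _ => phi_le hR _ _
        _ = ((S.filter fun c => ¬ StronglyIrred c).card : ℝ) := by simp
        _ ≤ _ := by
          rw [← Set.ncard_coe_finset, Nat.cast_le]
          refine Set.ncard_le_ncard ?_ ((toR_ball_finite (r * T)).subset (fun c (hc : ‖toR c‖ ≤ r * T ∧ ¬ StronglyIrred c) => hc.1))
          intro c hc
          rw [Finset.mem_coe, Finset.mem_filter] at hc
          exact ⟨hball c ((hSm c).1 hc.1), hc.2⟩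
    have h3 : ∑ c ∈ S with StronglyIrred c, W c ≤ (Orb e T).ncard := by
      have hmaps : ∀ c ∈ S.filter (fun c => StronglyIrred c), orbitZ c ∈ hO.toFinset := by
        intro c hc
        rw [Finset.mem_filter, hSm] at hc
        obtain ⟨a, b, -⟩ := phi_ne hT hc.1
        rw [Set.Finite.mem_toFinset]
        exact ⟨c, hc.2, a, b, rfl⟩
      rw [← Finset.sum_fiberwise_of_maps_to hmaps]
      calc _ ≤ ∑ O ∈ hO.toFinset, (1:ℝ) := by
            refine Finset.sum_le_sum fun O hOO => ?_
            rw [Set.Finite.mem_toFinset] at hOO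
            obtain ⟨c, -, -, h5, rfl⟩ := hOO
            have hD : iD (toR c) ≠ 0 := fun h0 => by simp [h0] at h5
            obtain ⟨M, k, hM, hk, hc⟩ := hesse_exists _ hD
            refine orb_le hR hT hM hk hc _ fun d hd => ?_
            rw [← (Finset.mem_filter.1 hd).2]
            exact orbit_self d
        _ = _ := by rw [Set.ncard_eq_toFinset_card _ hO]; simp
    have h4 : (0:ℝ) ≤ (Skew R T).ncard := by positivity
    have h5 : (0:ℝ) ≤ (Bad R e T).ncard := by positivity
    linarith
  · set Good := Orb e T \ (Skew R T ∪ orbitZ '' Bad R e T) with hGood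
    have hGf : Good.Finite := hO.subset Set.diff_subset
    have hBf : (Bad R e T).Finite := hfin.subset fun c hc => hc.1
    have h1 : (Orb e T).ncard ≤ Good.ncard + ((Skew R T).ncard + (Bad R e T).ncard) := by
      calc (Orb e T).ncard ≤ (Good ∪ (Skew R T ∪ orbitZ '' Bad R e T)).ncard := by
            refine Set.ncard_le_ncard ?_ (hGf.union (hskf.union (hBf.image _)))
            rw [hGood, Set.diff_union_self]; exact Set.subset_union_left
        _ ≤ Good.ncard + (Skew R T ∪ orbitZ '' Bad R e T).ncard := Set.ncard_union_le _ _
        _ ≤ Good.ncard + ((Skew R T).ncard + (orbitZ '' Bad R e T).ncard) := by gcongr; exact Set.ncard_union_le _ _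
        _ ≤ _ := by gcongr; exact Set.ncard_image_le hBf
    have h2 : (Good.ncard : ℝ) ≤ ∑ c ∈ S, W c := by
      calc (Good.ncard : ℝ) = ∑ O ∈ hGf.toFinset, (1:ℝ) := by rw [Set.ncard_eq_toFinset_card _ hGf]; simp
        _ ≤ ∑ O ∈ hGf.toFinset, ∑ c ∈ (S.filter fun c => orbitZ c ∈ hGf.toFinset).filter (fun c => orbitZ c = O), W c := by
            refine Finset.sum_le_sum fun O hOO => ?_
            have hOG := hOO
            rw [Set.Finite.mem_toFinset] at hOG
            obtain ⟨⟨c, h3, h4, h5, rfl⟩, h6⟩ := hOG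
            have hD : iD (toR c) ≠ 0 := fun h0 => by simp [h0] at h5
            obtain ⟨M, k, hM, hk, hc⟩ := hesse_exists _ hD
            have hw : ww R M = 1 := by
              by_contra hw
              exact h6 (Or.inl ⟨c, h3, h4, rfl, M, k, hM, hk, hc, Or.inl hw⟩)
            refine orb_ge hT hM hk hc h4 h5 hw ?_ _ ?_
            · intro γ hγ
              by_contra hne
              obtain ⟨δ, hδ⟩ : ∃ δ : Γ3, psi R (rM δ * M) ≠ 0 := by
                by_contra! h0
                rw [ww] at hw
                simp [h0] at hw
              refine h6 (Or.inr ⟨act (δ : M3 ℤ) c, ⟨?_, δ * γ * δ⁻¹, ?_, ?_⟩, ?_⟩)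
              · obtain ⟨a, b, -, -⟩ := inv_orbit δ c
                rwa [phi_toR hT, if_pos ⟨by rwa [a], by rwa [b]⟩, psf_orbit R δ hM hk hc]
              · intro h7
                rw [mul_inv_eq_one, mul_eq_left] at h7
                exact hne h7
              · rw [← act_mul two_ne_zero, ← Matrix.SpecialLinearGroup.coe_mul, inv_mul_cancel_right, Matrix.SpecialLinearGroup.coe_mul,
                  act_mul two_ne_zero, hγ]
              · exact orbit_eq (orbit_self _) ((mem_orbitZ _ _).2 ⟨δ, rfl⟩)
            · intro d hd hdo
              have h7 : orbitZ d = orbitZ c := orbit_eq (orbit_self d) hdo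
              rw [Finset.mem_filter, Finset.mem_filter, h7]
              exact ⟨⟨(hSm d).2 hd, hOO⟩, rfl⟩
        _ = ∑ c ∈ S.filter (fun c => orbitZ c ∈ hGf.toFinset), W c :=
            Finset.sum_fiberwise_of_maps_to (fun c hc => (Finset.mem_filter.1 hc).2) _
        _ ≤ _ := Finset.sum_le_sum_of_subset_of_nonneg (Finset.filter_subset _ _) fun c _ _ => hW0 c
    have h3 : ((Orb e T).ncard : ℝ) ≤ Good.ncard + ((Skew R T).ncard + (Bad R e T).ncard) := by exact_mod_cast h1
    have h4 : (0:ℝ) ≤ Set.ncard {c : Fin 10 → ℤ | ‖toR c‖ ≤ r * T ∧ ¬ StronglyIrred c} := by positivity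
    linarith

theorem Orb_count {e : ℝ} (he : e ≠ 0) :
    Tendsto (fun T : ℝ => ((Orb e T).ncard : ℝ) / T ^ 10) atTop (𝓝 (4 / 9 * (zeta2 * zeta3) * volume.real (Ω e))) := by
  obtain ⟨C, hC, hsk⟩ := ftail
  set V := volume.real (Ω e)
  rw [Metric.tendsto_nhds]
  intro ε hε
  have h1 : Tendsto (fun R => C * tl R) atTop (𝓝 0) := by simpa using tl_tendsto.const_mul C
  have h2 : Tendsto (fun R => 4 / 3 * gI R * V) atTop (𝓝 (4 / 9 * (zeta2 * zeta3) * V)) := by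
    have := (gI_tendsto.const_mul (4 / 3)).mul_const V
    convert this using 2; ring
  obtain ⟨R, hR1, hR2, hR⟩ := ((h1.eventually (gt_mem_nhds (show 0 < ε / 5 by positivity))).and
    ((Metric.tendsto_nhds.1 h2 (ε / 5) (by positivity)).and (eventually_gt_atTop 0))).exists
  obtain ⟨r, hr, hsup⟩ := phi_supp hR
  filter_upwards [eventually_gt_atTop 0, Metric.tendsto_nhds.1 (phi_sum hR he) (ε / 5) (by positivity),
    Metric.tendsto_nhds.1 (bad_count hR e) (ε / 5) (by positivity), Metric.tendsto_nhds.1 (red_count r hr) (ε / 5) (by positivity)] with T hT a1 a2 a3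
  have h3 := orb_compare hR e hr hsup hT
  have h4 := (hsk R T hR hT).2
  have hT10 : 0 < T ^ 10 := by positivity
  rw [Real.dist_eq] at a1 a2 a3 hR2 ⊢
  rw [sub_zero] at a2 a3
  have a2 := (le_abs_self _).trans_lt a2
  have a3 := (le_abs_self _).trans_lt a3
  have h5 : |((Orb e T).ncard : ℝ) / T ^ 10 - (∑' c : Fin 10 → ℤ, phi R e (T⁻¹ • toR c)) / T ^ 10| ≤
      C * tl R + (Bad R e T).ncard / T ^ 10 + Set.ncard {c : Fin 10 → ℤ | ‖toR c‖ ≤ r * T ∧ ¬ StronglyIrred c} / T ^ 10 := by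
    rw [← sub_div, abs_div, abs_of_pos hT10, div_le_iff₀ hT10]
    refine h3.trans ?_
    rw [add_mul, add_mul, div_mul_cancel₀ _ hT10.ne', div_mul_cancel₀ _ hT10.ne']
    linarith
  rw [abs_le] at h5
  rw [abs_lt] at *
  constructor <;> linarith [h5.1, h5.2, a1.1, a1.2, hR2.1, hR2.2]

end TC

open MvPolynomial

namespace TC
open Filter Topology MeasureTheory

theorem vol_pos {e : ℝ} (he : e = 1 ∨ e = -1) : 0 < volume.real (Ω e) := by
  have hne : (Ω e).Nonempty := by
    rcases he with rfl | rfl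
    · exact ⟨![1/2, 0], by norm_num [Ω]⟩
    · exact ⟨![-1/2, 0], by norm_num [Ω]⟩
  have hb : volume (Ω e) < ⊤ :=
    (Metric.isBounded_iff_subset_closedBall (0 : Fin 2 → ℝ)|>.2 ⟨2, fun x hx => by
      rw [mem_closedBall_zero_iff]; exact Ω_bdd e x hx⟩).measure_lt_top
  exact ENNReal.toReal_pos ((Ω_open e).measure_pos volume hne).ne' hb.ne

/-- The numerator counts orbits. -/
theorem num_eq (P Q : MvPolynomial (Fin 10) ℚ) (h : IsInvariantPair ℚ P Q) (e : ℝ) {T : ℝ} (hT : 0 < T) :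
    (∑' p : ℚ × ℚ, Set.indicator {p : ℚ × ℚ | 0 < e * (Δpair p : ℝ) ∧ (Hpair p : ℝ) < T ^ 12}
      (fun p => (hclass P Q p.1 p.2 : ℝ)) p) = (Orb e T).ncard := by
  classical
  have hI : ∀ c, ((Iinv P c : ℚ) : ℝ) = iI (toR c) := fun c => by
    rw [Iinv_eq P Q h, iI_toR]; push_cast; rfl
  have hJ : ∀ c, ((Jinv Q c : ℚ) : ℝ) = iJ (toR c) := fun c => by
    rw [Jinv_eq P Q h, iJ_toR]; push_cast; rfl
  have hDe : ∀ c, ((Δpair (Iinv P c, Jinv Q c) : ℚ) : ℝ) = iD (toR c) := fun c => by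
    rw [Δpair, iD]; push_cast; rw [hI, hJ]
  have hHe : ∀ c, ((Hpair (Iinv P c, Jinv Q c) : ℚ) : ℝ) = ht (toR c) := fun c => by
    rw [Hpair, ht]; push_cast; rw [hI, hJ]
  have hinv : ∀ c d, orbitZ c = orbitZ d → Iinv P c = Iinv P d ∧ Jinv Q c = Jinv Q d := by
    intro c d hcd
    have h1 : c ∈ orbitZ d := hcd ▸ orbit_self c
    obtain ⟨γ, rfl⟩ := (mem_orbitZ _ _).1 h1
    obtain ⟨-, -, a, b⟩ := inv_orbit γ d
    constructor
    · have : ((Iinv P (act (γ : M3 ℤ) d) : ℚ) : ℝ) = (Iinv P d : ℚ) := by rw [hI, hI, a]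
      exact_mod_cast this
    · have : ((Jinv Q (act (γ : M3 ℤ) d) : ℚ) : ℝ) = (Jinv Q d : ℚ) := by rw [hJ, hJ, b]
      exact_mod_cast this
  have hex : ∀ O : Set (Fin 10 → ℤ), ∃ c, (∃ d, O = orbitZ d) → O = orbitZ c := by
    intro O
    by_cases hO : ∃ d, O = orbitZ d
    · exact ⟨hO.choose, fun _ => hO.choose_spec⟩
    · exact ⟨0, fun h' => absurd h' hO⟩
  choose rep hrep using hex
  set m : Set (Fin 10 → ℤ) → ℚ × ℚ := fun O => (Iinv P (rep O), Jinv Q (rep O)) with hm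
  have hmo : ∀ c, m (orbitZ c) = (Iinv P c, Jinv Q c) := by
    intro c
    have h1 := hinv _ _ (hrep (orbitZ c) ⟨c, rfl⟩)
    rw [hm]; simp only; rw [← h1.1, ← h1.2]
  have hO := Orb_finite e hT
  set F := hO.toFinset with hF
  have hmem : ∀ O, O ∈ F ↔ O ∈ Orb e T := fun O => Set.Finite.mem_toFinset _
  have key : ∀ p : ℚ × ℚ, Set.indicator {p : ℚ × ℚ | 0 < e * (Δpair p : ℝ) ∧ (Hpair p : ℝ) < T ^ 12}
      (fun p => (hclass P Q p.1 p.2 : ℝ)) p = ((F.filter fun O => m O = p).card : ℝ) := by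
    intro p
    by_cases hp : 0 < e * (Δpair p : ℝ) ∧ (Hpair p : ℝ) < T ^ 12
    · rw [Set.indicator_of_mem (by exact hp), hclass, ← Set.ncard_coe_finset]
      congr 2
      ext O
      simp only [Set.mem_setOf_eq, Finset.coe_filter, hmem]
      constructor
      · rintro ⟨c, h1, h2, h3, rfl⟩
        have h4 : (Iinv P c, Jinv Q c) = p := by rw [h2, h3]
        refine ⟨⟨c, h1, ?_, ?_, rfl⟩, by rw [hmo, h4]⟩
        · rw [← hHe, h4]; exact hp.2
        · rw [← hDe, h4]; exact hp.1
      · rintro ⟨⟨c, h1, h2, h3, rfl⟩, h4⟩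
        rw [hmo] at h4
        exact ⟨c, h1, by rw [← h4], by rw [← h4], rfl⟩
    · rw [Set.indicator_of_notMem (by exact hp), Finset.filter_eq_empty_iff.2, Finset.card_empty, Nat.cast_zero]
      intro O hOF h4
      obtain ⟨c, h1, h2, h3, rfl⟩ := (hmem O).1 hOF
      rw [hmo] at h4
      refine hp ⟨?_, ?_⟩
      · rw [← h4, hDe]; exact h3
      · rw [← h4, hHe]; exact h2
  simp_rw [key]
  rw [tsum_eq_sum (s := F.image m)]
  · rw [Set.ncard_eq_toFinset_card _ hO, Finset.card_eq_sum_card_image m F]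
    push_cast; rfl
  · intro p hp
    rw [Finset.filter_eq_empty_iff.2, Finset.card_empty, Nat.cast_zero]
    intro O hOF h4
    exact hp (Finset.mem_image.2 ⟨O, hOF, h4⟩)

theorem main_lim (P Q : MvPolynomial (Fin 10) ℚ) (h : IsInvariantPair ℚ P Q) (e : ℝ) (he : e = 1 ∨ e = -1) :
    Tendsto (fun X : ℝ => (∑' p : ℚ × ℚ, Set.indicator {p : ℚ × ℚ | 0 < e * (Δpair p : ℝ) ∧ (Hpair p : ℝ) < X}
      (fun p => (hclass P Q p.1 p.2 : ℝ)) p) /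
      (Set.ncard {p : ℚ × ℚ | Eligible P Q p.1 p.2 ∧ 0 < e * (Δpair p : ℝ) ∧ (Hpair p : ℝ) < X} : ℝ))
      atTop (𝓝 (3 * zeta2 * zeta3)) := by
  have hV := vol_pos he
  have he0 : e ≠ 0 := by rcases he with rfl | rfl <;> norm_num
  have h1 := (Orb_count he0).div (eligible_count P Q h e he) (by positivity)
  have h2 : 4 / 9 * (zeta2 * zeta3) * volume.real (Ω e) / (4 / 27 * volume.real (Ω e)) = 3 * zeta2 * zeta3 := by
    field_simp; ring
  rw [h2] at h1
  refine (h1.comp (tendsto_rpow_atTop (show (0:ℝ) < 1 / 12 by norm_num))).congr' ?_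
  filter_upwards [eventually_gt_atTop 0] with X hX
  have hT : 0 < X ^ ((1:ℝ) / 12) := Real.rpow_pos_of_pos hX _
  have hX12 : (X ^ ((1:ℝ) / 12)) ^ 12 = X := by
    rw [← Real.rpow_natCast, ← Real.rpow_mul hX.le]; norm_num
  have h3 := num_eq P Q h e hT
  rw [hX12] at h3
  simp only [Function.comp_apply, Pi.div_apply]
  rw [h3, hX12, div_div_div_cancel_right₀ (pow_ne_zero _ hT.ne')]

end TC

/-- The average of `h(I₀,J₀)` over eligible pairs of bounded height equals `3ζ(2)ζ(3)`,
for each sign of the discriminant. -/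
theorem stmt12 (P Q : MvPolynomial (Fin 10) ℚ) (hPQ : IsInvariantPair ℚ P Q) :
    Filter.Tendsto (fun X : ℝ =>
        (∑' p : ℚ × ℚ, Set.indicator {p : ℚ × ℚ | 0 < Δpair p ∧ (Hpair p : ℝ) < X}
            (fun p => (hclass P Q p.1 p.2 : ℝ)) p) /
          (Set.ncard {p : ℚ × ℚ | Eligible P Q p.1 p.2 ∧ 0 < Δpair p ∧ (Hpair p : ℝ) < X} : ℝ))
      Filter.atTop (nhds (3 * zeta2 * zeta3)) ∧
    Filter.Tendsto (fun X : ℝ =>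
        (∑' p : ℚ × ℚ, Set.indicator {p : ℚ × ℚ | Δpair p < 0 ∧ (Hpair p : ℝ) < X}
            (fun p => (hclass P Q p.1 p.2 : ℝ)) p) /
          (Set.ncard {p : ℚ × ℚ | Eligible P Q p.1 p.2 ∧ Δpair p < 0 ∧ (Hpair p : ℝ) < X} : ℝ))
      Filter.atTop (nhds (3 * zeta2 * zeta3)) := by
  constructor
  · have h := TC.main_lim P Q hPQ 1 (Or.inl rfl)
    have h1 : ∀ p : ℚ × ℚ, 0 < (1:ℝ) * (Δpair p : ℝ) ↔ 0 < Δpair p := fun p => by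
      rw [one_mul]; exact_mod_cast Iff.rfl
    simpa only [h1] using h
  · have h := TC.main_lim P Q hPQ (-1) (Or.inr rfl)
    have h1 : ∀ p : ℚ × ℚ, 0 < (-1:ℝ) * (Δpair p : ℝ) ↔ Δpair p < 0 := fun p => by
      rw [neg_one_mul, neg_pos]; exact_mod_cast Iff.rfl
    simpa only [h1] using h
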